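/- (Almost conservation law.) Let 8/7 < s < 2 and ε > 0. There exist a constant C > 0 and N₀ ≥ 1 such that for every N ≥ N₀ and every initial datum u₀ ∈ C_c^∞(ℝ²) with E(I_N u₀) ≤ 1, there exists δ > 0, depending only on ‖u₀‖_{L²(ℝ²)}, such that the Duhamel solution u ∈ C([0,δ], H^s(ℝ²)) of i∂ₜu − Δ²u = |u|⁴u with u(0) = u₀ exists and satisfies |E(I_N u(t)) − E(I_N u₀)| ≤ C N^{−3+ε} for all t ∈ [0,δ]. -/

import Mathlib

open MeasureTheory Set
open scoped RealInnerProductSpace ENNReal NNReal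

noncomputable section

abbrev E2 : Type := EuclideanSpace ℝ (Fin 2)

/-- Spatial Fourier transform, convention `f̂(ξ) = ∫ e^{-i x·ξ} f(x) dx`. -/
def ft (f : E2 → ℂ) (ξ : E2) : ℂ :=
  ∫ x : E2, Complex.exp (-Complex.I * ((⟪x, ξ⟫ : ℝ) : ℂ)) * f x

/-- Inverse Fourier transform on ℝ². -/
def invFt (g : E2 → ℂ) (x : E2) : ℂ :=
  (((2 * Real.pi) ^ 2)⁻¹ : ℝ) • ∫ ξ : E2, Complex.exp (Complex.I * ((⟪x, ξ⟫ : ℝ) : ℂ)) * g ξ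

/-- Biharmonic Schrödinger propagator `e^{itΔ²}`, the Fourier multiplier with
symbol `e^{-it|ξ|⁴}`. -/
def bprop (t : ℝ) (φ : E2 → ℂ) : E2 → ℂ :=
  invFt fun ξ => Complex.exp (-Complex.I * (t : ℂ) * ((‖ξ‖ ^ 4 : ℝ) : ℂ)) * ft φ ξ

/-- The operator `|∇|^μ`, Fourier multiplier with symbol `|ξ|^μ`. -/
def fracGrad (μ : ℝ) (f : E2 → ℂ) : E2 → ℂ :=
  invFt fun ξ => ((‖ξ‖ ^ μ : ℝ) : ℂ) * ft f ξ

/-- The operator `⟨∇⟩^s`, Fourier multiplier with symbol `⟨ξ⟩^s`. -/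
def jap (s : ℝ) (f : E2 → ℂ) : E2 → ℂ :=
  invFt fun ξ => (((1 + ‖ξ‖ ^ 2) ^ (s / 2) : ℝ) : ℂ) * ft f ξ

/-- A general Fourier multiplier operator with real symbol `m`. -/
def mulOp (m : E2 → ℝ) (f : E2 → ℂ) : E2 → ℂ :=
  invFt fun ξ => ((m ξ : ℝ) : ℂ) * ft f ξ

/-- Inhomogeneous Sobolev norm `‖f‖_{H^s} = ‖⟨ξ⟩^s f̂‖_{L²}`. -/
def HsNorm (s : ℝ) (f : E2 → ℂ) : ℝ≥0∞ :=
  (∫⁻ ξ : E2, ENNReal.ofReal ((1 + ‖ξ‖ ^ 2) ^ s * ‖ft f ξ‖ ^ 2)) ^ (1/2 : ℝ)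

/-- Homogeneous Sobolev norm `‖f‖_{Ḣ^s} = ‖|ξ|^s f̂‖_{L²}`. -/
def HsHomNorm (s : ℝ) (f : E2 → ℂ) : ℝ≥0∞ :=
  (∫⁻ ξ : E2, ENNReal.ofReal (‖ξ‖ ^ (2 * s) * ‖ft f ξ‖ ^ 2)) ^ (1/2 : ℝ)

/-- Spatial Laplacian of a function on ℝ². -/
def lap (f : E2 → ℂ) (x : E2) : ℂ :=
  ∑ i : Fin 2,
    fderiv ℝ (fun y => fderiv ℝ f y (EuclideanSpace.single i (1:ℝ))) x
      (EuclideanSpace.single i (1:ℝ))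

/-- Bi-Laplacian `Δ²`. -/
def bilap (f : E2 → ℂ) : E2 → ℂ := lap (lap f)

/-- Integrand of the energy. -/
def energyIntegrand (v : E2 → ℂ) (x : E2) : ℝ :=
  (1/2) * ‖lap v x‖ ^ 2 + (1/6) * ‖v x‖ ^ 6

/-- Energy `E(v) = ∫ (1/2)|Δv|² + (1/6)|v|⁶`. -/
def energy (v : E2 → ℂ) : ℝ := ∫ x : E2, energyIntegrand v x

/-- The quintic nonlinearity `|v|⁴ v`. -/
def quintic (v : E2 → ℂ) (x : E2) : ℂ := ((‖v x‖ : ℝ) : ℂ) ^ 4 * v x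

/-- Space-time Fourier transform. -/
def stFt (u : ℝ → E2 → ℂ) (τ : ℝ) (ξ : E2) : ℂ :=
  ∫ t : ℝ, ∫ x : E2,
    Complex.exp (-Complex.I * (((⟪x, ξ⟫ : ℝ) : ℂ) + (t : ℂ) * (τ : ℂ))) * u t x

/-- Fourier restriction norm `‖u‖_{X^{s,b}}` adapted to the biharmonic equation. -/
def XNorm (s b : ℝ) (u : ℝ → E2 → ℂ) : ℝ≥0∞ :=
  (∫⁻ p : ℝ × E2,
      ENNReal.ofReal ((1 + ‖p.2‖ ^ 2) ^ s * (1 + (p.1 + ‖p.2‖ ^ 4) ^ 2) ^ b *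
        ‖stFt u p.1 p.2‖ ^ 2)) ^ (1/2 : ℝ)

/-- Restricted norm `‖u‖_{X^{s,b}_δ}` (infimum over extensions off `[0,δ]`). -/
def XNormR (s b δ : ℝ) (u : ℝ → E2 → ℂ) : ℝ≥0∞ :=
  ⨅ v ∈ {v : ℝ → E2 → ℂ | ∀ t ∈ Icc (0:ℝ) δ, ∀ x, v t x = u t x}, XNorm s b v

/-- Mixed norm `‖f‖_{L^q_t L^p_x (I × ℝ²)}`. -/
def mixedNorm (q p : ℝ≥0∞) (I : Set ℝ) (f : ℝ → E2 → ℂ) : ℝ≥0∞ :=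
  if q = ∞ then essSup (fun t => eLpNorm (f t) p volume) (volume.restrict I)
  else (∫⁻ t in I, (eLpNorm (f t) p volume) ^ q.toReal) ^ (1 / q.toReal)

/-- `u` satisfies the Duhamel formula for the quintic biharmonic NLS on `I` with data `u₀`. -/
def DuhamelOn (I : Set ℝ) (u : ℝ → E2 → ℂ) (u₀ : E2 → ℂ) : Prop :=
  ∀ t ∈ I, ∀ x : E2,
    u t x = bprop t u₀ x - Complex.I * ∫ t' in (0:ℝ)..t, bprop (t - t') (quintic (u t')) x

/-- `u` is a continuous curve in `H^s` on the time interval `I`. -/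
def ContHs (s : ℝ) (I : Set ℝ) (u : ℝ → E2 → ℂ) : Prop :=
  (∀ t ∈ I, HsNorm s (u t) < ⊤) ∧
  ∀ t₀ ∈ I, ∀ η : ℝ, 0 < η → ∃ τ > 0, ∀ t ∈ I, |t - t₀| < τ →
    HsNorm s (fun x => u t x - u t₀ x) < ENNReal.ofReal η

/-- `m` is an admissible `I`-method multiplier `m_N` of regularity `s`,
with derivative constants `Cd`. -/
structure IsIMult (s N : ℝ) (Cd : ℕ → ℝ) (m : E2 → ℝ) : Prop where
  smooth : ContDiff ℝ (⊤ : ℕ∞) m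
  pos : ∀ ξ, 0 < m ξ
  le_one : ∀ ξ, m ξ ≤ 1
  mono : ∀ ξ η : E2, ‖ξ‖ ≤ ‖η‖ → m η ≤ m ξ
  eq_one : ∀ ξ : E2, ‖ξ‖ ≤ N → m ξ = 1
  eq_rpow : ∀ ξ : E2, 2 * N ≤ ‖ξ‖ → m ξ = (‖ξ‖ / N) ^ (s - 2)
  deriv_bound : ∀ (j : ℕ) (ξ : E2), ξ ≠ 0 →
    ‖iteratedFDeriv ℝ j m ξ‖ ≤ Cd j * ‖ξ‖ ^ (-(j : ℝ))


open scoped ComplexConjugate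
open scoped FourierTransform SchwartzMap in
lemma ft_eq (f : E2 → ℂ) (ξ : E2) : ft f ξ = 𝓕 f ((2 * Real.pi)⁻¹ • ξ) := by
  unfold ft
  rw [Real.fourier_eq']
  congr 1
  ext x
  rw [smul_eq_mul, inner_smul_right]
  congr 2
  have : (Real.pi : ℂ) ≠ 0 := by exact_mod_cast Real.pi_ne_zero
  push_cast
  field_simp

open scoped FourierTransform in
lemma invFt_eq (g : E2 → ℂ) (x : E2) :
    invFt g x = (((2 * Real.pi) ^ 2)⁻¹ : ℝ) • 𝓕⁻ g ((2 * Real.pi)⁻¹ • x) := by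
  unfold invFt
  rw [Real.fourierInv_eq']
  congr 2
  ext v
  rw [smul_eq_mul, inner_smul_right]
  congr 2
  have : (Real.pi : ℂ) ≠ 0 := by exact_mod_cast Real.pi_ne_zero
  rw [real_inner_comm]
  push_cast
  field_simp

open scoped FourierTransform in
lemma invFt_eq' (g : E2 → ℂ) (x : E2) :
    invFt g x = 𝓕⁻ (fun η => g ((2 * Real.pi) • η)) x := by
  unfold invFt
  rw [Real.fourierInv_eq']
  have := Measure.integral_comp_smul (volume : Measure E2)
    (fun ξ : E2 => Complex.exp (Complex.I * ((⟪x, ξ⟫ : ℝ) : ℂ)) * g ξ) (2 * Real.pi)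
  rw [show (Module.finrank ℝ E2) = 2 by simp] at this
  rw [abs_of_nonneg (by positivity)] at this
  rw [← this]
  congr 1
  ext v
  rw [smul_eq_mul, inner_smul_right, real_inner_comm]
  congr 2
  push_cast
  ring

lemma twopi_pos : (0:ℝ) < 2 * Real.pi := by positivity

open scoped FourierTransform in
/-- Parseval-type swap. -/
lemma integral_fourier_mul {f g : E2 → ℂ} (hf : Integrable f) (hg : Integrable g) :
    ∫ ξ, 𝓕 f ξ * g ξ = ∫ x, f x * 𝓕 g x := by
  have := VectorFourier.integral_fourierIntegral_smul_eq_flip (L := innerₗ E2) (μ := volume)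
    (ν := volume) (e := Real.fourierChar) Real.continuous_fourierChar (by
      exact continuous_inner) hf hg
  simp only [smul_eq_mul, flip_innerₗ] at this
  exact this

open scoped FourierTransform SchwartzMap in
/-- If `a` and its inverse transform are integrable then transform of inverse is `a`. -/
lemma fourier_fourierInv_ae {a : E2 → ℂ} (ha : Integrable a) (hu : Integrable (𝓕⁻ a)) :
    𝓕 (𝓕⁻ a) =ᵐ[volume] a := by
  have hcont : Continuous (𝓕 (𝓕⁻ a)) :=
    VectorFourier.fourierIntegral_continuous Real.continuous_fourierChar continuous_inner hu
  refine ae_eq_of_integral_contDiff_smul_eq hcont.locallyIntegrable ha.locallyIntegrable ?_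
  intro g hg hgc
  let φ : 𝓢(E2, ℂ) := (hgc.comp_left (g := Complex.ofReal) (by simp)).toSchwartzMap
    (Complex.ofRealCLM.contDiff.comp hg)
  have hφ : ∀ x, φ x = (g x : ℂ) := fun x => rfl
  have e1 : ∀ x, g x • 𝓕 (𝓕⁻ a) x = 𝓕 (𝓕⁻ a) x * φ x := by
    intro x; rw [hφ, Complex.real_smul, mul_comm]
  have e2 : ∀ x, g x • a x = a x * φ x := by
    intro x; rw [hφ, Complex.real_smul, mul_comm]
  simp_rw [e1, e2]
  rw [integral_fourier_mul hu φ.integrable]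
  have h3 : ∀ x, 𝓕⁻ a x = 𝓕 (fun y => a (-y)) x := by
    intro x; rw [Real.fourierInv_eq_fourier_comp_neg]
  simp_rw [h3]
  rw [integral_fourier_mul ha.comp_neg (by exact (𝓕 φ).integrable)]
  rw [← integral_neg_eq_self]
  simp only [neg_neg]
  congr 1
  ext x
  congr 1
  have : 𝓕 (𝓕 (φ : E2 → ℂ)) (-x) = 𝓕⁻ (𝓕 (φ : E2 → ℂ)) x := by
    rw [Real.fourierInv_eq_fourier_neg]
  rw [this]
  have h5 := SchwartzMap.fourier_coe φ
  rw [Continuous.fourierInv_fourier_eq φ.continuous φ.integrable]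
  rw [← h5]; exact (𝓕 φ).integrable

open scoped FourierTransform in
lemma integrable_invFt_iff {a : E2 → ℂ} : Integrable (invFt a) ↔ Integrable (𝓕⁻ a) := by
  have h : invFt a = (((2 * Real.pi) ^ 2)⁻¹ : ℝ) • (fun x => 𝓕⁻ a ((2 * Real.pi)⁻¹ • x)) := by
    ext x; rw [invFt_eq]; rfl
  rw [h, integrable_smul_iff (by positivity)]
  exact integrable_comp_smul_iff volume _ (by positivity)

open scoped FourierTransform in
lemma ft_invFt_ae {a : E2 → ℂ} (ha : Integrable a) (hu : Integrable (invFt a)) :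
    ft (invFt a) =ᵐ[volume] a := by
  have ha' : Integrable (fun η => a ((2 * Real.pi) • η)) := ha.comp_smul twopi_pos.ne'
  have h : invFt a = 𝓕⁻ (fun η => a ((2 * Real.pi) • η)) := by
    ext x; rw [invFt_eq']
  rw [h] at hu ⊢
  have := fourier_fourierInv_ae ha' hu
  have hq : Measure.QuasiMeasurePreserving (fun ξ : E2 => (2 * Real.pi)⁻¹ • ξ) volume volume := by
    refine ⟨by fun_prop, ?_⟩
    rw [Measure.map_addHaar_smul _ (by positivity)]
    exact Measure.smul_absolutelyContinuous
  have h2 := hq.ae_eq this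
  filter_upwards [h2] with ξ hξ
  rw [ft_eq]
  simp only [Function.comp] at hξ
  rw [hξ, smul_smul, mul_inv_cancel₀ twopi_pos.ne', one_smul]

open scoped FourierTransform in
lemma integral_fourierInv_mul {f g : E2 → ℂ} (hf : Integrable f) (hg : Integrable g) :
    ∫ ξ, 𝓕⁻ f ξ * g ξ = ∫ x, f x * 𝓕⁻ g x := by
  have h := integral_fourier_mul hf.comp_neg hg
  have e1 : ∀ x, 𝓕⁻ f x = 𝓕 (fun y => f (-y)) x := by
    intro x; rw [Real.fourierInv_eq_fourier_comp_neg]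
  simp_rw [e1]
  rw [h, ← integral_neg_eq_self]
  simp only [neg_neg]
  simp_rw [Real.fourierInv_eq_fourier_neg]

open scoped FourierTransform SchwartzMap in
lemma Lp_fourierInv_ae {a : E2 → ℂ} (ha : Integrable a) (ha2 : MemLp a 2) :
    ((𝓕⁻ (ha2.toLp a) : Lp ℂ 2 (volume : Measure E2)) : E2 → ℂ) =ᵐ[volume] 𝓕⁻ a := by
  have hcont : Continuous (𝓕⁻ a) := by
    have : 𝓕⁻ a = fun x => 𝓕 (fun y => a (-y)) x := by
      ext x; rw [Real.fourierInv_eq_fourier_comp_neg]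
    rw [this]
    exact VectorFourier.fourierIntegral_continuous Real.continuous_fourierChar continuous_inner
      ha.comp_neg
  set A := ha2.toLp a with hA
  have hloc : LocallyIntegrable ((𝓕⁻ A : Lp ℂ 2 (volume : Measure E2)) : E2 → ℂ) :=
    (Lp.memLp (𝓕⁻ A)).locallyIntegrable (by norm_num)
  refine ae_eq_of_integral_contDiff_smul_eq hloc hcont.locallyIntegrable ?_
  intro g hg hgc
  let φ : 𝓢(E2, ℂ) := (hgc.comp_left (g := Complex.ofReal) (by simp)).toSchwartzMap
    (Complex.ofRealCLM.contDiff.comp hg)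
  have hφ : ∀ x, φ x = (g x : ℂ) := fun x => rfl
  have key := congrArg (fun T => T φ) (Lp.fourierInv_toTemperedDistribution_eq A)
  simp only [TemperedDistribution.fourierInv_apply, Lp.toTemperedDistribution_apply] at key
  have e1 : ∀ x, g x • ((𝓕⁻ A : Lp ℂ 2 (volume : Measure E2)) : E2 → ℂ) x
      = φ x • ((𝓕⁻ A : Lp ℂ 2 (volume : Measure E2)) : E2 → ℂ) x := by
    intro x; rw [hφ, Complex.real_smul, smul_eq_mul]
  simp_rw [e1]
  rw [← key]
  have e2 : ∀ x, g x • 𝓕⁻ a x = 𝓕⁻ a x * φ x := by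
    intro x; rw [hφ, Complex.real_smul, mul_comm]
  simp_rw [e2]
  rw [integral_fourierInv_mul ha φ.integrable]
  refine integral_congr_ae ?_
  filter_upwards [ha2.coeFn_toLp] with x hx
  rw [hx, smul_eq_mul, mul_comm, SchwartzMap.fourierInv_coe]

open scoped FourierTransform in
lemma memLp_fourierInv {a : E2 → ℂ} (ha : Integrable a) (ha2 : MemLp a 2) :
    MemLp (𝓕⁻ a) 2 := (memLp_congr_ae (Lp_fourierInv_ae ha ha2)).1 (Lp.memLp _)

open scoped FourierTransform ComplexConjugate in
lemma parseval_fourierInv {a b : E2 → ℂ} (ha : Integrable a) (ha2 : MemLp a 2)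
    (hb : Integrable b) (hb2 : MemLp b 2) :
    ∫ x, conj (𝓕⁻ a x) * 𝓕⁻ b x = ∫ ξ, conj (a ξ) * b ξ := by
  have h := (Lp.fourierTransformₗᵢ E2 ℂ).symm.inner_map_map (ha2.toLp a) (hb2.toLp b)
  rw [L2.inner_def, L2.inner_def] at h
  have e1 : ∫ x, conj (𝓕⁻ a x) * 𝓕⁻ b x = ∫ x, inner ℂ (((Lp.fourierTransformₗᵢ E2 ℂ).symm (ha2.toLp a) : Lp ℂ 2 (volume : Measure E2)) x) (((Lp.fourierTransformₗᵢ E2 ℂ).symm (hb2.toLp b) : Lp ℂ 2 (volume : Measure E2)) x) := by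
    refine integral_congr_ae ?_
    filter_upwards [Lp_fourierInv_ae ha ha2, Lp_fourierInv_ae hb hb2] with x h1 h2
    rw [← h1, ← h2]
    simp only [RCLike.inner_apply, mul_comm]
    rfl
  rw [e1, h]
  refine integral_congr_ae ?_
  filter_upwards [ha2.coeFn_toLp, hb2.coeFn_toLp] with x h1 h2
  rw [h1, h2, RCLike.inner_apply, mul_comm]

/-- the constant (2π)^{-2} -/
def c2 : ℝ := ((2 * Real.pi) ^ 2)⁻¹
lemma c2_pos : 0 < c2 := by unfold c2; positivity

open scoped FourierTransform in
lemma invFt_scale (a : E2 → ℂ) : invFt a = fun x => c2 • 𝓕⁻ a ((2 * Real.pi)⁻¹ • x) := by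
  ext x; rw [invFt_eq]; rfl

lemma memLp_comp_smul {f : E2 → ℂ} (hf : MemLp f 2) {c : ℝ} (hc : c ≠ 0) :
    MemLp (fun x => f (c • x)) 2 := by
  have hm : Measure.map (fun x : E2 => c • x) volume = ENNReal.ofReal |(c ^ 2)⁻¹| • volume := by
    have := Measure.map_addHaar_smul (volume : Measure E2) hc
    simpa using this
  have h2 : MemLp f 2 (Measure.map (fun x : E2 => c • x) volume) := by
    rw [hm]; exact hf.smul_measure (by simp)
  exact h2.comp_of_map (by fun_prop)

lemma memLp_invFt {a : E2 → ℂ} (ha : Integrable a) (ha2 : MemLp a 2) : MemLp (invFt a) 2 := by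
  rw [invFt_scale]
  exact (memLp_comp_smul (memLp_fourierInv ha ha2) (c := (2 * Real.pi)⁻¹) (by positivity)).const_smul c2

open scoped ComplexConjugate in
lemma parseval_invFt {a b : E2 → ℂ} (ha : Integrable a) (ha2 : MemLp a 2)
    (hb : Integrable b) (hb2 : MemLp b 2) :
    ∫ x, conj (invFt a x) * invFt b x = c2 * ∫ ξ, conj (a ξ) * b ξ := by
  rw [← parseval_fourierInv ha ha2 hb hb2, invFt_scale, invFt_scale]
  have h := Measure.integral_comp_smul (volume : Measure E2)
    (fun x => conj (FourierTransformInv.fourierInv a x) * FourierTransformInv.fourierInv b x) (2 * Real.pi)⁻¹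
  simp only [Complex.real_smul, map_mul, Complex.conj_ofReal]
  have e : ∀ x : E2, (c2:ℂ) * conj (FourierTransformInv.fourierInv a ((2 * Real.pi)⁻¹ • x)) * ((c2:ℂ) * FourierTransformInv.fourierInv b ((2 * Real.pi)⁻¹ • x)) = (c2:ℂ)^2 * (conj (FourierTransformInv.fourierInv a ((2 * Real.pi)⁻¹ • x)) * FourierTransformInv.fourierInv b ((2 * Real.pi)⁻¹ • x)) := by
    intro x; ring
  simp_rw [e]
  rw [integral_const_mul, h]
  rw [show (Module.finrank ℝ E2) = 2 by simp, abs_of_nonneg (by positivity), Complex.real_smul, ← mul_assoc]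
  congr 1
  unfold c2
  have : (Real.pi : ℂ) ≠ 0 := by exact_mod_cast Real.pi_ne_zero
  push_cast
  field_simp

lemma norm_invFt_le (a : E2 → ℂ) (x : E2) : ‖invFt a x‖ ≤ c2 * ∫ ξ, ‖a ξ‖ := by
  unfold invFt
  rw [norm_smul, Real.norm_of_nonneg (by positivity)]
  refine mul_le_mul_of_nonneg_left ?_ (by positivity)
  refine (norm_integral_le_integral_norm _).trans (le_of_eq ?_)
  congr 1; ext ξ
  rw [norm_mul, mul_comm Complex.I, Complex.norm_exp_ofReal_mul_I, one_mul]

lemma continuous_invFt {a : E2 → ℂ} (ha : Integrable a) : Continuous (invFt a) := by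
  suffices h : Continuous fun x : E2 =>
      (∫ ξ : E2, Complex.exp (Complex.I * ((⟪x, ξ⟫ : ℝ) : ℂ)) * a ξ) from h.const_smul c2
  refine continuous_of_dominated (bound := fun ξ => ‖a ξ‖) ?_ ?_ ha.norm ?_
  · intro x
    exact (Continuous.aestronglyMeasurable (by fun_prop)).mul ha.aestronglyMeasurable
  · intro x; filter_upwards with ξ
    rw [norm_mul, mul_comm Complex.I, Complex.norm_exp_ofReal_mul_I, one_mul]
  · filter_upwards with ξ
    fun_prop

lemma invFt_congr_ae {a b : E2 → ℂ} (h : a =ᵐ[volume] b) : invFt a = invFt b := by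
  ext x
  unfold invFt
  congr 1
  refine integral_congr_ae ?_
  filter_upwards [h] with ξ hξ
  rw [hξ]

open scoped ComplexConjugate in
lemma conj_invFt (a : E2 → ℂ) (x : E2) : conj (invFt a x) = invFt (fun ξ => conj (a (-ξ))) x := by
  unfold invFt
  rw [Complex.real_smul, Complex.real_smul, map_mul, Complex.conj_ofReal, ← integral_conj, ← integral_neg_eq_self]
  congr 2; ext ξ
  rw [map_mul, ← Complex.exp_conj]
  simp

open scoped FourierTransform Convolution in
lemma invFt_mul_invFt {a b : E2 → ℂ} (ha : Integrable a) (hb : Integrable b) (x : E2) :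
    invFt a x * invFt b x = invFt (fun ξ => (c2:ℂ) * ∫ η, a η * b (ξ - η)) x := by
  have h := Real.fourier_mul_convolution_eq ha hb (-((2 * Real.pi)⁻¹ • x))
  rw [← Real.fourierInv_eq_fourier_neg, ← Real.fourierInv_eq_fourier_neg, ← Real.fourierInv_eq_fourier_neg] at h
  have e : invFt (fun ξ => (c2:ℂ) * ∫ η, a η * b (ξ - η)) x = (c2:ℂ) * invFt (fun ξ => ∫ η, a η * b (ξ - η)) x := by
    unfold invFt
    simp_rw [Complex.real_smul, mul_left_comm _ (c2:ℂ), integral_const_mul]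
    ring
  rw [e, invFt_eq, invFt_eq, invFt_eq]
  have e2 : (a ⋆[ContinuousLinearMap.mul ℂ ℂ] b) = (fun ξ => ∫ η, a η * b (ξ - η)) := rfl
  rw [e2] at h
  rw [h]
  simp only [Complex.real_smul, c2]
  ring

open scoped FourierTransform SchwartzMap in
/-- the Fourier transform of a test function is Schwartz -/
lemma ft_schwartz {f : E2 → ℂ} (hf : ContDiff ℝ (⊤ : ℕ∞) f) (hc : HasCompactSupport f) :
    ∃ φ : 𝓢(E2, ℂ), (∀ ξ, φ ξ = ft f ξ) := by
  let F : 𝓢(E2, ℂ) := hc.toSchwartzMap hf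
  let L : E2 ≃L[ℝ] E2 := ContinuousLinearEquiv.smulLeft (Units.mk0 ((2 * Real.pi)⁻¹ : ℝ) (by positivity))
  refine ⟨SchwartzMap.compCLMOfContinuousLinearEquiv ℂ L (𝓕 F), fun ξ => ?_⟩
  rw [ft_eq]
  rfl

open scoped FourierTransform SchwartzMap in
lemma integrable_invFt_schwartz (φ : 𝓢(E2, ℂ)) : Integrable (invFt φ) := by
  rw [integrable_invFt_iff, ← SchwartzMap.fourierInv_coe]
  exact (𝓕⁻ φ).integrable

open scoped FourierTransform SchwartzMap in
lemma invFt_ft {f : E2 → ℂ} (hf : ContDiff ℝ (⊤ : ℕ∞) f) (hc : HasCompactSupport f) :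
    invFt (ft f) = f := by
  let F : 𝓢(E2, ℂ) := hc.toSchwartzMap hf
  have hF : ∀ x, F x = f x := fun x => rfl
  ext x
  rw [invFt_eq']
  have : (fun η => ft f ((2 * Real.pi) • η)) = 𝓕 f := by
    ext η; rw [ft_eq, smul_smul, inv_mul_cancel₀ twopi_pos.ne', one_smul]
  rw [this]
  have h := Continuous.fourierInv_fourier_eq (f := f) F.continuous F.integrable (by
    have := (𝓕 F).integrable (μ := volume)
    rw [SchwartzMap.fourier_coe] at this
    exact this)
  rw [h]

lemma hasFDerivAt_invFt {a : E2 → ℂ} (ha : Integrable a)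
    (ha1 : Integrable (fun ξ => ‖ξ‖ * ‖a ξ‖)) (x : E2) :
    HasFDerivAt (invFt a) (c2 • ∫ ξ : E2, (Complex.exp (Complex.I * ((⟪x, ξ⟫ : ℝ) : ℂ)) * a ξ) •
      (Complex.I • (Complex.ofRealCLM.comp (innerSL ℝ ξ)))) x := by
  suffices h : HasFDerivAt (fun x : E2 =>
      (∫ ξ : E2, Complex.exp (Complex.I * ((⟪x, ξ⟫ : ℝ) : ℂ)) * a ξ)) (∫ ξ : E2, (Complex.exp (Complex.I * ((⟪x, ξ⟫ : ℝ) : ℂ)) * a ξ) •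
      (Complex.I • (Complex.ofRealCLM.comp (innerSL ℝ ξ)))) x from h.const_smul c2
  have hm : ∀ x : E2, AEStronglyMeasurable (fun ξ : E2 => Complex.exp (Complex.I * ((⟪x, ξ⟫ : ℝ) : ℂ)) * a ξ) :=
    fun x => (Continuous.aestronglyMeasurable (by fun_prop)).mul ha.aestronglyMeasurable
  refine hasFDerivAt_integral_of_dominated_of_fderiv_le (F' := fun x ξ => (Complex.exp (Complex.I * ((⟪x, ξ⟫ : ℝ) : ℂ)) * a ξ) •
      (Complex.I • (Complex.ofRealCLM.comp (innerSL ℝ ξ)))) (bound := fun ξ => ‖ξ‖ * ‖a ξ‖)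
      Filter.univ_mem (Filter.Eventually.of_forall hm) ?_ ?_ ?_ ha1 ?_
  · refine ha.mono (hm x) ?_
    filter_upwards with ξ
    rw [norm_mul, mul_comm Complex.I, Complex.norm_exp_ofReal_mul_I, one_mul]
  · refine (hm x).smul (Continuous.aestronglyMeasurable ?_)
    exact (((ContinuousLinearMap.compL ℝ E2 ℝ ℂ) Complex.ofRealCLM).continuous.comp
      (innerSL ℝ (E := E2)).continuous).const_smul Complex.I
  · filter_upwards with ξ y _
    rw [norm_smul, norm_mul, mul_comm Complex.I, Complex.norm_exp_ofReal_mul_I, one_mul, norm_smul, Complex.norm_I, one_mul, mul_comm]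
    gcongr
    refine (ContinuousLinearMap.opNorm_comp_le _ _).trans ?_
    simp
  · filter_upwards with ξ y _
    have h1 : HasFDerivAt (fun y : E2 => ((⟪y, ξ⟫ : ℝ) : ℂ)) (Complex.ofRealCLM.comp (innerSL ℝ ξ)) y := by
      have : (fun y : E2 => ((⟪y, ξ⟫ : ℝ) : ℂ)) = (Complex.ofRealCLM.comp (innerSL ℝ ξ)) := by
        ext y; simp [real_inner_comm]
      rw [this]
      exact ContinuousLinearMap.hasFDerivAt _
    have h2 := ((h1.const_mul Complex.I).cexp).mul_const (a ξ)
    refine h2.congr_fderiv ?_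
    ext v
    simp
    ring

lemma fderiv_invFt_apply {a : E2 → ℂ} (ha : Integrable a)
    (ha1 : Integrable (fun ξ => ‖ξ‖ * ‖a ξ‖)) (x e : E2) :
    fderiv ℝ (invFt a) x e = invFt (fun ξ => Complex.I * ((⟪ξ, e⟫ : ℝ) : ℂ) * a ξ) x := by
  rw [(hasFDerivAt_invFt ha ha1 x).fderiv]
  rw [_root_.smul_apply, ContinuousLinearMap.integral_apply]
  · unfold invFt c2
    congr 2
    ext ξ
    simp
    ring
  · refine ha1.mono' ?_ ?_
    · refine ((Continuous.aestronglyMeasurable (by fun_prop)).mul ha.aestronglyMeasurable).smul (Continuous.aestronglyMeasurable ?_)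
      exact (((ContinuousLinearMap.compL ℝ E2 ℝ ℂ) Complex.ofRealCLM).continuous.comp
        (innerSL ℝ (E := E2)).continuous).const_smul Complex.I
    · filter_upwards with ξ
      rw [norm_smul, norm_mul, mul_comm Complex.I, Complex.norm_exp_ofReal_mul_I, one_mul, norm_smul, Complex.norm_I, one_mul, mul_comm]
      gcongr
      refine (ContinuousLinearMap.opNorm_comp_le _ _).trans ?_
      simp

lemma invFt_add {a b : E2 → ℂ} (ha : Integrable a) (hb : Integrable b) (x : E2) :
    invFt (fun ξ => a ξ + b ξ) x = invFt a x + invFt b x := by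
  unfold invFt
  simp_rw [mul_add]
  rw [integral_add, smul_add]
  · refine ha.bdd_mul (c := 1) (Continuous.aestronglyMeasurable (by fun_prop)) ?_
    filter_upwards with ξ
    rw [mul_comm Complex.I, Complex.norm_exp_ofReal_mul_I]
  · refine hb.bdd_mul (c := 1) (Continuous.aestronglyMeasurable (by fun_prop)) ?_
    filter_upwards with ξ
    rw [mul_comm Complex.I, Complex.norm_exp_ofReal_mul_I]

lemma lap_invFt {a : E2 → ℂ} (ha : Integrable a)
    (ha2 : Integrable (fun ξ => ‖ξ‖ ^ 2 * ‖a ξ‖)) (x : E2) :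
    lap (invFt a) x = invFt (fun ξ => -((‖ξ‖ ^ 2 : ℝ) : ℂ) * a ξ) x := by
  have ha1 : Integrable (fun ξ => ‖ξ‖ * ‖a ξ‖) := by
    refine (ha.norm.add ha2).mono' (Continuous.aestronglyMeasurable (by fun_prop) |>.mul ha.norm.aestronglyMeasurable) ?_
    filter_upwards with ξ
    rw [Real.norm_of_nonneg (by positivity)]
    simp only [Pi.add_apply]
    nlinarith [norm_nonneg (a ξ), mul_nonneg (norm_nonneg (a ξ)) (sq_nonneg (‖ξ‖ - 1)), mul_nonneg (norm_nonneg (a ξ)) (sq_nonneg (‖ξ‖))]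
  unfold lap
  have hle : ∀ (ξ e : E2), ‖e‖ = 1 → ‖(Complex.I * ((⟪ξ, e⟫ : ℝ) : ℂ) * a ξ)‖ ≤ ‖ξ‖ * ‖a ξ‖ := by
    intro ξ e he
    rw [norm_mul, norm_mul, Complex.norm_I, one_mul, Complex.norm_real]
    gcongr
    have := norm_inner_le_norm (𝕜 := ℝ) ξ e
    rwa [he, mul_one] at this
  have hm : ∀ e : E2, AEStronglyMeasurable (fun ξ => Complex.I * ((⟪ξ, e⟫ : ℝ) : ℂ) * a ξ) :=
    fun e => (Continuous.aestronglyMeasurable (by fun_prop)).mul ha.aestronglyMeasurable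
  have hI : ∀ e : E2, ‖e‖ = 1 → Integrable (fun ξ => Complex.I * ((⟪ξ, e⟫ : ℝ) : ℂ) * a ξ) :=
    fun e he => ha1.mono' (hm e) (by filter_upwards with ξ using hle ξ e he)
  have hI1 : ∀ e : E2, ‖e‖ = 1 → Integrable (fun ξ => ‖ξ‖ * ‖Complex.I * ((⟪ξ, e⟫ : ℝ) : ℂ) * a ξ‖) := by
    intro e he
    refine ha2.mono' (Continuous.aestronglyMeasurable (by fun_prop) |>.mul (hm e).norm) ?_
    filter_upwards with ξ
    rw [Real.norm_of_nonneg (by positivity), pow_two, mul_assoc ‖ξ‖ ‖ξ‖]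
    gcongr
    exact hle ξ e he
  have hn : ∀ i : Fin 2, ‖(EuclideanSpace.single i (1:ℝ) : E2)‖ = 1 := fun i => by simp
  have e1 : ∀ i : Fin 2, (fun y => fderiv ℝ (invFt a) y (EuclideanSpace.single i (1:ℝ))) =
      invFt (fun ξ => Complex.I * ((⟪ξ, EuclideanSpace.single i (1:ℝ)⟫ : ℝ) : ℂ) * a ξ) := by
    intro i; ext y; exact fderiv_invFt_apply ha ha1 y _
  simp_rw [e1]
  have e2 := fun i : Fin 2 => fderiv_invFt_apply (hI _ (hn i)) (hI1 _ (hn i)) x (EuclideanSpace.single i (1:ℝ))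
  have hI2 : ∀ i : Fin 2, Integrable (fun ξ => Complex.I * ((⟪ξ, EuclideanSpace.single i (1:ℝ)⟫ : ℝ) : ℂ) *
      (Complex.I * ((⟪ξ, EuclideanSpace.single i (1:ℝ)⟫ : ℝ) : ℂ) * a ξ)) := by
    intro i
    refine (hI1 _ (hn i)).mono' ((Continuous.aestronglyMeasurable (by fun_prop)).mul (hm _)) ?_
    filter_upwards with ξ
    rw [norm_mul, norm_mul, Complex.norm_I, one_mul, Complex.norm_real]
    gcongr
    have := norm_inner_le_norm (𝕜 := ℝ) ξ (EuclideanSpace.single i (1:ℝ))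
    rwa [hn, mul_one] at this
  simp_rw [e2]
  rw [Fin.sum_univ_two, ← invFt_add]
  · congr 1
    ext ξ
    simp only [EuclideanSpace.inner_single_right, one_mul]
    rw [EuclideanSpace.norm_sq_eq, Fin.sum_univ_two]
    simp only [Real.norm_eq_abs, sq_abs]
    push_cast
    simp
    linear_combination (a ξ * ((ξ 0 : ℂ)^2 + (ξ 1:ℂ)^2)) * Complex.I_mul_I
  · exact hI2 0
  · exact hI2 1

/-- oscillating phase -/
def eph (τ : ℝ) (ξ : E2) : ℂ := Complex.exp (-Complex.I * (τ : ℂ) * ((‖ξ‖ ^ 4 : ℝ) : ℂ))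

lemma norm_eph (τ : ℝ) (ξ : E2) : ‖eph τ ξ‖ = 1 := by
  unfold eph
  rw [show -Complex.I * (τ : ℂ) * ((‖ξ‖ ^ 4 : ℝ) : ℂ) = ((-τ * ‖ξ‖^4 : ℝ) : ℂ) * Complex.I by push_cast; ring]
  exact Complex.norm_exp_ofReal_mul_I _

lemma continuous_eph : Continuous (fun p : ℝ × E2 => eph p.1 p.2) := by
  unfold eph; fun_prop

/-- `1+|ξ|²` -/
def pj (ξ : E2) : ℝ := 1 + ‖ξ‖ ^ 2
lemma one_le_pj (ξ : E2) : 1 ≤ pj ξ := by unfold pj; nlinarith [sq_nonneg ‖ξ‖]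
lemma pj_pos (ξ : E2) : 0 < pj ξ := by have := one_le_pj ξ; linarith
lemma continuous_pj : Continuous pj := by unfold pj; fun_prop

lemma iteratedDeriv_phase (i : ℕ) : iteratedDeriv i (fun y : ℝ => Complex.exp (-Complex.I * (y:ℂ))) =
    fun y : ℝ => (-Complex.I) ^ i * Complex.exp (-Complex.I * (y:ℂ)) := by
  induction i with
  | zero => ext y; simp
  | succ i ih =>
    rw [iteratedDeriv_succ, ih]
    ext y
    have h1 : HasDerivAt (fun y : ℝ => (y:ℂ)) 1 y := Complex.ofRealCLM.hasDerivAt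
    have h2 := (((h1.const_mul (-Complex.I)).cexp).const_mul ((-Complex.I)^i)).deriv
    rw [h2]; ring

lemma eph_deriv_bound : ∃ k : ℕ, ∀ T : ℝ, ∃ C : ℝ, 0 ≤ C ∧ ∀ τ : ℝ, |τ| ≤ T → ∀ i ≤ 3, ∀ ξ : E2,
    ‖iteratedFDeriv ℝ i (eph τ) ξ‖ ≤ C * (1 + ‖ξ‖) ^ k := by
  have h4 : Function.HasTemperateGrowth (fun ξ : E2 => ‖ξ‖ ^ 4) := by
    have := (Function.hasTemperateGrowth_norm_sq E2).pow 2
    have e : (fun ξ : E2 => ‖ξ‖ ^ 4) = (fun ξ : E2 => ‖ξ‖ ^ 2) ^ 2 := by ext; simp; ring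
    rw [e]; exact this
  obtain ⟨k, C, hC, hb⟩ := h4.norm_iteratedFDeriv_le_uniform 3
  refine ⟨3 * k, fun T => ⟨6 * (max 1 (T * C)) ^ 3, by positivity, ?_⟩⟩
  intro τ hτ i hi ξ
  set D : ℝ := max 1 (T * C) * (1 + ‖ξ‖) ^ k with hD
  have hk1 : 1 ≤ (1 + ‖ξ‖) ^ k := one_le_pow₀ (by linarith [norm_nonneg ξ])
  have hD1 : 1 ≤ D := one_le_mul_of_one_le_of_one_le (le_max_left _ _) hk1
  have hcd : ContDiff ℝ (3:ℕ) (fun ξ : E2 => ‖ξ‖ ^ 4) := by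
    have : (fun ξ : E2 => ‖ξ‖ ^ 4) = fun ξ => (‖ξ‖^2)^2 := by ext; ring
    rw [this]; exact (contDiff_norm_sq ℝ).pow 2
  have e : eph τ = (fun y : ℝ => Complex.exp (-Complex.I * (y:ℂ))) ∘ (fun ξ => τ • ‖ξ‖ ^ 4) := by
    ext ξ; simp only [eph, Function.comp, smul_eq_mul]; congr 1; push_cast; ring
  have hg : ContDiff ℝ (3:ℕ) (fun y : ℝ => Complex.exp (-Complex.I * (y:ℂ))) := by
    exact (contDiff_const.mul Complex.ofRealCLM.contDiff).cexp
  have := norm_iteratedFDeriv_comp_le (n := i) (N := (3:ℕ)) hg (hcd.const_smul τ) (by exact_mod_cast hi) ξ (C := 1) (D := D) ?_ ?_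
  · rw [e]
    refine this.trans ?_
    have h1 : D ^ i ≤ D ^ 3 := pow_le_pow_right₀ hD1 hi
    have h2 : (i.factorial : ℝ) ≤ 6 := by
      have := Nat.factorial_le hi
      exact_mod_cast this
    calc (i.factorial : ℝ) * 1 * D ^ i ≤ 6 * 1 * D ^ 3 := by gcongr
      _ = _ := by rw [hD]; ring
  · intro j hj
    rw [norm_iteratedFDeriv_eq_norm_iteratedDeriv, iteratedDeriv_phase]
    rw [norm_mul, norm_pow, norm_neg, Complex.norm_I, one_pow, one_mul]
    rw [show ∀ y : ℝ, -Complex.I * (y:ℂ) = ((-y : ℝ):ℂ) * Complex.I by intro y; push_cast; ring]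
    rw [Complex.norm_exp_ofReal_mul_I]
  · intro j hj1 hj
    have hcd' : ContDiffAt ℝ (j:ℕ) (fun ξ : E2 => ‖ξ‖ ^ 4) ξ := (hcd.of_le (by exact_mod_cast hj.trans hi)).contDiffAt
    have e3 := iteratedFDeriv_const_smul_apply (𝕜 := ℝ) (i := j) (a := τ) hcd'
    have e4 : (fun ξ : E2 => τ • ‖ξ‖ ^ 4) = τ • (fun ξ : E2 => ‖ξ‖ ^ 4) := rfl
    rw [e4, e3, norm_smul]
    have h5 := hb j (hj.trans hi) ξ
    calc ‖τ‖ * _ ≤ T * (C * (1 + ‖ξ‖) ^ k) := by gcongr; exact (abs_nonneg _).trans hτ; exact hτ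
      _ = (T * C) * (1 + ‖ξ‖) ^ k := by ring
      _ ≤ D := by rw [hD]; gcongr; exact le_max_right _ _
      _ ≤ D ^ j := le_self_pow₀ hD1 (by omega)

lemma contDiff_eph (τ : ℝ) : ContDiff ℝ (3:ℕ) (eph τ) := by
  have h4 : ContDiff ℝ (3:ℕ) (fun ξ : E2 => ‖ξ‖ ^ 4) := by
    have : (fun ξ : E2 => ‖ξ‖ ^ 4) = fun ξ => (‖ξ‖^2)^2 := by ext; ring
    rw [this]; exact (contDiff_norm_sq ℝ).pow 2
  unfold eph
  exact (contDiff_const.mul (Complex.ofRealCLM.contDiff.comp h4)).cexp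

lemma contDiff_qinv : ContDiff ℝ (3:ℕ) (fun ξ : E2 => (pj ξ)⁻¹) := by
  refine ContDiff.inv ?_ (fun ξ => (pj_pos ξ).ne')
  exact contDiff_const.add (contDiff_norm_sq ℝ)

lemma qpow_deriv_bound : ∃ k : ℕ, ∀ n : ℕ, ∃ C : ℝ, 0 ≤ C ∧ ∀ i ≤ 3, ∀ ξ : E2,
    ‖iteratedFDeriv ℝ i (fun ξ => ((pj ξ)⁻¹) ^ (n + 3)) ξ‖ ≤ C * ((pj ξ)⁻¹) ^ n * (1 + ‖ξ‖) ^ k := by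
  have h4 : Function.HasTemperateGrowth (fun ξ : E2 => (pj ξ)⁻¹) := by
    have := (Function.hasTemperateGrowth_one_add_norm_sq_rpow E2 (-1))
    have e : (fun ξ : E2 => (pj ξ)⁻¹) = fun x : E2 => (1 + ‖x‖ ^ 2) ^ (-1 : ℝ) := by
      ext ξ; rw [Real.rpow_neg_one]; rfl
    rw [e]; exact this
  obtain ⟨k, C, hC, hb⟩ := h4.norm_iteratedFDeriv_le_uniform 3
  refine ⟨3 * k, fun n => ?_⟩
  set B : ℝ := ∑ j ∈ Finset.range 4, ‖∏ l ∈ Finset.range j, (((n+3 : ℕ):ℝ) - l)‖ with hB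
  refine ⟨6 * B * (max 1 C) ^ 3, by positivity, ?_⟩
  intro i hi ξ
  set D : ℝ := max 1 C * (1 + ‖ξ‖) ^ k with hD
  have hk1 : 1 ≤ (1 + ‖ξ‖) ^ k := one_le_pow₀ (by linarith [norm_nonneg ξ])
  have hD1 : 1 ≤ D := one_le_mul_of_one_le_of_one_le (le_max_left _ _) hk1
  have hq0 : 0 ≤ (pj ξ)⁻¹ := inv_nonneg.2 (pj_pos ξ).le
  have hq1 : (pj ξ)⁻¹ ≤ 1 := inv_le_one_of_one_le₀ (one_le_pj ξ)
  have hg : ContDiff ℝ (3:ℕ) (fun y : ℝ => y ^ (n+3)) := contDiff_id.pow _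
  have := norm_iteratedFDeriv_comp_le (n := i) (N := (3:ℕ)) hg contDiff_qinv (by exact_mod_cast hi) ξ (C := B * ((pj ξ)⁻¹) ^ n) (D := D) ?_ ?_
  · have e : (fun ξ => ((pj ξ)⁻¹) ^ (n + 3)) = (fun y : ℝ => y ^ (n+3)) ∘ (fun ξ => (pj ξ)⁻¹) := rfl
    rw [e]
    refine this.trans ?_
    have h1 : D ^ i ≤ D ^ 3 := pow_le_pow_right₀ hD1 hi
    have h2 : (i.factorial : ℝ) ≤ 6 := by
      have := Nat.factorial_le hi
      exact_mod_cast this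
    calc (i.factorial : ℝ) * (B * ((pj ξ)⁻¹) ^ n) * D ^ i ≤ 6 * (B * ((pj ξ)⁻¹) ^ n) * D ^ 3 := by gcongr
      _ = _ := by rw [hD]; ring
  · intro j hj
    rw [norm_iteratedFDeriv_eq_norm_iteratedDeriv, iteratedDeriv_eq_iterate, iter_deriv_pow, norm_mul]
    gcongr
    · exact Finset.single_le_sum (f := fun j => ‖∏ l ∈ Finset.range j, (((n+3 : ℕ):ℝ) - l)‖)
        (fun _ _ => norm_nonneg _) (Finset.mem_range.2 (by omega))
    · rw [norm_pow, Real.norm_of_nonneg hq0]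
      exact pow_le_pow_of_le_one hq0 hq1 (by omega)
  · intro j hj1 hj
    refine (hb j (hj.trans hi) ξ).trans ?_
    calc C * (1 + ‖ξ‖) ^ k ≤ D := by rw [hD]; gcongr; exact le_max_right _ _
      _ ≤ D ^ j := le_self_pow₀ hD1 (by omega)

/-- the uniform kernel multiplier -/
lemma kernel_bound : ∃ n : ℕ, ∀ T : ℝ, ∃ C : ℝ, 0 ≤ C ∧ ∀ τ : ℝ, |τ| ≤ T → ∀ i ≤ 3, ∀ ξ : E2,
    ‖iteratedFDeriv ℝ i (fun ξ => ((((pj ξ)⁻¹) ^ n : ℝ) : ℂ) * eph τ ξ) ξ‖ ≤ C * (1 + ‖ξ‖) ^ (-3 : ℝ) := by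
  obtain ⟨k1, h1⟩ := eph_deriv_bound
  obtain ⟨k2, h2⟩ := qpow_deriv_bound
  set K := k1 + k2 + 3 with hK
  obtain ⟨C2, hC2, h2⟩ := h2 K
  refine ⟨K + 3, fun T => ?_⟩
  obtain ⟨C1, hC1, h1⟩ := h1 T
  refine ⟨8 * C1 * C2 * 2 ^ K, by positivity, ?_⟩
  intro τ hτ i hi ξ
  have hcq : ContDiff ℝ (3:ℕ) (fun ξ : E2 => (pj ξ)⁻¹ ^ (K+3)) := contDiff_qinv.pow _
  have e : (fun ξ => ((((pj ξ)⁻¹) ^ (K+3) : ℝ) : ℂ) * eph τ ξ) = fun ξ => (pj ξ)⁻¹ ^ (K+3) • eph τ ξ := by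
    ext ξ; rw [Complex.real_smul]
  rw [e]
  have hm := norm_iteratedFDeriv_smul_le (𝕜 := ℝ) (N := (3:ℕ)) hcq (contDiff_eph τ) ξ (n := i) (by exact_mod_cast hi)
  refine hm.trans ?_
  have hx : 0 < 1 + ‖ξ‖ := by positivity
  have hq0 : 0 ≤ (pj ξ)⁻¹ := inv_nonneg.2 (pj_pos ξ).le
  set M := C2 * ((pj ξ)⁻¹) ^ K * (1 + ‖ξ‖) ^ k2 * (C1 * (1 + ‖ξ‖) ^ k1) with hM
  have hM0 : 0 ≤ M := by positivity
  calc _ ≤ ∑ j ∈ Finset.range (i + 1), (i.choose j : ℝ) * M := by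
        refine Finset.sum_le_sum fun j hj => ?_
        have hj' : j ≤ i := by simpa [Nat.lt_succ_iff] using hj
        rw [mul_assoc, hM]
        gcongr
        · exact h2 j (hj'.trans hi) ξ
        · exact h1 τ hτ (i - j) (by omega) ξ
    _ = (2:ℝ) ^ i * M := by
        rw [← Finset.sum_mul]; congr 1
        exact_mod_cast Nat.sum_range_choose i
    _ ≤ 8 * M := by
        gcongr
        calc (2:ℝ)^i ≤ 2^3 := pow_le_pow_right₀ (by norm_num) hi
          _ = 8 := by norm_num
    _ ≤ _ := ?_
  have hq : (pj ξ)⁻¹ ≤ 2 * ((1 + ‖ξ‖) ^ 2)⁻¹ := by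
    rw [inv_le_iff_one_le_mul₀ (pj_pos ξ), ← div_eq_mul_inv, div_mul_eq_mul_div, one_le_div (by positivity)]
    unfold pj; nlinarith [sq_nonneg (1 - ‖ξ‖)]
  have hqK : ((pj ξ)⁻¹) ^ K ≤ 2 ^ K * (((1 + ‖ξ‖) ^ 2)⁻¹) ^ K := by
    rw [← mul_pow]; gcongr
  have hfin : (((1 + ‖ξ‖) ^ 2)⁻¹) ^ K * (1 + ‖ξ‖) ^ k2 * (1 + ‖ξ‖) ^ k1 ≤ (1 + ‖ξ‖) ^ (-3 : ℝ) := by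
    rw [Real.rpow_neg hx.le, show (3:ℝ) = ((3:ℕ):ℝ) by norm_num, Real.rpow_natCast, inv_pow, ← pow_mul, mul_assoc, ← pow_add,
      inv_mul_eq_div, div_le_iff₀ (by positivity), inv_mul_eq_div, le_div_iff₀ (by positivity), ← pow_add]
    exact pow_le_pow_right₀ (by linarith [norm_nonneg ξ]) (by omega)
  calc 8 * M ≤ 8 * (C2 * (2 ^ K * (((1 + ‖ξ‖) ^ 2)⁻¹) ^ K) * (1 + ‖ξ‖) ^ k2 * (C1 * (1 + ‖ξ‖) ^ k1)) := by
        rw [hM]; gcongr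
    _ = 8 * C1 * C2 * 2 ^ K * ((((1 + ‖ξ‖) ^ 2)⁻¹) ^ K * (1 + ‖ξ‖) ^ k2 * (1 + ‖ξ‖) ^ k1) := by ring
    _ ≤ _ := by gcongr

/-- the kernel multiplier -/
def kmul (n : ℕ) (τ : ℝ) (ξ : E2) : ℂ := ((((pj ξ)⁻¹) ^ n : ℝ) : ℂ) * eph τ ξ

open scoped FourierTransform in
/-- the kernels are uniformly integrable -/
lemma kernel_integrable : ∃ n : ℕ, ∀ T : ℝ, ∃ C : ℝ≥0∞, C < ⊤ ∧ ∀ τ : ℝ, |τ| ≤ T →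
    Integrable (kmul n τ) ∧ Integrable (invFt (kmul n τ)) ∧ ∫⁻ x, ‖invFt (kmul n τ) x‖ₑ ≤ C := by
  obtain ⟨n, h⟩ := kernel_bound
  refine ⟨n, fun T => ?_⟩
  obtain ⟨C, hC, h⟩ := h T
  have hI3 : Integrable (fun ξ : E2 => (1 + ‖ξ‖) ^ (-3 : ℝ)) := integrable_one_add_norm (by simp; norm_num)
  set J := ∫ ξ : E2, (1 + ‖ξ‖) ^ (-3 : ℝ) with hJ
  have hcd : ∀ τ, ContDiff ℝ (3:ℕ) (kmul n τ) := fun τ =>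
    (Complex.ofRealCLM.contDiff.comp (contDiff_qinv.pow n)).mul (contDiff_eph τ)
  have hI : ∀ τ : ℝ, |τ| ≤ T → ∀ i ≤ 3, Integrable (fun ξ => ‖iteratedFDeriv ℝ i (kmul n τ) ξ‖) := by
    intro τ hτ i hi
    refine (hI3.const_mul C).mono' ?_ ?_
    · exact (ContDiff.continuous_iteratedFDeriv (by exact_mod_cast hi) (hcd τ)).norm.aestronglyMeasurable
    · filter_upwards with ξ
      rw [norm_norm]; exact h τ hτ i hi ξ
  have hJ' : ∀ τ : ℝ, |τ| ≤ T → ∀ i ≤ 3, ∫ ξ, ‖iteratedFDeriv ℝ i (kmul n τ) ξ‖ ≤ C * J := by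
    intro τ hτ i hi
    rw [hJ, ← integral_const_mul]
    exact integral_mono (hI τ hτ i hi) (hI3.const_mul C) (fun ξ => h τ hτ i hi ξ)
  have hF : ∀ τ : ℝ, |τ| ≤ T → ∀ w : E2, ‖𝓕 (kmul n τ) w‖ ≤ (256 * (C * J)) * (1 + ‖w‖) ^ (-3 : ℝ) := by
    intro τ hτ w
    have key : ∀ i ≤ 3, ‖w‖ ^ i * ‖𝓕 (kmul n τ) w‖ ≤ 8 * (4 * (C * J)) := by
      intro i hi
      have := Real.pow_mul_norm_iteratedFDeriv_fourier_le (K := 0) (N := 3) (f := kmul n τ) (hcd τ) (by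
        intro k j hk hj
        have hk0 : k = 0 := by simpa using hk
        subst hk0
        simp only [pow_zero, one_mul]
        exact hI τ hτ j (by exact_mod_cast hj)) (k := 0) (n := i) le_rfl (by exact_mod_cast hi) w
      simp only [norm_iteratedFDeriv_zero, pow_zero, Nat.cast_zero, mul_zero, zero_add, one_mul] at this
      refine this.trans ?_
      rw [Finset.sum_product]
      simp only [Finset.range_one, Finset.sum_singleton, pow_zero, one_mul]
      have hCJ : 0 ≤ C * J := (integral_nonneg (fun _ => norm_nonneg _)).trans (hJ' τ hτ 0 (by norm_num))
      have h2 : (2:ℝ)^i ≤ 8 := by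
        calc (2:ℝ)^i ≤ 2^3 := pow_le_pow_right₀ (by norm_num) hi
          _ = 8 := by norm_num
      have h3 : ∑ j ∈ Finset.range (i+1), ∫ ξ, ‖iteratedFDeriv ℝ j (kmul n τ) ξ‖ ≤ 4 * (C * J) := by
        calc _ ≤ ∑ j ∈ Finset.range (i+1), C * J := by
              refine Finset.sum_le_sum fun j hj => hJ' τ hτ j ?_
              have := Finset.mem_range.1 hj; omega
          _ = (i+1 : ℕ) * (C * J) := by simp
          _ ≤ 4 * (C * J) := by
              gcongr
              exact_mod_cast (by omega : i + 1 ≤ 4)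
      exact mul_le_mul h2 h3 (Finset.sum_nonneg fun _ _ => integral_nonneg fun _ => norm_nonneg _) (by norm_num)
    have hw : 0 < 1 + ‖w‖ := by positivity
    rw [Real.rpow_neg hw.le, show (3:ℝ) = ((3:ℕ):ℝ) by norm_num, Real.rpow_natCast, ← div_eq_mul_inv, le_div_iff₀ (by positivity)]
    have k0 := key 0 (by norm_num)
    have k3 := key 3 (by norm_num)
    simp only [pow_zero, one_mul] at k0
    have hx := norm_nonneg w
    have h4 : (1 + ‖w‖) ^ 3 ≤ 4 * (1 + ‖w‖ ^ 3) := by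
      nlinarith [mul_nonneg hx (sq_nonneg (1 - ‖w‖)), sq_nonneg (1 - ‖w‖)]
    calc ‖𝓕 (kmul n τ) w‖ * (1 + ‖w‖) ^ 3 ≤ ‖𝓕 (kmul n τ) w‖ * (4 * (1 + ‖w‖ ^ 3)) := by gcongr
      _ = 4 * (‖𝓕 (kmul n τ) w‖ + ‖w‖ ^ 3 * ‖𝓕 (kmul n τ) w‖) := by ring
      _ ≤ 256 * (C * J) := by linarith
  have hki : ∀ τ : ℝ, |τ| ≤ T → Integrable (kmul n τ) := by
    intro τ hτ
    have := hI τ hτ 0 (by norm_num)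
    simp only [norm_iteratedFDeriv_zero] at this
    exact (integrable_norm_iff (hcd τ).continuous.aestronglyMeasurable).1 this
  set B : E2 → ℝ := fun x => c2 * ((256 * (C * J)) * (1 + ‖(2*Real.pi)⁻¹ • x‖) ^ (-3 : ℝ)) with hB
  have hBi : Integrable B := by
    refine Integrable.const_mul ?_ _
    refine Integrable.const_mul ?_ _
    exact (integrable_comp_smul_iff volume (fun x : E2 => (1 + ‖x‖) ^ (-3 : ℝ)) (inv_ne_zero twopi_pos.ne')).2 hI3
  have hle : ∀ τ : ℝ, |τ| ≤ T → ∀ x, ‖invFt (kmul n τ) x‖ ≤ B x := by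
    intro τ hτ x
    rw [invFt_scale, norm_smul, Real.norm_of_nonneg c2_pos.le, Real.fourierInv_eq_fourier_neg]
    refine mul_le_mul_of_nonneg_left ?_ c2_pos.le
    have := hF τ hτ (-((2 * Real.pi)⁻¹ • x))
    rwa [norm_neg] at this
  refine ⟨∫⁻ x, ‖B x‖ₑ, hBi.2, fun τ hτ => ⟨hki τ hτ, hBi.mono' (continuous_invFt (hki τ hτ)).aestronglyMeasurable (Filter.Eventually.of_forall (hle τ hτ)), ?_⟩⟩
  refine lintegral_mono fun x => ?_
  rw [enorm_le_iff_norm_le]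
  exact (hle τ hτ x).trans (le_abs_self _)

lemma conv_invFt {K g : E2 → ℂ} (hK : Integrable K) (hg : Integrable g) (x : E2) :
    invFt (fun ξ => ft K ξ * g ξ) x = ∫ y, K y * invFt g (x - y) := by
  unfold invFt ft
  have e1 : ∀ ξ : E2, Complex.exp (Complex.I * ((⟪x, ξ⟫ : ℝ) : ℂ)) *
      ((∫ y : E2, Complex.exp (-Complex.I * ((⟪y, ξ⟫ : ℝ) : ℂ)) * K y) * g ξ) =
      ∫ y : E2, K y * (Complex.exp (Complex.I * ((⟪x - y, ξ⟫ : ℝ) : ℂ)) * g ξ) := by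
    intro ξ
    rw [← integral_mul_const, ← integral_const_mul]
    congr 1; ext y
    rw [inner_sub_left]
    push_cast
    rw [mul_sub, sub_eq_add_neg, Complex.exp_add, neg_mul]; ring
  simp_rw [e1]
  rw [integral_integral_swap]
  · rw [← integral_smul]
    congr 1; ext y
    rw [integral_const_mul, mul_smul_comm]
  · have h := (hK.mul_prod hg).swap
    refine h.mono ?_ ?_
    · have : (fun p : E2 × E2 => K p.2 * (Complex.exp (Complex.I * ((⟪x - p.2, p.1⟫ : ℝ) : ℂ)) * g p.1)) =
        fun p => (Complex.exp (Complex.I * ((⟪x - p.2, p.1⟫ : ℝ) : ℂ))) * (K p.2 * g p.1) := by ext p; ring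
      simp only [Function.uncurry_def]
      rw [this]
      refine AEStronglyMeasurable.mul (Continuous.aestronglyMeasurable (by fun_prop)) h.1
    · filter_upwards with p
      simp only [Function.uncurry_def, Function.comp, Prod.swap, norm_mul]
      rw [mul_comm Complex.I, Complex.norm_exp_ofReal_mul_I, one_mul]

/-- convolution -/
def cv {A : Type*} [NormedRing A] [NormedSpace ℝ A] (f g : E2 → A) (ξ : E2) : A := ∫ η, f η * g (ξ - η)

lemma invFt_const_mul (c : ℂ) (a : E2 → ℂ) (x : E2) : invFt (fun ξ => c * a ξ) x = c * invFt a x := by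
  unfold invFt
  rw [mul_smul_comm, ← integral_const_mul]
  congr 2; ext ξ; ring

lemma integrable_cv {a b : E2 → ℂ} (ha : Integrable a) (hb : Integrable b) : Integrable (cv a b) :=
  ha.integrable_convolution (ContinuousLinearMap.mul ℝ ℂ) hb

lemma lintegral_sq_invFt {a : E2 → ℂ} (ha : Integrable a) (ha2 : MemLp a 2) :
    eLpNorm (invFt a) 2 volume = ENNReal.ofReal (Real.sqrt c2) * eLpNorm a 2 volume := by
  have h := parseval_invFt ha ha2 ha ha2
  have e : ∀ f : E2 → ℂ, ∫ x, (starRingEnd ℂ) (f x) * f x = ((∫ x, ‖f x‖^2 : ℝ) : ℂ) := by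
    intro f; rw [← integral_complex_ofReal]; congr 1; ext x
    rw [mul_comm, Complex.mul_conj, Complex.normSq_eq_norm_sq]
  rw [e, e] at h
  have h' : ∫ x, ‖invFt a x‖^2 = c2 * ∫ x, ‖a x‖^2 := by exact_mod_cast h
  have g : ∀ f : E2 → ℂ, MemLp f 2 → eLpNorm f 2 volume = ENNReal.ofReal (Real.sqrt (∫ x, ‖f x‖^2)) := by
    intro f hf
    rw [hf.eLpNorm_eq_integral_rpow_norm (by norm_num) (by norm_num), Real.sqrt_eq_rpow]
    norm_num
  rw [g _ ha2, g _ (memLp_invFt ha ha2), h', Real.sqrt_mul c2_pos.le, ENNReal.ofReal_mul (Real.sqrt_nonneg _)]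

lemma kern_bound {K g : E2 → ℂ} (hK : Integrable K) (hK' : Integrable (invFt K)) (hg : Integrable g)
    (hg' : Integrable (invFt g)) :
    Integrable (invFt (fun ξ => K ξ * g ξ)) ∧
    ∫⁻ x, ‖invFt (fun ξ => K ξ * g ξ) x‖ₑ ≤ (∫⁻ x, ‖invFt K x‖ₑ) * ∫⁻ x, ‖invFt g x‖ₑ := by
  have e : invFt (fun ξ => K ξ * g ξ) = cv (invFt K) (invFt g) := by
    ext x
    unfold cv
    rw [← conv_invFt hK' hg]
    refine congrFun (invFt_congr_ae ?_) x
    filter_upwards [ft_invFt_ae hK hK'] with ξ hξ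
    rw [hξ]
  rw [e]
  refine ⟨integrable_cv hK' hg', ?_⟩
  calc ∫⁻ x, ‖cv (invFt K) (invFt g) x‖ₑ ≤ ∫⁻ x, ∫⁻ y, ‖invFt K y‖ₑ * ‖invFt g (x - y)‖ₑ := by
        refine lintegral_mono fun x => ?_
        refine (enorm_integral_le_lintegral_enorm _).trans (lintegral_mono fun y => ?_)
        rw [enorm_mul]
    _ = ∫⁻ y, ∫⁻ x, ‖invFt K y‖ₑ * ‖invFt g (x - y)‖ₑ := by
        have m1 := (continuous_invFt hK)
        have m2 := (continuous_invFt hg)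
        rw [lintegral_lintegral_swap]
        refine Measurable.aemeasurable ?_
        simp only [Function.uncurry_def]
        fun_prop
    _ = _ := by
        have : ∀ y, ∫⁻ x, ‖invFt K y‖ₑ * ‖invFt g (x - y)‖ₑ = ‖invFt K y‖ₑ * ∫⁻ x, ‖invFt g x‖ₑ := by
          intro y
          rw [lintegral_const_mul' _ _ enorm_ne_top, lintegral_sub_right_eq_self (fun x => ‖invFt g x‖ₑ)]
        simp_rw [this]
        rw [lintegral_mul_const'' _ (continuous_invFt hK).aemeasurable.enorm]

lemma cv_smooth_base {a b : E2 → ℂ} (ha : Integrable a) (ha2 : MemLp a 2) (hb : Integrable b) (hb2 : MemLp b 2) :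
    Integrable (invFt (cv a b)) ∧
    ∫⁻ x, ‖invFt (cv a b) x‖ₑ ≤ eLpNorm a 2 volume * eLpNorm b 2 volume := by
  have e : invFt (cv a b) = fun x => (c2:ℂ)⁻¹ * (invFt a x * invFt b x) := by
    ext x
    rw [invFt_mul_invFt ha hb, invFt_const_mul]
    have : (c2:ℂ) ≠ 0 := by exact_mod_cast c2_pos.ne'
    field_simp
    rfl
  have hA := memLp_invFt ha ha2
  have hB := memLp_invFt hb hb2
  rw [e]
  refine ⟨(hA.integrable_mul hB).const_mul _, ?_⟩
  simp_rw [enorm_mul]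
  rw [lintegral_const_mul' _ _ enorm_ne_top]
  have hh := ENNReal.lintegral_mul_le_Lp_mul_Lq volume (p := 2) (q := 2) ⟨by norm_num, by norm_num, by norm_num⟩ hA.1.aemeasurable.enorm hB.1.aemeasurable.enorm
  have g : ∀ f : E2 → ℂ, (∫⁻ x, ‖f x‖ₑ ^ (2:ℝ)) ^ (1/2:ℝ) = eLpNorm f 2 volume := by
    intro f
    rw [eLpNorm_eq_lintegral_rpow_enorm_toReal (by norm_num) (by norm_num)]
    norm_num
  rw [g, g, lintegral_sq_invFt ha ha2, lintegral_sq_invFt hb hb2] at hh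
  calc _ ≤ ‖(c2:ℂ)⁻¹‖ₑ * (ENNReal.ofReal (Real.sqrt c2) * eLpNorm a 2 volume * (ENNReal.ofReal (Real.sqrt c2) * eLpNorm b 2 volume)) := by
        gcongr; exact hh
    _ = (‖(c2:ℂ)⁻¹‖ₑ * (ENNReal.ofReal (Real.sqrt c2) * ENNReal.ofReal (Real.sqrt c2))) * (eLpNorm a 2 volume * eLpNorm b 2 volume) := by ring
    _ = eLpNorm a 2 volume * eLpNorm b 2 volume := by
        rw [← ENNReal.ofReal_mul (Real.sqrt_nonneg _), Real.mul_self_sqrt c2_pos.le, ← ofReal_norm, norm_inv, Complex.norm_real,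
          Real.norm_of_nonneg c2_pos.le, ← ENNReal.ofReal_mul (inv_nonneg.2 c2_pos.le), inv_mul_cancel₀ c2_pos.ne']
        simp

/-- weighted integrability class -/
def WI (n : ℕ) (a : E2 → ℂ) : Prop :=
  AEStronglyMeasurable a volume ∧ Integrable (fun ξ => ((pj ξ ^ n : ℝ) : ℂ) * a ξ) ∧
    MemLp (fun ξ => ((pj ξ ^ n : ℝ) : ℂ) * a ξ) 2

/-- weighted norm -/
def wn (n : ℕ) (a : E2 → ℂ) : ℝ≥0∞ := eLpNorm (fun ξ => ((pj ξ ^ n : ℝ) : ℂ) * a ξ) 2 volume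

lemma WI_mul {n k : ℕ} {a : E2 → ℂ} (h : WI (n+k) a) {μ : E2 → ℝ} (hμ : Continuous μ) (hb : ∀ ξ, |μ ξ| ≤ pj ξ ^ k) :
    WI n (fun ξ => (μ ξ : ℂ) * a ξ) ∧ wn n (fun ξ => (μ ξ : ℂ) * a ξ) ≤ wn (n+k) a := by
  obtain ⟨h1, h2, h3⟩ := h
  have hm : AEStronglyMeasurable (fun ξ => (μ ξ : ℂ) * a ξ) volume :=
    (Complex.continuous_ofReal.comp hμ).aestronglyMeasurable.mul h1
  have hm2 : AEStronglyMeasurable (fun ξ => ((pj ξ ^ n : ℝ) : ℂ) * ((μ ξ : ℂ) * a ξ)) volume :=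
    (Complex.continuous_ofReal.comp (continuous_pj.pow n)).aestronglyMeasurable.mul hm
  have hle : ∀ ξ, ‖((pj ξ ^ n : ℝ) : ℂ) * ((μ ξ : ℂ) * a ξ)‖ ≤ ‖((pj ξ ^ (n+k) : ℝ) : ℂ) * a ξ‖ := by
    intro ξ
    have hp := pj_pos ξ
    rw [norm_mul, norm_mul, norm_mul, Complex.norm_real, Complex.norm_real, Complex.norm_real, ← mul_assoc]
    refine mul_le_mul_of_nonneg_right ?_ (norm_nonneg _)
    rw [Real.norm_of_nonneg (pow_nonneg hp.le n), Real.norm_of_nonneg (pow_nonneg hp.le _), pow_add, Real.norm_eq_abs]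
    exact mul_le_mul_of_nonneg_left (hb ξ) (by positivity)
  exact ⟨⟨hm, h2.mono hm2 (Filter.Eventually.of_forall hle), h3.mono hm2 (Filter.Eventually.of_forall hle)⟩,
    eLpNorm_mono hle⟩

lemma WI_zero {n : ℕ} {a : E2 → ℂ} (h : WI n a) : WI 0 a := by
  have := (WI_mul (n := 0) (k := n) (by simpa using h) (μ := fun _ => 1) continuous_const (fun ξ => by
    rw [abs_one]; exact one_le_pow₀ (one_le_pj ξ))).1
  simpa using this

lemma WI_int {n : ℕ} {a : E2 → ℂ} (h : WI n a) : Integrable a := by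
  have := (WI_zero h).2.1; simpa using this

lemma WI_memLp {n : ℕ} {a : E2 → ℂ} (h : WI n a) : MemLp a 2 := by
  have := (WI_zero h).2.2; simpa using this

lemma cv_exists_ae {a b : E2 → ℂ} (ha : Integrable a) (hb : Integrable b) :
    ∀ᵐ ξ, Integrable (fun η => a η * b (ξ - η)) := by
  exact ha.ae_convolution_exists (ContinuousLinearMap.mul ℝ ℂ) hb

lemma pj_add (x y : E2) : pj (x + y) = pj x * 1 + 1 * ‖y‖^2 + (2 * x 0) * y 0 + (2 * x 1) * y 1 := by
  unfold pj
  rw [norm_add_sq_real]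
  simp [PiLp.inner_apply, Fin.sum_univ_two]
  ring

lemma abs_coord_le (ξ : E2) (i : Fin 2) : |2 * ξ i| ≤ pj ξ ^ 1 := by
  have h : |ξ i| ≤ ‖ξ‖ := by simpa using PiLp.norm_apply_le ξ i
  rw [abs_mul, pow_one]; unfold pj
  norm_num
  nlinarith [sq_nonneg (1 - ‖ξ‖), abs_nonneg (ξ i)]

lemma integral_add4 {f1 f2 f3 f4 : E2 → ℂ} (h1 : Integrable f1) (h2 : Integrable f2) (h3 : Integrable f3)
    (h4 : Integrable f4) : ∫ x, (f1 x + f2 x + f3 x + f4 x) = (∫ x, f1 x) + (∫ x, f2 x) + (∫ x, f3 x) + ∫ x, f4 x := by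
  have h12 : Integrable (fun x => f1 x + f2 x) := h1.add h2
  have h123 : Integrable (fun x => f1 x + f2 x + f3 x) := h12.add h3
  rw [integral_add h123 h4, integral_add h12 h3, integral_add h1 h2]

lemma cv_pj {a b : E2 → ℂ} (ha : WI 1 a) (hb : WI 1 b) :
    (fun ξ => ((pj ξ : ℝ) : ℂ) * cv a b ξ) =ᵐ[volume] fun ξ =>
      cv (fun ξ => ((pj ξ : ℝ) : ℂ) * a ξ) (fun ξ => ((1 : ℝ) : ℂ) * b ξ) ξ +
      cv (fun ξ => ((1 : ℝ) : ℂ) * a ξ) (fun ξ => ((‖ξ‖^2 : ℝ) : ℂ) * b ξ) ξ +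
      cv (fun ξ => ((2 * ξ 0 : ℝ) : ℂ) * a ξ) (fun ξ => ((ξ 0 : ℝ) : ℂ) * b ξ) ξ +
      cv (fun ξ => ((2 * ξ 1 : ℝ) : ℂ) * a ξ) (fun ξ => ((ξ 1 : ℝ) : ℂ) * b ξ) ξ := by
  have key : ∀ μ ν : E2 → ℝ, Continuous μ → Continuous ν → (∀ ξ, |μ ξ| ≤ pj ξ ^ 1) → (∀ ξ, |ν ξ| ≤ pj ξ ^ 1) →
      ∀ᵐ ξ, Integrable (fun η => ((μ η : ℂ) * a η) * ((ν (ξ - η) : ℂ) * b (ξ - η))) := by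
    intro μ ν hμ hν h1 h2
    have k1 : Integrable (fun ξ => (μ ξ : ℂ) * a ξ) := WI_int (WI_mul (n := 0) (k := 1) (by simpa using ha) hμ h1).1
    have k2 : Integrable (fun ξ => (ν ξ : ℂ) * b ξ) := WI_int (WI_mul (n := 0) (k := 1) (by simpa using hb) hν h2).1
    have k3 := cv_exists_ae k1 k2
    filter_upwards [k3] with ξ h
    exact h
  have b1 : ∀ ξ : E2, |pj ξ| ≤ pj ξ ^ 1 := fun ξ => by rw [abs_of_pos (pj_pos ξ), pow_one]
  have b2 : ∀ ξ : E2, |(1:ℝ)| ≤ pj ξ ^ 1 := fun ξ => by rw [abs_one, pow_one]; exact one_le_pj ξ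
  have b3 : ∀ ξ : E2, |‖ξ‖^2| ≤ pj ξ ^ 1 := fun ξ => by
    rw [abs_of_nonneg (by positivity), pow_one]; unfold pj; linarith
  have b4 : ∀ i (ξ : E2), |ξ i| ≤ pj ξ ^ 1 := fun i ξ => by
    have := abs_coord_le ξ i
    rw [abs_mul] at this
    norm_num at this
    rw [pow_one]
    linarith [abs_nonneg (ξ i)]
  filter_upwards [key pj (fun _ => 1) continuous_pj continuous_const b1 b2,
    key (fun _ => 1) (fun ξ => ‖ξ‖^2) continuous_const (by fun_prop) b2 b3,
    key (fun ξ => 2 * ξ 0) (fun ξ => ξ 0) (by fun_prop) (by fun_prop) (fun ξ => abs_coord_le ξ 0) (b4 0),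
    key (fun ξ => 2 * ξ 1) (fun ξ => ξ 1) (by fun_prop) (by fun_prop) (fun ξ => abs_coord_le ξ 1) (b4 1)] with ξ i1 i2 i3 i4
  unfold cv
  rw [← integral_const_mul]
  refine Eq.trans ?_ (integral_add4 i1 i2 i3 i4)
  congr 1; ext η
  have := pj_add η (ξ - η)
  rw [add_sub_cancel] at this
  rw [this]
  push_cast
  ring

lemma cv_smooth (n : ℕ) : ∃ C : ℝ≥0∞, C < ⊤ ∧ ∀ a b : E2 → ℂ, WI n a → WI n b →
    Integrable (fun ξ => ((pj ξ ^ n : ℝ) : ℂ) * cv a b ξ) ∧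
    Integrable (invFt (fun ξ => ((pj ξ ^ n : ℝ) : ℂ) * cv a b ξ)) ∧
    ∫⁻ x, ‖invFt (fun ξ => ((pj ξ ^ n : ℝ) : ℂ) * cv a b ξ) x‖ₑ ≤ C * wn n a * wn n b := by
  induction n with
  | zero =>
    refine ⟨1, by simp, fun a b ha hb => ?_⟩
    simp only [pow_zero, Complex.ofReal_one, one_mul, wn]
    have := cv_smooth_base (WI_int ha) (WI_memLp ha) (WI_int hb) (WI_memLp hb)
    exact ⟨integrable_cv (WI_int ha) (WI_int hb), this.1, this.2⟩
  | succ n ih =>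
    obtain ⟨C, hC, ih⟩ := ih
    refine ⟨4 * C, ENNReal.mul_lt_top (by norm_num) hC, fun a b ha hb => ?_⟩
    have key : ∀ μ ν : E2 → ℝ, Continuous μ → Continuous ν → (∀ ξ, |μ ξ| ≤ pj ξ ^ 1) → (∀ ξ, |ν ξ| ≤ pj ξ ^ 1) →
      Integrable (fun ξ => ((pj ξ ^ n : ℝ) : ℂ) * cv (fun ξ => (μ ξ : ℂ) * a ξ) (fun ξ => (ν ξ : ℂ) * b ξ) ξ) ∧
      Integrable (invFt (fun ξ => ((pj ξ ^ n : ℝ) : ℂ) * cv (fun ξ => (μ ξ : ℂ) * a ξ) (fun ξ => (ν ξ : ℂ) * b ξ) ξ)) ∧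
      ∫⁻ x, ‖invFt (fun ξ => ((pj ξ ^ n : ℝ) : ℂ) * cv (fun ξ => (μ ξ : ℂ) * a ξ) (fun ξ => (ν ξ : ℂ) * b ξ) ξ) x‖ₑ ≤
        C * wn (n+1) a * wn (n+1) b := by
      intro μ ν hμ hν h1 h2
      obtain ⟨k1, k2⟩ := WI_mul ha hμ h1
      obtain ⟨k3, k4⟩ := WI_mul hb hν h2
      obtain ⟨q1, q2, q3⟩ := ih _ _ k1 k3
      exact ⟨q1, q2, q3.trans (by gcongr)⟩
    have b1 : ∀ ξ : E2, |pj ξ| ≤ pj ξ ^ 1 := fun ξ => by rw [abs_of_pos (pj_pos ξ), pow_one]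
    have b2 : ∀ ξ : E2, |(1:ℝ)| ≤ pj ξ ^ 1 := fun ξ => by rw [abs_one, pow_one]; exact one_le_pj ξ
    have b3 : ∀ ξ : E2, |‖ξ‖^2| ≤ pj ξ ^ 1 := fun ξ => by
      rw [abs_of_nonneg (by positivity), pow_one]; unfold pj; linarith
    have b4 : ∀ i (ξ : E2), |ξ i| ≤ pj ξ ^ 1 := fun i ξ => by
      have := abs_coord_le ξ i
      rw [abs_mul] at this
      norm_num at this
      rw [pow_one]
      linarith [abs_nonneg (ξ i)]
    obtain ⟨p1, p2, p3⟩ := key pj (fun _ => 1) continuous_pj continuous_const b1 b2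
    obtain ⟨q1, q2, q3⟩ := key (fun _ => 1) (fun ξ => ‖ξ‖^2) continuous_const (by fun_prop) b2 b3
    obtain ⟨r1, r2, r3⟩ := key (fun ξ => 2 * ξ 0) (fun ξ => ξ 0) (by fun_prop) (by fun_prop) (fun ξ => abs_coord_le ξ 0) (b4 0)
    obtain ⟨s1, s2, s3⟩ := key (fun ξ => 2 * ξ 1) (fun ξ => ξ 1) (by fun_prop) (by fun_prop) (fun ξ => abs_coord_le ξ 1) (b4 1)
    have ha1 : WI 1 a := by
      have := (WI_mul (n := 1) (k := n) (by rwa [add_comm] at ha) (μ := fun _ => 1) continuous_const (fun ξ => by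
        rw [abs_one]; exact one_le_pow₀ (one_le_pj ξ))).1
      simpa using this
    have hb1 : WI 1 b := by
      have := (WI_mul (n := 1) (k := n) (by rwa [add_comm] at hb) (μ := fun _ => 1) continuous_const (fun ξ => by
        rw [abs_one]; exact one_le_pow₀ (one_le_pj ξ))).1
      simpa using this
    set f1 := (fun ξ => ((pj ξ ^ n : ℝ) : ℂ) * cv (fun ξ => ((pj ξ : ℝ) : ℂ) * a ξ) (fun ξ => ((1 : ℝ) : ℂ) * b ξ) ξ)
    set f2 := (fun ξ => ((pj ξ ^ n : ℝ) : ℂ) * cv (fun ξ => ((1 : ℝ) : ℂ) * a ξ) (fun ξ => ((‖ξ‖^2 : ℝ) : ℂ) * b ξ) ξ)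
    set f3 := (fun ξ => ((pj ξ ^ n : ℝ) : ℂ) * cv (fun ξ => ((2 * ξ 0 : ℝ) : ℂ) * a ξ) (fun ξ => ((ξ 0 : ℝ) : ℂ) * b ξ) ξ)
    set f4 := (fun ξ => ((pj ξ ^ n : ℝ) : ℂ) * cv (fun ξ => ((2 * ξ 1 : ℝ) : ℂ) * a ξ) (fun ξ => ((ξ 1 : ℝ) : ℂ) * b ξ) ξ)
    have hae : (fun ξ => ((pj ξ ^ (n+1) : ℝ) : ℂ) * cv a b ξ) =ᵐ[volume] fun ξ => f1 ξ + f2 ξ + f3 ξ + f4 ξ := by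
      filter_upwards [cv_pj ha1 hb1] with ξ hξ
      simp only [f1, f2, f3, f4]
      rw [pow_succ]; push_cast; push_cast at hξ
      rw [mul_assoc, hξ]; ring
    have hinv : invFt (fun ξ => ((pj ξ ^ (n+1) : ℝ) : ℂ) * cv a b ξ) = fun x => invFt f1 x + invFt f2 x + invFt f3 x + invFt f4 x := by
      rw [invFt_congr_ae hae]; ext x
      have pq : Integrable (fun ξ => f1 ξ + f2 ξ) := p1.add q1
      have pqr : Integrable (fun ξ => f1 ξ + f2 ξ + f3 ξ) := pq.add r1
      rw [invFt_add pqr s1, invFt_add pq r1, invFt_add p1 q1]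
    refine ⟨(((p1.add q1).add r1).add s1).congr hae.symm, ?_, ?_⟩
    · rw [hinv]; exact ((p2.add q2).add r2).add s2
    · rw [hinv]
      have m1 := p2.1.enorm
      have m2 := q2.1.enorm
      have m3 := r2.1.enorm
      calc _ ≤ ∫⁻ x, (‖invFt f1 x‖ₑ + ‖invFt f2 x‖ₑ + ‖invFt f3 x‖ₑ + ‖invFt f4 x‖ₑ) := by
            refine lintegral_mono fun x => ?_
            exact (enorm_add_le _ _).trans (by gcongr; exact (enorm_add_le _ _).trans (by gcongr; exact enorm_add_le _ _))
        _ = (∫⁻ x, ‖invFt f1 x‖ₑ) + (∫⁻ x, ‖invFt f2 x‖ₑ) + (∫⁻ x, ‖invFt f3 x‖ₑ) + (∫⁻ x, ‖invFt f4 x‖ₑ) := by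
            have m12 : AEMeasurable (fun x => ‖invFt f1 x‖ₑ + ‖invFt f2 x‖ₑ) volume := m1.add m2
            have m123 : AEMeasurable (fun x => ‖invFt f1 x‖ₑ + ‖invFt f2 x‖ₑ + ‖invFt f3 x‖ₑ) volume := m12.add m3
            rw [lintegral_add_left' m123, lintegral_add_left' m12, lintegral_add_left' m1]
        _ ≤ C * wn (n+1) a * wn (n+1) b + C * wn (n+1) a * wn (n+1) b + C * wn (n+1) a * wn (n+1) b + C * wn (n+1) a * wn (n+1) b := by
            gcongr
        _ = _ := by ring

/-- the number of derivatives needed for the kernels -/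
def kn : ℕ := Classical.choose kernel_integrable

lemma kn_spec : ∀ T : ℝ, ∃ C : ℝ≥0∞, C < ⊤ ∧ ∀ τ : ℝ, |τ| ≤ T →
    Integrable (kmul kn τ) ∧ Integrable (invFt (kmul kn τ)) ∧ ∫⁻ x, ‖invFt (kmul kn τ) x‖ₑ ≤ C :=
  Classical.choose_spec kernel_integrable

lemma kmul_mul (τ : ℝ) (n : ℕ) (g : E2 → ℂ) :
    (fun ξ => kmul n τ ξ * (((pj ξ ^ n : ℝ) : ℂ) * g ξ)) = fun ξ => eph τ ξ * g ξ := by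
  ext ξ
  unfold kmul
  have : ((pj ξ : ℝ) : ℂ) ≠ 0 := by exact_mod_cast (pj_pos ξ).ne'
  push_cast
  rw [inv_pow]
  field_simp

/-- dispersed products are integrable, uniformly -/
lemma dispersed_cv (T : ℝ) : ∃ C : ℝ≥0∞, C < ⊤ ∧ ∀ τ : ℝ, |τ| ≤ T → ∀ a b : E2 → ℂ, WI kn a → WI kn b →
    Integrable (invFt (fun ξ => eph τ ξ * cv a b ξ)) ∧
    ∫⁻ x, ‖invFt (fun ξ => eph τ ξ * cv a b ξ) x‖ₑ ≤ C * wn kn a * wn kn b := by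
  obtain ⟨C1, hC1, h1⟩ := kn_spec T
  obtain ⟨C2, hC2, h2⟩ := cv_smooth kn
  refine ⟨C1 * C2, ENNReal.mul_lt_top hC1 hC2, fun τ hτ a b ha hb => ?_⟩
  obtain ⟨p1, p2, p3⟩ := h1 τ hτ
  obtain ⟨q1, q2, q3⟩ := h2 a b ha hb
  obtain ⟨r1, r2⟩ := kern_bound p1 p2 q1 q2
  rw [kmul_mul] at r1 r2
  refine ⟨r1, r2.trans ?_⟩
  calc _ ≤ C1 * (C2 * wn kn a * wn kn b) := by gcongr
    _ = _ := by ring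

open scoped SchwartzMap in
/-- dispersed Schwartz functions are integrable -/
lemma dispersed_schwartz (τ : ℝ) (φ : 𝓢(E2, ℂ)) : Integrable (invFt (fun ξ => eph τ ξ * φ ξ)) := by
  obtain ⟨C1, hC1, h1⟩ := kn_spec |τ|
  obtain ⟨p1, p2, p3⟩ := h1 τ le_rfl
  have hg : Function.HasTemperateGrowth (fun ξ : E2 => ((pj ξ ^ kn : ℝ) : ℂ)) := by
    have h0 : Function.HasTemperateGrowth (fun ξ : E2 => ((pj ξ ^ kn : ℝ))) := by
      unfold pj; fun_prop
    fun_prop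
  let ψ := SchwartzMap.smulLeftCLM ℂ (fun ξ : E2 => ((pj ξ ^ kn : ℝ) : ℂ)) φ
  have hψ : (ψ : E2 → ℂ) = fun ξ => ((pj ξ ^ kn : ℝ) : ℂ) * φ ξ := by
    ext ξ
    exact SchwartzMap.smulLeftCLM_apply_apply hg φ ξ
  have r := (kern_bound p1 p2 ψ.integrable (integrable_invFt_schwartz ψ)).1
  rw [hψ, kmul_mul] at r
  exact r

/-- the `L²` norm of an extended-nonnegative function -/
def n2 (f : E2 → ℝ≥0∞) : ℝ≥0∞ := (∫⁻ ξ, f ξ ^ (2:ℝ)) ^ (1/2:ℝ)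

lemma n2_mono_ae {f g : E2 → ℝ≥0∞} (h : ∀ᵐ ξ, f ξ ≤ g ξ) : n2 f ≤ n2 g := by
  unfold n2
  refine ENNReal.rpow_le_rpow (lintegral_mono_ae ?_) (by norm_num)
  filter_upwards [h] with ξ hξ
  exact ENNReal.rpow_le_rpow hξ (by norm_num)

lemma n2_mono {f g : E2 → ℝ≥0∞} (h : ∀ ξ, f ξ ≤ g ξ) : n2 f ≤ n2 g :=
  n2_mono_ae (Filter.Eventually.of_forall h)

lemma n2_add_le {f g : E2 → ℝ≥0∞} (hf : Measurable f) (hg : Measurable g) :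
    n2 (fun ξ => f ξ + g ξ) ≤ n2 f + n2 g :=
  ENNReal.lintegral_Lp_add_le hf.aemeasurable hg.aemeasurable (by norm_num)

lemma n2_sq (f : E2 → ℝ≥0∞) : n2 f ^ (2:ℝ) = ∫⁻ ξ, f ξ ^ (2:ℝ) := by
  unfold n2
  rw [← ENNReal.rpow_mul]; norm_num

lemma n2_le_of_sq {f : E2 → ℝ≥0∞} {B : ℝ≥0∞} (h : ∫⁻ ξ, f ξ ^ (2:ℝ) ≤ B ^ (2:ℝ)) : n2 f ≤ B := by
  rw [← n2_sq] at h
  exact (ENNReal.rpow_le_rpow_iff (by norm_num)).1 h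

lemma n2_const_mul {f : E2 → ℝ≥0∞} (c : ℝ≥0∞) (hf : Measurable f) : n2 (fun ξ => c * f ξ) = c * n2 f := by
  unfold n2
  simp_rw [ENNReal.mul_rpow_of_nonneg _ _ (by norm_num : (0:ℝ) ≤ 2)]
  rw [lintegral_const_mul _ (by fun_prop), ENNReal.mul_rpow_of_nonneg _ _ (by norm_num), ← ENNReal.rpow_mul]
  norm_num

lemma lint_mul_le {f g : E2 → ℝ≥0∞} (hf : Measurable f) (hg : Measurable g) : ∫⁻ ξ, f ξ * g ξ ≤ n2 f * n2 g :=
  ENNReal.lintegral_mul_le_Lp_mul_Lq volume (p := 2) (q := 2) ⟨by norm_num, by norm_num, by norm_num⟩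
    hf.aemeasurable hg.aemeasurable

lemma n2_iSup_le {F : ℕ → E2 → ℝ≥0∞} (hF : ∀ n, Measurable (F n)) (hm : Monotone F) {B : ℝ≥0∞}
    (h : ∀ n, n2 (F n) ≤ B) : n2 (fun ξ => ⨆ n, F n ξ) ≤ B := by
  refine n2_le_of_sq ?_
  have e : ∀ ξ, (⨆ n, F n ξ) ^ (2:ℝ) = ⨆ n, F n ξ ^ (2:ℝ) := by
    intro ξ
    exact (ENNReal.orderIsoRpow 2 (by norm_num)).map_iSup _
  simp_rw [e]
  rw [lintegral_iSup (fun n => (hF n).pow_const _) (fun i j hij ξ => ENNReal.rpow_le_rpow (hm hij ξ) (by norm_num))]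
  refine iSup_le fun n => ?_
  rw [← n2_sq]
  exact ENNReal.rpow_le_rpow (h n) (by norm_num)

lemma n2_neg (f : E2 → ℝ≥0∞) : n2 (fun ξ => f (-ξ)) = n2 f := by
  unfold n2
  rw [lintegral_neg_eq_self (fun ξ => f ξ ^ (2:ℝ))]

lemma n2_sub_right (f : E2 → ℝ≥0∞) (a : E2) : n2 (fun ξ => f (ξ - a)) = n2 f := by
  unfold n2
  rw [lintegral_sub_right_eq_self (fun ξ => f ξ ^ (2:ℝ))]

/-- convolution of extended-nonnegative functions -/
def lc (f g : E2 → ℝ≥0∞) (ξ : E2) : ℝ≥0∞ := ∫⁻ η, f η * g (ξ - η)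

lemma measurable_lc {f g : E2 → ℝ≥0∞} (hf : Measurable f) (hg : Measurable g) : Measurable (lc f g) := by
  unfold lc
  exact Measurable.lintegral_prod_right' (f := fun p : E2 × E2 => f p.2 * g (p.1 - p.2)) (by fun_prop)

lemma lc_comm (f g : E2 → ℝ≥0∞) : lc f g = lc g f := by
  ext ξ; unfold lc
  rw [← lintegral_sub_left_eq_self _ ξ]
  congr 1; ext η
  rw [sub_sub_cancel, mul_comm]

lemma n2_lc_le {f g : E2 → ℝ≥0∞} (hf : Measurable f) (hg : Measurable g) :
    n2 (lc f g) ≤ (∫⁻ ξ, f ξ) * n2 g := by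
  refine n2_le_of_sq ?_
  have h1 : ∀ ξ, lc f g ξ ^ (2:ℝ) ≤ (∫⁻ η, f η) * ∫⁻ η, f η * g (ξ - η) ^ (2:ℝ) := by
    intro ξ
    have h := ENNReal.lintegral_mul_le_Lp_mul_Lq (volume : Measure E2) (p := 2) (q := 2) ⟨by norm_num, by norm_num, by norm_num⟩
      (f := fun η => f η ^ (1/2:ℝ)) (g := fun η => f η ^ (1/2:ℝ) * g (ξ - η)) (by fun_prop) (by fun_prop)
    have e1 : ∀ η, ((fun η => f η ^ (1/2:ℝ)) * fun η => f η ^ (1/2:ℝ) * g (ξ - η)) η = f η * g (ξ - η) := by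
      intro η
      simp only [Pi.mul_apply]
      rw [← mul_assoc, ← ENNReal.rpow_add_of_nonneg _ _ (by norm_num) (by norm_num)]; norm_num
    have e2 : ∀ η, (f η ^ (1/2:ℝ)) ^ (2:ℝ) = f η := by
      intro η; rw [← ENNReal.rpow_mul]; norm_num
    have e3 : ∀ η, (f η ^ (1/2:ℝ) * g (ξ - η)) ^ (2:ℝ) = f η * g (ξ - η) ^ (2:ℝ) := by
      intro η; rw [ENNReal.mul_rpow_of_nonneg _ _ (by norm_num), e2]
    simp_rw [e1, e2, e3] at h
    calc lc f g ξ ^ (2:ℝ) ≤ _ := ENNReal.rpow_le_rpow h (by norm_num)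
      _ = _ := by
        rw [ENNReal.mul_rpow_of_nonneg _ _ (by norm_num), ← ENNReal.rpow_mul, ← ENNReal.rpow_mul]; norm_num
  calc ∫⁻ ξ, lc f g ξ ^ (2:ℝ) ≤ ∫⁻ ξ, (∫⁻ η, f η) * ∫⁻ η, f η * g (ξ - η) ^ (2:ℝ) := lintegral_mono h1
    _ = (∫⁻ η, f η) * ∫⁻ ξ, ∫⁻ η, f η * g (ξ - η) ^ (2:ℝ) := by
        rw [lintegral_const_mul]
        exact Measurable.lintegral_prod_right' (f := fun p : E2 × E2 => f p.2 * g (p.1 - p.2) ^ (2:ℝ)) (by fun_prop)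
    _ = (∫⁻ η, f η) * ∫⁻ η, ∫⁻ ξ, f η * g (ξ - η) ^ (2:ℝ) := by
        rw [lintegral_lintegral_swap]
        exact Measurable.aemeasurable (by simp only [Function.uncurry_def]; fun_prop)
    _ = (∫⁻ η, f η) * ∫⁻ η, f η * n2 g ^ (2:ℝ) := by
        congr 2; ext η
        rw [lintegral_const_mul _ (by fun_prop), lintegral_sub_right_eq_self (fun x => g x ^ (2:ℝ)), n2_sq]
    _ = _ := by
        rw [lintegral_mul_const _ hf, ENNReal.mul_rpow_of_nonneg _ _ (by norm_num)]
        norm_num [sq, mul_assoc]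

/-- weighted norm -/
def nw (W f : E2 → ℝ≥0∞) : ℝ≥0∞ := n2 (fun ξ => W ξ * f ξ)

/-- admissible weights -/
structure IsWt (W : E2 → ℝ≥0∞) (C : ℝ≥0∞) : Prop where
  meas : Measurable W
  even : ∀ ξ, W (-ξ) = W ξ
  sub : ∀ ξ η, W (ξ + η) ≤ C * (W ξ + W η)
  l1 : ∀ f : E2 → ℝ≥0∞, Measurable f → ∫⁻ ξ, f ξ ≤ C * nw W f

lemma nw_mono {W f g : E2 → ℝ≥0∞} (h : ∀ ξ, f ξ ≤ g ξ) : nw W f ≤ nw W g :=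
  n2_mono fun ξ => by gcongr; exact h ξ

lemma nw_add_le {W f g : E2 → ℝ≥0∞} (hW : Measurable W) (hf : Measurable f) (hg : Measurable g) :
    nw W (fun ξ => f ξ + g ξ) ≤ nw W f + nw W g := by
  unfold nw
  simp_rw [mul_add]
  exact n2_add_le (by fun_prop) (by fun_prop)

lemma nw_const_mul {W f : E2 → ℝ≥0∞} (c : ℝ≥0∞) (hW : Measurable W) (hf : Measurable f) :
    nw W (fun ξ => c * f ξ) = c * nw W f := by
  unfold nw
  rw [← n2_const_mul c (by fun_prop)]
  congr 1; ext ξ; ring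

lemma nw_neg {W : E2 → ℝ≥0∞} {C : ℝ≥0∞} (hW : IsWt W C) (f : E2 → ℝ≥0∞) : nw W (fun ξ => f (-ξ)) = nw W f := by
  unfold nw
  rw [← n2_neg (fun ξ => W ξ * f ξ)]
  simp_rw [hW.even]

lemma nw_lc {W : E2 → ℝ≥0∞} {C : ℝ≥0∞} (hW : IsWt W C) {f g : E2 → ℝ≥0∞} (hf : Measurable f) (hg : Measurable g) :
    nw W (lc f g) ≤ 2 * C ^ 2 * nw W f * nw W g := by
  have hm := hW.meas
  have h1 : ∀ ξ, W ξ * lc f g ξ ≤ C * (lc g (fun η => W η * f η) ξ + lc f (fun η => W η * g η) ξ) := by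
    intro ξ
    have e1 : lc g (fun η => W η * f η) ξ = ∫⁻ η, W η * f η * g (ξ - η) := by rw [lc_comm]; rfl
    rw [e1]
    unfold lc
    rw [← lintegral_const_mul _ (by fun_prop), ← lintegral_add_left (by fun_prop), ← lintegral_const_mul _ (by fun_prop)]
    refine lintegral_mono fun η => ?_
    have := hW.sub η (ξ - η)
    rw [add_sub_cancel] at this
    calc W ξ * (f η * g (ξ - η)) ≤ C * (W η + W (ξ - η)) * (f η * g (ξ - η)) := by gcongr
      _ = _ := by ring
  have hWf : Measurable fun η => W η * f η := by fun_prop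
  have hWg : Measurable fun η => W η * g η := by fun_prop
  calc nw W (lc f g) ≤ n2 (fun ξ => C * (lc g (fun η => W η * f η) ξ + lc f (fun η => W η * g η) ξ)) := n2_mono h1
    _ = C * n2 (fun ξ => (lc g (fun η => W η * f η) ξ + lc f (fun η => W η * g η) ξ)) :=
        n2_const_mul _ ((measurable_lc hg hWf).add (measurable_lc hf hWg))
    _ ≤ C * (n2 (lc g (fun η => W η * f η)) + n2 (lc f (fun η => W η * g η))) := by
        gcongr; exact n2_add_le (measurable_lc hg hWf) (measurable_lc hf hWg)
    _ ≤ C * ((∫⁻ ξ, g ξ) * nw W f + (∫⁻ ξ, f ξ) * nw W g) := by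
        gcongr
        · exact n2_lc_le hg hWf
        · exact n2_lc_le hf hWg
    _ ≤ C * ((C * nw W g) * nw W f + (C * nw W f) * nw W g) := by
        gcongr
        · exact hW.l1 g hg
        · exact hW.l1 f hf
    _ = _ := by ring

/-- four-fold product -/
abbrev Y4 : Type := E2 × E2 × E2 × E2

/-- last frequency -/
def zl (ξ : E2) (z : Y4) : E2 := ξ - z.1 - z.2.1 - z.2.2.1 - z.2.2.2

lemma continuous_zl : Continuous (fun p : E2 × Y4 => zl p.1 p.2) := by
  unfold zl; fun_prop

/-- majorant quintic -/
def L5 (D : E2 → ℝ≥0∞) (ξ : E2) : ℝ≥0∞ :=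
  ∫⁻ z : Y4, D z.1 * D z.2.1 * D z.2.2.1 * D (-z.2.2.2) * D (-(zl ξ z))

lemma measurable_L5 {D : E2 → ℝ≥0∞} (hD : Measurable D) : Measurable (L5 D) := by
  unfold L5 zl
  exact Measurable.lintegral_prod_right' (f := fun p : E2 × Y4 => D p.2.1 * D p.2.2.1 * D p.2.2.2.1 * D (-p.2.2.2.2) *
    D (-(p.1 - p.2.1 - p.2.2.1 - p.2.2.2.1 - p.2.2.2.2))) (by fun_prop)

lemma lprod {β : Type*} [MeasureSpace β] [SFinite (volume : Measure β)] {a : E2 → ℝ≥0∞} {G : E2 × β → ℝ≥0∞}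
    (ha : Measurable a) (hG : Measurable G) : ∫⁻ p : E2 × β, a p.1 * G p = ∫⁻ x, a x * ∫⁻ y, G (x, y) := by
  rw [Measure.volume_eq_prod, lintegral_prod _ (by fun_prop)]
  congr 1; ext x
  exact lintegral_const_mul (a x) (f := fun y => G (x, y)) (hG.comp measurable_prodMk_left)

lemma L5_eq {D : E2 → ℝ≥0∞} (hD : Measurable D) :
    L5 D = lc D (lc D (lc D (lc (fun ξ => D (-ξ)) (fun ξ => D (-ξ))))) := by
  ext ξ
  unfold L5 lc zl
  simp_rw [mul_assoc]
  rw [lprod (G := fun z : Y4 => D z.2.1 * (D z.2.2.1 * (D (-z.2.2.2) * D (-(ξ - z.1 - z.2.1 - z.2.2.1 - z.2.2.2))))) hD (by fun_prop)]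
  congr 1; ext z1; congr 1
  rw [lprod (G := fun z : E2 × E2 × E2 => (D z.2.1 * (D (-z.2.2) * D (-(ξ - z1 - z.1 - z.2.1 - z.2.2))))) hD (by fun_prop)]
  congr 1; ext z2; congr 1
  rw [lprod (G := fun z : E2 × E2 => (D (-z.2) * D (-(ξ - z1 - z2 - z.1 - z.2)))) hD (by fun_prop)]

lemma nw_L5 {W : E2 → ℝ≥0∞} {C : ℝ≥0∞} (hW : IsWt W C) {D : E2 → ℝ≥0∞} (hD : Measurable D) :
    nw W (L5 D) ≤ (2 * C ^ 2) ^ 4 * nw W D ^ 5 := by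
  rw [L5_eq hD]
  have hD' : Measurable (fun ξ => D (-ξ)) := by fun_prop
  have m1 := measurable_lc hD' hD'
  have m2 := measurable_lc hD m1
  have m3 := measurable_lc hD m2
  have k1 := nw_lc hW hD' hD'
  have k2 := nw_lc hW hD m1
  have k3 := nw_lc hW hD m2
  have k4 := nw_lc hW hD m3
  rw [nw_neg hW] at k1
  set K := 2 * C ^ 2
  set x := nw W D
  calc _ ≤ _ := k4
    _ ≤ K * x * (K * x * (K * x * (K * x * x))) := by
        gcongr
        refine k3.trans ?_
        gcongr
        refine k2.trans ?_
        gcongr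
    _ = _ := by ring

lemma L5_mono {D D' : E2 → ℝ≥0∞} (h : ∀ ξ, D ξ ≤ D' ξ) (ξ : E2) : L5 D ξ ≤ L5 D' ξ := by
  unfold L5
  refine lintegral_mono fun z => ?_
  gcongr <;> exact h _

lemma iSup_mul_iSup_mono {f g : ℕ → ℝ≥0∞} (hf : Monotone f) (hg : Monotone g) :
    (⨆ n, f n) * (⨆ n, g n) = ⨆ n, f n * g n := by
  refine le_antisymm ?_ (iSup_le fun n => mul_le_mul' (le_iSup f n) (le_iSup g n))
  rw [ENNReal.iSup_mul]
  refine iSup_le fun i => ?_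
  rw [ENNReal.mul_iSup]
  refine iSup_le fun j => ?_
  refine le_trans ?_ (le_iSup (fun n => f n * g n) (max i j))
  exact mul_le_mul' (hf (le_max_left _ _)) (hg (le_max_right _ _))

lemma L5_iSup {F : ℕ → E2 → ℝ≥0∞} (hF : ∀ n, Measurable (F n)) (hm : Monotone F) (ξ : E2) :
    L5 (fun ξ => ⨆ n, F n ξ) ξ = ⨆ n, L5 (F n) ξ := by
  unfold L5
  rw [← lintegral_iSup]
  · congr 1; ext z
    have mm : ∀ x, Monotone fun n => F n x := fun x i j hij => hm hij x
    rw [iSup_mul_iSup_mono (mm _) (mm _), iSup_mul_iSup_mono _ (mm _),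
      iSup_mul_iSup_mono _ (mm _), iSup_mul_iSup_mono _ (mm _)]
    all_goals intro i j hij; dsimp only; gcongr <;> exact hm hij _
  · intro n
    have := hF n
    unfold zl; fun_prop
  · intro i j hij z
    dsimp only
    gcongr <;> exact hm hij _


/-- quintic product -/
def pr5 (f : E2 → ℂ) (ξ : E2) (z : Y4) : ℂ :=
  f z.1 * f z.2.1 * f z.2.2.1 * conj (f (-z.2.2.2)) * conj (f (-(zl ξ z)))

/-- quintic convolution -/
def N5 (f : E2 → ℂ) (ξ : E2) : ℂ := ∫ z : Y4, pr5 f ξ z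

/-- majorant quintic product -/
def dr5 (D : E2 → ℝ≥0∞) (ξ : E2) (z : Y4) : ℝ≥0∞ :=
  D z.1 * D z.2.1 * D z.2.2.1 * D (-z.2.2.2) * D (-(zl ξ z))

/-- domination of differences -/
structure Dom (a a' : ℂ) (d d' : ℝ≥0∞) : Prop where
  sub : ‖a - a'‖ₑ + d' ≤ d
  le : ‖a'‖ₑ ≤ d'

lemma Dom.le' {a a' : ℂ} {d d' : ℝ≥0∞} (h : Dom a a' d d') : ‖a‖ₑ ≤ d := by
  calc ‖a‖ₑ = ‖a - a' + a'‖ₑ := by simp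
    _ ≤ ‖a - a'‖ₑ + ‖a'‖ₑ := enorm_add_le _ _
    _ ≤ ‖a - a'‖ₑ + d' := by gcongr; exact h.le
    _ ≤ d := h.sub

lemma Dom.mul {a a' b b' : ℂ} {d d' e e' : ℝ≥0∞} (h : Dom a a' d d') (k : Dom b b' e e') :
    Dom (a * b) (a' * b') (d * e) (d' * e') := by
  refine ⟨?_, ?_⟩
  · calc ‖a * b - a' * b'‖ₑ + d' * e' = ‖(a - a') * b + a' * (b - b')‖ₑ + d' * e' := by congr 2; ring
      _ ≤ ‖a - a'‖ₑ * ‖b‖ₑ + ‖a'‖ₑ * ‖b - b'‖ₑ + d' * e' := by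
          gcongr
          refine (enorm_add_le _ _).trans ?_
          rw [enorm_mul, enorm_mul]
      _ ≤ ‖a - a'‖ₑ * e + d' * ‖b - b'‖ₑ + d' * e' := by
          gcongr
          · exact k.le'
          · exact h.le
      _ = ‖a - a'‖ₑ * e + d' * (‖b - b'‖ₑ + e') := by ring
      _ ≤ ‖a - a'‖ₑ * e + d' * e := by gcongr; exact k.sub
      _ = (‖a - a'‖ₑ + d') * e := by ring
      _ ≤ d * e := by gcongr; exact h.sub
  · rw [enorm_mul]
    exact mul_le_mul' h.le k.le

lemma enorm_conj (a : ℂ) : ‖conj a‖ₑ = ‖a‖ₑ := by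
  rw [← ofReal_norm, ← ofReal_norm, RCLike.norm_conj]

lemma Dom.conj {a a' : ℂ} {d d' : ℝ≥0∞} (h : Dom a a' d d') : Dom (conj a) (conj a') d d' := by
  refine ⟨?_, ?_⟩
  · rw [← map_sub, enorm_conj]; exact h.sub
  · rw [enorm_conj]; exact h.le

lemma Dom.ephm {a a' : ℂ} {d d' : ℝ≥0∞} (h : Dom a a' d d') (t : ℝ) (ξ : E2) :
    Dom (eph t ξ * a) (eph t ξ * a') d d' := by
  have e : ‖eph t ξ‖ₑ = 1 := by rw [← ofReal_norm, norm_eph]; simp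
  refine ⟨?_, ?_⟩
  · rw [← mul_sub, enorm_mul, e, one_mul]; exact h.sub
  · rw [enorm_mul, e, one_mul]; exact h.le

lemma pr5_dom {f f' : E2 → ℂ} {D D' : E2 → ℝ≥0∞} (h : ∀ ξ, Dom (f ξ) (f' ξ) (D ξ) (D' ξ)) (ξ : E2) (z : Y4) :
    Dom (pr5 f ξ z) (pr5 f' ξ z) (dr5 D ξ z) (dr5 D' ξ z) :=
  ((((h _).mul (h _)).mul (h _)).mul (h _).conj).mul (h _).conj

lemma pr5_le {f : E2 → ℂ} {D : E2 → ℝ≥0∞} (h : ∀ ξ, ‖f ξ‖ₑ ≤ D ξ) (ξ : E2) (z : Y4) :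
    ‖pr5 f ξ z‖ₑ ≤ dr5 D ξ z := by
  unfold pr5 dr5
  simp only [enorm_mul, enorm_conj]
  gcongr <;> exact h _

lemma measurable_zl (ξ : E2) : Measurable (zl ξ) := by unfold zl; fun_prop

lemma measurable_pr5 {f : E2 → ℂ} (hf : Measurable f) : Measurable fun p : E2 × Y4 => pr5 f p.1 p.2 := by
  have := continuous_zl.measurable
  unfold pr5
  have hc : Measurable (conj : ℂ → ℂ) := Complex.continuous_conj.measurable
  fun_prop

lemma integrable_pr5 {f : E2 → ℂ} {D : E2 → ℝ≥0∞} (hf : Measurable f) (h : ∀ ξ, ‖f ξ‖ₑ ≤ D ξ) (ξ : E2)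
    (hL : L5 D ξ < ⊤) : Integrable (pr5 f ξ) := by
  refine ⟨((measurable_pr5 hf).comp measurable_prodMk_left).aestronglyMeasurable, ?_⟩
  exact (lintegral_mono fun z => pr5_le h ξ z).trans_lt hL

lemma N5_le {f : E2 → ℂ} {D : E2 → ℝ≥0∞} (h : ∀ ξ, ‖f ξ‖ₑ ≤ D ξ) (ξ : E2) :
    ‖N5 f ξ‖ₑ ≤ L5 D ξ :=
  (enorm_integral_le_lintegral_enorm _).trans (lintegral_mono fun z => pr5_le h ξ z)

lemma measurable_dr5 {D : E2 → ℝ≥0∞} (hD : Measurable D) (ξ : E2) : Measurable (dr5 D ξ) := by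
  have := measurable_zl ξ
  unfold dr5; fun_prop

lemma N5_dom {f f' : E2 → ℂ} {D D' : E2 → ℝ≥0∞} (hf : Measurable f) (hf' : Measurable f')
    (hD' : Measurable D') (h : ∀ ξ, Dom (f ξ) (f' ξ) (D ξ) (D' ξ)) (ξ : E2) :
    Dom (N5 f ξ) (N5 f' ξ) (L5 D ξ) (L5 D' ξ) := by
  refine ⟨?_, N5_le (fun ξ => (h ξ).le) ξ⟩
  rcases eq_or_ne (L5 D ξ) ⊤ with e | e
  · rw [e]; exact le_top
  have i1 := integrable_pr5 hf (fun ξ => (h ξ).le') ξ (lt_top_iff_ne_top.2 e)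
  have hmono : L5 D' ξ ≤ L5 D ξ := L5_mono (fun ξ => le_trans le_add_self (h ξ).sub) ξ
  have i2 := integrable_pr5 hf' (fun ξ => (h ξ).le) ξ (hmono.trans_lt (lt_top_iff_ne_top.2 e))
  unfold N5
  rw [← integral_sub i1 i2]
  calc _ ≤ (∫⁻ z, ‖pr5 f ξ z - pr5 f' ξ z‖ₑ) + L5 D' ξ := by
        gcongr; exact enorm_integral_le_lintegral_enorm _
    _ = ∫⁻ z, ‖pr5 f ξ z - pr5 f' ξ z‖ₑ + dr5 D' ξ z := by
        rw [lintegral_add_right _ (measurable_dr5 hD' ξ)]; rfl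
    _ ≤ L5 D ξ := lintegral_mono fun z => (pr5_dom h ξ z).sub

/-- the constant in front of the quintic convolution -/
def k0 : ℝ := c2 ^ 4
lemma k0_pos : 0 < k0 := pow_pos c2_pos 4

/-- interaction picture nonlinearity -/
def Nt (v : ℝ → E2 → ℂ) (t : ℝ) (ξ : E2) : ℂ :=
  conj (eph t ξ) * N5 (fun η => eph t η * v t η) ξ

/-- Picard map -/
def Psi (g : E2 → ℂ) (v : ℝ → E2 → ℂ) (t : ℝ) (ξ : E2) : ℂ :=
  g ξ - Complex.I * (k0 : ℂ) * ∫ t' in (0:ℝ)..t, Nt v t' ξ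

lemma measurable_Nt {v : ℝ → E2 → ℂ} (hv : Measurable (Function.uncurry v)) :
    Measurable (Function.uncurry (Nt v)) := by
  have hc : Measurable (conj : ℂ → ℂ) := Complex.continuous_conj.measurable
  have he := continuous_eph.measurable
  have h1 : Measurable fun p : ℝ × E2 => N5 (fun η => eph p.1 η * v p.1 η) p.2 := by
    unfold N5
    refine StronglyMeasurable.measurable ?_
    refine StronglyMeasurable.integral_prod_right' (f := fun q : (ℝ × E2) × Y4 => pr5 (fun η => eph q.1.1 η * v q.1.1 η) q.1.2 q.2) ?_
    refine Measurable.stronglyMeasurable ?_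
    have hz : Measurable fun q : (ℝ × E2) × Y4 => zl q.1.2 q.2 := by unfold zl; fun_prop
    have hw : Measurable fun p : ℝ × E2 => eph p.1 p.2 * v p.1 p.2 := he.mul hv
    have hcomp : ∀ h : (ℝ × E2) × Y4 → E2, Measurable h →
        Measurable fun q : (ℝ × E2) × Y4 => eph q.1.1 (h q) * v q.1.1 (h q) := by
      intro h hh
      exact hw.comp (f := fun q : (ℝ × E2) × Y4 => (q.1.1, h q)) (by fun_prop)
    have a1 := hcomp (fun q => q.2.1) (by fun_prop)
    have a2 := hcomp (fun q => q.2.2.1) (by fun_prop)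
    have a3 := hcomp (fun q => q.2.2.2.1) (by fun_prop)
    have a4 := hcomp (fun q => -q.2.2.2.2) (by fun_prop)
    have a5 := hcomp (fun q => -(zl q.1.2 q.2)) (by fun_prop)
    unfold pr5
    exact (((a1.mul a2).mul a3).mul (hc.comp a4)).mul (hc.comp a5)
  unfold Function.uncurry Nt
  exact (hc.comp he).mul h1

lemma measurable_timeInt {F : ℝ → E2 → ℂ} (hF : Measurable (Function.uncurry F)) :
    Measurable (fun p : ℝ × E2 => ∫ t' in (0:ℝ)..p.1, F t' p.2) := by
  have key : ∀ p : ℝ × E2, ∫ t' in (0:ℝ)..p.1, F t' p.2 =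
      (∫ t', if 0 < t' ∧ t' ≤ p.1 then F t' p.2 else 0) - ∫ t', if p.1 < t' ∧ t' ≤ 0 then F t' p.2 else 0 := by
    intro p
    unfold intervalIntegral
    rw [← integral_indicator measurableSet_Ioc, ← integral_indicator measurableSet_Ioc]
    congr 1 <;> (congr 1; ext t'; simp only [indicator, mem_Ioc])
  simp_rw [key]
  have hm : Measurable fun q : (ℝ × E2) × ℝ => F q.2 q.1.2 :=
    hF.comp (f := fun q : (ℝ × E2) × ℝ => (q.2, q.1.2)) (by fun_prop)
  refine Measurable.sub ?_ ?_
  · refine StronglyMeasurable.measurable ?_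
    refine StronglyMeasurable.integral_prod_right' (f := fun q : (ℝ × E2) × ℝ => if 0 < q.2 ∧ q.2 ≤ q.1.1 then F q.2 q.1.2 else 0) ?_
    refine (Measurable.ite ?_ hm measurable_const).stronglyMeasurable
    exact (measurableSet_lt measurable_const measurable_snd).inter (measurableSet_le measurable_snd (by fun_prop))
  · refine StronglyMeasurable.measurable ?_
    refine StronglyMeasurable.integral_prod_right' (f := fun q : (ℝ × E2) × ℝ => if q.1.1 < q.2 ∧ q.2 ≤ 0 then F q.2 q.1.2 else 0) ?_
    refine (Measurable.ite ?_ hm measurable_const).stronglyMeasurable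
    exact (measurableSet_lt (by fun_prop) measurable_snd).inter (measurableSet_le measurable_snd measurable_const)

lemma measurable_Psi {g : E2 → ℂ} (hg : Measurable g) {v : ℝ → E2 → ℂ} (hv : Measurable (Function.uncurry v)) :
    Measurable (Function.uncurry (Psi g v)) := by
  have := measurable_timeInt (measurable_Nt hv)
  unfold Function.uncurry Psi
  exact (hg.comp measurable_snd).sub (measurable_const.mul this)

lemma Nt_dom {v v' : ℝ → E2 → ℂ} {D D' : E2 → ℝ≥0∞} (hv : Measurable (Function.uncurry v))
    (hv' : Measurable (Function.uncurry v')) (hD' : Measurable D') {t : ℝ}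
    (h : ∀ ξ, Dom (v t ξ) (v' t ξ) (D ξ) (D' ξ)) (ξ : E2) :
    Dom (Nt v t ξ) (Nt v' t ξ) (L5 D ξ) (L5 D' ξ) := by
  have he : Measurable fun η => eph t η := (continuous_eph.comp (Continuous.prodMk_right t)).measurable
  have m1 : Measurable (v t) := hv.comp measurable_prodMk_left
  have m2 : Measurable (v' t) := hv'.comp measurable_prodMk_left
  have := N5_dom (f := fun η => eph t η * v t η) (f' := fun η => eph t η * v' t η) (by fun_prop) (by fun_prop) hD'
    (fun η => (h η).ephm t η) ξ
  have e : ‖conj (eph t ξ)‖ₑ = 1 := by rw [← ofReal_norm, RCLike.norm_conj, norm_eph]; simp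
  refine ⟨?_, ?_⟩
  · unfold Nt; rw [← mul_sub, enorm_mul, e, one_mul]; exact this.sub
  · unfold Nt; rw [enorm_mul, e, one_mul]; exact this.le

lemma Nt_le {v : ℝ → E2 → ℂ} {D : E2 → ℝ≥0∞} {t : ℝ} (h : ∀ ξ, ‖v t ξ‖ₑ ≤ D ξ) (ξ : E2) :
    ‖Nt v t ξ‖ₑ ≤ L5 D ξ := by
  have e : ∀ η, ‖eph t η‖ₑ = 1 := fun η => by rw [← ofReal_norm, norm_eph]; simp
  unfold Nt; rw [enorm_mul, enorm_conj, e, one_mul]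
  refine N5_le (fun η => ?_) ξ
  rw [enorm_mul, e, one_mul]; exact h η

lemma uIoc_sub {δ t : ℝ} (ht : t ∈ Icc (-δ) δ) {t' : ℝ} (h : t' ∈ uIoc 0 t) : t' ∈ Icc (-δ) δ := by
  have h0 : 0 ≤ δ := by linarith [ht.1, ht.2]
  rcases mem_uIoc.1 h with h | h
  · exact ⟨by linarith [h.1], by linarith [h.2, ht.2]⟩
  · exact ⟨by linarith [h.1, ht.1], by linarith [h.2]⟩

lemma intervalIntegrable_Nt {v : ℝ → E2 → ℂ} {D : E2 → ℝ≥0∞} (hv : Measurable (Function.uncurry v)) {δ : ℝ}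
    (h : ∀ t ∈ Icc (-δ) δ, ∀ ξ, ‖v t ξ‖ₑ ≤ D ξ) {ξ : E2} (hL : L5 D ξ ≠ ⊤) {t : ℝ} (ht : t ∈ Icc (-δ) δ) :
    IntervalIntegrable (fun t' => Nt v t' ξ) volume 0 t := by
  rw [intervalIntegrable_iff]
  refine Measure.integrableOn_of_bounded (M := (L5 D ξ).toReal) ?_ ?_ ?_
  · simp [uIoc]
  · exact ((measurable_Nt hv).comp measurable_prodMk_right).aestronglyMeasurable
  · filter_upwards [ae_restrict_mem measurableSet_uIoc] with t' ht'
    have := Nt_le (fun ξ => h t' (uIoc_sub ht ht') ξ) ξ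
    rw [← ofReal_norm] at this
    exact (ENNReal.ofReal_le_iff_le_toReal hL).1 this

lemma timeInt_dom {F F' : ℝ → ℂ} {a b : ℝ≥0∞} {t δ : ℝ} (ht : t ∈ Icc (-δ) δ) (ha : a ≠ ⊤)
    (h : ∀ t' ∈ Icc (-δ) δ, Dom (F t') (F' t') a b)
    (hF : IntervalIntegrable F volume 0 t) (hF' : IntervalIntegrable F' volume 0 t) :
    ‖(∫ t' in (0:ℝ)..t, F t') - ∫ t' in (0:ℝ)..t, F' t'‖ₑ + ENNReal.ofReal δ * b ≤ ENNReal.ofReal δ * a := by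
  have h0 : 0 ≤ δ := by linarith [ht.1, ht.2]
  have hab : b ≤ a := le_trans le_add_self (h t ht).sub
  have hb : b ≠ ⊤ := ne_top_of_le_ne_top ha hab
  rw [← intervalIntegral.integral_sub hF hF']
  have : ‖∫ t' in (0:ℝ)..t, (F t' - F' t')‖ ≤ (a - b).toReal * |t - 0| := by
    refine intervalIntegral.norm_integral_le_of_norm_le_const fun t' ht' => ?_
    have := ENNReal.le_sub_of_add_le_right hb (h t' (uIoc_sub ht ht')).sub
    rw [← ofReal_norm] at this
    exact (ENNReal.ofReal_le_iff_le_toReal (by finiteness)).1 this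
  have h2 : ‖∫ t' in (0:ℝ)..t, (F t' - F' t')‖ₑ ≤ ENNReal.ofReal δ * (a - b) := by
    rw [← ofReal_norm, ← ENNReal.ofReal_toReal (a := a - b) (by finiteness), ← ENNReal.ofReal_mul h0]
    refine ENNReal.ofReal_le_ofReal (this.trans ?_)
    rw [mul_comm]
    gcongr
    rw [sub_zero]; exact abs_le.2 ht
  calc _ ≤ ENNReal.ofReal δ * (a - b) + ENNReal.ofReal δ * b := by gcongr
    _ = ENNReal.ofReal δ * a := by rw [← mul_add, tsub_add_cancel_of_le hab]

/-- the majorant map -/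
def PsiD (g : E2 → ℂ) (δ : ℝ) (D : E2 → ℝ≥0∞) (ξ : E2) : ℝ≥0∞ :=
  ‖g ξ‖ₑ + ENNReal.ofReal k0 * (ENNReal.ofReal δ * L5 D ξ)

lemma L5_zero (ξ : E2) : L5 0 ξ = 0 := by unfold L5; simp

lemma Psi_dom {g : E2 → ℂ} {v v' : ℝ → E2 → ℂ} {D D' : E2 → ℝ≥0∞} (hv : Measurable (Function.uncurry v))
    (hv' : Measurable (Function.uncurry v')) (hD' : Measurable D') {δ : ℝ} (hδ : 0 < δ)
    (h : ∀ t ∈ Icc (-δ) δ, ∀ ξ, Dom (v t ξ) (v' t ξ) (D ξ) (D' ξ)) (t : ℝ) (ht : t ∈ Icc (-δ) δ) (ξ : E2) :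
    Dom (Psi g v t ξ) (Psi g v' t ξ) (PsiD g δ D ξ) (PsiD g δ D' ξ) := by
  have hk := k0_pos
  have enk : ‖Complex.I * (k0 : ℂ)‖ₑ = ENNReal.ofReal k0 := by
    rw [← ofReal_norm]; simp [abs_of_pos hk]
  have genN : ∀ {w w' : ℝ → E2 → ℂ} {A B : E2 → ℝ≥0∞}, Measurable (Function.uncurry w) →
      Measurable (Function.uncurry w') → Measurable B →
      (∀ t ∈ Icc (-δ) δ, ∀ ξ, Dom (w t ξ) (w' t ξ) (A ξ) (B ξ)) → L5 A ξ ≠ ⊤ →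
      ‖(∫ t' in (0:ℝ)..t, Nt w t' ξ) - ∫ t' in (0:ℝ)..t, Nt w' t' ξ‖ₑ + ENNReal.ofReal δ * L5 B ξ ≤ ENNReal.ofReal δ * L5 A ξ := by
    intro w w' A B mw mw' mB hh e
    have hB : L5 B ξ ≠ ⊤ := ne_top_of_le_ne_top e (L5_mono (fun ξ => le_trans le_add_self (hh t ht ξ).sub) ξ)
    refine timeInt_dom ht e (fun t' ht' => Nt_dom mw mw' mB (hh t' ht') ξ) ?_ ?_
    · exact intervalIntegrable_Nt mw (fun t ht ξ => (hh t ht ξ).le') e ht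
    · exact intervalIntegrable_Nt mw' (fun t ht ξ => (hh t ht ξ).le) hB ht
  refine ⟨?_, ?_⟩
  · rcases eq_or_ne (L5 D ξ) ⊤ with e | e
    · unfold PsiD; rw [e, ENNReal.mul_top (by simpa using hδ), ENNReal.mul_top (by simpa using hk)]; simp
    have := genN hv hv' hD' h e
    unfold Psi PsiD
    rw [sub_sub_sub_cancel_left, ← mul_sub, enorm_mul, enk, enorm_sub_rev]
    calc _ = ‖g ξ‖ₑ + ENNReal.ofReal k0 * (‖(∫ t' in (0:ℝ)..t, Nt v t' ξ) - ∫ t' in (0:ℝ)..t, Nt v' t' ξ‖ₑ + ENNReal.ofReal δ * L5 D' ξ) := by ring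
      _ ≤ _ := by gcongr
  · rcases eq_or_ne (L5 D' ξ) ⊤ with e | e
    · unfold PsiD; rw [e, ENNReal.mul_top (by simpa using hδ), ENNReal.mul_top (by simpa using hk)]; simp
    have := genN (w := v') (w' := fun _ _ => 0) (A := D') (B := 0) hv' measurable_const measurable_zero
      (fun t ht ξ => ⟨by simpa using (h t ht ξ).le, by simp⟩) e
    have hz : ∀ t', Nt (fun _ _ => (0:ℂ)) t' ξ = 0 := by intro t'; simp [Nt, N5, pr5]
    simp only [hz, L5_zero] at this
    simp only [intervalIntegral.integral_zero, sub_zero, mul_zero, add_zero] at this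
    unfold Psi PsiD
    refine (enorm_sub_le).trans ?_
    rw [enorm_mul, enk]
    gcongr

/-- majorant iterates -/
def Dn (g : E2 → ℂ) (δ : ℝ) : ℕ → E2 → ℝ≥0∞
  | 0 => fun ξ => ‖g ξ‖ₑ
  | n + 1 => PsiD g δ (Dn g δ n)

/-- Picard iterates -/
def vn (g : E2 → ℂ) : ℕ → ℝ → E2 → ℂ
  | 0 => fun _ ξ => g ξ
  | n + 1 => Psi g (vn g n)

lemma measurable_PsiD {g : E2 → ℂ} (hg : Measurable g) {δ : ℝ} {D : E2 → ℝ≥0∞} (hD : Measurable D) :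
    Measurable (PsiD g δ D) := by
  have := measurable_L5 hD
  unfold PsiD; fun_prop

lemma measurable_Dn {g : E2 → ℂ} (hg : Measurable g) (δ : ℝ) (n : ℕ) : Measurable (Dn g δ n) := by
  induction n with
  | zero => exact hg.enorm
  | succ n ih => exact measurable_PsiD hg ih

lemma measurable_vn {g : E2 → ℂ} (hg : Measurable g) (n : ℕ) : Measurable (Function.uncurry (vn g n)) := by
  induction n with
  | zero => exact hg.comp measurable_snd
  | succ n ih => exact measurable_Psi hg ih

lemma PsiD_mono {g : E2 → ℂ} {δ : ℝ} {D D' : E2 → ℝ≥0∞} (h : ∀ ξ, D ξ ≤ D' ξ) (ξ : E2) :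
    PsiD g δ D ξ ≤ PsiD g δ D' ξ := by
  unfold PsiD; gcongr; exact L5_mono h ξ

lemma Dn_mono (g : E2 → ℂ) (δ : ℝ) : Monotone (Dn g δ) := by
  refine monotone_nat_of_le_succ fun n => ?_
  induction n with
  | zero => intro ξ; simp [Dn, PsiD]
  | succ n ih => intro ξ; exact PsiD_mono ih ξ

lemma vn_dom {g : E2 → ℂ} (hg : Measurable g) {δ : ℝ} (hδ : 0 < δ) (n : ℕ) :
    ∀ t ∈ Icc (-δ) δ, ∀ ξ, Dom (vn g (n + 1) t ξ) (vn g n t ξ) (Dn g δ (n + 1) ξ) (Dn g δ n ξ) := by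
  induction n with
  | zero =>
    intro t ht ξ
    have := Psi_dom (g := g) (v := vn g 0) (v' := fun _ _ => 0) (D := Dn g δ 0) (D' := 0) (measurable_vn hg 0)
      measurable_const measurable_zero hδ (fun t ht ξ => ⟨by simp [vn, Dn], by simp⟩) t ht ξ
    have hz : ∀ t', Nt (fun _ _ => (0:ℂ)) t' ξ = 0 := by intro t'; simp [Nt, N5, pr5]
    have e1 : Psi g (fun _ _ => 0) t ξ = g ξ := by simp [Psi, hz]
    have e2 : PsiD g δ 0 ξ = ‖g ξ‖ₑ := by simp [PsiD, L5_zero]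
    rw [e1, e2] at this
    exact this
  | succ n ih => exact Psi_dom (measurable_vn hg _) (measurable_vn hg _) (measurable_Dn hg δ n) hδ ih

lemma vn_dom' {g : E2 → ℂ} (hg : Measurable g) {δ : ℝ} (hδ : 0 < δ) (n k : ℕ) :
    ∀ t ∈ Icc (-δ) δ, ∀ ξ, ‖vn g (n + k) t ξ - vn g n t ξ‖ₑ + Dn g δ n ξ ≤ Dn g δ (n + k) ξ := by
  intro t ht ξ
  induction k with
  | zero => simp
  | succ k ih =>
    have := (vn_dom hg hδ (n + k) t ht ξ).sub
    calc _ ≤ ‖vn g (n + k + 1) t ξ - vn g (n + k) t ξ‖ₑ + ‖vn g (n + k) t ξ - vn g n t ξ‖ₑ + Dn g δ n ξ := by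
          gcongr
          refine le_trans (le_of_eq ?_) (enorm_add_le _ _)
          congr 1; simp [add_assoc]
      _ ≤ ‖vn g (n + k + 1) t ξ - vn g (n + k) t ξ‖ₑ + Dn g δ (n + k) ξ := by
          rw [add_assoc]; gcongr
      _ ≤ _ := this

lemma PsiD_iSup {g : E2 → ℂ} (hg : Measurable g) (δ : ℝ) (ξ : E2) :
    PsiD g δ (fun ξ => ⨆ n, Dn g δ n ξ) ξ = ⨆ n, Dn g δ n ξ := by
  have mm : Monotone fun n => Dn g δ n ξ := fun i j h => Dn_mono g δ h ξ
  rw [← mm.iSup_nat_add 1]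
  unfold PsiD
  rw [L5_iSup (measurable_Dn hg δ) (Dn_mono g δ), ENNReal.mul_iSup, ENNReal.mul_iSup, ENNReal.add_iSup]
  rfl

lemma nw_Dn {g : E2 → ℂ} (hg : Measurable g) {δ : ℝ} {W : E2 → ℝ≥0∞} {C R : ℝ≥0∞} (hW : IsWt W C)
    (hR : nw W (fun ξ => ‖g ξ‖ₑ) ≤ R)
    (hδ : ENNReal.ofReal k0 * (ENNReal.ofReal δ * ((2 * C ^ 2) ^ 4 * (2 * R) ^ 5)) ≤ R) (n : ℕ) :
    nw W (Dn g δ n) ≤ 2 * R := by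
  have hm := hW.meas
  induction n with
  | zero => exact hR.trans (le_mul_of_one_le_left' (by norm_num))
  | succ n ih =>
    have m1 := measurable_Dn hg δ n
    have m2 := measurable_L5 m1
    calc nw W (Dn g δ (n + 1)) ≤ nw W (fun ξ => ‖g ξ‖ₑ) + nw W (fun ξ => ENNReal.ofReal k0 * (ENNReal.ofReal δ * L5 (Dn g δ n) ξ)) := by
          exact nw_add_le hm hg.enorm (by fun_prop)
      _ = nw W (fun ξ => ‖g ξ‖ₑ) + ENNReal.ofReal k0 * (ENNReal.ofReal δ * nw W (L5 (Dn g δ n))) := by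
          rw [nw_const_mul _ hm (by fun_prop), nw_const_mul _ hm (by fun_prop)]
      _ ≤ R + ENNReal.ofReal k0 * (ENNReal.ofReal δ * ((2 * C ^ 2) ^ 4 * (2 * R) ^ 5)) := by
          gcongr
          exact (nw_L5 hW m1).trans (by gcongr)
      _ ≤ R + R := by gcongr
      _ = 2 * R := by ring

lemma Dom.tendsto_of {a : ℂ} {b : ℕ → ℂ} {d : ℝ≥0∞} {e : ℕ → ℝ≥0∞} (hd : d ≠ ⊤)
    (h : ∀ n, ‖a - b n‖ₑ + e n ≤ d) (he : Filter.Tendsto e Filter.atTop (nhds d)) :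
    Filter.Tendsto b Filter.atTop (nhds a) := by
  rw [tendsto_iff_edist_tendsto_0]
  have h1 : Filter.Tendsto (fun n => d - e n) Filter.atTop (nhds (d - d)) :=
    ENNReal.Tendsto.sub tendsto_const_nhds he (Or.inl hd)
  rw [tsub_self] at h1
  refine tendsto_of_tendsto_of_tendsto_of_le_of_le tendsto_const_nhds h1 (fun _ => zero_le) (fun n => ?_)
  rw [edist_comm, edist_eq_enorm_sub]
  exact ENNReal.le_sub_of_add_le_right (ne_top_of_le_ne_top hd (le_trans le_add_self (h n))) (h n)

theorem exists_v {g : E2 → ℂ} (hg : Measurable g) {δ : ℝ} (hδ0 : 0 < δ) {W : E2 → ℝ≥0∞} {C R : ℝ≥0∞} (hW : IsWt W C)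
    (hR : nw W (fun ξ => ‖g ξ‖ₑ) ≤ R)
    (hδ : ENNReal.ofReal k0 * (ENNReal.ofReal δ * ((2 * C ^ 2) ^ 4 * (2 * R) ^ 5)) ≤ R) :
    ∃ D : E2 → ℝ≥0∞, ∃ v : ℝ → E2 → ℂ, Measurable D ∧ nw W D ≤ 2 * R ∧ Measurable (Function.uncurry v) ∧
      (∀ t ∈ Icc (-δ) δ, ∀ ξ, ‖v t ξ‖ₑ ≤ D ξ) ∧ (∀ ξ, D ξ = PsiD g δ D ξ) ∧
      (∀ t ∈ Icc (-δ) δ, ∀ ξ, D ξ ≠ ⊤ → v t ξ = Psi g v t ξ) ∧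
      (∀ t, ∀ ξ, D ξ = ⊤ → v t ξ = 0) := by
  set D : E2 → ℝ≥0∞ := fun ξ => ⨆ n, Dn g δ n ξ with hD
  have mD : Measurable D := Measurable.iSup fun n => measurable_Dn hg δ n
  have mm : ∀ ξ, Monotone fun n => Dn g δ n ξ := fun ξ i j h => Dn_mono g δ h ξ
  have tD : ∀ ξ, Filter.Tendsto (fun n => Dn g δ n ξ) Filter.atTop (nhds (D ξ)) := fun ξ => tendsto_atTop_iSup (mm ξ)
  have nD : nw W D ≤ 2 * R := by
    have : nw W D = n2 (fun ξ => ⨆ n, W ξ * Dn g δ n ξ) := by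
      unfold nw; congr 1; ext ξ; rw [hD, ENNReal.mul_iSup]
    rw [this]
    refine n2_iSup_le (fun n => hW.meas.mul (measurable_Dn hg δ n)) ?_ (fun n => nw_Dn hg hW hR hδ n)
    intro i j hij ξ
    exact mul_le_mul' le_rfl (Dn_mono g δ hij ξ)
  -- the limit
  have hlim : ∀ t ∈ Icc (-δ) δ, ∀ ξ, D ξ ≠ ⊤ → ∃ l, Filter.Tendsto (fun n => vn g n t ξ) Filter.atTop (nhds l) := by
    intro t ht ξ hξ
    refine cauchySeq_tendsto_of_complete ?_
    refine EMetric.cauchySeq_iff_le_tendsto_0.2 ⟨fun N => 2 * (D ξ - Dn g δ N ξ), ?_, ?_⟩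
    · intro n m N hn hm
      have k : ∀ n, N ≤ n → edist (vn g n t ξ) (vn g N t ξ) ≤ D ξ - Dn g δ N ξ := by
        intro n hn
        obtain ⟨k, rfl⟩ := Nat.exists_eq_add_of_le hn
        rw [edist_eq_enorm_sub]
        refine ENNReal.le_sub_of_add_le_right (ne_top_of_le_ne_top hξ (le_iSup (fun n => Dn g δ n ξ) N)) ?_
        exact (vn_dom' hg hδ0 N k t ht ξ).trans (le_iSup (fun n => Dn g δ n ξ) _)
      calc _ ≤ edist (vn g n t ξ) (vn g N t ξ) + edist (vn g m t ξ) (vn g N t ξ) := edist_triangle_right _ _ _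
        _ ≤ _ := by dsimp only; rw [two_mul]; exact add_le_add (k n hn) (k m hm)
    · have h1 : Filter.Tendsto (fun n => D ξ - Dn g δ n ξ) Filter.atTop (nhds (D ξ - D ξ)) :=
        ENNReal.Tendsto.sub tendsto_const_nhds (tD ξ) (Or.inl hξ)
      rw [tsub_self] at h1
      simpa using ENNReal.Tendsto.const_mul h1 (Or.inr (by norm_num : (2:ℝ≥0∞) ≠ ⊤))
  let S : Set (ℝ × E2) := {p | p.1 ∈ Icc (-δ) δ ∧ D p.2 ≠ ⊤}
  have mS : MeasurableSet S := by
    refine (measurableSet_Icc.preimage measurable_fst).inter ?_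
    exact ((measurableSet_singleton _).compl).preimage (mD.comp measurable_snd)
  have hw : ∀ p : ℝ × E2, ∃ l, Filter.Tendsto (fun n => S.indicator (Function.uncurry (vn g n)) p) Filter.atTop (nhds l) := by
    intro p
    by_cases hp : p ∈ S
    · obtain ⟨l, hl⟩ := hlim p.1 hp.1 p.2 hp.2
      refine ⟨l, hl.congr fun n => ?_⟩
      rw [indicator_of_mem hp]; rfl
    · refine ⟨0, tendsto_const_nhds.congr fun n => ?_⟩
      rw [indicator_of_notMem hp]
  choose w hw using hw
  have mw : Measurable w := measurable_of_tendsto_metrizable (fun n => (measurable_vn hg n).indicator mS) (tendsto_pi_nhds.2 hw)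
  have hv1 : ∀ t ∈ Icc (-δ) δ, ∀ ξ, D ξ ≠ ⊤ → Filter.Tendsto (fun n => vn g n t ξ) Filter.atTop (nhds (w (t, ξ))) := by
    intro t ht ξ hξ
    refine (hw (t, ξ)).congr fun n => ?_
    rw [indicator_of_mem (show (t, ξ) ∈ S from ⟨ht, hξ⟩)]; rfl
  have hv0 : ∀ t, ∀ ξ, D ξ = ⊤ → w (t, ξ) = 0 := by
    intro t ξ hξ
    refine tendsto_nhds_unique (hw (t, ξ)) (tendsto_const_nhds.congr fun n => ?_)
    rw [indicator_of_notMem]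
    exact fun h => h.2 hξ
  have hdom : ∀ n, ∀ t ∈ Icc (-δ) δ, ∀ ξ, Dom (w (t, ξ)) (vn g n t ξ) (D ξ) (Dn g δ n ξ) := by
    intro n t ht ξ
    refine ⟨?_, (vn_dom hg hδ0 n t ht ξ).le⟩
    by_cases hξ : D ξ = ⊤
    · rw [hξ]; exact le_top
    have h1 : Filter.Tendsto (fun k => ‖vn g (n + k) t ξ - vn g n t ξ‖ₑ + Dn g δ n ξ) Filter.atTop
        (nhds (‖w (t, ξ) - vn g n t ξ‖ₑ + Dn g δ n ξ)) := by
      have h2 : Filter.Tendsto (fun k => vn g (n + k) t ξ) Filter.atTop (nhds (w (t, ξ))) := by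
        have := (Filter.tendsto_add_atTop_iff_nat n).2 (hv1 t ht ξ hξ)
        simpa only [add_comm] using this
      exact ((h2.sub_const _).enorm).add_const _
    refine le_of_tendsto' h1 fun k => ?_
    exact (vn_dom' hg hδ0 n k t ht ξ).trans (le_iSup (fun n => Dn g δ n ξ) _)
  have mv : Measurable (Function.uncurry fun t ξ => w (t, ξ)) := mw
  refine ⟨D, fun t ξ => w (t, ξ), mD, nD, mv, fun t ht ξ => (hdom 0 t ht ξ).le', fun ξ => (PsiD_iSup hg δ ξ).symm, ?_, hv0⟩
  intro t ht ξ hξ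
  have h1 : Filter.Tendsto (fun n => vn g (n + 1) t ξ) Filter.atTop (nhds (Psi g (fun t ξ => w (t, ξ)) t ξ)) := by
    refine Dom.tendsto_of (d := D ξ) (e := fun n => Dn g δ (n + 1) ξ) hξ (fun n => ?_)
      ((Filter.tendsto_add_atTop_iff_nat 1).2 (tD ξ))
    have := (Psi_dom (g := g) mv (measurable_vn hg n) (measurable_Dn hg δ n) hδ0 (hdom n) t ht ξ).sub
    rw [PsiD_iSup hg] at this
    exact this
  exact tendsto_nhds_unique ((Filter.tendsto_add_atTop_iff_nat 1).2 (hv1 t ht ξ hξ)) h1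

/-- the data of an interaction-picture solution with majorant -/
structure Sol (g : E2 → ℂ) (δ : ℝ) (D : E2 → ℝ≥0∞) (v : ℝ → E2 → ℂ) : Prop where
  pos : 0 < δ
  mg : Measurable g
  mD : Measurable D
  mv : Measurable (Function.uncurry v)
  le : ∀ t ∈ Icc (-δ) δ, ∀ ξ, ‖v t ξ‖ₑ ≤ D ξ
  eqD : ∀ ξ, D ξ = PsiD g δ D ξ
  eqv : ∀ t ∈ Icc (-δ) δ, ∀ ξ, D ξ ≠ ⊤ → v t ξ = Psi g v t ξ
  zero : ∀ t, ∀ ξ, D ξ = ⊤ → v t ξ = 0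

namespace Sol
variable {g : E2 → ℂ} {δ : ℝ} {D : E2 → ℝ≥0∞} {v : ℝ → E2 → ℂ}

lemma L5_ne_top (h : Sol g δ D v) {ξ : E2} (hξ : D ξ ≠ ⊤) : L5 D ξ ≠ ⊤ := by
  intro e
  apply hξ
  have hk := k0_pos
  have hδ := h.pos
  rw [h.eqD ξ, PsiD, e, ENNReal.mul_top (by simpa using hδ), ENNReal.mul_top (by simpa using hk)]; simp

lemma g_le (h : Sol g δ D v) (ξ : E2) : ‖g ξ‖ₑ ≤ D ξ := by
  rw [h.eqD ξ, PsiD]; exact le_self_add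

lemma cont (h : Sol g δ D v) (ξ : E2) : ContinuousOn (fun t => v t ξ) (Icc (-δ) δ) := by
  by_cases hξ : D ξ = ⊤
  · refine (continuousOn_const (c := (0:ℂ))).congr fun t ht => h.zero t ξ hξ
  have hδ := h.pos
  refine ContinuousOn.congr (f := fun t => Psi g v t ξ) ?_ (fun t ht => h.eqv t ht ξ hξ)
  unfold Psi
  refine continuousOn_const.sub (continuousOn_const.mul ?_)
  have i0 : IntervalIntegrable (fun t' => Nt v t' ξ) volume (-δ) δ :=
    (intervalIntegrable_Nt h.mv h.le (h.L5_ne_top hξ) (left_mem_Icc.2 (by linarith))).symm.trans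
      (intervalIntegrable_Nt h.mv h.le (h.L5_ne_top hξ) (right_mem_Icc.2 (by linarith)))
  have := intervalIntegral.continuousOn_primitive_interval' (a := 0) i0 (by rw [uIcc_of_le (by linarith)]; exact ⟨by linarith, by linarith⟩)
  rwa [uIcc_of_le (by linarith)] at this

lemma mvt (h : Sol g δ D v) (t : ℝ) : Measurable (v t) := h.mv.comp measurable_prodMk_left

lemma meas_dr5 (h : Sol g δ D v) (ξ : E2) : Measurable (dr5 D ξ) := measurable_dr5 h.mD ξ

lemma contN5 (h : Sol g δ D v) {ξ : E2} (hξ : D ξ ≠ ⊤) :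
    ContinuousOn (fun t => N5 (fun η => eph t η * v t η) ξ) (Icc (-δ) δ) := by
  have hL := h.L5_ne_top hξ
  have e : ∀ t η, ‖eph t η‖ₑ = 1 := fun t η => by rw [← ofReal_norm, norm_eph]; simp
  have hdr : ∀ᵐ z : Y4, dr5 D ξ z < ⊤ := ae_lt_top (h.meas_dr5 ξ) hL
  unfold N5
  refine continuousOn_of_dominated (bound := fun z => (dr5 D ξ z).toReal) ?_ ?_ ?_ ?_
  · intro t ht
    have := h.mvt t
    have he : Measurable fun η => eph t η := (continuous_eph.comp (Continuous.prodMk_right t)).measurable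
    exact ((measurable_pr5 (f := fun η => eph t η * v t η) (by fun_prop)).comp measurable_prodMk_left).aestronglyMeasurable
  · intro t ht
    filter_upwards [hdr] with z hz
    have := pr5_le (f := fun η => eph t η * v t η) (D := D) (fun η => by rw [enorm_mul, e, one_mul]; exact h.le t ht η) ξ z
    rw [← ofReal_norm] at this
    exact (ENNReal.ofReal_le_iff_le_toReal hz.ne).1 this
  · exact integrable_toReal_of_lintegral_ne_top (h.meas_dr5 ξ).aemeasurable hL
  · refine Filter.Eventually.of_forall fun z => ?_
    have c : ∀ η, ContinuousOn (fun t => eph t η * v t η) (Icc (-δ) δ) := fun η =>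
      ((continuous_eph.comp (Continuous.prodMk_left η)).continuousOn).mul (h.cont η)
    unfold pr5
    exact ((((c _).mul (c _)).mul (c _)).mul (Complex.continuous_conj.comp_continuousOn (c _))).mul
      (Complex.continuous_conj.comp_continuousOn (c _))

lemma contNt (h : Sol g δ D v) {ξ : E2} (hξ : D ξ ≠ ⊤) :
    ContinuousOn (fun t => Nt v t ξ) (Icc (-δ) δ) := by
  unfold Nt
  exact (Complex.continuous_conj.comp (continuous_eph.comp (Continuous.prodMk_left ξ))).continuousOn.mul (h.contN5 hξ)

lemma at_zero (h : Sol g δ D v) {ξ : E2} (hξ : D ξ ≠ ⊤) : v 0 ξ = g ξ := by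
  rw [h.eqv 0 ⟨by linarith [h.pos], h.pos.le⟩ ξ hξ]; simp [Psi]

end Sol

open Classical in
/-- time derivative of the interaction-picture solution -/
def wd (D : E2 → ℝ≥0∞) (v : ℝ → E2 → ℂ) (t : ℝ) (ξ : E2) : ℂ :=
  if D ξ = ⊤ then 0 else -(Complex.I * (k0 : ℂ) * Nt v t ξ)

/-- majorant of the time derivative -/
def D2 (D : E2 → ℝ≥0∞) (ξ : E2) : ℝ≥0∞ := ENNReal.ofReal k0 * L5 D ξ

namespace Sol
variable {g : E2 → ℂ} {δ : ℝ} {D : E2 → ℝ≥0∞} {v : ℝ → E2 → ℂ}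

lemma hasDeriv (h : Sol g δ D v) (ξ : E2) {t : ℝ} (ht : t ∈ Ioo (-δ) δ) :
    HasDerivAt (fun t => v t ξ) (wd D v t ξ) t := by
  unfold wd
  split_ifs with hξ
  · have : (fun t => v t ξ) = fun _ => 0 := by ext t; exact h.zero t ξ hξ
    rw [this]; exact hasDerivAt_const _ _
  have hδ := h.pos
  have ht' : t ∈ Icc (-δ) δ := ⟨ht.1.le, ht.2.le⟩
  have hn : Icc (-δ) δ ∈ nhds t := Icc_mem_nhds ht.1 ht.2
  have h1 : HasDerivAt (fun t => ∫ t' in (0:ℝ)..t, Nt v t' ξ) (Nt v t ξ) t := by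
    refine intervalIntegral.integral_hasDerivAt_right (intervalIntegrable_Nt h.mv h.le (h.L5_ne_top hξ) ht') ?_ ?_
    · exact (((measurable_Nt h.mv).comp measurable_prodMk_right).stronglyMeasurable).stronglyMeasurableAtFilter
    · exact (h.contNt hξ).continuousAt hn
  have h2 : HasDerivAt (fun t => Psi g v t ξ) (-(Complex.I * (k0 : ℂ) * Nt v t ξ)) t := by
    have := (h1.const_mul (Complex.I * (k0 : ℂ))).const_sub (g ξ)
    exact this
  refine h2.congr_of_eventuallyEq ?_
  filter_upwards [hn] with t ht
  exact h.eqv t ht ξ hξ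

lemma wd_le (h : Sol g δ D v) {t : ℝ} (ht : t ∈ Icc (-δ) δ) (ξ : E2) : ‖wd D v t ξ‖ₑ ≤ D2 D ξ := by
  unfold wd D2
  split_ifs with hξ
  · simp
  have hk := k0_pos
  have enk : ‖Complex.I * (k0 : ℂ)‖ₑ = ENNReal.ofReal k0 := by
    rw [← ofReal_norm]; simp [abs_of_pos hk]
  rw [enorm_neg, enorm_mul, enk]
  gcongr
  exact Nt_le (h.le t ht) ξ

lemma measurable_wd (h : Sol g δ D v) : Measurable (Function.uncurry (wd D v)) := by
  unfold wd Function.uncurry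
  refine Measurable.ite ?_ measurable_const ?_
  · exact (measurableSet_singleton _).preimage (h.mD.comp measurable_snd)
  · exact (measurable_const.mul (measurable_Nt h.mv)).neg

lemma cont_wd (h : Sol g δ D v) (ξ : E2) : ContinuousOn (fun t => wd D v t ξ) (Icc (-δ) δ) := by
  by_cases hξ : D ξ = ⊤
  · simp only [wd, hξ, if_true]; exact continuousOn_const
  · simp only [wd, hξ, if_false]
    exact (continuousOn_const.mul (h.contNt hξ)).neg

end Sol


/-- the constant controlling `L¹` by a weighted `L²` norm -/
def Cs (s : ℝ) : ℝ≥0∞ := n2 (fun ξ => ENNReal.ofReal (pj ξ ^ (-(s/2))))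

lemma Cs_lt_top {s : ℝ} (hs : 1 < s) : Cs s < ⊤ := by
  unfold Cs n2
  refine ENNReal.rpow_lt_top_of_nonneg (by norm_num) ?_
  have h := integrable_rpow_neg_one_add_norm_sq (E := E2) (μ := volume) (r := 2 * s) (by simp; linarith)
  have e : ∀ ξ : E2, ENNReal.ofReal (pj ξ ^ (-(s/2))) ^ (2:ℝ) = ENNReal.ofReal ((1 + ‖ξ‖ ^ 2) ^ (-(2 * s) / 2)) := by
    intro ξ
    have := pj_pos ξ
    rw [ENNReal.ofReal_rpow_of_nonneg (by positivity) (by norm_num), ← Real.rpow_mul this.le]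
    unfold pj; congr 2; ring
  simp_rw [e]
  exact h.lintegral_lt_top.ne

lemma isWt_of {w : E2 → ℝ} (hm : Measurable w) (he : ∀ ξ, w (-ξ) = w ξ) {K s : ℝ} (hK : 0 ≤ K)
    (hsub : ∀ ξ η, w (ξ + η) ≤ K * (w ξ + w η)) (hlow : ∀ ξ, pj ξ ^ (s/2) ≤ w ξ) :
    IsWt (fun ξ => ENNReal.ofReal (w ξ)) (ENNReal.ofReal K + Cs s) := by
  have wpos : ∀ ξ, 0 < w ξ := fun ξ => lt_of_lt_of_le (Real.rpow_pos_of_pos (pj_pos ξ) _) (hlow ξ)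
  refine ⟨by fun_prop, fun ξ => by simp only [he], fun ξ η => ?_, fun f hf => ?_⟩
  · calc ENNReal.ofReal (w (ξ + η)) ≤ ENNReal.ofReal (K * (w ξ + w η)) := ENNReal.ofReal_le_ofReal (hsub ξ η)
      _ = ENNReal.ofReal K * (ENNReal.ofReal (w ξ) + ENNReal.ofReal (w η)) := by
          rw [ENNReal.ofReal_mul hK, ENNReal.ofReal_add (wpos ξ).le (wpos η).le]
      _ ≤ _ := by gcongr; exact le_self_add
  · have hp := continuous_pj.measurable
    have e : ∀ ξ, f ξ ≤ ENNReal.ofReal (pj ξ ^ (-(s/2))) * (ENNReal.ofReal (w ξ) * f ξ) := by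
      intro ξ
      rw [← mul_assoc, ← ENNReal.ofReal_mul (Real.rpow_nonneg (pj_pos ξ).le _)]
      refine le_mul_of_one_le_left' ?_
      rw [ENNReal.one_le_ofReal, Real.rpow_neg (pj_pos ξ).le, ← div_eq_inv_mul, le_div_iff₀ (Real.rpow_pos_of_pos (pj_pos ξ) _), one_mul]
      exact hlow ξ
    calc ∫⁻ ξ, f ξ ≤ ∫⁻ ξ, ENNReal.ofReal (pj ξ ^ (-(s/2))) * (ENNReal.ofReal (w ξ) * f ξ) := lintegral_mono e
      _ ≤ Cs s * nw (fun ξ => ENNReal.ofReal (w ξ)) f := by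
          refine lint_mul_le ?_ ?_ <;> fun_prop
      _ ≤ _ := by gcongr; exact le_add_self

lemma pj_neg (ξ : E2) : pj (-ξ) = pj ξ := by unfold pj; rw [norm_neg]

lemma pj_add_le (ξ η : E2) : pj (ξ + η) ≤ 4 * max (pj ξ) (pj η) := by
  have h := norm_add_le ξ η
  have h1 := le_max_left (pj ξ) (pj η)
  have h2 := le_max_right (pj ξ) (pj η)
  unfold pj at *
  nlinarith [norm_nonneg (ξ + η), sq_nonneg (‖ξ‖ - ‖η‖), norm_nonneg ξ, norm_nonneg η]

/-- profile of the weight -/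
def phiw (s N p : ℝ) : ℝ := min p (N ^ (2 - s) * p ^ (s/2))

/-- the weight `ω` -/
def om (s N : ℝ) (ξ : E2) : ℝ := phiw s N (pj ξ)

lemma phiw_mono {s N p q : ℝ} (hs : 0 ≤ s) (hN : 0 ≤ N) (hp : 0 ≤ p) (h : p ≤ q) : phiw s N p ≤ phiw s N q := by
  unfold phiw
  have : 0 ≤ N ^ (2 - s) := Real.rpow_nonneg hN _
  exact min_le_min h (by gcongr)

lemma phiw_scale {s N p c : ℝ} (hs2 : s ≤ 2) (hN : 0 ≤ N) (hp : 0 ≤ p) (hc : 1 ≤ c) :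
    phiw s N (c * p) ≤ c * phiw s N p := by
  unfold phiw
  have h0 : 0 ≤ N ^ (2 - s) := Real.rpow_nonneg hN _
  have h1 : 0 ≤ p ^ (s/2) := Real.rpow_nonneg hp _
  rw [mul_min_of_nonneg _ _ (by linarith)]
  refine min_le_min le_rfl ?_
  rw [Real.mul_rpow (by linarith) hp]
  have : c ^ (s/2) ≤ c := by
    calc c ^ (s/2) ≤ c ^ (1:ℝ) := Real.rpow_le_rpow_of_exponent_le hc (by linarith)
      _ = c := Real.rpow_one c
  calc N ^ (2 - s) * (c ^ (s/2) * p ^ (s/2)) ≤ N ^ (2 - s) * (c * p ^ (s/2)) := by gcongr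
    _ = _ := by ring

lemma phiw_nonneg {s N p : ℝ} (hN : 0 ≤ N) (hp : 0 ≤ p) : 0 ≤ phiw s N p :=
  le_min hp (mul_nonneg (Real.rpow_nonneg hN _) (Real.rpow_nonneg hp _))

lemma om_nonneg {s N : ℝ} (hN : 0 ≤ N) (ξ : E2) : 0 ≤ om s N ξ := phiw_nonneg hN (pj_pos ξ).le

lemma om_add_le {s N : ℝ} (hs : 0 ≤ s) (hs2 : s ≤ 2) (hN : 0 ≤ N) (ξ η : E2) :
    om s N (ξ + η) ≤ 4 * (om s N ξ + om s N η) := by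
  have hx := pj_pos ξ
  have hy := pj_pos η
  have ho := om_nonneg (s := s) hN ξ
  have ho' := om_nonneg (s := s) hN η
  calc om s N (ξ + η) ≤ phiw s N (4 * max (pj ξ) (pj η)) := phiw_mono hs hN (pj_pos _).le (pj_add_le ξ η)
    _ ≤ 4 * phiw s N (max (pj ξ) (pj η)) := phiw_scale hs2 hN (by positivity) (by norm_num)
    _ ≤ _ := by
        gcongr
        rcases max_choice (pj ξ) (pj η) with h | h <;> rw [h] <;> unfold om at * <;> linarith

lemma le_om {s N : ℝ} (hs2 : s ≤ 2) (hN : 1 ≤ N) (ξ : E2) : pj ξ ^ (s/2) ≤ om s N ξ := by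
  have h1 := one_le_pj ξ
  refine le_min ?_ ?_
  · calc pj ξ ^ (s/2) ≤ pj ξ ^ (1:ℝ) := Real.rpow_le_rpow_of_exponent_le h1 (by linarith)
      _ = pj ξ := Real.rpow_one _
  · refine le_mul_of_one_le_left (Real.rpow_nonneg (pj_pos ξ).le _) (Real.one_le_rpow hN (by linarith))

lemma continuous_om (s N : ℝ) (hs : 0 ≤ s) : Continuous (om s N) := by
  unfold om phiw
  have := continuous_pj
  exact this.min (continuous_const.mul (this.rpow_const fun ξ => Or.inr (by linarith)))

lemma om_neg (s N : ℝ) (ξ : E2) : om s N (-ξ) = om s N ξ := by unfold om; rw [pj_neg]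

/-- the full weight -/
def wt (s N lam : ℝ) (k : ℕ) (ξ : E2) : ℝ := om s N ξ + lam * pj ξ ^ k

lemma isWt_wt {s N lam : ℝ} (hs : 1 < s) (hs2 : s ≤ 2) (hN : 1 ≤ N) (hlam : 0 ≤ lam) {k : ℕ} (hk : 1 ≤ k) :
    IsWt (fun ξ => ENNReal.ofReal (wt s N lam k ξ)) (ENNReal.ofReal (4 ^ k) + Cs s) := by
  refine isWt_of ?_ ?_ (by positivity) ?_ ?_
  · have := (continuous_om s N (by linarith)).measurable
    have := continuous_pj.measurable
    unfold wt; fun_prop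
  · intro ξ; unfold wt; rw [om_neg, pj_neg]
  · intro ξ η
    have hx := pj_pos ξ
    have hy := pj_pos η
    unfold wt
    have h1 := om_add_le (s := s) (N := N) (by linarith) hs2 (by linarith) ξ η
    have h4 : (4:ℝ) ≤ 4 ^ k := by
      calc (4:ℝ) = 4 ^ 1 := by norm_num
        _ ≤ 4 ^ k := pow_le_pow_right₀ (by norm_num) hk
    have ho := om_nonneg (s := s) (N := N) (by linarith) ξ
    have ho' := om_nonneg (s := s) (N := N) (by linarith) η
    have h2 : om s N (ξ + η) ≤ 4 ^ k * (om s N ξ + om s N η) := h1.trans (by gcongr)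
    have h3 : pj (ξ + η) ^ k ≤ 4 ^ k * (pj ξ ^ k + pj η ^ k) := by
      calc pj (ξ + η) ^ k ≤ (4 * max (pj ξ) (pj η)) ^ k := pow_le_pow_left₀ (pj_pos _).le (pj_add_le ξ η) k
        _ = 4 ^ k * (max (pj ξ) (pj η)) ^ k := mul_pow _ _ _
        _ ≤ _ := by
          gcongr
          have := pow_pos hx k
          have := pow_pos hy k
          rcases max_choice (pj ξ) (pj η) with h | h <;> rw [h] <;> linarith
    calc _ ≤ 4 ^ k * (om s N ξ + om s N η) + lam * (4 ^ k * (pj ξ ^ k + pj η ^ k)) := by gcongr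
      _ = _ := by ring
  · intro ξ
    have := le_om hs2 hN ξ
    have : 0 ≤ lam * pj ξ ^ k := mul_nonneg hlam (pow_nonneg (pj_pos ξ).le k)
    unfold wt; linarith

/-- polynomial weight -/
def Wk (k : ℕ) (ξ : E2) : ℝ≥0∞ := ENNReal.ofReal (pj ξ ^ k)

lemma isWt_Wk {k : ℕ} (hk : 1 ≤ k) : IsWt (Wk k) (ENNReal.ofReal (4 ^ k) + Cs 2) := by
  refine isWt_of (w := fun ξ => pj ξ ^ k) ?_ ?_ (by positivity) ?_ ?_
  · have := continuous_pj.measurable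
    fun_prop
  · intro ξ; simp only [pj_neg]
  · intro ξ η
    have hx := pj_pos ξ
    have hy := pj_pos η
    calc pj (ξ + η) ^ k ≤ (4 * max (pj ξ) (pj η)) ^ k := pow_le_pow_left₀ (pj_pos _).le (pj_add_le ξ η) k
      _ = 4 ^ k * (max (pj ξ) (pj η)) ^ k := mul_pow _ _ _
      _ ≤ _ := by
        gcongr
        have := pow_pos hx k
        have := pow_pos hy k
        rcases max_choice (pj ξ) (pj η) with h | h <;> rw [h] <;> linarith
  · intro ξ
    have := one_le_pj ξ
    calc pj ξ ^ ((2:ℝ)/2) = pj ξ ^ 1 := by norm_num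
      _ ≤ pj ξ ^ k := pow_le_pow_right₀ this hk


lemma nw_mono_wt {W W' f : E2 → ℝ≥0∞} (h : ∀ ξ, W ξ ≤ W' ξ) : nw W f ≤ nw W' f :=
  n2_mono fun ξ => by gcongr; exact h ξ

lemma measurable_Wk (k : ℕ) : Measurable (Wk k) := by
  have := continuous_pj.measurable
  unfold Wk; fun_prop

lemma Wk_mono {k l : ℕ} (h : k ≤ l) (ξ : E2) : Wk k ξ ≤ Wk l ξ :=
  ENNReal.ofReal_le_ofReal (pow_le_pow_right₀ (one_le_pj ξ) h)

lemma Wk_mul (k l : ℕ) (ξ : E2) : Wk k ξ * Wk l ξ = Wk (k + l) ξ := by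
  unfold Wk
  rw [← ENNReal.ofReal_mul (pow_nonneg (pj_pos ξ).le _), pow_add]

lemma lint_Wk_le (n : ℕ) {M : E2 → ℝ≥0∞} (hM : Measurable M) :
    ∫⁻ ξ, Wk n ξ * M ξ ≤ (ENNReal.ofReal (4 ^ 1) + Cs 2) * nw (Wk (n + 1)) M := by
  have := (isWt_Wk (k := 1) le_rfl).l1 (fun ξ => Wk n ξ * M ξ) ((measurable_Wk n).mul hM)
  refine this.trans (le_of_eq ?_)
  congr 1
  unfold nw
  congr 1; ext ξ
  rw [← mul_assoc, Wk_mul, add_comm]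

lemma C1_lt_top (k : ℕ) : ENNReal.ofReal (4 ^ k) + Cs 2 < ⊤ := by
  have := Cs_lt_top (s := 2) (by norm_num)
  finiteness

lemma eLpNorm_two (f : E2 → ℂ) : eLpNorm f 2 volume = n2 (fun ξ => ‖f ξ‖ₑ) := by
  rw [eLpNorm_eq_lintegral_rpow_enorm_toReal (by norm_num) (by norm_num)]
  unfold n2; norm_num

lemma enorm_pj (n : ℕ) (ξ : E2) : ‖((pj ξ ^ n : ℝ) : ℂ)‖ₑ = Wk n ξ := by
  have := pj_pos ξ
  rw [← ofReal_norm, Complex.norm_real, Real.norm_of_nonneg (by positivity)]; rfl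

lemma WI_of {n : ℕ} {b : E2 → ℂ} {M : E2 → ℝ≥0∞} (hb : Measurable b) (hM : Measurable M) (h : ∀ ξ, ‖b ξ‖ₑ ≤ M ξ)
    (hn : nw (Wk (n + 1)) M < ⊤) : WI n b ∧ wn n b ≤ nw (Wk n) M := by
  have hp := continuous_pj.measurable
  have hm : Measurable (fun ξ => ((pj ξ ^ n : ℝ) : ℂ) * b ξ) := by fun_prop
  have e : ∀ ξ, ‖((pj ξ ^ n : ℝ) : ℂ) * b ξ‖ₑ ≤ Wk n ξ * M ξ := fun ξ => by
    rw [enorm_mul, enorm_pj]; gcongr; exact h ξ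
  have hw : wn n b ≤ nw (Wk n) M := by
    unfold wn; rw [eLpNorm_two]; exact n2_mono e
  refine ⟨⟨hb.aestronglyMeasurable, ⟨hm.aestronglyMeasurable, ?_⟩, hm.aestronglyMeasurable, ?_⟩, hw⟩
  · refine (lintegral_mono e).trans_lt ((lint_Wk_le n hM).trans_lt ?_)
    exact ENNReal.mul_lt_top (C1_lt_top 1) hn
  · exact hw.trans_lt ((nw_mono_wt (Wk_mono (Nat.le_succ n))).trans_lt hn)

lemma measurable_cv {f g : E2 → ℂ} (hf : Measurable f) (hg : Measurable g) : Measurable (cv f g) := by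
  unfold cv
  refine StronglyMeasurable.measurable ?_
  refine StronglyMeasurable.integral_prod_right' (f := fun p : E2 × E2 => f p.2 * g (p.1 - p.2)) ?_
  exact Measurable.stronglyMeasurable (by fun_prop)

lemma cv_le {f g : E2 → ℂ} {F G : E2 → ℝ≥0∞} (hf : ∀ ξ, ‖f ξ‖ₑ ≤ F ξ) (hg : ∀ ξ, ‖g ξ‖ₑ ≤ G ξ) (ξ : E2) :
    ‖cv f g ξ‖ₑ ≤ lc F G ξ := by
  refine (enorm_integral_le_lintegral_enorm _).trans (lintegral_mono fun η => ?_)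
  rw [enorm_mul]; exact mul_le_mul' (hf _) (hg _)

lemma cv_level {β : Type*} [MeasureSpace β] [SFinite (volume : Measure β)] {f : E2 → ℂ} {D M : E2 → ℝ≥0∞}
    {G : E2 → β → ℂ} {B : E2 → ℂ} (hf : Measurable f) (hD : Measurable D) (hMm : Measurable M)
    (hfD : ∀ ξ, ‖f ξ‖ₑ ≤ D ξ) (hG : Measurable (Function.uncurry G)) (hM : ∀ ζ, ∫⁻ y, ‖G ζ y‖ₑ ≤ M ζ)
    (hB : ∀ ζ, M ζ < ⊤ → ∫ y, G ζ y = B ζ) (ξ : E2) :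
    (∫⁻ p : E2 × β, ‖f p.1 * G (ξ - p.1) p.2‖ₑ ≤ lc D M ξ) ∧
    (lc D M ξ < ⊤ → ∫ p : E2 × β, f p.1 * G (ξ - p.1) p.2 = cv f B ξ) := by
  have hm : Measurable fun p : E2 × β => f p.1 * G (ξ - p.1) p.2 :=
    (hf.comp measurable_fst).mul (hG.comp (f := fun p : E2 × β => (ξ - p.1, p.2)) (by fun_prop))
  have h1 : ∫⁻ p : E2 × β, ‖f p.1 * G (ξ - p.1) p.2‖ₑ ≤ lc D M ξ := by
    rw [Measure.volume_eq_prod, lintegral_prod _ hm.enorm.aemeasurable]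
    refine lintegral_mono fun z => ?_
    simp only [enorm_mul]
    have hGz : Measurable fun y => ‖G (ξ - z) y‖ₑ := (hG.comp measurable_prodMk_left).enorm
    rw [lintegral_const_mul _ hGz]
    exact mul_le_mul' (hfD z) (hM _)
  refine ⟨h1, fun hL => ?_⟩
  have hi : Integrable (fun p : E2 × β => f p.1 * G (ξ - p.1) p.2) := ⟨hm.aestronglyMeasurable, h1.trans_lt hL⟩
  rw [Measure.volume_eq_prod] at hi ⊢
  rw [integral_prod _ hi]
  unfold cv
  have hae : ∀ᵐ z, D z * M (ξ - z) < ⊤ := ae_lt_top (by fun_prop) hL.ne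
  refine integral_congr_ae ?_
  filter_upwards [hae] with z hz
  rw [integral_const_mul]
  by_cases hz0 : f z = 0
  · simp [hz0]
  congr 1
  refine hB _ ?_
  have : D z ≠ 0 := fun h => hz0 (by simpa [h] using hfD z)
  by_contra hc
  rw [not_lt, top_le_iff] at hc
  rw [hc, ENNReal.mul_top this] at hz
  exact lt_irrefl _ hz

/-- reflected conjugate -/
def rf (f : E2 → ℂ) (ξ : E2) : ℂ := conj (f (-ξ))

lemma measurable_rf {f : E2 → ℂ} (hf : Measurable f) : Measurable (rf f) :=
  Complex.continuous_conj.measurable.comp (hf.comp measurable_neg)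

/-- the three inner convolutions -/
def cv4 (f : E2 → ℂ) : E2 → ℂ := cv f (cv f (cv (rf f) (rf f)))

/-- majorant of the inner convolutions -/
def lc4 (D : E2 → ℝ≥0∞) : E2 → ℝ≥0∞ := lc D (lc D (lc (fun ξ => D (-ξ)) (fun ξ => D (-ξ))))

lemma measurable_lc4 {D : E2 → ℝ≥0∞} (hD : Measurable D) : Measurable (lc4 D) := by
  have hD' : Measurable (fun ξ => D (-ξ)) := by fun_prop
  exact measurable_lc hD (measurable_lc hD (measurable_lc hD' hD'))

lemma measurable_cv4 {f : E2 → ℂ} (hf : Measurable f) : Measurable (cv4 f) :=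
  measurable_cv hf (measurable_cv hf (measurable_cv (measurable_rf hf) (measurable_rf hf)))

lemma rf_le {f : E2 → ℂ} {D : E2 → ℝ≥0∞} (h : ∀ ξ, ‖f ξ‖ₑ ≤ D ξ) (ξ : E2) : ‖rf f ξ‖ₑ ≤ D (-ξ) := by
  unfold rf; rw [enorm_conj]; exact h _

lemma cv4_le {f : E2 → ℂ} {D : E2 → ℝ≥0∞} (h : ∀ ξ, ‖f ξ‖ₑ ≤ D ξ) (ξ : E2) : ‖cv4 f ξ‖ₑ ≤ lc4 D ξ :=
  cv_le h (cv_le h (cv_le (rf_le h) (rf_le h))) ξ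

lemma N5_eq {f : E2 → ℂ} {D : E2 → ℝ≥0∞} (hf : Measurable f) (hD : Measurable D) (h : ∀ ξ, ‖f ξ‖ₑ ≤ D ξ) {ξ : E2}
    (hL : L5 D ξ < ⊤) : N5 f ξ = cv f (cv4 f) ξ := by
  have hD' : Measurable (fun ξ => D (-ξ)) := by fun_prop
  have hr := measurable_rf hf
  have m1 := measurable_lc hD' hD'
  have m2 := measurable_lc hD m1
  have m3 := measurable_lc hD m2
  let G1 : E2 → E2 → ℂ := fun ζ y => rf f y * rf f (ζ - y)
  have l1 := fun ζ => cv_level (f := f) (D := D) (G := G1) (M := lc (fun ξ => D (-ξ)) (fun ξ => D (-ξ)))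
    (B := cv (rf f) (rf f)) hf hD m1 h (by unfold Function.uncurry; fun_prop)
    (fun ζ => lintegral_mono fun y => by rw [enorm_mul]; exact mul_le_mul' (rf_le h _) (rf_le h _))
    (fun ζ _ => rfl) ζ
  let G2 : E2 → E2 × E2 → ℂ := fun ζ p => f p.1 * G1 (ζ - p.1) p.2
  have l2 := fun ζ => cv_level (f := f) (D := D) (G := G2) (B := cv f (cv (rf f) (rf f))) hf hD m2 h
    (by unfold Function.uncurry; fun_prop) (fun ζ => (l1 ζ).1) (fun ζ => (l1 ζ).2) ζ
  let G3 : E2 → E2 × E2 × E2 → ℂ := fun ζ p => f p.1 * G2 (ζ - p.1) p.2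
  have l3 := cv_level (f := f) (D := D) (G := G3) (B := cv f (cv f (cv (rf f) (rf f)))) hf hD m3 h
    (by unfold Function.uncurry; fun_prop) (fun ζ => (l2 ζ).1) (fun ζ => (l2 ζ).2) ξ
  have := l3.2 (by rw [← L5_eq hD]; exact hL)
  unfold cv4
  rw [← this]
  unfold N5
  congr 1; ext z
  simp only [pr5, G3, G2, G1, rf, zl]
  ring

lemma nw_lc4 {W : E2 → ℝ≥0∞} {C : ℝ≥0∞} (hW : IsWt W C) {D : E2 → ℝ≥0∞} (hD : Measurable D) :
    nw W (lc4 D) ≤ (2 * C ^ 2) ^ 3 * nw W D ^ 4 := by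
  have hD' : Measurable (fun ξ => D (-ξ)) := by fun_prop
  have m1 := measurable_lc hD' hD'
  have m2 := measurable_lc hD m1
  have k1 := nw_lc hW hD' hD'
  have k2 := nw_lc hW hD m1
  have k3 := nw_lc hW hD m2
  rw [nw_neg hW] at k1
  set K := 2 * C ^ 2
  set x := nw W D
  calc _ ≤ _ := k3
    _ ≤ K * x * (K * x * (K * x * x)) := by
        gcongr
        refine k2.trans ?_
        gcongr
    _ = _ := by ring


/-- `f` is dominated by a fast decaying majorant -/
structure Rg (f : E2 → ℂ) (D : E2 → ℝ≥0∞) : Prop where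
  mf : Measurable f
  mD : Measurable D
  le : ∀ ξ, ‖f ξ‖ₑ ≤ D ξ
  fin : nw (Wk (kn + 3)) D < ⊤

namespace Rg
variable {f : E2 → ℂ} {D : E2 → ℝ≥0∞}

lemma fin' (h : Rg f D) {n : ℕ} (hn : n ≤ kn + 3) : nw (Wk n) D < ⊤ :=
  (nw_mono_wt (Wk_mono hn)).trans_lt h.fin

lemma wi (h : Rg f D) : WI (kn + 2) f := (WI_of h.mf h.mD h.le h.fin).1

lemma int (h : Rg f D) : Integrable f := WI_int h.wi
lemma mem (h : Rg f D) : MemLp f 2 := WI_memLp h.wi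

lemma finL5 (h : Rg f D) : nw (Wk (kn + 3)) (L5 D) < ⊤ := by
  refine (nw_L5 (isWt_Wk (by omega)) h.mD).trans_lt ?_
  have h1 := (C1_lt_top (kn + 3)).ne
  have h2 := h.fin.ne
  generalize ENNReal.ofReal (4 ^ (kn + 3)) + Cs 2 = K at *
  finiteness

lemma finlc4 (h : Rg f D) : nw (Wk (kn + 3)) (lc4 D) < ⊤ := by
  refine (nw_lc4 (isWt_Wk (by omega)) h.mD).trans_lt ?_
  have h1 := (C1_lt_top (kn + 3)).ne
  have h2 := h.fin.ne
  generalize ENNReal.ofReal (4 ^ (kn + 3)) + Cs 2 = K at *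
  finiteness

lemma ae_of_nw {n : ℕ} {M : E2 → ℝ≥0∞} (hM : Measurable M) (h : nw (Wk (n + 1)) M < ⊤) : ∀ᵐ ξ, M ξ < ⊤ := by
  have h1 := lint_Wk_le n hM
  have h2 : ∫⁻ ξ, M ξ ≤ ∫⁻ ξ, Wk n ξ * M ξ := by
    refine lintegral_mono fun ξ => ?_
    conv_lhs => rw [← one_mul (M ξ)]
    gcongr
    rw [Wk, ← ENNReal.ofReal_one]
    exact ENNReal.ofReal_le_ofReal (one_le_pow₀ (one_le_pj ξ))
  refine ae_lt_top hM (ne_of_lt ?_)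
  refine (h2.trans h1).trans_lt ?_
  exact ENNReal.mul_lt_top (C1_lt_top 1) h

lemma aeL5 (h : Rg f D) : ∀ᵐ ξ, L5 D ξ < ⊤ := ae_of_nw (measurable_L5 h.mD) h.finL5
lemma aeD (h : Rg f D) : ∀ᵐ ξ, D ξ < ⊤ := ae_of_nw h.mD h.fin

lemma N5_ae (h : Rg f D) : N5 f =ᵐ[volume] cv f (cv4 f) := by
  filter_upwards [h.aeL5] with ξ hξ
  exact N5_eq h.mf h.mD h.le hξ

lemma quintic_eq (h : Rg f D) (x : E2) : quintic (invFt f) x = invFt (fun ξ => (k0 : ℂ) * N5 f ξ) x := by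
  have hf := h.int
  have hr : Integrable (rf f) := by
    have := (Complex.conjCLE.toContinuousLinearMap.integrable_comp hf.comp_neg)
    exact this
  have mul : ∀ {a b : E2 → ℂ}, Integrable a → Integrable b → invFt a x * invFt b x = c2 * invFt (cv a b) x := by
    intro a b ha hb
    rw [invFt_mul_invFt ha hb, ← invFt_const_mul]; rfl
  rw [invFt_const_mul, invFt_congr_ae h.N5_ae]
  have e : quintic (invFt f) x = invFt f x * (invFt f x * (invFt f x * (invFt (rf f) x * invFt (rf f) x))) := by
    have : invFt (rf f) x = conj (invFt f x) := (conj_invFt f x).symm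
    rw [this, quintic]
    have h2 : ((‖invFt f x‖ : ℝ) : ℂ) ^ 2 = invFt f x * conj (invFt f x) := by
      rw [Complex.mul_conj, Complex.normSq_eq_norm_sq]; push_cast; rfl
    calc _ = (((‖invFt f x‖ : ℝ) : ℂ) ^ 2) ^ 2 * invFt f x := by ring
      _ = _ := by rw [h2]; ring
  have i1 := integrable_cv hr hr
  have i2 := integrable_cv hf i1
  have i3 := integrable_cv hf i2
  rw [e, mul hr hr]
  have : k0 = c2 * c2 * c2 * c2 := by unfold k0; ring
  rw [this]; push_cast
  calc _ = (c2:ℂ) * (invFt f x * (invFt f x * (invFt f x * (invFt (cv (rf f) (rf f)) x)))) := by ring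
    _ = (c2:ℂ) * (c2:ℂ) * (invFt f x * (invFt f x * invFt (cv f (cv (rf f) (rf f))) x)) := by
      rw [mul hf i1]; ring
    _ = (c2:ℂ) * (c2:ℂ) * (c2:ℂ) * (invFt f x * invFt (cv4 f) x) := by
      rw [mul hf i2]; unfold cv4; ring
    _ = _ := by rw [mul hf (show Integrable (cv4 f) volume from i3)]; ring

lemma n5r (h : Rg f D) : Rg (N5 f) (L5 D) where
  mf := by
    have : Measurable (fun p : E2 × Y4 => pr5 f p.1 p.2) := measurable_pr5 h.mf
    exact (StronglyMeasurable.integral_prod_right' (f := fun p : E2 × Y4 => pr5 f p.1 p.2) this.stronglyMeasurable).measurable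
  mD := measurable_L5 h.mD
  le := N5_le h.le
  fin := h.finL5

lemma ephm (h : Rg f D) (t : ℝ) : Rg (fun ξ => eph t ξ * f ξ) D where
  mf := ((continuous_eph.comp (Continuous.prodMk_right t)).measurable).mul h.mf
  mD := h.mD
  le ξ := by rw [enorm_mul, show ‖eph t ξ‖ₑ = 1 by rw [← ofReal_norm, norm_eph]; simp, one_mul]; exact h.le ξ
  fin := h.fin

/-- dispersed quintic is in L1 with bound -/
lemma disp (T : ℝ) : ∃ C : ℝ≥0∞, C < ⊤ ∧ ∀ τ : ℝ, |τ| ≤ T → ∀ {f : E2 → ℂ} {D : E2 → ℝ≥0∞}, Rg f D →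
    Integrable (invFt (fun ξ => eph τ ξ * N5 f ξ)) ∧
    ∫⁻ x, ‖invFt (fun ξ => eph τ ξ * N5 f ξ) x‖ₑ ≤ C * nw (Wk kn) D * nw (Wk kn) (lc4 D) := by
  obtain ⟨C, hC, H⟩ := dispersed_cv T
  refine ⟨C, hC, fun τ hτ f D h => ?_⟩
  obtain ⟨a1, a2⟩ := WI_of (n := kn) h.mf h.mD h.le (h.fin' (by omega))
  obtain ⟨b1, b2⟩ := WI_of (n := kn) (measurable_cv4 h.mf) (measurable_lc4 h.mD) (cv4_le h.le)
    ((nw_mono_wt (Wk_mono (by omega))).trans_lt h.finlc4)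
  have e : invFt (fun ξ => eph τ ξ * N5 f ξ) = invFt (fun ξ => eph τ ξ * cv f (cv4 f) ξ) := by
    apply invFt_congr_ae
    filter_upwards [h.N5_ae] with ξ hξ
    rw [hξ]
  rw [e]
  obtain ⟨c1, c2⟩ := H τ hτ f (cv4 f) a1 b1
  refine ⟨c1, c2.trans ?_⟩
  gcongr

lemma ft_quintic (h : Rg f D) : ft (quintic (invFt f)) =ᵐ[volume] fun ξ => (k0 : ℂ) * N5 f ξ := by
  have e : quintic (invFt f) = invFt (fun ξ => (k0 : ℂ) * N5 f ξ) := funext h.quintic_eq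
  rw [e]
  apply ft_invFt_ae (h.n5r.int.const_mul _)
  have e2 : invFt (fun ξ => (k0 : ℂ) * N5 f ξ) = fun x => (k0:ℂ) * invFt (fun ξ => eph 0 ξ * N5 f ξ) x := by
    funext x; rw [invFt_const_mul]; simp [eph]
  rw [e2]
  obtain ⟨C, hC, H⟩ := disp 0
  exact (H 0 (by simp) h).1.const_mul _

lemma bprop_quintic (h : Rg f D) (t : ℝ) : bprop t (quintic (invFt f)) = invFt (fun ξ => eph t ξ * ((k0:ℂ) * N5 f ξ)) := by
  unfold bprop
  apply invFt_congr_ae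
  filter_upwards [h.ft_quintic] with ξ hξ
  rw [hξ]; rfl

end Rg


lemma measurable_invFt_param {F : ℝ → E2 → ℂ} (hF : Measurable (Function.uncurry F)) :
    Measurable (fun p : ℝ × E2 => invFt (F p.1) p.2) := by
  unfold invFt
  refine Measurable.const_smul (g := fun p : ℝ × E2 => ∫ ξ : E2, Complex.exp (Complex.I * ((⟪p.2, ξ⟫ : ℝ) : ℂ)) * F p.1 ξ) ?_ (((2 * Real.pi) ^ 2)⁻¹ : ℝ)
  refine (StronglyMeasurable.integral_prod_right' (f := fun q : (ℝ × E2) × E2 =>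
    Complex.exp (Complex.I * ((⟪q.1.2, q.2⟫ : ℝ) : ℂ)) * F q.1.1 q.2) ?_).measurable
  have h1 : Measurable fun q : (ℝ × E2) × E2 => F q.1.1 q.2 :=
    hF.comp (f := fun q : (ℝ × E2) × E2 => (q.1.1, q.2)) (by fun_prop)
  have h2 : Continuous fun q : (ℝ × E2) × E2 => Complex.exp (Complex.I * ((⟪q.1.2, q.2⟫ : ℝ) : ℂ)) := by fun_prop
  exact (h2.measurable.mul h1).stronglyMeasurable

lemma invFt_timeInt {F : ℝ → E2 → ℂ} (hF : Measurable (Function.uncurry F)) {M : E2 → ℝ≥0∞}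
    (hM : ∫⁻ ξ, M ξ < ⊤) {t : ℝ} (ht : 0 ≤ t) (h : ∀ t' ∈ Icc 0 t, ∀ ξ, ‖F t' ξ‖ₑ ≤ M ξ) (x : E2) :
    invFt (fun ξ => ∫ t' in (0:ℝ)..t, F t' ξ) x = ∫ t' in (0:ℝ)..t, invFt (F t') x := by
  unfold invFt
  rw [intervalIntegral.integral_smul]
  congr 1
  simp_rw [intervalIntegral.integral_of_le ht]
  simp_rw [← integral_const_mul]
  apply integral_integral_swap
  have h2 : Continuous fun q : E2 × ℝ => Complex.exp (Complex.I * ((⟪x, q.1⟫ : ℝ) : ℂ)) := by fun_prop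
  have hm : Measurable fun q : E2 × ℝ => Complex.exp (Complex.I * ((⟪x, q.1⟫ : ℝ) : ℂ)) * F q.2 q.1 :=
    h2.measurable.mul (hF.comp measurable_swap)
  refine ⟨hm.aestronglyMeasurable, ?_⟩
  unfold HasFiniteIntegral
  rw [lintegral_prod _ (by exact hm.enorm.aemeasurable)]
  have hb : ∀ ξ, ∫⁻ t' in Ioc 0 t, ‖Function.uncurry (fun ξ t' => Complex.exp (Complex.I * ((⟪x, ξ⟫ : ℝ) : ℂ)) * F t' ξ) (ξ, t')‖ₑ ≤ M ξ * ENNReal.ofReal t := by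
    intro ξ
    have : ∫⁻ t' in Ioc 0 t, M ξ = M ξ * ENNReal.ofReal t := by simp
    rw [← this]
    refine setLIntegral_mono measurable_const fun t' ht' => ?_
    simp only [Function.uncurry]
    rw [enorm_mul, show ‖Complex.exp (Complex.I * ((⟪x, ξ⟫ : ℝ) : ℂ))‖ₑ = 1 by
      rw [← ofReal_norm, mul_comm, Complex.norm_exp_ofReal_mul_I]; simp, one_mul]
    exact h t' (Ioc_subset_Icc_self ht') ξ
  refine (lintegral_mono hb).trans_lt ?_
  rw [lintegral_mul_const' _ _ ENNReal.ofReal_ne_top]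
  exact ENNReal.mul_lt_top hM ENNReal.ofReal_lt_top

lemma eph_mul_conj (t : ℝ) (ξ : E2) : eph t ξ * conj (eph t ξ) = 1 := by
  rw [Complex.mul_conj, Complex.normSq_eq_norm_sq, norm_eph]; simp

lemma eph_sub (t t' : ℝ) (ξ : E2) : eph (t - t') ξ = eph t ξ * conj (eph t' ξ) := by
  unfold eph
  rw [← Complex.exp_conj, ← Complex.exp_add]
  congr 1
  simp only [map_mul, map_neg, Complex.conj_I, Complex.conj_ofReal]
  push_cast; ring

lemma ft_sub {f g : E2 → ℂ} (hf : Integrable f) (hg : Integrable g) (ξ : E2) :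
    ft (fun x => f x - g x) ξ = ft f ξ - ft g ξ := by
  unfold ft
  have hb : ∀ f : E2 → ℂ, Integrable f → Integrable fun x : E2 => Complex.exp (-Complex.I * ((⟪x, ξ⟫ : ℝ) : ℂ)) * f x := by
    intro f hf
    refine hf.bdd_mul (c := 1) (Continuous.aestronglyMeasurable (by fun_prop)) (Filter.Eventually.of_forall fun x => ?_)
    rw [show -Complex.I * ((⟪x, ξ⟫ : ℝ) : ℂ) = ((-⟪x, ξ⟫ : ℝ) : ℂ) * Complex.I by push_cast; ring, Complex.norm_exp_ofReal_mul_I]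
  rw [← integral_sub (hb f hf) (hb g hg)]
  congr 1; funext x; ring

/-- Fourier side solution -/
def uh (v : ℝ → E2 → ℂ) (t : ℝ) (ξ : E2) : ℂ := eph t ξ * v t ξ

/-- the solution -/
def us (v : ℝ → E2 → ℂ) (t : ℝ) (x : E2) : ℂ := invFt (uh v t) x

namespace Sol
variable {g : E2 → ℂ} {δ : ℝ} {D : E2 → ℝ≥0∞} {v : ℝ → E2 → ℂ}

lemma rgv (h : Sol g δ D v) (hf : nw (Wk (kn + 3)) D < ⊤) {t : ℝ} (ht : t ∈ Icc (-δ) δ) : Rg (v t) D where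
  mf := h.mvt t
  mD := h.mD
  le := h.le t ht
  fin := hf

lemma rg (h : Sol g δ D v) (hf : nw (Wk (kn + 3)) D < ⊤) {t : ℝ} (ht : t ∈ Icc (-δ) δ) : Rg (uh v t) D :=
  (h.rgv hf ht).ephm t

lemma rgg (h : Sol g δ D v) (hf : nw (Wk (kn + 3)) D < ⊤) : Rg g D where
  mf := h.mg
  mD := h.mD
  le := h.g_le
  fin := hf

lemma mIcc (h : Sol g δ D v) {t : ℝ} (ht : t ∈ Icc 0 δ) : t ∈ Icc (-δ) δ := ⟨by have := h.pos; linarith [ht.1], ht.2⟩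

lemma us_eq (h : Sol g δ D v) (hf : nw (Wk (kn + 3)) D < ⊤) {t : ℝ} (ht : t ∈ Icc 0 δ) (x : E2) :
    us v t x = invFt (fun ξ => eph t ξ * g ξ) x -
      Complex.I * ∫ t' in (0:ℝ)..t, invFt (fun ξ => eph (t - t') ξ * ((k0 : ℂ) * N5 (uh v t') ξ)) x := by
  have hm : Measurable (fun ξ => eph t ξ) := (continuous_eph.comp (Continuous.prodMk_right t)).measurable
  have hF : Measurable (Function.uncurry fun t' ξ => eph t ξ * ((k0 : ℂ) * Nt v t' ξ)) := by
    have := measurable_Nt h.mv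
    exact (hm.comp measurable_snd).mul (this.const_mul _)
  have hM : ∫⁻ ξ, ENNReal.ofReal k0 * L5 D ξ < ⊤ := by
    have hr := (h.rgg hf)
    rw [lintegral_const_mul _ (measurable_L5 h.mD)]
    refine ENNReal.mul_lt_top ENNReal.ofReal_lt_top ?_
    have h1 := lint_Wk_le 0 (measurable_L5 h.mD)
    simp only [Wk, pow_zero, ENNReal.ofReal_one, one_mul] at h1
    refine h1.trans_lt (ENNReal.mul_lt_top (C1_lt_top 1) ?_)
    exact (nw_mono_wt (Wk_mono (by omega))).trans_lt hr.finL5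
  have hb : ∀ t' ∈ Icc 0 t, ∀ ξ, ‖eph t ξ * ((k0 : ℂ) * Nt v t' ξ)‖ₑ ≤ ENNReal.ofReal k0 * L5 D ξ := by
    intro t' ht' ξ
    rw [enorm_mul, enorm_mul, show ‖eph t ξ‖ₑ = 1 by rw [← ofReal_norm, norm_eph]; simp, one_mul,
      show ‖(k0:ℂ)‖ₑ = ENNReal.ofReal k0 by rw [← ofReal_norm, Complex.norm_real, Real.norm_of_nonneg k0_pos.le]]
    gcongr
    exact Nt_le (h.le t' (h.mIcc ⟨ht'.1, ht'.2.trans ht.2⟩)) ξ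
  have e := invFt_timeInt hF hM ht.1 hb x
  have e1 : ∀ t', (fun ξ => eph (t - t') ξ * ((k0 : ℂ) * N5 (uh v t') ξ)) = fun ξ => eph t ξ * ((k0 : ℂ) * Nt v t' ξ) := by
    intro t'; funext ξ
    rw [eph_sub, Nt]
    unfold uh; ring
  simp_rw [e1]
  rw [← e]
  have hi : Integrable (fun ξ => eph t ξ * g ξ) := ((h.rgg hf).ephm t).int
  have hi2 : Integrable (fun ξ => ∫ t' in (0:ℝ)..t, eph t ξ * ((k0 : ℂ) * Nt v t' ξ)) := by
    refine ⟨((measurable_timeInt hF).comp measurable_prodMk_left).aestronglyMeasurable (f := fun ξ => ∫ t' in (0:ℝ)..t, eph t ξ * ((k0 : ℂ) * Nt v t' ξ)), ?_⟩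
    unfold HasFiniteIntegral
    refine (lintegral_mono (g := fun ξ => ENNReal.ofReal t * (ENNReal.ofReal k0 * L5 D ξ)) fun ξ => ?_).trans_lt ?_
    · dsimp only
      rw [intervalIntegral.integral_of_le ht.1]
      refine (enorm_integral_le_lintegral_enorm _).trans ?_
      have : ∫⁻ t' in Ioc 0 t, (ENNReal.ofReal k0 * L5 D ξ) = ENNReal.ofReal t * (ENNReal.ofReal k0 * L5 D ξ) := by simp [mul_comm]
      rw [← this]
      exact setLIntegral_mono measurable_const fun t' ht' => hb t' (Ioc_subset_Icc_self ht') ξ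
    · rw [lintegral_const_mul' _ _ ENNReal.ofReal_ne_top]
      exact ENNReal.mul_lt_top ENNReal.ofReal_lt_top hM
  rw [sub_eq_add_neg, ← neg_mul, ← invFt_const_mul, ← invFt_add hi (hi2.const_mul _)]
  unfold us
  refine congrFun (invFt_congr_ae ?_) x
  filter_upwards [(h.rgg hf).aeD] with ξ hξ
  rw [uh, h.eqv t (h.mIcc ht) ξ hξ.ne, Psi, intervalIntegral.integral_const_mul, intervalIntegral.integral_const_mul]
  ring

lemma us_int (h : Sol g δ D v) (hf : nw (Wk (kn + 3)) D < ⊤) {t : ℝ} (ht : t ∈ Icc 0 δ)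
    (hg : Integrable (invFt (fun ξ => eph t ξ * g ξ))) : Integrable (us v t) := by
  have hm : Measurable (fun ξ => eph t ξ) := (continuous_eph.comp (Continuous.prodMk_right t)).measurable
  have hF : Measurable (Function.uncurry fun t' ξ => eph (t - t') ξ * ((k0 : ℂ) * N5 (uh v t') ξ)) := by
    have := measurable_Nt h.mv
    have e1 : (Function.uncurry fun t' ξ => eph (t - t') ξ * ((k0 : ℂ) * N5 (uh v t') ξ)) = Function.uncurry fun t' ξ => eph t ξ * ((k0 : ℂ) * Nt v t' ξ) := by
      funext ⟨t', ξ⟩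
      simp only [Function.uncurry]
      rw [eph_sub, Nt]; unfold uh; ring
    rw [e1]
    exact (hm.comp measurable_snd).mul (this.const_mul _)
  have hmp := measurable_invFt_param hF
  obtain ⟨C, hC, H⟩ := Rg.disp δ
  have e : us v t = fun x => invFt (fun ξ => eph t ξ * g ξ) x -
      Complex.I * ∫ t' in (0:ℝ)..t, invFt (fun ξ => eph (t - t') ξ * ((k0 : ℂ) * N5 (uh v t') ξ)) x :=
    funext fun x => h.us_eq hf ht x
  rw [e]
  refine hg.sub (Integrable.const_mul ?_ _)
  simp_rw [intervalIntegral.integral_of_le ht.1]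
  have hhint : Integrable (fun p : ℝ × E2 => invFt (fun ξ => eph (t - p.1) ξ * ((k0 : ℂ) * N5 (uh v p.1) ξ)) p.2)
      ((volume.restrict (Ioc 0 t)).prod volume) := by
    refine ⟨hmp.aestronglyMeasurable, ?_⟩
    unfold HasFiniteIntegral
    rw [lintegral_prod _ hmp.enorm.aemeasurable]
    set B := C * nw (Wk kn) D * nw (Wk kn) (lc4 D) with hB
    refine (setLIntegral_mono (g := fun _ => ENNReal.ofReal k0 * B) measurable_const fun t' ht' => ?_).trans_lt ?_
    · have hr := h.rg hf (h.mIcc ⟨ht'.1.le, ht'.2.trans ht.2⟩)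
      have hh := (H (t - t') (by rw [abs_of_nonneg (by linarith [ht'.2])]; linarith [ht'.1, ht.2]) hr).2
      have e2 : (fun ξ => eph (t - t') ξ * ((k0 : ℂ) * N5 (uh v t') ξ)) = fun ξ => (k0:ℂ) * (eph (t - t') ξ * N5 (uh v t') ξ) := by
        funext ξ; ring
      dsimp only
      rw [e2]
      simp_rw [invFt_const_mul, enorm_mul]
      rw [lintegral_const_mul' _ _ (by simp), show ‖(k0:ℂ)‖ₑ = ENNReal.ofReal k0 by rw [← ofReal_norm, Complex.norm_real, Real.norm_of_nonneg k0_pos.le]]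
      gcongr
    · rw [lintegral_const]
      have h1 : nw (Wk kn) D < ⊤ := (h.rgg hf).fin' (by omega)
      have h2 : nw (Wk kn) (lc4 D) < ⊤ := (nw_mono_wt (Wk_mono (by omega))).trans_lt (h.rgg hf).finlc4
      refine ENNReal.mul_lt_top (ENNReal.mul_lt_top ENNReal.ofReal_lt_top (ENNReal.mul_lt_top (ENNReal.mul_lt_top hC h1) h2)) ?_
      simp
  exact hhint.integral_prod_right

lemma ft_us (h : Sol g δ D v) (hf : nw (Wk (kn + 3)) D < ⊤) {t : ℝ} (ht : t ∈ Icc 0 δ)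
    (hg : Integrable (invFt (fun ξ => eph t ξ * g ξ))) : ft (us v t) =ᵐ[volume] uh v t :=
  ft_invFt_ae (h.rg hf (h.mIcc ht)).int (h.us_int hf ht hg)

lemma duhamel (h : Sol g δ D v) (hf : nw (Wk (kn + 3)) D < ⊤) {u₀ : E2 → ℂ} (hu : ∀ ξ, g ξ = ft u₀ ξ) :
    DuhamelOn (Icc 0 δ) (us v) u₀ := by
  intro t ht x
  rw [h.us_eq hf ht x]
  congr 1
  · unfold bprop
    refine congrFun (congrArg invFt ?_) x
    funext ξ; rw [hu]; rfl
  · congr 1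
    apply intervalIntegral.integral_congr
    intro t' ht'
    rw [uIcc_of_le ht.1] at ht'
    have hr := h.rg hf (h.mIcc ⟨ht'.1, ht'.2.trans ht.2⟩)
    dsimp only
    exact (congrFun (hr.bprop_quintic (t - t')) x).symm

lemma us_zero (h : Sol g δ D v) (hf : nw (Wk (kn + 3)) D < ⊤) {u₀ : E2 → ℂ} (hu : ∀ ξ, g ξ = ft u₀ ξ)
    (h1 : ContDiff ℝ (⊤ : ℕ∞) u₀) (h2 : HasCompactSupport u₀) (x : E2) : us v 0 x = u₀ x := by
  rw [← congrFun (invFt_ft h1 h2) x]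
  unfold us
  refine congrFun (invFt_congr_ae ?_) x
  filter_upwards [(h.rgg hf).aeD] with ξ hξ
  rw [uh, h.at_zero hξ.ne, hu]
  simp [eph]

lemma mulOp_us (h : Sol g δ D v) (hf : nw (Wk (kn + 3)) D < ⊤) {t : ℝ} (ht : t ∈ Icc 0 δ)
    (hg : Integrable (invFt (fun ξ => eph t ξ * g ξ))) (m : E2 → ℝ) :
    mulOp m (us v t) = invFt (fun ξ => (m ξ : ℂ) * uh v t ξ) := by
  unfold mulOp
  apply invFt_congr_ae
  filter_upwards [h.ft_us hf ht hg] with ξ hξ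
  rw [hξ]

lemma cont_uh (h : Sol g δ D v) (ξ : E2) : ContinuousOn (fun t => uh v t ξ) (Icc (-δ) δ) := by
  unfold uh
  exact ((continuous_eph.comp (Continuous.prodMk_left ξ)).continuousOn).mul (h.cont ξ)

lemma pjs_le {s : ℝ} (hs2 : s ≤ 2) {a : ℂ} {M : ℝ≥0∞} (ξ : E2) (ha : ‖a‖ₑ ≤ M) :
    ENNReal.ofReal ((1 + ‖ξ‖ ^ 2) ^ s * ‖a‖ ^ 2) ≤ (Wk 1 ξ * M) ^ (2:ℝ) := by
  rw [ENNReal.ofReal_mul (by positivity), ENNReal.mul_rpow_of_nonneg _ _ (by norm_num)]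
  gcongr
  · rw [Wk, ENNReal.ofReal_rpow_of_pos (pow_pos (pj_pos ξ) 1), pow_one]
    exact ENNReal.ofReal_le_ofReal (Real.rpow_le_rpow_of_exponent_le (one_le_pj ξ) hs2)
  · rw [ENNReal.ofReal_pow (norm_nonneg _), ofReal_norm]
    calc ‖a‖ₑ ^ 2 ≤ M ^ 2 := by gcongr
      _ = _ := by norm_cast

lemma contHs (h : Sol g δ D v) (hf : nw (Wk (kn + 3)) D < ⊤) {s : ℝ} (hs2 : s ≤ 2)
    (hg : ∀ t, Integrable (invFt (fun ξ => eph t ξ * g ξ))) : ContHs s (Icc 0 δ) (us v) := by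
  have hfin : nw (Wk 1) D < ⊤ := (h.rgg hf).fin' (by omega)
  have hfin2 : ∫⁻ ξ, (Wk 1 ξ * D ξ) ^ (2:ℝ) < ⊤ := by
    rw [← n2_sq]; exact ENNReal.rpow_lt_top_of_nonneg (by norm_num) hfin.ne
  have hhalf : ∀ {a b : ℝ≥0∞}, a ≤ b → a ^ (1/2:ℝ) ≤ b ^ (1/2:ℝ) := fun hab => ENNReal.rpow_le_rpow hab (by norm_num)
  refine ⟨fun t ht => ?_, fun t₀ ht₀ η hη => ?_⟩
  · unfold HsNorm
    refine ENNReal.rpow_lt_top_of_nonneg (by norm_num) (ne_of_lt ?_)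
    refine (lintegral_mono_ae ?_).trans_lt hfin2
    filter_upwards [h.ft_us hf ht (hg t)] with ξ hξ
    rw [hξ]
    exact pjs_le hs2 ξ ((h.rg hf (h.mIcc ht)).le ξ)
  · have key : Filter.Tendsto (fun t => ∫⁻ ξ, ENNReal.ofReal ((1 + ‖ξ‖ ^ 2) ^ s * ‖uh v t ξ - uh v t₀ ξ‖ ^ 2))
        (nhdsWithin t₀ (Icc 0 δ)) (nhds (∫⁻ ξ : E2, 0)) := by
      refine tendsto_lintegral_filter_of_dominated_convergence (fun ξ => (Wk 1 ξ * (2 * D ξ)) ^ (2:ℝ)) ?_ ?_ ?_ ?_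
      · filter_upwards with t
        have hmt : ∀ t, Measurable (uh v t) := fun t =>
          ((continuous_eph.comp (Continuous.prodMk_right t)).measurable).mul (h.mvt t)
        have := (hmt t).sub (hmt t₀)
        have h3 : Measurable fun ξ : E2 => (1 + ‖ξ‖ ^ 2) ^ s := by fun_prop
        exact (h3.mul (this.norm.pow_const 2)).ennreal_ofReal
      · filter_upwards [self_mem_nhdsWithin] with t ht
        refine Filter.Eventually.of_forall fun ξ => pjs_le hs2 ξ ?_
        refine (enorm_sub_le).trans ?_
        rw [two_mul]
        exact add_le_add ((h.rg hf (h.mIcc ht)).le ξ) ((h.rg hf (h.mIcc ht₀)).le ξ)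
      · have : (fun ξ => (Wk 1 ξ * (2 * D ξ)) ^ (2:ℝ)) = fun ξ => (2:ℝ≥0∞) ^ (2:ℝ) * (Wk 1 ξ * D ξ) ^ (2:ℝ) := by
          funext ξ; rw [← ENNReal.mul_rpow_of_nonneg _ _ (by norm_num)]; ring_nf
        rw [this, lintegral_const_mul' _ _ (by simp)]
        exact (ENNReal.mul_lt_top (by simp) hfin2).ne
      · refine Filter.Eventually.of_forall fun ξ => ?_
        have hc : Filter.Tendsto (fun t => uh v t ξ) (nhdsWithin t₀ (Icc 0 δ)) (nhds (uh v t₀ ξ)) :=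
          ((h.cont_uh ξ) t₀ (h.mIcc ht₀)).mono_left (nhdsWithin_mono _ fun t ht => h.mIcc ht)
        have h2 : Filter.Tendsto (fun t => (1 + ‖ξ‖ ^ 2) ^ s * ‖uh v t ξ - uh v t₀ ξ‖ ^ 2) (nhdsWithin t₀ (Icc 0 δ)) (nhds ((1 + ‖ξ‖ ^ 2) ^ s * ‖uh v t₀ ξ - uh v t₀ ξ‖ ^ 2)) :=
          (((hc.sub_const _).norm.pow 2).const_mul _)
        have := ENNReal.tendsto_ofReal h2
        simpa using this
    rw [lintegral_zero] at key
    have hη2 : 0 < (ENNReal.ofReal η) ^ (2:ℝ) := ENNReal.rpow_pos (by simpa using hη) (by simp)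
    have ev := key.eventually (gt_mem_nhds hη2)
    rw [eventually_nhdsWithin_iff, Metric.eventually_nhds_iff] at ev
    obtain ⟨τ, hτ, hh⟩ := ev
    refine ⟨τ, hτ, fun t ht htt => ?_⟩
    have := hh (by rw [Real.dist_eq]; exact htt) ht
    unfold HsNorm
    have e : ∫⁻ ξ : E2, ENNReal.ofReal ((1 + ‖ξ‖ ^ 2) ^ s * ‖ft (fun x => us v t x - us v t₀ x) ξ‖ ^ 2) =
        ∫⁻ ξ, ENNReal.ofReal ((1 + ‖ξ‖ ^ 2) ^ s * ‖uh v t ξ - uh v t₀ ξ‖ ^ 2) := by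
      apply lintegral_congr_ae
      filter_upwards [h.ft_us hf ht (hg t), h.ft_us hf ht₀ (hg t₀)] with ξ h1 h2
      rw [ft_sub (h.us_int hf ht (hg t)) (h.us_int hf ht₀ (hg t₀)), h1, h2]
    rw [e]
    have h4 := ENNReal.rpow_lt_rpow this (z := 1/2) (by norm_num)
    rwa [← ENNReal.rpow_mul, show (2:ℝ) * (1/2) = 1 by norm_num, ENNReal.rpow_one] at h4

end Sol


namespace Rg
variable {f : E2 → ℂ} {D : E2 → ℝ≥0∞}

lemma sq_int {b : E2 → ℂ} (hb : Integrable b) (hb2 : MemLp b 2) :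
    Integrable (fun x => ‖invFt b x‖ ^ 2) ∧ ∫ x, ‖invFt b x‖ ^ 2 = c2 * ∫ ξ, ‖b ξ‖ ^ 2 := by
  have e : ∀ f : E2 → ℂ, ∫ x, conj (f x) * f x = ((∫ x, ‖f x‖^2 : ℝ) : ℂ) := by
    intro f
    rw [← integral_complex_ofReal]
    congr 1; funext x
    rw [mul_comm, Complex.mul_conj, Complex.normSq_eq_norm_sq]
  refine ⟨(memLp_invFt hb hb2).integrable_norm_pow (by norm_num), ?_⟩
  have := parseval_invFt hb hb2 hb hb2
  rw [e, e] at this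
  exact_mod_cast this

lemma mulr (h : Rg f D) {m : E2 → ℝ} (hm : Measurable m) (hm1 : ∀ ξ, |m ξ| ≤ 1) : Rg (fun ξ => (m ξ : ℂ) * f ξ) D where
  mf := (Complex.measurable_ofReal.comp hm).mul h.mf
  mD := h.mD
  le ξ := by
    rw [enorm_mul]
    refine le_trans ?_ (h.le ξ)
    conv_rhs => rw [← one_mul ‖f ξ‖ₑ]
    gcongr
    rw [← ofReal_norm, Complex.norm_real, Real.norm_eq_abs, ← ENNReal.ofReal_one]
    exact ENNReal.ofReal_le_ofReal (hm1 ξ)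
  fin := h.fin

lemma lap_part (h : Rg f D) : Integrable (fun x => ‖lap (invFt f) x‖ ^ 2) ∧
    ∫ x, ‖lap (invFt f) x‖ ^ 2 = c2 * ∫ ξ, ‖ξ‖ ^ 4 * ‖f ξ‖ ^ 2 := by
  have hw : WI 0 (fun ξ => ((‖ξ‖^2 : ℝ) : ℂ) * f ξ) := by
    have h1 : WI (kn + 1 + 1) f := h.wi
    have := (WI_mul (n := kn + 1) (k := 1) h1 (μ := fun ξ => ‖ξ‖^2) (by fun_prop) (fun ξ => by
      rw [abs_of_nonneg (by positivity), pow_one]; unfold pj; linarith)).1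
    exact WI_zero this
  have hi := WI_int hw
  have hi2 := WI_memLp hw
  have e : lap (invFt f) = invFt (fun ξ => -((‖ξ‖ ^ 2 : ℝ) : ℂ) * f ξ) := by
    funext x
    refine lap_invFt h.int ?_ x
    convert hi.norm using 2 with ξ
    rw [norm_mul, Complex.norm_real, Real.norm_of_nonneg (by positivity)]
  have e2 : (fun ξ : E2 => -((‖ξ‖ ^ 2 : ℝ) : ℂ) * f ξ) = fun ξ => (-1:ℂ) * (((‖ξ‖ ^ 2 : ℝ) : ℂ) * f ξ) := by
    funext ξ; ring
  rw [e, e2]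
  obtain ⟨a, b⟩ := sq_int (hi.const_mul (-1)) (hi2.const_mul (-1))
  refine ⟨a, b.trans ?_⟩
  congr 2; funext ξ
  rw [norm_mul, norm_mul, Complex.norm_real, Real.norm_of_nonneg (by positivity)]
  simp; ring

lemma six_part (h : Rg f D) : Integrable (fun x => ‖invFt f x‖ ^ 6) ∧
    ∫ x, ‖invFt f x‖ ^ 6 = c2 * k0 * (∫ ξ, conj (f ξ) * N5 f ξ).re := by
  have hN := h.n5r
  have e : ∀ x, conj (invFt f x) * invFt (fun ξ => (k0:ℂ) * N5 f ξ) x = ((‖invFt f x‖ ^ 6 : ℝ) : ℂ) := by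
    intro x
    rw [← h.quintic_eq, quintic]
    have h2 : invFt f x * conj (invFt f x) = ((‖invFt f x‖ : ℝ) : ℂ) ^ 2 := by
      rw [Complex.mul_conj, Complex.normSq_eq_norm_sq]; push_cast; rfl
    calc _ = ((‖invFt f x‖ : ℝ) : ℂ) ^ 4 * (invFt f x * conj (invFt f x)) := by ring
      _ = _ := by rw [h2]; push_cast; ring
  have hp := parseval_invFt h.int h.mem (hN.int.const_mul (k0:ℂ)) (hN.mem.const_mul (k0:ℂ))
  simp_rw [e] at hp
  have hi : Integrable (fun x => conj (invFt f x) * invFt (fun ξ => (k0:ℂ) * N5 f ξ) x) := by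
    have h1 : MemLp (fun x => conj (invFt f x)) 2 := (memLp_invFt h.int h.mem).star
    exact MemLp.integrable_mul h1 (memLp_invFt (hN.int.const_mul (k0:ℂ)) (hN.mem.const_mul (k0:ℂ)))
  simp_rw [e] at hi
  refine ⟨hi.re.congr (Filter.Eventually.of_forall fun x => Complex.ofReal_re _), ?_⟩
  rw [integral_complex_ofReal] at hp
  have e3 : ∫ ξ, conj (f ξ) * ((k0:ℂ) * N5 f ξ) = (k0:ℂ) * ∫ ξ, conj (f ξ) * N5 f ξ := by
    rw [← integral_const_mul]; congr 1; funext ξ; ring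
  rw [e3, ← mul_assoc] at hp
  have := congrArg Complex.re hp
  rw [Complex.ofReal_re] at this
  rw [this, ← Complex.ofReal_mul, Complex.re_ofReal_mul]

lemma energy_eq (h : Rg f D) : energy (invFt f) =
    c2 / 2 * (∫ ξ, ‖ξ‖ ^ 4 * ‖f ξ‖ ^ 2) + c2 * k0 / 6 * (∫ ξ, conj (f ξ) * N5 f ξ).re := by
  unfold energy energyIntegrand
  rw [integral_add (h.lap_part.1.const_mul _) (h.six_part.1.const_mul _), integral_const_mul, integral_const_mul,
    h.lap_part.2, h.six_part.2]
  ring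

lemma energy_ge (h : Rg f D) : c2 / 2 * (∫ ξ, ‖ξ‖ ^ 4 * ‖f ξ‖ ^ 2) ≤ energy (invFt f) := by
  rw [h.energy_eq]
  have : 0 ≤ c2 * k0 * (∫ ξ, conj (f ξ) * N5 f ξ).re := by
    rw [← h.six_part.2]; positivity
  linarith

lemma int4 (h : Rg f D) : Integrable (fun ξ => ‖ξ‖ ^ 4 * ‖f ξ‖ ^ 2) := by
  have hw : WI 0 (fun ξ => ((‖ξ‖^2 : ℝ) : ℂ) * f ξ) := by
    have h1 : WI (kn + 1 + 1) f := h.wi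
    have := (WI_mul (n := kn + 1) (k := 1) h1 (μ := fun ξ => ‖ξ‖^2) (by fun_prop) (fun ξ => by
      rw [abs_of_nonneg (by positivity), pow_one]; unfold pj; linarith)).1
    exact WI_zero this
  have := (WI_memLp hw).integrable_norm_pow (by norm_num)
  refine this.congr (Filter.Eventually.of_forall fun ξ => ?_)
  dsimp only
  rw [norm_mul, Complex.norm_real, Real.norm_of_nonneg (by positivity)]; ring

end Rg


open scoped SchwartzMap in
lemma nw_schwartz (k : ℕ) (φ : 𝓢(E2, ℂ)) : nw (Wk k) (fun ξ => ‖φ ξ‖ₑ) < ⊤ := by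
  have hg : Function.HasTemperateGrowth (fun ξ : E2 => ((pj ξ ^ k : ℝ) : ℂ)) := by
    have h0 : Function.HasTemperateGrowth (fun ξ : E2 => ((pj ξ ^ k : ℝ))) := by
      unfold pj; fun_prop
    fun_prop
  let ψ := SchwartzMap.smulLeftCLM ℂ (fun ξ : E2 => ((pj ξ ^ k : ℝ) : ℂ)) φ
  have hψ : (ψ : E2 → ℂ) = fun ξ => ((pj ξ ^ k : ℝ) : ℂ) * φ ξ := by
    ext ξ
    exact SchwartzMap.smulLeftCLM_apply_apply hg φ ξ
  have h1 : eLpNorm ψ 2 volume < ⊤ := (ψ.memLp 2 volume).2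
  rw [eLpNorm_two, hψ] at h1
  unfold nw
  convert h1 using 3 with ξ
  rw [enorm_mul, enorm_pj]

section mult
variable {s N : ℝ} {Cd : ℕ → ℝ} {m : E2 → ℝ}

lemma m_le_om (hs : 1 < s) (hs2 : s < 2) (hN : 1 ≤ N) (hm : IsIMult s N Cd m) (ξ : E2) :
    ‖ξ‖ ^ 2 * m ξ ≤ 5 * om s N ξ := by
  have hpj := one_le_pj ξ
  have hm0 := hm.pos ξ
  have hm1 := hm.le_one ξ
  have hn : ‖ξ‖ ^ 2 ≤ pj ξ := by unfold pj; linarith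
  have h1 : ‖ξ‖ ^ 2 * m ξ ≤ pj ξ := by nlinarith [sq_nonneg ‖ξ‖]
  have hNp : 0 < N := by linarith
  unfold om phiw
  rw [mul_min_of_nonneg _ _ (by norm_num)]
  refine le_min (by linarith) ?_
  rcases le_total (2 * N) ‖ξ‖ with h | h
  · have hx : 0 < ‖ξ‖ := by linarith
    rw [hm.eq_rpow ξ h, Real.div_rpow hx.le hNp.le]
    have e1 : ‖ξ‖ ^ 2 * (‖ξ‖ ^ (s - 2) / N ^ (s - 2)) = N ^ (2 - s) * ‖ξ‖ ^ s := by
      rw [show (2 - s) = -(s - 2) by ring, Real.rpow_neg hNp.le, Real.rpow_sub hx]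
      simp only [Real.rpow_ofNat]; field_simp
    rw [e1]
    have e2 : ‖ξ‖ ^ s ≤ pj ξ ^ (s / 2) := by
      calc ‖ξ‖ ^ s = (‖ξ‖ ^ 2) ^ (s / 2) := by
            rw [← Real.rpow_natCast, ← Real.rpow_mul hx.le]; congr 1; push_cast; ring
        _ ≤ _ := Real.rpow_le_rpow (by positivity) hn (by linarith)
    have : 0 ≤ N ^ (2 - s) * pj ξ ^ (s / 2) := by positivity
    nlinarith [Real.rpow_pos_of_pos hNp (2 - s)]
  · have h2 : pj ξ ≤ 5 * N ^ 2 := by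
      unfold pj; nlinarith [norm_nonneg ξ]
    have h3 : pj ξ ^ (1 - s / 2) ≤ 5 * N ^ (2 - s) := by
      calc pj ξ ^ (1 - s / 2) ≤ (5 * N ^ 2) ^ (1 - s / 2) := Real.rpow_le_rpow (by linarith) h2 (by linarith)
        _ = 5 ^ (1 - s / 2) * N ^ (2 - s) := by
            rw [Real.mul_rpow (by norm_num) (by positivity), ← Real.rpow_natCast N 2, ← Real.rpow_mul hNp.le]
            congr 2; push_cast; ring
        _ ≤ 5 ^ (1:ℝ) * N ^ (2 - s) := by
            gcongr
            · norm_num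
            · linarith
        _ = _ := by simp
    have e3 : pj ξ = pj ξ ^ (1 - s / 2) * pj ξ ^ (s / 2) := by
      rw [← Real.rpow_add (pj_pos ξ)]; simp
    calc ‖ξ‖ ^ 2 * m ξ ≤ pj ξ := h1
      _ = pj ξ ^ (1 - s / 2) * pj ξ ^ (s / 2) := e3
      _ ≤ 5 * N ^ (2 - s) * pj ξ ^ (s / 2) := by
        have := Real.rpow_pos_of_pos (pj_pos ξ) (s/2)
        gcongr
      _ = _ := by ring

lemma om_le_m (hs : 1 < s) (hs2 : s < 2) (hN : 1 ≤ N) (hm : IsIMult s N Cd m) (ξ : E2) :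
    om s N ξ ≤ 4 * (1 + ‖ξ‖ ^ 2 * m ξ) := by
  have hNp : 0 < N := by linarith
  have hm0 := hm.pos ξ
  unfold om phiw
  rcases le_total ‖ξ‖ N with h | h
  · refine (min_le_left _ _).trans ?_
    rw [hm.eq_one ξ h]; unfold pj; nlinarith [sq_nonneg ‖ξ‖]
  · refine (min_le_right _ _).trans ?_
    have hx : 0 < ‖ξ‖ := by linarith
    have h2 : ‖(2:ℝ) • ξ‖ = 2 * ‖ξ‖ := by rw [norm_smul]; simp
    have h3 : m ((2:ℝ) • ξ) ≤ m ξ := hm.mono _ _ (by rw [h2]; linarith)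
    rw [hm.eq_rpow _ (by rw [h2]; linarith), h2] at h3
    have h4 : (2:ℝ)⁻¹ * (‖ξ‖ / N) ^ (s - 2) ≤ m ξ := by
      refine le_trans ?_ h3
      rw [mul_div_assoc, Real.mul_rpow (by norm_num) (by positivity)]
      have : (2:ℝ)⁻¹ ≤ 2 ^ (s - 2) := by
        rw [← Real.rpow_neg_one]
        exact Real.rpow_le_rpow_of_exponent_le (by norm_num) (by linarith)
      gcongr
    have h5 : pj ξ ^ (s/2) ≤ 2 * ‖ξ‖ ^ s := by
      have : pj ξ ≤ 2 * ‖ξ‖ ^ 2 := by unfold pj; nlinarith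
      calc pj ξ ^ (s/2) ≤ (2 * ‖ξ‖ ^ 2) ^ (s/2) := Real.rpow_le_rpow (pj_pos ξ).le this (by linarith)
        _ = 2 ^ (s/2) * ‖ξ‖ ^ s := by
          rw [Real.mul_rpow (by norm_num) (by positivity), ← Real.rpow_natCast, ← Real.rpow_mul hx.le]
          congr 2; push_cast; ring
        _ ≤ 2 ^ (1:ℝ) * ‖ξ‖ ^ s := by
          gcongr
          · norm_num
          · linarith
        _ = _ := by simp
    have e1 : ‖ξ‖ ^ 2 * (‖ξ‖ / N) ^ (s - 2) = N ^ (2 - s) * ‖ξ‖ ^ s := by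
      rw [Real.div_rpow hx.le hNp.le]
      rw [show (2 - s) = -(s - 2) by ring, Real.rpow_neg hNp.le, Real.rpow_sub hx]
      simp only [Real.rpow_ofNat]; field_simp
    have hN2 := Real.rpow_pos_of_pos hNp (2 - s)
    calc N ^ (2 - s) * pj ξ ^ (s/2) ≤ N ^ (2 - s) * (2 * ‖ξ‖ ^ s) := by gcongr
      _ = 4 * (‖ξ‖ ^ 2 * (2⁻¹ * (‖ξ‖ / N) ^ (s - 2))) := by rw [mul_left_comm (‖ξ‖^2), e1]; ring
      _ ≤ 4 * (‖ξ‖ ^ 2 * m ξ) := by gcongr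
      _ ≤ _ := by linarith

lemma om_ge (hs : 1 < s) (hN : 1 ≤ N) {ξ : E2} (h : N ≤ ‖ξ‖) : N ^ 2 ≤ om s N ξ := by
  have hNp : 0 < N := by linarith
  have h1 : N ^ 2 ≤ pj ξ := by unfold pj; nlinarith
  unfold om phiw
  refine le_min h1 ?_
  calc N ^ 2 = N ^ (2 - s) * (N ^ 2) ^ (s/2) := by
        rw [← Real.rpow_natCast, ← Real.rpow_mul hNp.le, ← Real.rpow_add hNp]
        congr 1; push_cast; ring
    _ ≤ _ := by
      gcongr

end mult

lemma nw_sq_real {w : E2 → ℝ} (hw : ∀ ξ, 0 ≤ w ξ) (f : E2 → ℂ) :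
    nw (fun ξ => ENNReal.ofReal (w ξ)) (fun ξ => ‖f ξ‖ₑ) = (∫⁻ ξ, ENNReal.ofReal ((w ξ * ‖f ξ‖) ^ 2)) ^ (1/2:ℝ) := by
  unfold nw n2
  congr 2; funext ξ
  dsimp only
  rw [← ofReal_norm, ← ENNReal.ofReal_mul (hw ξ), ENNReal.ofReal_rpow_of_nonneg (mul_nonneg (hw ξ) (norm_nonneg _)) (by norm_num)]
  norm_num

/-- radius in terms of the mass -/
def Rr (r : ℝ) : ℝ := Real.sqrt (32 * (r ^ 2 + 2) / c2)

lemma init_bound {s N : ℝ} {Cd : ℕ → ℝ} {m : E2 → ℝ} (hs : 1 < s) (hs2 : s < 2) (hN : 1 ≤ N)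
    (hm : IsIMult s N Cd m) {u₀ : E2 → ℂ} (h1 : ContDiff ℝ (⊤ : ℕ∞) u₀) (h2 : HasCompactSupport u₀)
    (hE : energy (mulOp m u₀) ≤ 1) :
    nw (fun ξ => ENNReal.ofReal (om s N ξ)) (fun ξ => ‖ft u₀ ξ‖ₑ) ≤
      ENNReal.ofReal (Rr ((eLpNorm u₀ 2 volume).toReal)) := by
  obtain ⟨φ, hφ⟩ := ft_schwartz h1 h2
  have e : ft u₀ = φ := funext fun ξ => (hφ ξ).symm
  have rg : Rg (ft u₀) (fun ξ => ‖ft u₀ ξ‖ₑ) := by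
    rw [e]
    exact ⟨φ.continuous.measurable, φ.continuous.measurable.enorm, fun ξ => le_rfl, nw_schwartz _ φ⟩
  have hmm : Measurable m := hm.smooth.continuous.measurable
  have rm := rg.mulr hmm (fun ξ => by rw [abs_of_pos (hm.pos ξ)]; exact hm.le_one ξ)
  have g1 := rm.energy_ge
  change _ ≤ energy (mulOp m u₀) at g1
  have g2 := Rg.sq_int rg.int rg.mem
  have i1 : Integrable fun ξ => ‖ft u₀ ξ‖ ^ 2 := rg.mem.integrable_norm_pow (by norm_num)
  have i2 := rm.int4
  set r := (eLpNorm u₀ 2 volume).toReal with hr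
  have hr2 : ∫ x, ‖u₀ x‖ ^ 2 = r ^ 2 := by
    have hmem : MemLp u₀ 2 volume := h1.continuous.memLp_of_hasCompactSupport h2
    have := hmem.eLpNorm_eq_integral_rpow_norm (by norm_num) (by norm_num)
    rw [hr, this, ENNReal.toReal_ofReal (by positivity)]
    simp only [ENNReal.toReal_ofNat, Real.rpow_ofNat]
    rw [← Real.rpow_natCast, ← Real.rpow_mul (by positivity)]
    norm_num
  rw [invFt_ft h1 h2, hr2] at g2
  have hc := c2_pos
  have b1 : ∫ ξ, ‖ft u₀ ξ‖ ^ 2 = r ^ 2 / c2 := by rw [g2.2]; field_simp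
  have b2 : (∫ ξ, ‖ξ‖ ^ 4 * ‖(m ξ : ℂ) * ft u₀ ξ‖ ^ 2) ≤ 2 / c2 := by
    rw [le_div_iff₀ hc]; nlinarith
  rw [nw_sq_real (fun ξ => om_nonneg (by linarith) ξ)]
  have key : ∫⁻ ξ, ENNReal.ofReal ((om s N ξ * ‖ft u₀ ξ‖) ^ 2) ≤ ENNReal.ofReal (32 * (r ^ 2 + 2) / c2) := by
    calc _ ≤ ∫⁻ ξ, ENNReal.ofReal (32 * (‖ft u₀ ξ‖ ^ 2 + ‖ξ‖ ^ 4 * ‖(m ξ : ℂ) * ft u₀ ξ‖ ^ 2)) := by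
          refine lintegral_mono fun ξ => ENNReal.ofReal_le_ofReal ?_
          have a1 := om_le_m hs hs2 hN hm ξ
          have a2 := om_nonneg (s := s) (N := N) (by linarith) ξ
          have a3 : 0 ≤ ‖ξ‖ ^ 2 * m ξ := mul_nonneg (by positivity) (hm.pos ξ).le
          rw [norm_mul, Complex.norm_real, Real.norm_of_nonneg (hm.pos ξ).le]
          have a4 : om s N ξ ^ 2 ≤ 32 * (1 + (‖ξ‖ ^ 2 * m ξ) ^ 2) := by
            have : om s N ξ ^ 2 ≤ (4 * (1 + ‖ξ‖ ^ 2 * m ξ)) ^ 2 := by gcongr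
            nlinarith [sq_nonneg (1 - ‖ξ‖ ^ 2 * m ξ)]
          have a5 := sq_nonneg ‖ft u₀ ξ‖
          calc (om s N ξ * ‖ft u₀ ξ‖) ^ 2 = om s N ξ ^ 2 * ‖ft u₀ ξ‖ ^ 2 := by ring
            _ ≤ 32 * (1 + (‖ξ‖ ^ 2 * m ξ) ^ 2) * ‖ft u₀ ξ‖ ^ 2 := by gcongr
            _ = _ := by ring
      _ = ENNReal.ofReal (∫ ξ, 32 * (‖ft u₀ ξ‖ ^ 2 + ‖ξ‖ ^ 4 * ‖(m ξ : ℂ) * ft u₀ ξ‖ ^ 2)) := by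
          have i3 : Integrable (fun ξ => 32 * (‖ft u₀ ξ‖ ^ 2 + ‖ξ‖ ^ 4 * ‖(m ξ : ℂ) * ft u₀ ξ‖ ^ 2)) :=
            (i1.add i2).const_mul 32
          rw [← ofReal_integral_eq_lintegral_ofReal i3
            (Filter.Eventually.of_forall fun ξ => by simp only [Pi.zero_apply]; positivity)]
      _ ≤ _ := by
          apply ENNReal.ofReal_le_ofReal
          rw [integral_const_mul, integral_add i1 i2, b1, mul_div_assoc, add_div]
          gcongr
  refine (ENNReal.rpow_le_rpow key (by norm_num)).trans ?_
  rw [ENNReal.ofReal_rpow_of_nonneg (by positivity) (by norm_num), Rr, Real.sqrt_eq_rpow]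


/-! ### the one- and two-dimensional kernel estimates -/

lemma erpow_anti {a b : ℝ≥0∞} {p : ℝ} (hp : p ≤ 0) (h : a ≤ b) : b ^ p ≤ a ^ p := by
  have e : ∀ x : ℝ≥0∞, x ^ p = (x ^ (-p))⁻¹ := fun x => by rw [← ENNReal.rpow_neg, neg_neg]
  rw [e, e]
  exact ENNReal.inv_le_inv.2 (ENNReal.rpow_le_rpow h (by linarith))

/-- one dimensional constant -/
def K1c (s η : ℝ) : ℝ≥0∞ :=
  2 * ((∫⁻ y : ℝ in Icc (-1) 1, ENNReal.ofReal |y| ^ (η - 1)) + ∫⁻ y : ℝ, ENNReal.ofReal ((1 + y ^ 2) ^ (-s/2)))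

lemma K1c_lt_top {s η : ℝ} (hs : 1 < s) (hη : 0 < η) : K1c s η < ⊤ := by
  have h1 : (∫⁻ y : ℝ in Icc (-1) 1, ENNReal.ofReal |y| ^ (η - 1)) < ⊤ := by
    have e : (Icc (-1) 1 : Set ℝ) ⊆ Icc (-1) 0 ∪ Icc 0 1 := by
      intro x hx
      rcases le_total x 0 with h | h
      · exact Or.inl ⟨hx.1, h⟩
      · exact Or.inr ⟨h, hx.2⟩
    have b : (∫⁻ y : ℝ in Icc 0 1, ENNReal.ofReal |y| ^ (η - 1)) < ⊤ := by
      have i : IntervalIntegrable (fun x : ℝ => x ^ (η - 1)) volume 0 1 :=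
        intervalIntegral.intervalIntegrable_rpow' (by linarith)
      rw [intervalIntegrable_iff_integrableOn_Ioc_of_le (by norm_num)] at i
      have := i.hasFiniteIntegral
      rw [HasFiniteIntegral] at this
      rw [setLIntegral_congr Ioc_ae_eq_Icc.symm]
      refine lt_of_le_of_lt (le_of_eq ?_) this
      refine setLIntegral_congr_fun measurableSet_Ioc fun y hy => ?_
      have hy0 : 0 < y := hy.1
      rw [abs_of_pos hy0, ENNReal.ofReal_rpow_of_pos hy0, ← ofReal_norm, Real.norm_of_nonneg (by positivity)]
    have b' : (∫⁻ y : ℝ in Icc (-1) 0, ENNReal.ofReal |y| ^ (η - 1)) < ⊤ := by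
      have : (∫⁻ y : ℝ in Icc (-1) 0, ENNReal.ofReal |y| ^ (η - 1)) = ∫⁻ y : ℝ in Icc 0 1, ENNReal.ofReal |y| ^ (η - 1) := by
        rw [← lintegral_indicator measurableSet_Icc, ← lintegral_indicator measurableSet_Icc, ← lintegral_neg_eq_self]
        congr 1; funext y
        unfold indicator
        have : (-y ∈ Icc (-1:ℝ) 0) ↔ (y ∈ Icc (0:ℝ) 1) := by
          constructor <;> intro h <;> constructor <;> linarith [h.1, h.2]
        simp only [this, abs_neg]
      rw [this]; exact b
    calc _ ≤ ∫⁻ y : ℝ in Icc (-1) 0 ∪ Icc 0 1, ENNReal.ofReal |y| ^ (η - 1) := lintegral_mono_set e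
      _ ≤ _ := lintegral_union_le _ _ _
      _ < ⊤ := ENNReal.add_lt_top.2 ⟨b', b⟩
  have h2 : (∫⁻ y : ℝ, ENNReal.ofReal ((1 + y ^ 2) ^ (-s/2))) < ⊤ := by
    have := integrable_rpow_neg_one_add_norm_sq (E := ℝ) (μ := volume) (r := s) (by simpa using hs)
    simp only [Real.norm_eq_abs, sq_abs] at this
    have h3 := this.hasFiniteIntegral
    rw [HasFiniteIntegral] at h3
    refine lt_of_le_of_lt (lintegral_mono fun y => ?_) h3
    rw [← ofReal_norm]
    exact ENNReal.ofReal_le_ofReal (le_abs_self _)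
  unfold K1c
  exact ENNReal.mul_lt_top (by norm_num) (ENNReal.add_lt_top.2 ⟨h1, h2⟩)

lemma kernel_one {s η A : ℝ} (hs : 1 < s) (hη : 0 < η) (hη1 : η < 1) (hA : 0 < A) {S : Set ℝ} (hS : IsCompact S)
    {G : ℝ → ℝ} (hG : Continuous G) (hl : ∀ y ∈ S, ∀ y' ∈ S, A * |y - y'| ≤ |G y - G y'|) :
    ∫⁻ y in S, ENNReal.ofReal |G y| ^ (η - 1) * ENNReal.ofReal ((1 + y ^ 2) ^ (-s/2)) ≤
      ENNReal.ofReal (A ^ (η - 1)) * K1c s η := by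
  rcases S.eq_empty_or_nonempty with h0 | hne
  · simp [h0]
  obtain ⟨z, hz, hmin⟩ := hS.exists_isMinOn hne hG.abs.continuousOn
  have hη' : η - 1 ≤ 0 := by linarith
  have q : ∀ y ∈ S, A / 2 * |y - z| ≤ |G y| := by
    intro y hy
    have h1 := hl y hy z hz
    have h2 : |G z| ≤ |G y| := hmin hy
    have h3 := abs_sub (G y) (G z)
    linarith
  set I : ℝ → ℝ≥0∞ := fun y => (Icc (-1:ℝ) 1).indicator (fun y => ENNReal.ofReal |y| ^ (η - 1)) y with hI
  have hIm : Measurable I := by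
    refine Measurable.indicator ?_ measurableSet_Icc
    fun_prop
  have p : ∀ y ∈ S, ENNReal.ofReal |G y| ^ (η - 1) * ENNReal.ofReal ((1 + y ^ 2) ^ (-s/2)) ≤
      ENNReal.ofReal (A ^ (η - 1)) * (2 * (I (y - z) + ENNReal.ofReal ((1 + y ^ 2) ^ (-s/2)))) := by
    intro y hy
    have w1 : (1 + y ^ 2) ^ (-s/2) ≤ 1 :=
      Real.rpow_le_one_of_one_le_of_nonpos (by nlinarith [sq_nonneg y]) (by linarith)
    have a1 : ENNReal.ofReal |G y| ^ (η - 1) ≤ ENNReal.ofReal (A / 2 * |y - z|) ^ (η - 1) :=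
      erpow_anti hη' (ENNReal.ofReal_le_ofReal (q y hy))
    have a2 : ENNReal.ofReal (A / 2 * |y - z|) ^ (η - 1) = ENNReal.ofReal (A ^ (η-1)) * (ENNReal.ofReal ((1/2:ℝ) ^ (η-1)) * ENNReal.ofReal |y - z| ^ (η-1)) := by
      rw [ENNReal.ofReal_mul (by positivity), ENNReal.mul_rpow_of_ne_top (by simp) (by simp), ENNReal.ofReal_rpow_of_pos (by positivity),
        ← mul_assoc, ← ENNReal.ofReal_mul (by positivity), ← Real.mul_rpow hA.le (by norm_num)]
      norm_num [div_eq_mul_inv]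
    have a3 : ENNReal.ofReal ((1/2:ℝ) ^ (η-1)) ≤ 2 := by
      rw [show (2:ℝ≥0∞) = ENNReal.ofReal 2 by simp]
      apply ENNReal.ofReal_le_ofReal
      have : (1/2:ℝ) ^ (η-1) ≤ (1/2:ℝ) ^ (-1:ℝ) := Real.rpow_le_rpow_of_exponent_ge (by norm_num) (by norm_num) (by linarith)
      refine this.trans (le_of_eq ?_)
      rw [Real.rpow_neg_one]; norm_num
    calc _ ≤ (ENNReal.ofReal (A ^ (η-1)) * (2 * ENNReal.ofReal |y - z| ^ (η-1))) * ENNReal.ofReal ((1 + y ^ 2) ^ (-s/2)) := by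
          gcongr
          rw [a2] at a1
          exact a1.trans (by gcongr)
      _ = ENNReal.ofReal (A ^ (η-1)) * (2 * (ENNReal.ofReal |y - z| ^ (η-1) * ENNReal.ofReal ((1 + y ^ 2) ^ (-s/2)))) := by ring
      _ ≤ _ := by
        gcongr
        by_cases hc : y - z ∈ Icc (-1:ℝ) 1
        · have e1 : I (y - z) = ENNReal.ofReal |y - z| ^ (η-1) := by simp only [hI]; exact indicator_of_mem hc _
          rw [e1]
          refine le_trans ?_ le_self_add
          calc _ ≤ ENNReal.ofReal |y - z| ^ (η-1) * 1 := by
                gcongr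
                rw [← ENNReal.ofReal_one]; exact ENNReal.ofReal_le_ofReal w1
            _ = _ := mul_one _
        · refine le_trans ?_ le_add_self
          have h1 : 1 ≤ |y - z| := by
            by_contra hh
            rw [not_le, abs_lt] at hh
            exact hc ⟨hh.1.le, hh.2.le⟩
          calc _ ≤ 1 * ENNReal.ofReal ((1 + y ^ 2) ^ (-s/2)) := by
                gcongr
                have : ENNReal.ofReal |y - z| ^ (η-1) ≤ (1:ℝ≥0∞) ^ (η-1) := by
                  refine erpow_anti hη' ?_
                  rw [← ENNReal.ofReal_one]; exact ENNReal.ofReal_le_ofReal h1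
                simpa using this
            _ = _ := one_mul _
  have hm2 : Measurable fun y : ℝ => ENNReal.ofReal ((1 + y ^ 2) ^ (-s/2)) := by fun_prop
  have hm3 : Measurable fun y : ℝ => I (y - z) := hIm.comp (measurable_id.sub_const z)
  calc _ ≤ ∫⁻ y in S, ENNReal.ofReal (A ^ (η - 1)) * (2 * (I (y - z) + ENNReal.ofReal ((1 + y ^ 2) ^ (-s/2)))) :=
        setLIntegral_mono' hS.measurableSet p
    _ ≤ ∫⁻ y, ENNReal.ofReal (A ^ (η - 1)) * (2 * (I (y - z) + ENNReal.ofReal ((1 + y ^ 2) ^ (-s/2)))) :=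
        setLIntegral_le_lintegral _ _
    _ = _ := by
      have hm4 : Measurable fun y : ℝ => I (y - z) + ENNReal.ofReal ((1 + y ^ 2) ^ (-s/2)) := hm3.add hm2
      rw [lintegral_const_mul _ (hm4.const_mul 2), lintegral_const_mul _ hm4, lintegral_add_left hm3,
        lintegral_sub_right_eq_self I z, hI, lintegral_indicator measurableSet_Icc]
      rfl

lemma lint_E2 {F : E2 → ℝ≥0∞} (hF : Measurable F) : ∫⁻ ζ, F ζ = ∫⁻ x : ℝ, ∫⁻ y : ℝ, F !₂[x, y] := by
  have h1 := (EuclideanSpace.volume_preserving_symm_measurableEquiv_toLp (Fin 2)).symm.lintegral_comp hF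
  have h2 := (volume_preserving_finTwoArrow ℝ).symm.lintegral_comp
    (f := fun v => F ((MeasurableEquiv.toLp 2 (Fin 2 → ℝ)) v)) (hF.comp (MeasurableEquiv.measurable _))
  rw [← h1]
  simp only [MeasurableEquiv.symm_symm] at *
  rw [← h2]
  have h3 : Measurable fun p : ℝ × ℝ => F !₂[p.1, p.2] := by
    refine hF.comp ?_
    refine Continuous.measurable ?_
    fun_prop
  rw [Measure.volume_eq_prod] 
  exact lintegral_prod _ h3.aemeasurable

lemma lint_E2' {F : E2 → ℝ≥0∞} (hF : Measurable F) : ∫⁻ ζ, F ζ = ∫⁻ y : ℝ, ∫⁻ x : ℝ, F !₂[x, y] := by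
  rw [lint_E2 hF]
  apply lintegral_lintegral_swap
  have h3 : Measurable fun p : ℝ × ℝ => F !₂[p.1, p.2] := by
    refine hF.comp ?_
    refine Continuous.measurable ?_
    fun_prop
  exact h3.aemeasurable

lemma low_lip {a b τ x y y' X Y n : ℝ} (hn : 0 ≤ n) (ha : |a| = 1) (hb : |b| = 1) (h1 : n ^ 2 = X ^ 2 + Y ^ 2)
    (h2 : n ^ 2 ≤ 2 * Y ^ 2) (h3 : x ^ 2 + y ^ 2 ≤ (n / 10) ^ 2) (h4 : x ^ 2 + y' ^ 2 ≤ (n / 10) ^ 2) :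
    n ^ 3 * |y - y'| ≤ |(a * ((X - x) ^ 2 + (Y - y) ^ 2) ^ 2 + b * (x ^ 2 + y ^ 2) ^ 2 + τ) -
      (a * ((X - x) ^ 2 + (Y - y') ^ 2) ^ 2 + b * (x ^ 2 + y' ^ 2) ^ 2 + τ)| := by
  have S : ∀ w : ℝ, x ^ 2 + w ^ 2 ≤ (n / 10) ^ 2 → 4 / 5 * n ^ 2 ≤ (X - x) ^ 2 + (Y - w) ^ 2 := by
    intro w hw
    have : (X * x + Y * w) ^ 2 ≤ (n ^ 2 / 10) ^ 2 := by
      calc (X * x + Y * w) ^ 2 ≤ (X ^ 2 + Y ^ 2) * (x ^ 2 + w ^ 2) := by nlinarith [sq_nonneg (X * w - Y * x)]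
        _ ≤ n ^ 2 * (n / 10) ^ 2 := by rw [← h1]; gcongr
        _ = _ := by ring
    have h := abs_le_of_sq_le_sq this (by positivity)
    have := (abs_le.1 (abs_le_of_sq_le_sq this (by positivity))).2
    nlinarith [sq_nonneg x, sq_nonneg w]
  have S1 := S y h3
  have S2 := S y' h4
  have Yb : 7 / 10 * n ≤ |Y| := by
    by_contra hh
    rw [not_le] at hh
    have := sq_abs Y
    nlinarith [abs_nonneg Y]
  have yb : |y| ≤ n / 10 := abs_le_of_sq_le_sq (by nlinarith [sq_nonneg x]) (by positivity)
  have yb' : |y'| ≤ n / 10 := abs_le_of_sq_le_sq (by nlinarith [sq_nonneg x]) (by positivity)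
  set T := x ^ 2 + y ^ 2 with hT
  set T' := x ^ 2 + y' ^ 2 with hT'
  set U := (X - x) ^ 2 + (Y - y) ^ 2 with hU
  set U' := (X - x) ^ 2 + (Y - y') ^ 2 with hU'
  have e : (a * U ^ 2 + b * T ^ 2 + τ) - (a * U' ^ 2 + b * T' ^ 2 + τ) =
      (y - y') * (b * ((y + y') * (T + T')) - a * ((2 * Y - y - y') * (U + U'))) := by
    rw [hT, hT', hU, hU']; ring
  rw [e, abs_mul, mul_comm]
  gcongr
  have k1 : 6 / 5 * n ≤ |2 * Y - y - y'| := by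
    have : |2 * Y| ≤ |2 * Y - y - y'| + |y| + |y'| := by
      calc |2 * Y| = |(2 * Y - y - y') + y + y'| := by ring_nf
        _ ≤ _ := (abs_add_le _ _).trans (by gcongr; exact abs_add_le _ _)
    rw [abs_mul, abs_two] at this
    linarith
  have k2 : 6 / 5 * n * (8 / 5 * n ^ 2) ≤ |a * ((2 * Y - y - y') * (U + U'))| := by
    rw [abs_mul, ha, one_mul, abs_mul]
    have : 8 / 5 * n ^ 2 ≤ |U + U'| := le_trans (by linarith) (le_abs_self _)
    gcongr
  have k3 : |b * ((y + y') * (T + T'))| ≤ (n / 5) * (n ^ 2 / 50) := by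
    rw [abs_mul, hb, one_mul, abs_mul]
    have t1 : |y + y'| ≤ n / 5 := (abs_add_le _ _).trans (by linarith)
    have t2 : |T + T'| ≤ n ^ 2 / 50 := by
      rw [abs_of_nonneg (by positivity)]; linarith
    gcongr
  have k4 := abs_sub_abs_le_abs_sub (a * ((2 * Y - y - y') * (U + U'))) (b * ((y + y') * (T + T')))
  rw [abs_sub_comm] at k4
  have : 0 ≤ n ^ 3 := by positivity
  nlinarith

lemma E2_norm_sq (ξ : E2) : ‖ξ‖ ^ 2 = ξ 0 ^ 2 + ξ 1 ^ 2 := by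
  rw [EuclideanSpace.norm_sq_eq]; simp [Fin.sum_univ_two]

lemma E2_norm_four (ξ : E2) : ‖ξ‖ ^ 4 = (ξ 0 ^ 2 + ξ 1 ^ 2) ^ 2 := by
  rw [← E2_norm_sq]; ring

lemma pj_rpow_le {s : ℝ} (hs : 0 < s) (x y : ℝ) : pj (!₂[x, y] : E2) ^ (-s) ≤ (1 + x ^ 2) ^ (-s/2) * (1 + y ^ 2) ^ (-s/2) := by
  have e : pj (!₂[x, y] : E2) = 1 + x ^ 2 + y ^ 2 := by unfold pj; rw [E2_norm_sq]; simp; ring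
  rw [e, ← Real.mul_rpow (by positivity) (by positivity)]
  calc (1 + x ^ 2 + y ^ 2) ^ (-s) = ((1 + x ^ 2 + y ^ 2) ^ 2) ^ (-s/2) := by
        rw [← Real.rpow_natCast (1 + x ^ 2 + y ^ 2), ← Real.rpow_mul (by positivity)]; congr 1; push_cast; ring
    _ ≤ _ := by
      apply Real.rpow_le_rpow_of_nonpos (by positivity) _ (by linarith)
      nlinarith [sq_nonneg x, sq_nonneg y, mul_nonneg (sq_nonneg x) (sq_nonneg y), sq_nonneg (x^2), sq_nonneg (y^2)]

/-- the kernel integrand -/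
def kr (s η a b τ : ℝ) (P ζ : E2) : ℝ≥0∞ :=
  {ζ : E2 | ‖ζ‖ ≤ ‖P‖ / 10}.indicator (fun ζ => ENNReal.ofReal |a * ‖P - ζ‖ ^ 4 + b * ‖ζ‖ ^ 4 + τ| ^ (η - 1) *
    ENNReal.ofReal (pj ζ ^ (-s))) ζ

lemma measurable_kr (s η a b τ : ℝ) (P : E2) : Measurable (kr s η a b τ P) := by
  unfold kr
  refine Measurable.indicator ?_ (measurableSet_le (by fun_prop) (by fun_prop))
  have := continuous_pj.measurable
  fun_prop

lemma kernel_two_aux {s η n a b τ X Y : ℝ} (hs : 1 < s) (hη : 0 < η) (hη1 : η < 1) (ha : |a| = 1) (hb : |b| = 1)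
    (hn : 0 < n) (h1 : n ^ 2 = X ^ 2 + Y ^ 2) (h2 : n ^ 2 ≤ 2 * Y ^ 2) {F : ℝ → ℝ → ℝ≥0∞}
    (hF : ∀ x y, F x y ≤ {y : ℝ | x ^ 2 + y ^ 2 ≤ (n / 10) ^ 2}.indicator (fun y =>
      ENNReal.ofReal |a * ((X - x) ^ 2 + (Y - y) ^ 2) ^ 2 + b * (x ^ 2 + y ^ 2) ^ 2 + τ| ^ (η - 1) *
       ENNReal.ofReal ((1 + x ^ 2) ^ (-s/2) * (1 + y ^ 2) ^ (-s/2))) y) :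
    ∫⁻ x, ∫⁻ y, F x y ≤ ENNReal.ofReal (n ^ (3 * (η - 1))) * K1c s η ^ 2 := by
  have hm2 : Measurable fun y : ℝ => ENNReal.ofReal ((1 + y ^ 2) ^ (-s/2)) := by fun_prop
  have inner : ∀ x, ∫⁻ y, F x y ≤ ENNReal.ofReal ((1 + x ^ 2) ^ (-s/2)) * (ENNReal.ofReal ((n ^ 3) ^ (η - 1)) * K1c s η) := by
    intro x
    have hSm : MeasurableSet {y : ℝ | x ^ 2 + y ^ 2 ≤ (n / 10) ^ 2} := measurableSet_le (by fun_prop) (by fun_prop)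
    have hSc : IsCompact {y : ℝ | x ^ 2 + y ^ 2 ≤ (n / 10) ^ 2} := by
      refine (isCompact_Icc (a := -(n/10)) (b := n/10)).of_isClosed_subset (isClosed_le (by fun_prop) (by fun_prop)) ?_
      intro y hy
      have hy' : x ^ 2 + y ^ 2 ≤ (n / 10) ^ 2 := hy
      exact abs_le.1 (abs_le_of_sq_le_sq (by nlinarith [sq_nonneg x]) (by positivity))
    calc _ ≤ _ := lintegral_mono (hF x)
      _ = ∫⁻ y in {y : ℝ | x ^ 2 + y ^ 2 ≤ (n / 10) ^ 2}, ENNReal.ofReal ((1 + x ^ 2) ^ (-s/2)) *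
          (ENNReal.ofReal |a * ((X - x) ^ 2 + (Y - y) ^ 2) ^ 2 + b * (x ^ 2 + y ^ 2) ^ 2 + τ| ^ (η - 1) *
       ENNReal.ofReal ((1 + y ^ 2) ^ (-s/2))) := by
          rw [lintegral_indicator hSm]
          congr 1; funext y
          rw [ENNReal.ofReal_mul (by positivity)]; ring
      _ ≤ _ := by
        rw [lintegral_const_mul _ (by fun_prop)]
        gcongr
        refine kernel_one hs hη hη1 (by positivity) hSc (by fun_prop) ?_
        intro y hy y' hy'
        exact low_lip hn.le ha hb h1 h2 hy hy'
  calc _ ≤ _ := lintegral_mono inner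
    _ = (∫⁻ x : ℝ, ENNReal.ofReal ((1 + x ^ 2) ^ (-s/2))) * (ENNReal.ofReal ((n ^ 3) ^ (η - 1)) * K1c s η) :=
      lintegral_mul_const _ hm2
    _ ≤ K1c s η * (ENNReal.ofReal ((n ^ 3) ^ (η - 1)) * K1c s η) := by
      gcongr
      unfold K1c
      rw [two_mul]
      exact le_add_self.trans le_self_add
    _ = _ := by
      rw [Real.rpow_mul hn.le]; norm_cast; ring

lemma kernel_two {s η a b τ : ℝ} (hs : 1 < s) (hη : 0 < η) (hη1 : η < 1) (ha : |a| = 1) (hb : |b| = 1) {P : E2} (hP : P ≠ 0) :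
    ∫⁻ ζ, kr s η a b τ P ζ ≤ ENNReal.ofReal (‖P‖ ^ (3 * (η - 1))) * K1c s η ^ 2 := by
  have hn : 0 < ‖P‖ := norm_pos_iff.2 hP
  have hns := E2_norm_sq P
  have key : ∀ x y : ℝ, kr s η a b τ P !₂[x, y] ≤ {p : ℝ × ℝ | p.1 ^ 2 + p.2 ^ 2 ≤ (‖P‖ / 10) ^ 2}.indicator (fun p =>
      ENNReal.ofReal |a * ((P 0 - p.1) ^ 2 + (P 1 - p.2) ^ 2) ^ 2 + b * (p.1 ^ 2 + p.2 ^ 2) ^ 2 + τ| ^ (η - 1) *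
       ENNReal.ofReal ((1 + p.1 ^ 2) ^ (-s/2) * (1 + p.2 ^ 2) ^ (-s/2))) (x, y) := by
    intro x y
    unfold kr indicator
    have e1 : ‖(!₂[x, y] : E2)‖ ≤ ‖P‖ / 10 ↔ x ^ 2 + y ^ 2 ≤ (‖P‖ / 10) ^ 2 := by
      rw [← sq_le_sq₀ (norm_nonneg _) (by positivity), E2_norm_sq]; simp
    simp only [mem_ofPred_eq, e1]
    split_ifs
    · rw [E2_norm_four, E2_norm_four]
      simp only [PiLp.sub_apply, Matrix.cons_val_zero, Matrix.cons_val_one]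
      gcongr
      exact pj_rpow_le (by linarith) x y
    · exact le_rfl
  rcases le_total (P 0 ^ 2) (P 1 ^ 2) with h | h
  · rw [lint_E2 (measurable_kr ..)]
    refine kernel_two_aux (X := P 0) (Y := P 1) (τ := τ) hs hη hη1 ha hb hn hns (by linarith) (fun x y => (key x y).trans (le_of_eq ?_))
    simp only [indicator, mem_ofPred_eq]
  · rw [lint_E2' (measurable_kr ..)]
    refine kernel_two_aux (X := P 1) (Y := P 0) (τ := τ) hs hη hη1 ha hb hn (by rw [hns]; ring) (by linarith) (fun x y => (key y x).trans (le_of_eq ?_))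
    simp only [indicator, mem_ofPred_eq]
    rw [show y ^ 2 + x ^ 2 = x ^ 2 + y ^ 2 by ring, show (P 0 - y) ^ 2 + (P 1 - x) ^ 2 = (P 1 - x) ^ 2 + (P 0 - y) ^ 2 by ring,
      mul_comm ((1 + y ^ 2) ^ (-s/2))]


/-! ### the hyperplane -/

abbrev X6 : Type := E2 × Y4

/-- coordinates on the hyperplane -/
def zeta (p : X6) : Fin 6 → E2 := ![-p.1, p.2.1, p.2.2.1, p.2.2.2.1, p.2.2.2.2, zl p.1 p.2]

def zetaL : X6 →ₗ[ℝ] (Fin 6 → E2) where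
  toFun := zeta
  map_add' p q := by
    funext i
    fin_cases i <;> simp [zeta, zl] <;> abel
  map_smul' c p := by
    funext i
    fin_cases i <;> simp [zeta, zl, smul_sub]

def retL : (Fin 6 → E2) →ₗ[ℝ] X6 where
  toFun := fun ζ => (-ζ 0, ζ 1, ζ 2, ζ 3, ζ 4)
  map_add' p q := by simp; abel
  map_smul' c p := by simp

lemma zeta_sum (p : X6) : ∑ i, zeta p i = 0 := by
  simp [Fin.sum_univ_succ, zeta, zl]

lemma zeta_ret {ζ : Fin 6 → E2} (h : ∑ i, ζ i = 0) : zeta (retL ζ) = ζ := by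
  simp [Fin.sum_univ_succ] at h
  funext i
  fin_cases i <;> simp [zeta, retL, zl]
  have : ζ 5 = -(ζ 0 + (ζ 1 + (ζ 2 + (ζ 3 + ζ 4)))) := by
    rw [eq_neg_iff_add_eq_zero, ← h]
    abel
  rw [this]; abel

lemma ret_zeta (p : X6) : retL (zeta p) = p := by
  simp [zeta, retL]

def permL (σ : Equiv.Perm (Fin 6)) : X6 →ₗ[ℝ] X6 := retL ∘ₗ LinearMap.funLeft ℝ E2 σ ∘ₗ zetaL

lemma zeta_permL (σ : Equiv.Perm (Fin 6)) (p : X6) : zeta (permL σ p) = zeta p ∘ σ := by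
  change zeta (retL (zeta p ∘ σ)) = _
  apply zeta_ret
  rw [← zeta_sum p]
  exact Equiv.sum_comp σ (zeta p)

lemma permL_mul (σ τ : Equiv.Perm (Fin 6)) : permL (σ * τ) = permL τ * permL σ := by
  refine LinearMap.ext fun p => ?_
  change retL (zeta p ∘ ((σ * τ : Equiv.Perm (Fin 6)) : Fin 6 → Fin 6)) = retL (zeta (permL σ p) ∘ τ)
  rw [zeta_permL]; rfl

lemma permL_one : permL 1 = 1 := by
  refine LinearMap.ext fun p => ?_
  change retL (zeta p ∘ (1 : Equiv.Perm (Fin 6))) = p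
  exact ret_zeta p

lemma permL_pow (σ : Equiv.Perm (Fin 6)) (n : ℕ) : permL (σ ^ n) = permL σ ^ n := by
  induction n with
  | zero => simpa using permL_one
  | succ k ih => rw [pow_succ, permL_mul, ih, pow_succ']

lemma permL_det (σ : Equiv.Perm (Fin 6)) : |LinearMap.det (permL σ)| = 1 := by
  have h : LinearMap.det (permL σ) ^ (orderOf σ) = 1 := by
    rw [← map_pow, ← permL_pow, pow_orderOf_eq_one, permL_one]; simp
  have h2 : |LinearMap.det (permL σ)| ^ (orderOf σ) = 1 := by rw [← abs_pow, h, abs_one]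
  exact (pow_eq_one_iff_of_nonneg (abs_nonneg _) (orderOf_pos σ).ne').1 h2

instance haarX6 : (volume : Measure X6).IsAddHaarMeasure := by
  have i2 : (volume : Measure (E2 × E2)).IsAddHaarMeasure :=
    Measure.prod.instIsAddHaarMeasure (volume : Measure E2) (volume : Measure E2)
  have i3 : (volume : Measure (E2 × E2 × E2)).IsAddHaarMeasure := by
    apply Measure.prod.instIsAddHaarMeasure (volume : Measure E2) (volume : Measure (E2 × E2))
  have i4 : (volume : Measure (E2 × E2 × E2 × E2)).IsAddHaarMeasure := by
    apply Measure.prod.instIsAddHaarMeasure (volume : Measure E2) (volume : Measure (E2 × E2 × E2))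
  apply Measure.prod.instIsAddHaarMeasure (volume : Measure E2) (volume : Measure (E2 × E2 × E2 × E2))

lemma permL_mp (σ : Equiv.Perm (Fin 6)) : MeasurePreserving (permL σ) (volume : Measure X6) volume := by
  have hd := permL_det σ
  have h0 : LinearMap.det (permL σ) ≠ 0 := by intro h; rw [h] at hd; norm_num at hd
  refine ⟨(LinearMap.continuous_of_finiteDimensional _).measurable, ?_⟩
  rw [Measure.map_linearMap_addHaar_eq_smul_addHaar _ h0, abs_inv, hd]
  simp

lemma continuous_zeta : Continuous zeta := LinearMap.continuous_of_finiteDimensional zetaL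

lemma measurable_zeta : Measurable zeta := continuous_zeta.measurable

lemma lint_perm (σ : Equiv.Perm (Fin 6)) {F : (Fin 6 → E2) → ℝ≥0∞} (hF : Measurable F) :
    ∫⁻ p, F (zeta p ∘ σ) = ∫⁻ p, F (zeta p) := by
  rw [← (permL_mp σ).lintegral_comp (f := fun p => F (zeta p)) (hF.comp measurable_zeta)]
  simp only [zeta_permL]

lemma int_perm (σ : Equiv.Perm (Fin 6)) {F : (Fin 6 → E2) → ℂ} (hF : Measurable F) :
    ∫ p, F (zeta p ∘ σ) = ∫ p, F (zeta p) := by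
  have h := integral_map (μ := volume) (permL_mp σ).measurable.aemeasurable (f := fun p => F (zeta p))
    (hF.comp measurable_zeta).aestronglyMeasurable
  rw [(permL_mp σ).map_eq] at h
  rw [h]
  simp only [zeta_permL]

/-- iterated integral formula -/
lemma lint_X6 {F : (Fin 6 → E2) → ℝ≥0∞} (hF : Measurable F) :
    ∫⁻ p, F (zeta p) = ∫⁻ ξ : E2, ∫⁻ z1 : E2, ∫⁻ z2 : E2, ∫⁻ z3 : E2, ∫⁻ z4 : E2,
      F ![-ξ, z1, z2, z3, z4, ξ - z1 - z2 - z3 - z4] := by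
  have c : Continuous fun q : X6 => (![-q.1, q.2.1, q.2.2.1, q.2.2.2.1, q.2.2.2.2, q.1 - q.2.1 - q.2.2.1 - q.2.2.2.1 - q.2.2.2.2] : Fin 6 → E2) :=
    continuous_zeta
  rw [Measure.volume_eq_prod, lintegral_prod (fun p : X6 => F (zeta p)) (hF.comp measurable_zeta).aemeasurable]
  congr 1; funext ξ
  rw [Measure.volume_eq_prod, lintegral_prod _ (by
    exact (hF.comp (c.measurable.comp (measurable_const.prodMk measurable_id))).aemeasurable)]
  congr 1; funext z1
  rw [Measure.volume_eq_prod, lintegral_prod _ (by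
    exact (hF.comp (c.measurable.comp (measurable_const.prodMk (measurable_const.prodMk measurable_id)))).aemeasurable)]
  congr 1; funext z2
  rw [Measure.volume_eq_prod, lintegral_prod _ (by
    exact (hF.comp (c.measurable.comp (measurable_const.prodMk (measurable_const.prodMk (measurable_const.prodMk measurable_id))))).aemeasurable)]
  rfl

lemma base_bound {f0 f1 f2 f3 f4 f5 : E2 → ℝ≥0∞} (h0 : Measurable f0) (h1 : Measurable f1) (h2 : Measurable f2)
    (h3 : Measurable f3) (h4 : Measurable f4) (h5 : Measurable f5) :
    ∫⁻ p, f0 (zeta p 0) * f1 (zeta p 1) * f2 (zeta p 2) * f3 (zeta p 3) * f4 (zeta p 4) * f5 (zeta p 5) ≤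
      n2 f0 * (∫⁻ z, f1 z) * (∫⁻ z, f2 z) * (∫⁻ z, f3 z) * (∫⁻ z, f4 z) * n2 f5 := by
  have hm : Measurable fun p : X6 => f0 (zeta p 0) * f1 (zeta p 1) * f2 (zeta p 2) * f3 (zeta p 3) * f4 (zeta p 4) * f5 (zeta p 5) := by
    have := measurable_zeta
    fun_prop
  rw [Measure.volume_eq_prod, lintegral_prod_symm' _ hm]
  have inner : ∀ z : Y4, ∫⁻ ξ : E2, f0 (zeta (ξ, z) 0) * f1 (zeta (ξ, z) 1) * f2 (zeta (ξ, z) 2) * f3 (zeta (ξ, z) 3) * f4 (zeta (ξ, z) 4) * f5 (zeta (ξ, z) 5)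
      ≤ (n2 f0 * n2 f5) * (f1 z.1 * (f2 z.2.1 * (f3 z.2.2.1 * f4 z.2.2.2))) := by
    intro z
    calc _ = ∫⁻ ξ : E2, (f1 z.1 * (f2 z.2.1 * (f3 z.2.2.1 * f4 z.2.2.2))) * (f0 (-ξ) * f5 (ξ - (z.1 + z.2.1 + z.2.2.1 + z.2.2.2))) := by
          congr 1; funext ξ
          have : zl ξ z = ξ - (z.1 + z.2.1 + z.2.2.1 + z.2.2.2) := by unfold zl; abel
          simp only [zeta, this]
          simp
          ring
      _ = (f1 z.1 * (f2 z.2.1 * (f3 z.2.2.1 * f4 z.2.2.2))) * ∫⁻ ξ : E2, (f0 (-ξ) * f5 (ξ - (z.1 + z.2.1 + z.2.2.1 + z.2.2.2))) :=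
          lintegral_const_mul _ (by fun_prop)
      _ ≤ (f1 z.1 * (f2 z.2.1 * (f3 z.2.2.1 * f4 z.2.2.2))) * (n2 (fun ξ => f0 (-ξ)) * n2 (fun ξ => f5 (ξ - (z.1 + z.2.1 + z.2.2.1 + z.2.2.2)))) := by
          gcongr
          exact lint_mul_le (by fun_prop) (by fun_prop)
      _ = _ := by
          rw [n2_neg, n2_sub_right, mul_comm]
  refine (lintegral_mono inner).trans (le_of_eq ?_)
  have m1 : Measurable fun z : Y4 => f1 z.1 * (f2 z.2.1 * (f3 z.2.2.1 * f4 z.2.2.2)) := by fun_prop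
  rw [lintegral_const_mul _ m1]
  have p1 : (∫⁻ z : Y4, f1 z.1 * (f2 z.2.1 * (f3 z.2.2.1 * f4 z.2.2.2))) = (∫⁻ z, f1 z) * ((∫⁻ z, f2 z) * ((∫⁻ z, f3 z) * ∫⁻ z, f4 z)) := by
    rw [Measure.volume_eq_prod, lintegral_prod_mul (f := f1) (g := fun w : E2 × E2 × E2 => f2 w.1 * (f3 w.2.1 * f4 w.2.2)) h1.aemeasurable (by fun_prop)]
    rw [Measure.volume_eq_prod, lintegral_prod_mul (f := f2) (g := fun w : E2 × E2 => f3 w.1 * f4 w.2) h2.aemeasurable (by fun_prop)]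
    rw [Measure.volume_eq_prod, lintegral_prod_mul (f := f3) (g := f4) h3.aemeasurable h4.aemeasurable]
  rw [p1]; ring


/-! ### the multilinear estimates -/

lemma om_tail {s N : ℝ} (hs : 1 < s) (hs2 : s < 2) (hN : 1 ≤ N) {ζ : E2} (h : N / 100 ≤ ‖ζ‖) :
    N ^ 2 * pj (N⁻¹ • ζ) ^ (s/2) ≤ 10001 * om s N ζ := by
  have hNp : 0 < N := by linarith
  set q := pj (N⁻¹ • ζ) with hq
  have hq1 : 1 ≤ q := one_le_pj _
  have e : q = 1 + ‖ζ‖ ^ 2 / N ^ 2 := by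
    rw [hq]; unfold pj; rw [norm_smul, norm_inv, Real.norm_of_nonneg hNp.le]; field_simp
  have b : N ^ 2 * q ≤ 10001 * pj ζ := by
    rw [e, mul_add, mul_div_cancel₀ _ (by positivity)]; unfold pj; nlinarith
  unfold om phiw
  rw [mul_min_of_nonneg _ _ (by norm_num)]
  refine le_min ?_ ?_
  · refine le_trans ?_ b
    gcongr
    calc q ^ (s/2) ≤ q ^ (1:ℝ) := Real.rpow_le_rpow_of_exponent_le hq1 (by linarith)
      _ = q := Real.rpow_one _
  · calc N ^ 2 * q ^ (s/2) = N ^ (2 - s) * (N ^ 2 * q) ^ (s/2) := by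
          rw [Real.mul_rpow (by positivity) (by linarith), ← Real.rpow_natCast N 2, ← Real.rpow_mul hNp.le, ← mul_assoc,
            ← Real.rpow_add hNp]
          congr 2; push_cast; ring
      _ ≤ N ^ (2 - s) * (10001 * pj ζ) ^ (s/2) := by gcongr
      _ = N ^ (2 - s) * (10001 ^ (s/2) * pj ζ ^ (s/2)) := by
          rw [Real.mul_rpow (by norm_num) (pj_pos ζ).le]
      _ ≤ N ^ (2 - s) * (10001 ^ (1:ℝ) * pj ζ ^ (s/2)) := by
          have := pj_pos ζ
          gcongr
          · norm_num
          · linarith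
      _ = _ := by rw [Real.rpow_one]; ring

/-- restriction to high frequencies -/
def hi (N : ℝ) (h : E2 → ℝ≥0∞) (ζ : E2) : ℝ≥0∞ := {ζ : E2 | N / 100 ≤ ‖ζ‖}.indicator h ζ

lemma measurable_hi {N : ℝ} {h : E2 → ℝ≥0∞} (hh : Measurable h) : Measurable (hi N h) :=
  hh.indicator (measurableSet_le (by fun_prop) (by fun_prop))

/-- enn-valued weight -/
def eo (s N : ℝ) (ζ : E2) : ℝ≥0∞ := ENNReal.ofReal (om s N ζ)

lemma measurable_eo {s N : ℝ} (hs : 1 < s) : Measurable (eo s N) :=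
  (continuous_om s N (by linarith)).measurable.ennreal_ofReal

lemma om_pos {s N : ℝ} (hs2 : s < 2) (hN : 1 ≤ N) (ζ : E2) : 0 < om s N ζ :=
  lt_of_lt_of_le (Real.rpow_pos_of_pos (pj_pos ζ) _) (le_om hs2.le hN ζ)

lemma lint_hi {s N : ℝ} (hs : 1 < s) (hs2 : s < 2) (hN : 1 ≤ N) {h : E2 → ℝ≥0∞} (hh : Measurable h) :
    ∫⁻ ζ, hi N h ζ ≤ (10001 * Cs s) * ENNReal.ofReal (N ^ (-1:ℝ)) * nw (eo s N) h := by
  have hNp : 0 < N := by linarith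
  set Q : E2 → ℝ≥0∞ := fun x => ENNReal.ofReal (pj x ^ (-(s/2))) with hQ
  have hQm : Measurable Q := by have := continuous_pj.measurable; fun_prop
  have p : ∀ ζ, hi N h ζ ≤ (ENNReal.ofReal (10001 * N ^ (-2:ℝ)) * Q (N⁻¹ • ζ)) * (eo s N ζ * h ζ) := by
    intro ζ
    unfold hi indicator
    split_ifs with hc
    · rw [← mul_assoc, hQ, ← ENNReal.ofReal_mul (by positivity), eo, ← ENNReal.ofReal_mul (by have := pj_pos (N⁻¹ • ζ); positivity)]
      refine le_mul_of_one_le_left' ?_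
      rw [ENNReal.one_le_ofReal]
      have t := om_tail hs hs2 hN hc
      have hq := pj_pos (N⁻¹ • ζ)
      rw [Real.rpow_neg hq.le, Real.rpow_neg hNp.le]
      have hq2 := Real.rpow_pos_of_pos hq (s/2)
      simp only [Real.rpow_ofNat]
      rw [show 10001 * (N ^ 2)⁻¹ * (pj (N⁻¹ • ζ) ^ (s / 2))⁻¹ * om s N ζ = (10001 * om s N ζ) / (N ^ 2 * pj (N⁻¹ • ζ) ^ (s/2)) by field_simp]
      rw [le_div_iff₀ (by positivity)]; linarith
    · exact zero_le
  have hm1 : Measurable fun ζ : E2 => Q (N⁻¹ • ζ) := hQm.comp (by fun_prop)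
  have hm2 := measurable_eo (N := N) hs
  have sc : n2 (fun ζ => Q (N⁻¹ • ζ)) = ENNReal.ofReal N * Cs s := by
    unfold n2 Cs n2
    have h1 := lintegral_map (μ := volume) (f := fun ζ => Q ζ ^ (2:ℝ)) (g := fun ζ : E2 => N⁻¹ • ζ) (by fun_prop) (by fun_prop)
    rw [Measure.map_addHaar_smul volume (by positivity), lintegral_smul_measure] at h1
    rw [← h1]
    have : |((N⁻¹) ^ Module.finrank ℝ E2)⁻¹| = N ^ (2:ℝ) := by
      simp
    rw [this, smul_eq_mul, ENNReal.mul_rpow_of_nonneg _ _ (by norm_num), ENNReal.ofReal_rpow_of_nonneg (by positivity) (by norm_num), ← Real.rpow_mul hNp.le]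
    norm_num
    rw [hQ]
  calc _ ≤ ∫⁻ ζ, (ENNReal.ofReal (10001 * N ^ (-2:ℝ)) * Q (N⁻¹ • ζ)) * (eo s N ζ * h ζ) := lintegral_mono p
    _ ≤ n2 (fun ζ => ENNReal.ofReal (10001 * N ^ (-2:ℝ)) * Q (N⁻¹ • ζ)) * nw (eo s N) h := lint_mul_le (by fun_prop) (by fun_prop)
    _ = _ := by
      rw [n2_const_mul _ hm1, sc, ← mul_assoc (ENNReal.ofReal _), ← ENNReal.ofReal_mul (by positivity), mul_assoc,
        show 10001 * N ^ (-2:ℝ) * N = 10001 * N ^ (-1:ℝ) by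
          rw [mul_assoc, ← Real.rpow_add_one hNp.ne']; norm_num]
      rw [ENNReal.ofReal_mul (by norm_num)]
      norm_num
      ring

lemma isWt_eo {s N : ℝ} (hs : 1 < s) (hs2 : s < 2) (hN : 1 ≤ N) : IsWt (eo s N) (ENNReal.ofReal (4 ^ 1) + Cs s) := by
  have := isWt_wt hs hs2.le hN le_rfl (k := 1) le_rfl
  simp only [wt, zero_mul, add_zero] at this
  exact this

/-- constant for `L¹` -/
def Cw (s : ℝ) : ℝ≥0∞ := ENNReal.ofReal (4 ^ 1) + Cs s

lemma Cw_lt_top {s : ℝ} (hs : 1 < s) : Cw s < ⊤ := ENNReal.add_lt_top.2 ⟨by simp, Cs_lt_top hs⟩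

/-- kernel A -/
def KA (s N : ℝ) (h : E2 → ℝ≥0∞) (ζ : Fin 6 → E2) : ℝ≥0∞ :=
  (eo s N (ζ 0) * h (ζ 0)) * hi N h (ζ 1) * hi N h (ζ 2) * hi N h (ζ 3) * h (ζ 4) * (eo s N (ζ 5) * h (ζ 5))

/-- kernel 0 -/
def KZ (s N : ℝ) (h : E2 → ℝ≥0∞) (ζ : Fin 6 → E2) : ℝ≥0∞ :=
  (eo s N (ζ 0) * h (ζ 0)) * h (ζ 1) * h (ζ 2) * h (ζ 3) * h (ζ 4) * (eo s N (ζ 5) * h (ζ 5))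

/-- kernel B -/
def KB (s N η : ℝ) (e : Fin 6 → ℝ) (h : E2 → ℝ≥0∞) (ζ : Fin 6 → E2) : ℝ≥0∞ :=
  ((eo s N (ζ 0) * h (ζ 0)) ^ 2 * (eo s N (ζ 1) * h (ζ 1)) ^ 2 * h (ζ 2) * h (ζ 3)) *
   {ζ : Fin 6 → E2 | ‖ζ 4‖ ≤ ‖ζ 4 + ζ 5‖ / 10 ∧ N / 10 ≤ ‖ζ 4 + ζ 5‖}.indicator
     (fun ζ => ENNReal.ofReal |∑ i, e i * ‖ζ i‖ ^ 4| ^ (η - 1) * ENNReal.ofReal (pj (ζ 4) ^ (-s))) ζ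

lemma KZ_bound {s N : ℝ} (hs : 1 < s) (hs2 : s < 2) (hN : 1 ≤ N) {h : E2 → ℝ≥0∞} (hh : Measurable h) : Measurable (KZ s N h) ∧ ∫⁻ p, KZ s N h (zeta p) ≤ Cw s ^ 4 * nw (eo s N) h ^ 6 := by
  have hm := measurable_eo (N := N) hs
  have l1 := (isWt_eo hs hs2 hN).l1 h hh
  refine ⟨by unfold KZ; fun_prop, ?_⟩
  refine (base_bound (f0 := fun ζ => eo s N ζ * h ζ) (f5 := fun ζ => eo s N ζ * h ζ) (by fun_prop) hh hh hh hh (by fun_prop)).trans ?_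
  change nw (eo s N) h * _ * _ * _ * _ * nw (eo s N) h ≤ _
  calc _ ≤ nw (eo s N) h * (Cw s * nw (eo s N) h) * (Cw s * nw (eo s N) h) * (Cw s * nw (eo s N) h) * (Cw s * nw (eo s N) h) * nw (eo s N) h := by
        unfold Cw; gcongr
    _ = _ := by ring

lemma KA_bound {s N : ℝ} (hs : 1 < s) (hs2 : s < 2) (hN : 1 ≤ N) {h : E2 → ℝ≥0∞} (hh : Measurable h) : Measurable (KA s N h) ∧ ∫⁻ p, KA s N h (zeta p) ≤
    (Cw s * (10001 * Cs s) ^ 3) * ENNReal.ofReal (N ^ (-3:ℝ)) * nw (eo s N) h ^ 6 := by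
  have hm := measurable_eo (N := N) hs
  have l1 := (isWt_eo hs hs2 hN).l1 h hh
  have l2 := lint_hi hs hs2 hN hh
  have mh := measurable_hi (N := N) hh
  refine ⟨by unfold KA; fun_prop, ?_⟩
  refine (base_bound (f0 := fun ζ => eo s N ζ * h ζ) (f5 := fun ζ => eo s N ζ * h ζ) (by fun_prop) mh mh mh hh (by fun_prop)).trans ?_
  change nw (eo s N) h * _ * _ * _ * _ * nw (eo s N) h ≤ _
  have e : ENNReal.ofReal (N ^ (-3:ℝ)) = ENNReal.ofReal (N ^ (-1:ℝ)) ^ 3 := by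
    rw [← ENNReal.ofReal_pow (by positivity), ← Real.rpow_natCast, ← Real.rpow_mul (by linarith)]; norm_num
  set Y := ENNReal.ofReal (N ^ (-1:ℝ))
  set A := nw (eo s N) h
  calc _ ≤ A * (10001 * Cs s * Y * A) * (10001 * Cs s * Y * A) * (10001 * Cs s * Y * A) * (Cw s * A) * A := by
        unfold Cw; gcongr
    _ = _ := by rw [e]; ring

lemma measurable_KB {s N : ℝ} (η : ℝ) (e : Fin 6 → ℝ) (hs : 1 < s) {h : E2 → ℝ≥0∞} (hh : Measurable h) : Measurable (KB s N η e h) := by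
  have hm := measurable_eo (N := N) hs
  unfold KB
  refine Measurable.mul (by fun_prop) (Measurable.indicator ?_ ?_)
  · have := continuous_pj.measurable
    fun_prop
  · have a1 : MeasurableSet {ζ : Fin 6 → E2 | ‖ζ 4‖ ≤ ‖ζ 4 + ζ 5‖ / 10} := measurableSet_le (by fun_prop) (by fun_prop)
    have a2 : MeasurableSet {ζ : Fin 6 → E2 | N / 10 ≤ ‖ζ 4 + ζ 5‖} := measurableSet_le (by fun_prop) (by fun_prop)
    exact a1.inter a2

lemma KB_bound {s N η : ℝ} (hs : 1 < s) (hs2 : s < 2) (hN : 1 ≤ N) (hη : 0 < η) (hη1 : η < 1) {e : Fin 6 → ℝ}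
    (he : ∀ i, |e i| = 1) {h : E2 → ℝ≥0∞} (hh : Measurable h) :
    ∫⁻ p, KB s N η e h (zeta p) ≤ (ENNReal.ofReal (1000 * N ^ (3 * (η - 1))) * K1c s η ^ 2 * Cw s ^ 2) * nw (eo s N) h ^ 6 := by
  have hNp : 0 < N := by linarith
  have hm := measurable_eo (N := N) hs
  have l1 := (isWt_eo hs hs2 hN).l1 h hh
  set A := nw (eo s N) h with hA
  have l2 : ∫⁻ z, (eo s N z * h z) ^ 2 = A ^ 2 := by
    rw [hA, nw, ← ENNReal.rpow_natCast, Nat.cast_ofNat, n2_sq]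
    congr 1; funext z
    rw [← ENNReal.rpow_natCast]; norm_num
  rw [lint_X6 (measurable_KB η e hs hh)]
  set B := ENNReal.ofReal (1000 * N ^ (3 * (η - 1))) * K1c s η ^ 2 with hB
  have inner : ∀ ξ z1 z2 z3 : E2, ∫⁻ z4 : E2, KB s N η e h ![-ξ, z1, z2, z3, z4, ξ - z1 - z2 - z3 - z4] ≤
      (eo s N (-ξ) * h (-ξ)) ^ 2 * ((eo s N z1 * h z1) ^ 2 * (h z2 * (h z3 * B))) := by
    intro ξ z1 z2 z3
    set P := ξ - z1 - z2 - z3 with hP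
    set τ := e 0 * ‖ξ‖ ^ 4 + e 1 * ‖z1‖ ^ 4 + e 2 * ‖z2‖ ^ 4 + e 3 * ‖z3‖ ^ 4 with hτ
    by_cases hc : N / 10 ≤ ‖P‖
    · have hP0 : 0 < ‖P‖ := by linarith
      calc _ ≤ ∫⁻ z4 : E2, ((eo s N (-ξ) * h (-ξ)) ^ 2 * (eo s N z1 * h z1) ^ 2 * h z2 * h z3) * kr s η (e 5) (e 4) τ P z4 := by
            refine lintegral_mono fun z4 => ?_
            unfold KB
            simp only [Fin.isValue, Matrix.cons_val]
            gcongr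
            unfold kr indicator
            simp only [mem_ofPred_eq, Matrix.cons_val, add_sub_cancel]
            by_cases hd : ‖z4‖ ≤ ‖P‖ / 10
            · rw [if_pos ⟨hd, hc⟩, if_pos hd]
              refine le_of_eq ?_
              congr 4
              simp [Fin.sum_univ_succ, hτ]
              ring
            · rw [if_neg (fun hh => hd hh.1)]; exact zero_le
        _ = ((eo s N (-ξ) * h (-ξ)) ^ 2 * (eo s N z1 * h z1) ^ 2 * h z2 * h z3) * ∫⁻ z4 : E2, kr s η (e 5) (e 4) τ P z4 :=
            lintegral_const_mul _ (measurable_kr ..)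
        _ ≤ ((eo s N (-ξ) * h (-ξ)) ^ 2 * (eo s N z1 * h z1) ^ 2 * h z2 * h z3) * B := by
            gcongr
            refine (kernel_two hs hη hη1 (he 5) (he 4) (norm_pos_iff.1 hP0)).trans ?_
            rw [hB]
            gcongr
            calc ‖P‖ ^ (3 * (η - 1)) ≤ (N / 10) ^ (3 * (η - 1)) :=
                  Real.rpow_le_rpow_of_nonpos (by positivity) hc (by linarith)
              _ = 10 ^ (-(3 * (η - 1))) * N ^ (3 * (η - 1)) := by
                  rw [Real.div_rpow hNp.le (by norm_num), Real.rpow_neg (by norm_num)]; ring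
              _ ≤ 10 ^ (3:ℝ) * N ^ (3 * (η - 1)) := by
                  gcongr
                  · norm_num
                  · linarith
              _ = _ := by norm_num
        _ = _ := by ring
    · calc _ = ∫⁻ z4 : E2, (0:ℝ≥0∞) := by
            congr 1; funext z4
            unfold KB
            rw [indicator_of_notMem, mul_zero]
            simp only [mem_ofPred_eq, Matrix.cons_val, add_sub_cancel]
            exact fun hh => hc hh.2
        _ ≤ _ := by simp
  have neg2 : ∫⁻ ξ : E2, (eo s N (-ξ) * h (-ξ)) ^ 2 = A ^ 2 := by
    rw [← l2]; exact lintegral_neg_eq_self (fun ξ => (eo s N ξ * h ξ) ^ 2)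
  calc _ ≤ ∫⁻ ξ, ∫⁻ z1, ∫⁻ z2, ∫⁻ z3, (eo s N (-ξ) * h (-ξ)) ^ 2 * ((eo s N z1 * h z1) ^ 2 * (h z2 * (h z3 * B))) :=
        lintegral_mono fun ξ => lintegral_mono fun z1 => lintegral_mono fun z2 => lintegral_mono fun z3 => inner ξ z1 z2 z3
    _ = A ^ 2 * (A ^ 2 * ((∫⁻ z, h z) * ((∫⁻ z, h z) * B))) := by
        have q1 : ∀ c : ℝ≥0∞, ∫⁻ z3, c * (h z3 * B) = c * ((∫⁻ z, h z) * B) := fun c => by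
          rw [lintegral_const_mul _ (by fun_prop), lintegral_mul_const _ hh]
        have q2 : ∀ ξ z1 : E2, ∫⁻ z2, ∫⁻ z3, (eo s N (-ξ) * h (-ξ)) ^ 2 * ((eo s N z1 * h z1) ^ 2 * (h z2 * (h z3 * B))) =
            (eo s N (-ξ) * h (-ξ)) ^ 2 * ((eo s N z1 * h z1) ^ 2 * ((∫⁻ z, h z) * ((∫⁻ z, h z) * B))) := by
          intro ξ z1
          simp only [← mul_assoc _ _ (h _ * B), q1]
          rw [lintegral_mul_const _ (by fun_prop), lintegral_const_mul _ (by fun_prop), lintegral_const_mul _ (by fun_prop)]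
          ring
        simp only [q2]
        have q3 : ∀ ξ : E2, ∫⁻ z1, (eo s N (-ξ) * h (-ξ)) ^ 2 * ((eo s N z1 * h z1) ^ 2 * ((∫⁻ z, h z) * ((∫⁻ z, h z) * B))) =
            (eo s N (-ξ) * h (-ξ)) ^ 2 * (A ^ 2 * ((∫⁻ z, h z) * ((∫⁻ z, h z) * B))) := by
          intro ξ
          rw [lintegral_const_mul _ (by fun_prop), lintegral_mul_const _ (by fun_prop), l2]
        simp only [q3]
        rw [lintegral_mul_const _ (by fun_prop), neg2]
    _ ≤ A ^ 2 * (A ^ 2 * ((Cw s * A) * ((Cw s * A) * B))) := by unfold Cw; gcongr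
    _ = _ := by ring


lemma eo_inv {s N : ℝ} (hs2 : s < 2) (hN : 1 ≤ N) (ζ : E2) :
    (eo s N ζ)⁻¹ * eo s N ζ = 1 := by
  have := om_pos hs2 hN ζ
  exact ENNReal.inv_mul_cancel (by unfold eo; simpa using this) (by unfold eo; simp)

lemma eo_inv_sq {s N : ℝ} (hs2 : s < 2) (hN : 1 ≤ N) (ζ : E2) :
    (eo s N ζ)⁻¹ ^ 2 ≤ ENNReal.ofReal (pj ζ ^ (-s)) := by
  have h0 := om_pos hs2 hN ζ
  have hp := Real.rpow_pos_of_pos (pj_pos ζ) (s/2)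
  unfold eo
  rw [← ENNReal.ofReal_inv_of_pos h0, ← ENNReal.ofReal_pow (by positivity)]
  apply ENNReal.ofReal_le_ofReal
  have e : pj ζ ^ (-s) = ((pj ζ ^ (s/2))⁻¹) ^ 2 := by
    rw [← Real.rpow_neg (pj_pos ζ).le, ← Real.rpow_natCast, ← Real.rpow_mul (pj_pos ζ).le]; congr 1; push_cast; ring
  rw [e]
  have := le_om hs2.le hN ζ
  gcongr

lemma KB_low {s N η : ℝ} (hs2 : s < 2) (hN : 1 ≤ N) (e : Fin 6 → ℝ) (h : E2 → ℝ≥0∞) {ζ : Fin 6 → E2}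
    (h1 : ‖ζ 4‖ ≤ ‖ζ 5‖ / 20) (h2 : N / 5 ≤ ‖ζ 5‖) :
    ((eo s N (ζ 0) * h (ζ 0)) * (eo s N (ζ 1) * h (ζ 1)) * (eo s N (ζ 4))⁻¹) ^ 2 * (h (ζ 2) * h (ζ 3)) *
      ENNReal.ofReal |∑ i, e i * ‖ζ i‖ ^ 4| ^ (η - 1) ≤ KB s N η e h ζ := by
  have t : ‖ζ 5‖ ≤ ‖ζ 4 + ζ 5‖ + ‖ζ 4‖ := by
    have := norm_sub_le (ζ 4 + ζ 5) (ζ 4)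
    rwa [add_sub_cancel_left] at this
  unfold KB
  rw [indicator_of_mem (by constructor <;> linarith)]
  calc _ = ((eo s N (ζ 0) * h (ζ 0)) ^ 2 * (eo s N (ζ 1) * h (ζ 1)) ^ 2 * h (ζ 2) * h (ζ 3)) *
      (ENNReal.ofReal |∑ i, e i * ‖ζ i‖ ^ 4| ^ (η - 1) * (eo s N (ζ 4))⁻¹ ^ 2) := by ring
    _ ≤ _ := by
      gcongr
      exact eo_inv_sq hs2 hN _

lemma pt {s N η : ℝ} (hs2 : s < 2) (hN : 1 ≤ N) (e : Fin 6 → ℝ) (h : E2 → ℝ≥0∞) {ζ : Fin 6 → E2}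
    (h0 : ∑ i, ζ i = 0) (hm : Antitone fun i => ‖ζ i‖) (hi0 : N ≤ ‖ζ 0‖) {q κ : ℝ≥0∞} (hq : q ≤ κ)
    (hq2 : q ≤ κ * ENNReal.ofReal |∑ i, e i * ‖ζ i‖ ^ 4| ^ (η - 1)) :
    ∃ ρ : Equiv.Perm (Fin 6), eo s N (ζ 0) * eo s N (ζ 1) * q * ∏ i, h (ζ i) ≤ κ * (KA s N h (ζ ∘ ρ) + KB s N η (e ∘ ρ) h (ζ ∘ ρ)) := by
  have m01 : ‖ζ 1‖ ≤ ‖ζ 0‖ := hm (by decide)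
  have m12 : ‖ζ 2‖ ≤ ‖ζ 1‖ := hm (by decide)
  have m23 : ‖ζ 3‖ ≤ ‖ζ 2‖ := hm (by decide)
  have m34 : ‖ζ 4‖ ≤ ‖ζ 3‖ := hm (by decide)
  have m45 : ‖ζ 5‖ ≤ ‖ζ 4‖ := hm (by decide)
  have five : ‖ζ 0‖ ≤ 5 * ‖ζ 1‖ := by
    have e0 : ζ 0 = -(ζ 1 + ζ 2 + ζ 3 + ζ 4 + ζ 5) := by
      rw [eq_neg_iff_add_eq_zero, ← h0]
      simp only [Fin.sum_univ_six]; abel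
    have : ‖ζ 0‖ ≤ ‖ζ 1‖ + ‖ζ 2‖ + ‖ζ 3‖ + ‖ζ 4‖ + ‖ζ 5‖ := by
      rw [e0, norm_neg]
      refine (norm_add_le _ _).trans ?_
      gcongr
      refine (norm_add_le _ _).trans ?_
      gcongr
      exact norm_add₃_le
    linarith
  rw [Fin.prod_univ_six]
  by_cases hc : N / 100 ≤ ‖ζ 4‖
  · refine ⟨Equiv.swap 1 2 * Equiv.swap 2 3 * Equiv.swap 3 4 * Equiv.swap 4 5, ?_⟩
    set ρ : Equiv.Perm (Fin 6) := Equiv.swap 1 2 * Equiv.swap 2 3 * Equiv.swap 3 4 * Equiv.swap 4 5 with hρ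
    have r0 : ρ 0 = 0 := by rw [hρ]; decide
    have r1 : ρ 1 = 2 := by rw [hρ]; decide
    have r2 : ρ 2 = 3 := by rw [hρ]; decide
    have r3 : ρ 3 = 4 := by rw [hρ]; decide
    have r4 : ρ 4 = 5 := by rw [hρ]; decide
    have r5 : ρ 5 = 1 := by rw [hρ]; decide
    have t : ∀ z : E2, N / 100 ≤ ‖z‖ → hi N h z = h z := by
      intro z hz; unfold hi; rw [indicator_apply, if_pos]; exact hz
    calc _ ≤ eo s N (ζ 0) * eo s N (ζ 1) * κ * (h (ζ 0) * h (ζ 1) * h (ζ 2) * h (ζ 3) * h (ζ 4) * h (ζ 5)) := by gcongr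
      _ = κ * KA s N h (ζ ∘ ρ) := by
        unfold KA
        simp only [Function.comp_apply, r0, r1, r2, r3, r4, r5]
        rw [t _ hc, t _ (by linarith), t _ (by linarith)]
        ring
      _ ≤ _ := by gcongr; exact le_self_add
  · rw [not_le] at hc
    have small : ‖ζ 4‖ ≤ ‖ζ 1‖ / 20 := by linarith
    set x := (eo s N (ζ 0) * h (ζ 0)) * (eo s N (ζ 5) * h (ζ 5)) * (eo s N (ζ 4))⁻¹ with hx
    set y := (eo s N (ζ 1) * h (ζ 1)) * (eo s N (ζ 4) * h (ζ 4)) * (eo s N (ζ 5))⁻¹ with hy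
    set w := ENNReal.ofReal |∑ i, e i * ‖ζ i‖ ^ 4| ^ (η - 1) with hw
    have xy : eo s N (ζ 0) * eo s N (ζ 1) * q * (h (ζ 0) * h (ζ 1) * h (ζ 2) * h (ζ 3) * h (ζ 4) * h (ζ 5)) ≤
        κ * ((x * y) * (h (ζ 2) * h (ζ 3)) * w) := by
      calc _ ≤ eo s N (ζ 0) * eo s N (ζ 1) * (κ * w) * (h (ζ 0) * h (ζ 1) * h (ζ 2) * h (ζ 3) * h (ζ 4) * h (ζ 5)) := by gcongr
        _ = eo s N (ζ 0) * eo s N (ζ 1) * (κ * w) * (h (ζ 0) * h (ζ 1) * h (ζ 2) * h (ζ 3) * h (ζ 4) * h (ζ 5)) * (((eo s N (ζ 4))⁻¹ * eo s N (ζ 4)) * ((eo s N (ζ 5))⁻¹ * eo s N (ζ 5))) := by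
          rw [eo_inv hs2 hN, eo_inv hs2 hN]; ring
        _ = _ := by rw [hx, hy]; ring
    have sumρ : ∀ ρ : Equiv.Perm (Fin 6), ∑ i, (e ∘ ρ) i * ‖(ζ ∘ ρ) i‖ ^ 4 = ∑ i, e i * ‖ζ i‖ ^ 4 := fun ρ =>
      Equiv.sum_comp ρ (fun i => e i * ‖ζ i‖ ^ 4)
    rcases le_total y x with hyx | hxy
    · refine ⟨Equiv.swap 1 5, xy.trans ?_⟩
      set ρ : Equiv.Perm (Fin 6) := Equiv.swap 1 5 with hρ
      have r0 : ρ 0 = 0 := by rw [hρ]; decide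
      have r1 : ρ 1 = 5 := by rw [hρ]; decide
      have r2 : ρ 2 = 2 := by rw [hρ]; decide
      have r3 : ρ 3 = 3 := by rw [hρ]; decide
      have r4 : ρ 4 = 4 := by rw [hρ]; decide
      have r5 : ρ 5 = 1 := by rw [hρ]; decide
      have kb := KB_low (s := s) (η := η) hs2 hN (e ∘ ρ) h (ζ := ζ ∘ ρ) (by simp only [Function.comp_apply, r4, r5]; linarith) (by simp only [Function.comp_apply, r5]; linarith)
      rw [sumρ] at kb
      simp only [Function.comp_apply, r0, r1, r2, r3, r4, ← hx, ← hw] at kb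
      calc _ ≤ κ * ((x * x) * (h (ζ 2) * h (ζ 3)) * w) := by gcongr
        _ ≤ _ := by
          rw [← sq]
          gcongr
          exact kb.trans le_add_self
    · refine ⟨Equiv.swap 0 1 * Equiv.swap 1 4 * Equiv.swap 4 5, xy.trans ?_⟩
      set ρ : Equiv.Perm (Fin 6) := Equiv.swap 0 1 * Equiv.swap 1 4 * Equiv.swap 4 5 with hρ
      have r0 : ρ 0 = 1 := by rw [hρ]; decide
      have r1 : ρ 1 = 4 := by rw [hρ]; decide
      have r2 : ρ 2 = 2 := by rw [hρ]; decide
      have r3 : ρ 3 = 3 := by rw [hρ]; decide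
      have r4 : ρ 4 = 5 := by rw [hρ]; decide
      have r5 : ρ 5 = 0 := by rw [hρ]; decide
      have kb := KB_low (s := s) (η := η) hs2 hN (e ∘ ρ) h (ζ := ζ ∘ ρ) (by simp only [Function.comp_apply, r4, r5]; linarith) (by simp only [Function.comp_apply, r5]; linarith)
      rw [sumρ] at kb
      simp only [Function.comp_apply, r0, r1, r2, r3, r4, ← hy, ← hw] at kb
      calc _ ≤ κ * ((y * y) * (h (ζ 2) * h (ζ 3)) * w) := by gcongr
        _ ≤ _ := by
          rw [← sq]
          gcongr
          exact kb.trans le_add_self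

/-- the constant -/
def CM (s η : ℝ) : ℝ≥0∞ := 720 * (Cw s * (10001 * Cs s) ^ 3 + 1000 * K1c s η ^ 2 * Cw s ^ 2)

lemma CM_lt_top {s η : ℝ} (hs : 1 < s) (hη : 0 < η) : CM s η < ⊤ := by
  have h1 := (Cw_lt_top hs).ne
  have h2 := (Cs_lt_top hs).ne
  have h3 := (K1c_lt_top hs hη).ne
  unfold CM
  generalize Cw s = a at *
  generalize Cs s = b at *
  generalize K1c s η = c at *
  finiteness

lemma exists_sort (ζ : Fin 6 → E2) : ∃ σ : Equiv.Perm (Fin 6), Antitone fun i => ‖(ζ ∘ σ) i‖ := by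
  refine ⟨Tuple.sort (fun i => -‖ζ i‖), ?_⟩
  have := Tuple.monotone_sort (fun i => -‖ζ i‖)
  intro i j hij
  have h := this hij
  simp only [Function.comp_apply] at h ⊢
  linarith

lemma perm_sum_le (a : ℝ≥0∞) (F : Equiv.Perm (Fin 6) → ℝ≥0∞) (σ : Equiv.Perm (Fin 6)) (h : a = F σ) : a ≤ ∑ ρ, F ρ := by
  rw [h]
  exact Finset.single_le_sum (f := F) (fun _ _ => zero_le) (Finset.mem_univ σ)

lemma multi {s N η : ℝ} (hs : 1 < s) (hs2 : s < 2) (hN : 1 ≤ N) (hη : 0 < η) (hη1 : η < 1) {e : Fin 6 → ℝ}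
    (he : ∀ i, |e i| = 1) {h : E2 → ℝ≥0∞} (hh : Measurable h) {S q : (Fin 6 → E2) → ℝ≥0∞} {κ : ℝ≥0∞}
    (hS : ∀ ζ, ∑ i, ζ i = 0 → ∀ σ : Equiv.Perm (Fin 6), (Antitone fun i => ‖(ζ ∘ σ) i‖) →
      S ζ ≤ eo s N (ζ (σ 0)) * eo s N (ζ (σ 1)) ∧ (‖ζ (σ 0)‖ < N → S ζ = 0))
    (hq : ∀ ζ, q ζ ≤ κ) (hq2 : ∀ ζ, q ζ ≤ κ * ENNReal.ofReal |∑ i, e i * ‖ζ i‖ ^ 4| ^ (η - 1)) :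
    ∫⁻ p, S (zeta p) * q (zeta p) * ∏ i, h (zeta p i) ≤ κ * (CM s η * ENNReal.ofReal (N ^ (3 * (η - 1))) * nw (eo s N) h ^ 6) := by
  have hNp : 0 < N := by linarith
  have point : ∀ p : X6, S (zeta p) * q (zeta p) * ∏ i, h (zeta p i) ≤
      ∑ ρ : Equiv.Perm (Fin 6), κ * (KA s N h (zeta p ∘ ρ) + KB s N η (e ∘ ρ) h (zeta p ∘ ρ)) := by
    intro p
    obtain ⟨σ, hσ⟩ := exists_sort (zeta p)
    have hsum : ∑ i, (zeta p ∘ σ) i = 0 := by rw [← zeta_sum p]; exact Equiv.sum_comp σ (zeta p)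
    obtain ⟨b1, b2⟩ := hS _ (zeta_sum p) σ hσ
    by_cases hc : ‖zeta p (σ 0)‖ < N
    · rw [b2 hc]; simp
    · rw [not_lt] at hc
      have e1 : ∑ i, (e ∘ σ) i * ‖(zeta p ∘ σ) i‖ ^ 4 = ∑ i, e i * ‖zeta p i‖ ^ 4 :=
        Equiv.sum_comp σ (fun i => e i * ‖zeta p i‖ ^ 4)
      have e2 : ∏ i, h ((zeta p ∘ σ) i) = ∏ i, h (zeta p i) := Equiv.prod_comp σ (fun i => h (zeta p i))
      obtain ⟨ρ, hρ⟩ := pt (s := s) (η := η) hs2 hN (e ∘ σ) h hsum hσ hc (hq (zeta p)) (by rw [e1]; exact hq2 _)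
      rw [e2] at hρ
      refine le_trans (le_trans ?_ hρ) ?_
      · gcongr; exact b1
      · exact perm_sum_le _ (fun ρ : Equiv.Perm (Fin 6) => κ * (KA s N h (zeta p ∘ ρ) + KB s N η (e ∘ ρ) h (zeta p ∘ ρ))) (σ * ρ) rfl
  have mA := (KA_bound hs hs2 hN hh).1
  have mB := fun ρ : Equiv.Perm (Fin 6) => measurable_KB (N := N) η (e ∘ ρ) hs hh
  have mc : ∀ ρ : Equiv.Perm (Fin 6), Measurable fun ζ : Fin 6 → E2 => ζ ∘ ρ := fun ρ => by
    refine measurable_pi_lambda _ fun i => measurable_pi_apply _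
  have mz := measurable_zeta
  have each : ∀ ρ : Equiv.Perm (Fin 6), ∫⁻ p, κ * (KA s N h (zeta p ∘ ρ) + KB s N η (e ∘ ρ) h (zeta p ∘ ρ)) ≤
      κ * ((Cw s * (10001 * Cs s) ^ 3 + 1000 * K1c s η ^ 2 * Cw s ^ 2) * ENNReal.ofReal (N ^ (3 * (η - 1))) * nw (eo s N) h ^ 6) := by
    intro ρ
    have m1 : Measurable fun p => KA s N h (zeta p ∘ ρ) := mA.comp ((mc ρ).comp mz)
    have m2 : Measurable fun p => KB s N η (e ∘ ρ) h (zeta p ∘ ρ) := (mB ρ).comp ((mc ρ).comp mz)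
    have m12 : Measurable fun p => KA s N h (zeta p ∘ ρ) + KB s N η (e ∘ ρ) h (zeta p ∘ ρ) := m1.add m2
    rw [lintegral_const_mul _ m12]
    gcongr
    rw [lintegral_add_left m1, lint_perm ρ mA, lint_perm ρ (mB ρ)]
    have b1 := (KA_bound hs hs2 hN hh).2
    have b2 := KB_bound hs hs2 hN hη hη1 (e := e ∘ ρ) (fun i => he _) hh
    have b3 : ENNReal.ofReal (N ^ (-3:ℝ)) ≤ ENNReal.ofReal (N ^ (3 * (η - 1))) := by
      apply ENNReal.ofReal_le_ofReal
      exact Real.rpow_le_rpow_of_exponent_le hN (by linarith)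
    rw [ENNReal.ofReal_mul (by norm_num)] at b2
    have b1' := b1.trans (show _ ≤ Cw s * (10001 * Cs s) ^ 3 * ENNReal.ofReal (N ^ (3 * (η - 1))) * nw (eo s N) h ^ 6 by gcongr)
    have e3 : ENNReal.ofReal 1000 = 1000 := by norm_num
    rw [e3] at b2
    calc _ ≤ _ := add_le_add b1' b2
      _ = _ := by ring
  calc _ ≤ _ := lintegral_mono point
    _ = ∑ ρ : Equiv.Perm (Fin 6), ∫⁻ p, κ * (KA s N h (zeta p ∘ ρ) + KB s N η (e ∘ ρ) h (zeta p ∘ ρ)) := by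
        refine lintegral_finsetSum _ fun ρ _ => ?_
        exact ((mA.comp ((mc ρ).comp mz)).add ((mB ρ).comp ((mc ρ).comp mz))).const_mul κ
    _ ≤ ∑ ρ : Equiv.Perm (Fin 6), _ := Finset.sum_le_sum fun ρ _ => each ρ
    _ = _ := by
        rw [Finset.sum_const, Finset.card_univ, Fintype.card_perm, Fintype.card_fin, nsmul_eq_mul]
        unfold CM
        norm_num [Nat.factorial]
        ring

/-- crude multilinear bound without gain -/
lemma multi0 {s N : ℝ} (hs : 1 < s) (hs2 : s < 2) (hN : 1 ≤ N) {h : E2 → ℝ≥0∞} (hh : Measurable h) {S : (Fin 6 → E2) → ℝ≥0∞} {κ : ℝ≥0∞}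
    (hS : ∀ ζ, ∑ i, ζ i = 0 → ∀ σ : Equiv.Perm (Fin 6), (Antitone fun i => ‖(ζ ∘ σ) i‖) →
      S ζ ≤ κ * (eo s N (ζ (σ 0)) * eo s N (ζ (σ 1)))) :
    ∫⁻ p, S (zeta p) * ∏ i, h (zeta p i) ≤ κ * (720 * Cw s ^ 4 * nw (eo s N) h ^ 6) := by
  obtain ⟨mK, bK⟩ := KZ_bound hs hs2 hN hh
  have point : ∀ p : X6, S (zeta p) * ∏ i, h (zeta p i) ≤ ∑ ρ : Equiv.Perm (Fin 6), κ * KZ s N h (zeta p ∘ ρ) := by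
    intro p
    obtain ⟨σ, hσ⟩ := exists_sort (zeta p)
    have b1 := hS _ (zeta_sum p) σ hσ
    have e2 : ∏ i, h ((zeta p ∘ σ) i) = ∏ i, h (zeta p i) := Equiv.prod_comp σ (fun i => h (zeta p i))
    obtain ⟨ρ, key⟩ : ∃ ρ : Equiv.Perm (Fin 6), κ * (eo s N (zeta p (σ 0)) * eo s N (zeta p (σ 1))) * ∏ i, h (zeta p i) = κ * KZ s N h ((zeta p ∘ σ) ∘ ρ) := by
      refine ⟨Equiv.swap 1 5, ?_⟩
      rw [← e2]
      generalize hz : zeta p ∘ σ = z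
      have z0 : zeta p (σ 0) = z 0 := by rw [← hz]; rfl
      have z1 : zeta p (σ 1) = z 1 := by rw [← hz]; rfl
      rw [z0, z1]
      set ρ : Equiv.Perm (Fin 6) := Equiv.swap 1 5 with hρ
      have r0 : ρ 0 = 0 := by rw [hρ]; decide
      have r1 : ρ 1 = 5 := by rw [hρ]; decide
      have r2 : ρ 2 = 2 := by rw [hρ]; decide
      have r3 : ρ 3 = 3 := by rw [hρ]; decide
      have r4 : ρ 4 = 4 := by rw [hρ]; decide
      have r5 : ρ 5 = 1 := by rw [hρ]; decide
      unfold KZ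
      simp only [Function.comp_apply, r0, r1, r2, r3, r4, r5, Fin.prod_univ_six]
      ring
    calc _ ≤ κ * (eo s N (zeta p (σ 0)) * eo s N (zeta p (σ 1))) * ∏ i, h (zeta p i) := by gcongr
      _ ≤ _ := perm_sum_le _ (fun ρ : Equiv.Perm (Fin 6) => κ * KZ s N h (zeta p ∘ ρ)) (σ * ρ) key
  have mc : ∀ ρ : Equiv.Perm (Fin 6), Measurable fun ζ : Fin 6 → E2 => ζ ∘ ρ := fun ρ => by
    refine measurable_pi_lambda _ fun i => measurable_pi_apply _
  have mz := measurable_zeta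
  have m1 : ∀ ρ : Equiv.Perm (Fin 6), Measurable fun p => KZ s N h (zeta p ∘ ρ) := fun ρ => mK.comp ((mc ρ).comp mz)
  calc _ ≤ _ := lintegral_mono point
    _ = ∑ ρ : Equiv.Perm (Fin 6), ∫⁻ p, κ * KZ s N h (zeta p ∘ ρ) := by
        exact lintegral_finsetSum _ fun ρ _ => (m1 ρ).const_mul κ
    _ ≤ ∑ ρ : Equiv.Perm (Fin 6), κ * (Cw s ^ 4 * nw (eo s N) h ^ 6) := Finset.sum_le_sum fun ρ _ => by
        rw [lintegral_const_mul _ (m1 ρ), lint_perm ρ mK]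
        gcongr
    _ = _ := by
        rw [Finset.sum_const, Finset.card_univ, Fintype.card_perm, Fintype.card_fin, nsmul_eq_mul]
        norm_num [Nat.factorial]
        ring


lemma om_mono_norm {s N : ℝ} (hs : 1 < s) (hN : 1 ≤ N) {ξ η : E2} (h : ‖ξ‖ ≤ ‖η‖) : om s N ξ ≤ om s N η := by
  refine phiw_mono (by linarith) (by linarith) (pj_pos ξ).le ?_
  unfold pj; gcongr

/-- product symbol -/
def Mm (m : E2 → ℝ) (ζ : Fin 6 → E2) : ℝ := ∏ i, m (ζ i)

/-- main symbol -/
def sg (m : E2 → ℝ) (ζ : Fin 6 → E2) : ℝ := ‖ζ 0‖ ^ 4 * ((m (ζ 0)) ^ 2 - Mm m ζ)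

section symb
variable {s N : ℝ} {Cd : ℕ → ℝ} {m : E2 → ℝ}

lemma five_le {ζ : Fin 6 → E2} (h0 : ∑ i, ζ i = 0) {σ : Equiv.Perm (Fin 6)} (hm : Antitone fun i => ‖(ζ ∘ σ) i‖) :
    ‖ζ (σ 0)‖ ≤ 5 * ‖ζ (σ 1)‖ ∧ ‖ζ (σ 1)‖ ≤ ‖ζ (σ 0)‖ := by
  have h0' : ∑ i, (ζ ∘ σ) i = 0 := by rw [← h0]; exact Equiv.sum_comp σ ζ
  have z0 : ζ (σ 0) = (ζ ∘ σ) 0 := rfl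
  have z1 : ζ (σ 1) = (ζ ∘ σ) 1 := rfl
  rw [z0, z1]
  generalize ζ ∘ σ = z at *
  have m01 : ‖z 1‖ ≤ ‖z 0‖ := hm (by decide)
  have m12 : ‖z 2‖ ≤ ‖z 1‖ := hm (by decide)
  have m23 : ‖z 3‖ ≤ ‖z 1‖ := hm (by decide)
  have m34 : ‖z 4‖ ≤ ‖z 1‖ := hm (by decide)
  have m45 : ‖z 5‖ ≤ ‖z 1‖ := hm (by decide)
  refine ⟨?_, m01⟩
  have e0 : z 0 = -(z 1 + z 2 + z 3 + z 4 + z 5) := by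
    rw [eq_neg_iff_add_eq_zero, ← h0']
    simp only [Fin.sum_univ_six]; abel
  have : ‖z 0‖ ≤ ‖z 1‖ + ‖z 2‖ + ‖z 3‖ + ‖z 4‖ + ‖z 5‖ := by
    conv_lhs => rw [e0, norm_neg]
    refine (norm_add_le _ _).trans ?_
    gcongr
    refine (norm_add_le _ _).trans ?_
    gcongr
    exact norm_add₃_le
  linarith

lemma le_top1 {ζ : Fin 6 → E2} {σ : Equiv.Perm (Fin 6)} (hm : Antitone fun i => ‖(ζ ∘ σ) i‖) (i : Fin 6) : ‖ζ i‖ ≤ ‖ζ (σ 0)‖ := by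
  have := hm (Fin.zero_le (σ.symm i))
  simpa using this

lemma Mm_bounds (hm : IsIMult s N Cd m) (ζ : Fin 6 → E2) : 0 ≤ Mm m ζ ∧ Mm m ζ ≤ 1 :=
  ⟨Finset.prod_nonneg fun i _ => (hm.pos _).le, Finset.prod_le_one (fun i _ => (hm.pos _).le) fun i _ => hm.le_one _⟩

lemma Mm_le_two (hm : IsIMult s N Cd m) (ζ : Fin 6 → E2) (σ : Equiv.Perm (Fin 6)) : Mm m ζ ≤ m (ζ (σ 0)) * m (ζ (σ 1)) := by
  have e : Mm m ζ = ∏ i, m (ζ (σ i)) := (Equiv.prod_comp σ fun i => m (ζ i)).symm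
  rw [e, Fin.prod_univ_six]
  have p := fun i => (hm.pos (ζ (σ i))).le
  have l := fun i => hm.le_one (ζ (σ i))
  have a := mul_nonneg (p 0) (p 1)
  calc _ ≤ m (ζ (σ 0)) * m (ζ (σ 1)) * 1 * 1 * 1 * 1 := by
        have := p 2; have := p 3; have := p 4; have := p 5
        gcongr
        · exact l 2
        · exact l 3
        · exact l 4
        · exact l 5
    _ = _ := by ring

lemma m_low (hm : IsIMult s N Cd m) {ζ : Fin 6 → E2} {σ : Equiv.Perm (Fin 6)} (ha : Antitone fun i => ‖(ζ ∘ σ) i‖)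
    (h : ‖ζ (σ 0)‖ < N) : (m (ζ 0)) ^ 2 - Mm m ζ = 0 := by
  have e : ∀ i, m (ζ i) = 1 := fun i => hm.eq_one _ ((le_top1 ha i).trans h.le)
  unfold Mm
  simp [e]

lemma sg_bound (hs : 1 < s) (hs2 : s < 2) (hN : 1 ≤ N) (hm : IsIMult s N Cd m) {ζ : Fin 6 → E2} (h0 : ∑ i, ζ i = 0)
    {σ : Equiv.Perm (Fin 6)} (ha : Antitone fun i => ‖(ζ ∘ σ) i‖) :
    |sg m ζ| ≤ 625 * (om s N (ζ (σ 0)) * om s N (ζ (σ 1))) := by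
  obtain ⟨h5, h10⟩ := five_le h0 ha
  have ht := le_top1 ha
  set x := ζ (σ 0) with hx
  set y := ζ (σ 1) with hy
  have mx := m_le_om hs hs2 hN hm x
  have my := m_le_om hs hs2 hN hm y
  have px := (hm.pos x).le
  have py := (hm.pos y).le
  have pz := (hm.pos (ζ 0)).le
  have ox : 0 ≤ om s N x := om_nonneg (by linarith) x
  have oy : 0 ≤ om s N y := om_nonneg (by linarith) y
  have oyx : om s N y ≤ om s N x := om_mono_norm hs hN h10
  have key : ‖x‖ ^ 2 * m x * (‖y‖ ^ 2 * m y) ≤ 25 * (om s N x * om s N y) := by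
    calc _ ≤ (5 * om s N x) * (5 * om s N y) := by gcongr
      _ = _ := by ring
  have A : ‖ζ 0‖ ^ 4 * Mm m ζ ≤ 625 * (om s N x * om s N y) := by
    calc _ ≤ ‖x‖ ^ 4 * (m x * m y) := by
          have := (Mm_bounds hm ζ).1
          gcongr
          · exact ht 0
          · exact Mm_le_two hm ζ σ
      _ = ‖x‖ ^ 2 * m x * (‖x‖ ^ 2 * m y) := by ring
      _ ≤ ‖x‖ ^ 2 * m x * ((5 * ‖y‖) ^ 2 * m y) := by gcongr
      _ = 25 * (‖x‖ ^ 2 * m x * (‖y‖ ^ 2 * m y)) := by ring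
      _ ≤ _ := by linarith
  have B : ‖ζ 0‖ ^ 4 * (m (ζ 0)) ^ 2 ≤ 625 * (om s N x * om s N y) := by
    have hsq : ‖ζ 0‖ ^ 4 * (m (ζ 0)) ^ 2 = (‖ζ 0‖ ^ 2 * m (ζ 0)) ^ 2 := by ring
    rw [hsq]
    rcases eq_or_ne (σ.symm 0) 0 with h | h
    · have : ζ 0 = x := by rw [hx, show σ 0 = 0 from ((Equiv.symm_apply_eq σ).1 h).symm]
      rw [this, sq]
      have mxy : m x ≤ m y := hm.mono _ _ h10
      calc _ ≤ ‖x‖ ^ 2 * m x * ((5 * ‖y‖) ^ 2 * m y) := by gcongr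
        _ = 25 * (‖x‖ ^ 2 * m x * (‖y‖ ^ 2 * m y)) := by ring
        _ ≤ _ := by linarith
    · have h1 : (1 : Fin 6) ≤ σ.symm 0 := by
        have := Fin.pos_of_ne_zero h
        exact this
      have hz : ‖ζ 0‖ ≤ ‖y‖ := by
        have := ha h1
        simpa using this
      have mz := m_le_om hs hs2 hN hm (ζ 0)
      have oz := om_mono_norm (s := s) hs hN hz
      have oz0 : 0 ≤ om s N (ζ 0) := om_nonneg (by linarith) _
      calc _ ≤ (5 * om s N (ζ 0)) ^ 2 := by gcongr
        _ = 25 * (om s N (ζ 0) * om s N (ζ 0)) := by ring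
        _ ≤ 25 * (om s N x * om s N y) := by
          gcongr
          exact oz.trans oyx
        _ ≤ _ := by have := mul_nonneg ox oy; linarith
  have A0 : 0 ≤ ‖ζ 0‖ ^ 4 * Mm m ζ := by have := (Mm_bounds hm ζ).1; positivity
  have B0 : 0 ≤ ‖ζ 0‖ ^ 4 * (m (ζ 0)) ^ 2 := by positivity
  unfold sg
  rw [abs_le]
  constructor <;> nlinarith

lemma sd_bound (hs : 1 < s) (hs2 : s < 2) (hN : 1 ≤ N) (hm : IsIMult s N Cd m) {ζ : Fin 6 → E2} (h0 : ∑ i, ζ i = 0)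
    {σ : Equiv.Perm (Fin 6)} (ha : Antitone fun i => ‖(ζ ∘ σ) i‖) :
    |(m (ζ 0)) ^ 2 - Mm m ζ| ≤ 25 * N ^ (-4:ℝ) * (om s N (ζ (σ 0)) * om s N (ζ (σ 1))) := by
  obtain ⟨h5, h10⟩ := five_le h0 ha
  have hNp : 0 < N := by linarith
  set x := ζ (σ 0) with hx
  set y := ζ (σ 1) with hy
  have ox : 0 ≤ om s N x := om_nonneg (by linarith) x
  have oy : 0 ≤ om s N y := om_nonneg (by linarith) y
  have hNr : 0 ≤ N ^ (-4:ℝ) := Real.rpow_nonneg hNp.le _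
  rcases lt_or_ge ‖x‖ N with h | h
  · rw [m_low hm ha h, abs_zero]
    positivity
  · have b1 := om_ge (s := s) hs hN h
    have b2 : N ^ 2 ≤ 25 * om s N y := by
      have e1 : om s N x ≤ 25 * om s N y := by
        calc _ ≤ phiw s N (25 * pj y) := by
              refine phiw_mono (by linarith) hNp.le (pj_pos x).le ?_
              unfold pj
              nlinarith [norm_nonneg x, norm_nonneg y]
          _ ≤ _ := phiw_scale hs2.le hNp.le (pj_pos y).le (by norm_num)
      linarith
    have b3 : N ^ 4 ≤ 25 * (om s N x * om s N y) := by
      calc N ^ 4 = N ^ 2 * N ^ 2 := by ring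
        _ ≤ om s N x * (25 * om s N y) := by gcongr
        _ = _ := by ring
    have e4 : N ^ (-4:ℝ) * N ^ 4 = 1 := by
      rw [← Real.rpow_natCast, ← Real.rpow_add hNp]; norm_num
    have b4 : 1 ≤ 25 * N ^ (-4:ℝ) * (om s N x * om s N y) := by
      calc 1 = N ^ (-4:ℝ) * N ^ 4 := e4.symm
        _ ≤ N ^ (-4:ℝ) * (25 * (om s N x * om s N y)) := by gcongr
        _ = _ := by ring
    refine le_trans ?_ b4
    have := Mm_bounds hm ζ
    have h1 := hm.le_one (ζ 0)
    have h2 := hm.pos (ζ 0)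
    rw [abs_le]
    constructor <;> nlinarith
end symb

/-- oscillatory factor -/
def qt (t x : ℝ) : ℂ := ∫ τ in (0:ℝ)..t, Complex.exp (-(Complex.I * τ * x))

lemma norm_expi (τ x : ℝ) : ‖Complex.exp (-(Complex.I * τ * x))‖ = 1 := by
  have : -(Complex.I * τ * x) = ((-(τ * x) : ℝ) : ℂ) * Complex.I := by push_cast; ring
  rw [this, Complex.norm_exp_ofReal_mul_I]

lemma qt_zero (x : ℝ) : qt 0 x = 0 := by unfold qt; simp

lemma qt_deriv (t x : ℝ) : HasDerivAt (fun t => qt t x) (Complex.exp (-(Complex.I * t * x))) t := by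
  unfold qt
  have c : Continuous fun τ : ℝ => Complex.exp (-(Complex.I * τ * x)) := by fun_prop
  exact intervalIntegral.integral_hasDerivAt_right (c.intervalIntegrable _ _) (c.stronglyMeasurableAtFilter _ _) c.continuousAt

lemma qt_le (t x : ℝ) : ‖qt t x‖ ≤ |t| := by
  unfold qt
  have := intervalIntegral.norm_integral_le_of_norm_le_const (a := 0) (b := t) (C := 1) (f := fun τ : ℝ => Complex.exp (-(Complex.I * τ * x))) (fun τ _ => (norm_expi τ x).le)
  simpa using this

lemma qt_eq {t x : ℝ} (hx : x ≠ 0) : qt t x = (Complex.exp (-(Complex.I * t * x)) - 1) / (-(Complex.I * x)) := by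
  have hc : -(Complex.I * x) ≠ 0 := by simpa using hx
  unfold qt
  have := integral_exp_mul_complex (a := 0) (b := t) hc
  rw [show (fun τ : ℝ => Complex.exp (-(Complex.I * τ * x))) = fun τ : ℝ => Complex.exp (-(Complex.I * x) * τ) by funext τ; congr 1; ring]
  rw [this]
  congr 1
  simp only [Complex.ofReal_zero, mul_zero, Complex.exp_zero]
  congr 2; ring

lemma qt_le2 {t x : ℝ} (hx : x ≠ 0) : ‖qt t x‖ ≤ 2 / |x| := by
  rw [qt_eq hx, norm_div, norm_neg, norm_mul, Complex.norm_I, one_mul, Complex.norm_real, Real.norm_eq_abs]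
  gcongr
  refine (norm_sub_le _ _).trans ?_
  rw [norm_expi]; norm_num

lemma qt_interp {t x η : ℝ} (ht : 0 ≤ t) (hη : 0 < η) (hη1 : η < 1) :
    ‖qt t x‖ₑ ≤ ENNReal.ofReal (2 * t ^ η) * ENNReal.ofReal |x| ^ (η - 1) := by
  rcases ht.eq_or_lt with rfl | ht
  · rw [qt_zero]; simp
  rcases eq_or_ne x 0 with rfl | hx
  · rw [abs_zero, ENNReal.ofReal_zero, ENNReal.zero_rpow_of_neg (by linarith), ENNReal.mul_top]
    · exact le_top
    · rw [Ne, ENNReal.ofReal_eq_zero, not_le]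
      have := Real.rpow_pos_of_pos ht η
      positivity
  · have hx' : 0 < |x| := abs_pos.2 hx
    rw [ENNReal.ofReal_rpow_of_pos hx', ← ENNReal.ofReal_mul (by positivity), ← ofReal_norm]
    apply ENNReal.ofReal_le_ofReal
    have h1 := qt_le t x
    rw [abs_of_pos ht] at h1
    have h2 := qt_le2 (t := t) hx
    have n0 := norm_nonneg (qt t x)
    calc ‖qt t x‖ = ‖qt t x‖ ^ η * ‖qt t x‖ ^ (1 - η) := by
          rw [← Real.rpow_add_of_nonneg n0 hη.le (by linarith)]; simp
      _ ≤ t ^ η * (2 / |x|) ^ (1 - η) := by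
          gcongr
      _ = t ^ η * (2 ^ (1 - η) * |x| ^ (η - 1)) := by
          rw [Real.div_rpow (by norm_num) hx'.le, div_eq_mul_inv, ← Real.rpow_neg hx'.le, neg_sub]
      _ ≤ t ^ η * (2 ^ (1:ℝ) * |x| ^ (η - 1)) := by
          gcongr
          · norm_num
          · linarith
      _ = _ := by rw [Real.rpow_one]; ring

lemma qt_crude {t x η : ℝ} (ht : 0 ≤ t) (ht1 : t ≤ 1) (hη : 0 < η) (hη1 : η < 1) : ‖qt t x‖ₑ ≤ ENNReal.ofReal (2 * t ^ η) := by
  rw [← ofReal_norm]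
  apply ENNReal.ofReal_le_ofReal
  have h1 := qt_le t x
  rw [abs_of_nonneg ht] at h1
  have h2 : t ≤ t ^ η := by
    conv_lhs => rw [← Real.rpow_one t]
    exact Real.rpow_le_rpow_of_exponent_ge_of_imp ht ht1 hη1.le (fun _ h => absurd h one_ne_zero)
  have := Real.rpow_nonneg ht η
  linarith


/-- signed factor -/
def cj (i : Fin 6) (f : E2 → ℂ) (z : E2) : ℂ := if i = 1 ∨ i = 2 ∨ i = 3 then f z else conj (f (-z))

/-- signs -/
def es (i : Fin 6) : ℝ := if i = 1 ∨ i = 2 ∨ i = 3 then 1 else -1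

lemma es_abs (i : Fin 6) : |es i| = 1 := by unfold es; split_ifs <;> simp

/-- resonance function -/
def Om (ζ : Fin 6 → E2) : ℝ := ∑ i, es i * ‖ζ i‖ ^ 4

lemma continuous_Om : Continuous Om := by unfold Om; fun_prop

/-- product with one modified slot -/
def PK (k : Fin 6) (f g : E2 → ℂ) (ζ : Fin 6 → E2) : ℂ := ∏ i, cj i (if i = k then g else f) (ζ i)

/-- plain product -/
def PR (f : E2 → ℂ) (ζ : Fin 6 → E2) : ℂ := ∏ i, cj i f (ζ i)

lemma PK_self (k : Fin 6) (f : E2 → ℂ) (ζ : Fin 6 → E2) : PK k f f ζ = PR f ζ := by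
  unfold PK PR; simp

lemma cj_le {f : E2 → ℂ} {H : E2 → ℝ≥0∞} (hf : ∀ z, ‖f z‖ₑ ≤ H z) (hH : ∀ z, H (-z) = H z) (i : Fin 6) (z : E2) : ‖cj i f z‖ₑ ≤ H z := by
  unfold cj
  split_ifs
  · exact hf z
  · rw [enorm_conj, ← hH]; exact hf _

lemma measurable_cj {f : E2 → ℂ} (hf : Measurable f) (i : Fin 6) : Measurable (cj i f) := by
  unfold cj
  split_ifs
  · exact hf
  · exact Complex.continuous_conj.measurable.comp (hf.comp measurable_neg)

lemma measurable_PK {f g : E2 → ℂ} (hf : Measurable f) (hg : Measurable g) (k : Fin 6) : Measurable (PK k f g) := by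
  unfold PK
  refine Finset.measurable_fun_prod _ fun i _ => ?_
  refine (measurable_cj ?_ i).comp (measurable_pi_apply i)
  split_ifs
  · exact hg
  · exact hf

lemma measurable_PR {f : E2 → ℂ} (hf : Measurable f) : Measurable (PR f) := by
  have := measurable_PK hf hf 0
  rwa [show PK 0 f f = PR f from funext fun ζ => PK_self 0 f ζ] at this

lemma PK_le {f g : E2 → ℂ} {H : E2 → ℝ≥0∞} (hf : ∀ z, ‖f z‖ₑ ≤ H z) (hg : ∀ z, ‖g z‖ₑ ≤ H z) (hH : ∀ z, H (-z) = H z) (k : Fin 6)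
    (ζ : Fin 6 → E2) : ‖PK k f g ζ‖ₑ ≤ ∏ i, H (ζ i) := by
  unfold PK
  rw [show ‖∏ i, cj i (if i = k then g else f) (ζ i)‖ₑ = ∏ i, ‖cj i (if i = k then g else f) (ζ i)‖ₑ by
    simp only [Fin.prod_univ_six, enorm_mul]]
  refine Finset.prod_le_prod' fun i _ => cj_le ?_ hH i _
  split_ifs
  · exact hg
  · exact hf

lemma PR_le {f : E2 → ℂ} {H : E2 → ℝ≥0∞} (hf : ∀ z, ‖f z‖ₑ ≤ H z) (hH : ∀ z, H (-z) = H z)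
    (ζ : Fin 6 → E2) : ‖PR f ζ‖ₑ ≤ ∏ i, H (ζ i) := by
  rw [← PK_self 0]; exact PK_le hf hf hH 0 ζ

lemma PK_zeta (f g : E2 → ℂ) (p : X6) : PK 0 f g (zeta p) = conj (g p.1) * pr5 f p.1 p.2 := by
  unfold PK pr5 cj zeta
  simp only [Fin.prod_univ_six]
  simp [Fin.ext_iff]
  ring

lemma PR_phase (t : ℝ) (f : E2 → ℂ) (ζ : Fin 6 → E2) :
    PR (fun z => eph t z * f z) ζ = Complex.exp (-(Complex.I * t * Om ζ)) * PR f ζ := by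
  have e : ∀ i, cj i (fun z => eph t z * f z) (ζ i) = Complex.exp (-(Complex.I * t * (es i * ‖ζ i‖ ^ 4 : ℝ))) * cj i f (ζ i) := by
    intro i
    unfold cj es eph
    split_ifs
    · push_cast
      ring_nf
    · rw [map_mul, ← Complex.exp_conj]
      congr 2
      simp
  unfold PR
  simp only [e, Finset.prod_mul_distrib]
  congr 1
  rw [← Complex.exp_sum]
  congr 1
  unfold Om
  push_cast
  rw [Finset.mul_sum, Finset.sum_neg_distrib]

lemma PR_deriv {V : ℝ → E2 → ℂ} {dV : E2 → ℂ} {t : ℝ} (h : ∀ z, HasDerivAt (fun τ => V τ z) (dV z) t) (ζ : Fin 6 → E2) :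
    HasDerivAt (fun τ => PR (V τ) ζ) (∑ k, PK k (V t) dV ζ) t := by
  have hc : ∀ i, HasDerivAt (fun τ => cj i (V τ) (ζ i)) (cj i dV (ζ i)) t := by
    intro i
    unfold cj
    split_ifs
    · exact h _
    · exact (h _).star
  have := HasDerivAt.fun_finsetProd (u := Finset.univ) (x := t) (fun i _ => hc i)
  unfold PR
  refine this.congr_deriv ?_
  refine Finset.sum_congr rfl fun k _ => ?_
  unfold PK
  rw [← Finset.mul_prod_erase Finset.univ _ (Finset.mem_univ k), smul_eq_mul, mul_comm]
  congr 1
  · simp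
  · refine Finset.prod_congr rfl fun j hj => ?_
    rw [if_neg (Finset.ne_of_mem_erase hj)]

lemma Mm_perm (m : E2 → ℝ) (ζ : Fin 6 → E2) (σ : Equiv.Perm (Fin 6)) : Mm m (ζ ∘ σ) = Mm m ζ :=
  Equiv.prod_comp σ fun i => m (ζ i)

lemma zeta_neg (p : X6) : zeta (-p) = fun i => -zeta p i := by
  funext i
  fin_cases i <;> simp [zeta, zl]
  abel

lemma X6_neg_inv : (volume : Measure X6).IsNegInvariant := by
  have hd : |LinearMap.det (-1 : X6 →ₗ[ℝ] X6)| = 1 := by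
    have h : LinearMap.det (-1 : X6 →ₗ[ℝ] X6) ^ 2 = 1 := by 
      rw [← map_pow, show (-1 : X6 →ₗ[ℝ] X6) ^ 2 = 1 from LinearMap.ext fun p => neg_neg p, map_one]
    have h2 : |LinearMap.det (-1 : X6 →ₗ[ℝ] X6)| ^ 2 = 1 := by rw [sq_abs, h]
    exact (pow_eq_one_iff_of_nonneg (abs_nonneg _) two_ne_zero).1 h2
  have h0 : LinearMap.det (-1 : X6 →ₗ[ℝ] X6) ≠ 0 := by intro h; rw [h] at hd; norm_num at hd
  refine ⟨?_⟩
  have := Measure.map_linearMap_addHaar_eq_smul_addHaar (volume : Measure X6) h0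
  rw [abs_inv, hd] at this
  simp only [inv_one, ENNReal.ofReal_one, one_smul] at this
  exact this

lemma PK_flip (f g : E2 → ℂ) (k : Fin 6) : ∃ σ : Equiv.Perm (Fin 6), (∀ ζ, PK k f g ζ = PK 0 f g (ζ ∘ σ)) ∨
    ∀ ζ : Fin 6 → E2, PK k f g ζ = conj (PK 0 f g (fun i => -((ζ ∘ σ) i))) := by
  fin_cases k
  · exact ⟨1, Or.inl fun ζ => rfl⟩
  · refine ⟨Equiv.swap 0 1 * Equiv.swap 4 2 * Equiv.swap 5 3, Or.inr fun ζ => ?_⟩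
    set ρ : Equiv.Perm (Fin 6) := Equiv.swap 0 1 * Equiv.swap 4 2 * Equiv.swap 5 3 with hρ
    have r0 : ρ 0 = 1 := by rw [hρ]; decide
    have r1 : ρ 1 = 0 := by rw [hρ]; decide
    have r2 : ρ 2 = 4 := by rw [hρ]; decide
    have r3 : ρ 3 = 5 := by rw [hρ]; decide
    have r4 : ρ 4 = 2 := by rw [hρ]; decide
    have r5 : ρ 5 = 3 := by rw [hρ]; decide
    unfold PK cj
    simp only [Function.comp_apply, r0, r1, r2, r3, r4, r5, Fin.prod_univ_six]
    simp [Fin.ext_iff]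
    ring
  · refine ⟨Equiv.swap 0 2 * Equiv.swap 4 1 * Equiv.swap 5 3, Or.inr fun ζ => ?_⟩
    set ρ : Equiv.Perm (Fin 6) := Equiv.swap 0 2 * Equiv.swap 4 1 * Equiv.swap 5 3 with hρ
    have r0 : ρ 0 = 2 := by rw [hρ]; decide
    have r1 : ρ 1 = 4 := by rw [hρ]; decide
    have r2 : ρ 2 = 0 := by rw [hρ]; decide
    have r3 : ρ 3 = 5 := by rw [hρ]; decide
    have r4 : ρ 4 = 1 := by rw [hρ]; decide
    have r5 : ρ 5 = 3 := by rw [hρ]; decide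
    unfold PK cj
    simp only [Function.comp_apply, r0, r1, r2, r3, r4, r5, Fin.prod_univ_six]
    simp [Fin.ext_iff]
    ring
  · refine ⟨Equiv.swap 0 3 * Equiv.swap 4 1 * Equiv.swap 5 2, Or.inr fun ζ => ?_⟩
    set ρ : Equiv.Perm (Fin 6) := Equiv.swap 0 3 * Equiv.swap 4 1 * Equiv.swap 5 2 with hρ
    have r0 : ρ 0 = 3 := by rw [hρ]; decide
    have r1 : ρ 1 = 4 := by rw [hρ]; decide
    have r2 : ρ 2 = 5 := by rw [hρ]; decide
    have r3 : ρ 3 = 0 := by rw [hρ]; decide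
    have r4 : ρ 4 = 1 := by rw [hρ]; decide
    have r5 : ρ 5 = 2 := by rw [hρ]; decide
    unfold PK cj
    simp only [Function.comp_apply, r0, r1, r2, r3, r4, r5, Fin.prod_univ_six]
    simp [Fin.ext_iff]
    ring
  · refine ⟨Equiv.swap 0 4, Or.inl fun ζ => ?_⟩
    set ρ : Equiv.Perm (Fin 6) := Equiv.swap 0 4 with hρ
    have r0 : ρ 0 = 4 := by rw [hρ]; decide
    have r1 : ρ 1 = 1 := by rw [hρ]; decide
    have r2 : ρ 2 = 2 := by rw [hρ]; decide
    have r3 : ρ 3 = 3 := by rw [hρ]; decide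
    have r4 : ρ 4 = 0 := by rw [hρ]; decide
    have r5 : ρ 5 = 5 := by rw [hρ]; decide
    unfold PK cj
    simp only [Function.comp_apply, r0, r1, r2, r3, r4, r5, Fin.prod_univ_six]
    simp [Fin.ext_iff]
    left; ring
  · refine ⟨Equiv.swap 0 5, Or.inl fun ζ => ?_⟩
    set ρ : Equiv.Perm (Fin 6) := Equiv.swap 0 5 with hρ
    have r0 : ρ 0 = 5 := by rw [hρ]; decide
    have r1 : ρ 1 = 1 := by rw [hρ]; decide
    have r2 : ρ 2 = 2 := by rw [hρ]; decide
    have r3 : ρ 3 = 3 := by rw [hρ]; decide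
    have r4 : ρ 4 = 4 := by rw [hρ]; decide
    have r5 : ρ 5 = 0 := by rw [hρ]; decide
    unfold PK cj
    simp only [Function.comp_apply, r0, r1, r2, r3, r4, r5, Fin.prod_univ_six]
    simp [Fin.ext_iff]
    ring

lemma PK_sym {f g : E2 → ℂ} (hf : Measurable f) (hg : Measurable g) {m : E2 → ℝ} (hm : Measurable m) (hme : ∀ z, m (-z) = m z) (k : Fin 6) :
    (∫ p, (Mm m (zeta p) : ℂ) * PK k f g (zeta p)).re = (∫ p, (Mm m (zeta p) : ℂ) * PK 0 f g (zeta p)).re := by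
  have mM : Measurable (Mm m) := by
    unfold Mm
    exact Finset.measurable_fun_prod _ fun i _ => hm.comp (measurable_pi_apply i)
  have mF : Measurable fun ζ : Fin 6 → E2 => (Mm m ζ : ℂ) * PK 0 f g ζ := (Complex.measurable_ofReal.comp mM).mul (measurable_PK hf hg 0)
  obtain ⟨σ, h | h⟩ := PK_flip f g k
  · have e : ∀ p, (Mm m (zeta p) : ℂ) * PK k f g (zeta p) = (fun ζ => (Mm m ζ : ℂ) * PK 0 f g ζ) (zeta p ∘ σ) := fun p => by
      dsimp only; rw [h, Mm_perm]
    simp only [e]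
    rw [int_perm σ mF]
  · have e : ∀ p, (Mm m (zeta p) : ℂ) * PK k f g (zeta p) = (fun ζ : Fin 6 → E2 => conj ((Mm m (fun i => -ζ i) : ℂ) * PK 0 f g (fun i => -ζ i))) (zeta p ∘ σ) := fun p => by
      dsimp only
      rw [h, map_mul, Complex.conj_ofReal]
      congr 2
      rw [← Mm_perm m (zeta p) σ]
      unfold Mm
      simp only [hme]
    simp only [e]
    have mneg : Measurable fun ζ : Fin 6 → E2 => (fun i => -ζ i : Fin 6 → E2) := by fun_prop
    rw [int_perm σ (F := fun ζ : Fin 6 → E2 => conj ((Mm m (fun i => -ζ i) : ℂ) * PK 0 f g (fun i => -ζ i)))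
      (Complex.continuous_conj.measurable.comp (mF.comp mneg))]
    rw [integral_conj, Complex.conj_re]
    congr 1
    have := X6_neg_inv
    have := integral_neg_eq_self (fun p : X6 => (Mm m (zeta p) : ℂ) * PK 0 f g (zeta p)) volume
    simp only [zeta_neg] at this
    exact this


lemma integ_T {F : (Fin 6 → E2) → ℂ} {B : (Fin 6 → E2) → ℝ≥0∞} (hF : Measurable F) (hb : ∀ ζ, ‖F ζ‖ₑ ≤ B ζ)
    (fin : ∫⁻ p, B (zeta p) < ⊤) : Integrable fun p => F (zeta p) :=
  ⟨(hF.comp measurable_zeta).aestronglyMeasurable, (lintegral_mono fun p => hb (zeta p)).trans_lt fin⟩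

lemma enorm_T {F : (Fin 6 → E2) → ℂ} {B : (Fin 6 → E2) → ℝ≥0∞} (hb : ∀ ζ, ‖F ζ‖ₑ ≤ B ζ) :
    ‖∫ p, F (zeta p)‖ₑ ≤ ∫⁻ p, B (zeta p) :=
  (enorm_integral_le_lintegral_enorm _).trans (lintegral_mono fun p => hb (zeta p))

lemma sum_PK_le {f g : E2 → ℂ} {H : E2 → ℝ≥0∞} (hf : ∀ z, ‖f z‖ₑ ≤ H z) (hg : ∀ z, ‖g z‖ₑ ≤ H z) (hH : ∀ z, H (-z) = H z)
    (ζ : Fin 6 → E2) : ‖∑ k, PK k f g ζ‖ₑ ≤ 6 * ∏ i, H (ζ i) := by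
  refine (enorm_sum_le _ _).trans ?_
  calc _ ≤ ∑ k : Fin 6, ∏ i, H (ζ i) := Finset.sum_le_sum fun k _ => PK_le hf hg hH k ζ
    _ = _ := by simp

lemma deriv_T {δ : ℝ} {V dV : ℝ → E2 → ℂ} {H : E2 → ℝ≥0∞} {a a' : ℝ → (Fin 6 → E2) → ℂ} {A : (Fin 6 → E2) → ℝ≥0∞}
    (mV : ∀ t, Measurable (V t)) (mdV : ∀ t, Measurable (dV t))
    (hd : ∀ t ∈ Ioo (-δ) δ, ∀ z, HasDerivAt (fun τ => V τ z) (dV t z) t)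
    (bV : ∀ t ∈ Ioo (-δ) δ, ∀ z, ‖V t z‖ₑ ≤ H z) (bdV : ∀ t ∈ Ioo (-δ) δ, ∀ z, ‖dV t z‖ₑ ≤ H z)
    (hH : ∀ z, H (-z) = H z)
    (ma : ∀ t, Measurable (a t)) (ma' : ∀ t, Measurable (a' t)) (had : ∀ t ζ, HasDerivAt (fun τ => a τ ζ) (a' t ζ) t)
    (ba : ∀ t ∈ Ioo (-δ) δ, ∀ ζ, ‖a t ζ‖ₑ ≤ A ζ) (ba' : ∀ t ∈ Ioo (-δ) δ, ∀ ζ, ‖a' t ζ‖ₑ ≤ A ζ)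
    (mB : Measurable fun p => A (zeta p) * ∏ i, H (zeta p i))
    (fin : ∫⁻ p, A (zeta p) * ∏ i, H (zeta p i) < ⊤) {t : ℝ} (ht : t ∈ Ioo (-δ) δ) :
    HasDerivAt (fun τ => ∫ p, a τ (zeta p) * PR (V τ) (zeta p))
      (∫ p, (a' t (zeta p) * PR (V t) (zeta p) + a t (zeta p) * ∑ k, PK k (V t) (dV t) (zeta p))) t := by
  have mF : ∀ τ, Measurable fun ζ => a τ ζ * PR (V τ) ζ := fun τ => (ma τ).mul (measurable_PR (mV τ))
  have mF' : ∀ τ, Measurable fun ζ => a' τ ζ * PR (V τ) ζ + a τ ζ * ∑ k, PK k (V τ) (dV τ) ζ := fun τ =>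
    ((ma' τ).mul (measurable_PR (mV τ))).add ((ma τ).mul (Finset.measurable_fun_sum _ fun k _ => measurable_PK (mV τ) (mdV τ) k))
  have fin7 : ∫⁻ p, 7 * (A (zeta p) * ∏ i, H (zeta p i)) ≠ ⊤ := by
    rw [lintegral_const_mul _ mB]
    exact ENNReal.mul_ne_top (by norm_num) fin.ne
  have aef : ∀ᵐ p, A (zeta p) * ∏ i, H (zeta p i) < ⊤ := ae_lt_top mB fin.ne
  refine (hasDerivAt_integral_of_dominated_loc_of_deriv_le (s := Ioo (-δ) δ)
    (F := fun τ p => a τ (zeta p) * PR (V τ) (zeta p))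
    (F' := fun τ p => a' τ (zeta p) * PR (V τ) (zeta p) + a τ (zeta p) * ∑ k, PK k (V τ) (dV τ) (zeta p))
    (bound := fun p => (7 * (A (zeta p) * ∏ i, H (zeta p i))).toReal) (Ioo_mem_nhds ht.1 ht.2) ?_ ?_ ?_ ?_ ?_ ?_).2
  · exact Filter.Eventually.of_forall fun τ => ((mF τ).comp measurable_zeta).aestronglyMeasurable
  · refine integ_T (B := fun ζ => A ζ * ∏ i, H (ζ i)) (mF t) (fun ζ => ?_) fin
    rw [enorm_mul]
    exact mul_le_mul' (ba t ht ζ) (PR_le (bV t ht) hH ζ)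
  · exact ((mF' t).comp measurable_zeta).aestronglyMeasurable
  · filter_upwards [aef] with p hp τ hτ
    rw [← ENNReal.ofReal_le_iff_le_toReal (ENNReal.mul_ne_top (by norm_num) hp.ne), ofReal_norm]
    refine (enorm_add_le _ _).trans ?_
    rw [enorm_mul, enorm_mul]
    calc _ ≤ A (zeta p) * (∏ i, H (zeta p i)) + A (zeta p) * (6 * ∏ i, H (zeta p i)) :=
          add_le_add (mul_le_mul' (ba' τ hτ _) (PR_le (bV τ hτ) hH _)) (mul_le_mul' (ba τ hτ _) (sum_PK_le (bV τ hτ) (bdV τ hτ) hH _))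
      _ = _ := by ring
  · exact integrable_toReal_of_lintegral_ne_top (measurable_const.mul mB).aemeasurable fin7
  · refine Filter.Eventually.of_forall fun p τ hτ => ?_
    exact (had τ (zeta p)).mul (PR_deriv (hd τ hτ) (zeta p))

/-- symmetrised majorant -/
def hh (D : E2 → ℝ≥0∞) (z : E2) : ℝ≥0∞ := D z + D (-z) + (D2 D z + D2 D (-z))

lemma hh_neg (D : E2 → ℝ≥0∞) (z : E2) : hh D (-z) = hh D z := by
  unfold hh
  rw [neg_neg, add_comm (D (-z)), add_comm (D2 D (-z))]

lemma measurable_D2 {D : E2 → ℝ≥0∞} (hD : Measurable D) : Measurable (D2 D) := by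
  have := measurable_L5 hD
  unfold D2; fun_prop

lemma measurable_hh {D : E2 → ℝ≥0∞} (hD : Measurable D) : Measurable (hh D) := by
  have := measurable_D2 hD
  unfold hh; fun_prop

lemma D_le_hh (D : E2 → ℝ≥0∞) (z : E2) : D z ≤ hh D z := by
  unfold hh
  exact le_self_add.trans le_self_add

lemma D2_le_hh (D : E2 → ℝ≥0∞) (z : E2) : D2 D z ≤ hh D z := by
  unfold hh
  exact le_self_add.trans le_add_self

lemma DD2_le_hh (D : E2 → ℝ≥0∞) (z : E2) : D z + D2 D z ≤ hh D z := by
  unfold hh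
  exact add_le_add le_self_add le_self_add

lemma nw_hh {W : E2 → ℝ≥0∞} {C : ℝ≥0∞} (hW : IsWt W C) {D : E2 → ℝ≥0∞} (hD : Measurable D) :
    nw W (hh D) ≤ 2 * nw W D + 2 * (ENNReal.ofReal k0 * ((2 * C ^ 2) ^ 4 * nw W D ^ 5)) := by
  have mL := measurable_L5 hD
  have m2 := measurable_D2 hD
  have mn : Measurable fun z => D (-z) := by fun_prop
  have m2n : Measurable fun z => D2 D (-z) := by fun_prop
  have ma : Measurable fun z => D z + D (-z) := by fun_prop
  have mb : Measurable fun z => D2 D z + D2 D (-z) := by fun_prop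
  have e2 : nw W (D2 D) ≤ ENNReal.ofReal k0 * ((2 * C ^ 2) ^ 4 * nw W D ^ 5) := by
    unfold D2
    rw [nw_const_mul _ hW.meas mL]
    gcongr
    exact nw_L5 hW hD
  have s1 := nw_add_le hW.meas ma mb
  have s2 := nw_add_le hW.meas hD mn
  have s3 := nw_add_le hW.meas m2 m2n
  rw [nw_neg hW] at s2
  rw [nw_neg hW (D2 D)] at s3
  calc _ ≤ (nw W D + nw W D) + (nw W (D2 D) + nw W (D2 D)) := s1.trans (add_le_add s2 s3)
    _ = 2 * nw W D + 2 * nw W (D2 D) := by ring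
    _ ≤ _ := by gcongr

/-- qualitative majorant -/
def Hq (D : E2 → ℝ≥0∞) (z : E2) : ℝ≥0∞ := Wk 2 z * hh D z

lemma Wk_neg (k : ℕ) (z : E2) : Wk k (-z) = Wk k z := by unfold Wk; rw [pj_neg]

lemma one_le_Wk (k : ℕ) (z : E2) : 1 ≤ Wk k z := by
  unfold Wk
  rw [← ENNReal.ofReal_one]
  exact ENNReal.ofReal_le_ofReal (one_le_pow₀ (one_le_pj z))

lemma Hq_neg (D : E2 → ℝ≥0∞) (z : E2) : Hq D (-z) = Hq D z := by unfold Hq; rw [hh_neg, Wk_neg]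

lemma measurable_Hq {D : E2 → ℝ≥0∞} (hD : Measurable D) : Measurable (Hq D) := (measurable_Wk 2).mul (measurable_hh hD)

lemma hh_le_Hq (D : E2 → ℝ≥0∞) (z : E2) : hh D z ≤ Hq D z := le_mul_of_one_le_left' (one_le_Wk 2 z)

lemma nw_hh_fin {D : E2 → ℝ≥0∞} (hD : Measurable D) (hf : nw (Wk (kn + 3)) D < ⊤) : nw (Wk (kn + 3)) (hh D) < ⊤ := by
  refine (nw_hh (isWt_Wk (k := kn + 3) (by omega)) hD).trans_lt ?_
  have h1 := (C1_lt_top (kn + 3)).ne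
  have h2 := hf.ne
  generalize nw (Wk (kn + 3)) D = a at *
  generalize ENNReal.ofReal (4 ^ (kn + 3)) + Cs 2 = b at *
  finiteness

lemma Hq_n2 {D : E2 → ℝ≥0∞} (hD : Measurable D) (hf : nw (Wk (kn + 3)) D < ⊤) : n2 (Hq D) < ⊤ ∧ ∫⁻ z, Hq D z < ⊤ := by
  have h1 := nw_hh_fin hD hf
  constructor
  · exact (nw_mono_wt (f := hh D) (Wk_mono (show 2 ≤ kn + 3 by omega))).trans_lt h1
  · refine (lint_Wk_le 2 (measurable_hh hD)).trans_lt ?_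
    exact ENNReal.mul_lt_top (C1_lt_top 1) ((nw_mono_wt (f := hh D) (Wk_mono (show 2 + 1 ≤ kn + 3 by omega))).trans_lt h1)

lemma Hq_meas {D : E2 → ℝ≥0∞} (hD : Measurable D) : Measurable fun p => ∏ i, Hq D (zeta p i) :=
  Finset.measurable_fun_prod _ fun i _ => (measurable_Hq hD).comp ((measurable_pi_apply i).comp measurable_zeta)

lemma Hq_fin {D : E2 → ℝ≥0∞} (hD : Measurable D) (hf : nw (Wk (kn + 3)) D < ⊤) : ∫⁻ p, ∏ i, Hq D (zeta p i) < ⊤ := by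
  have m := measurable_Hq hD
  have b := base_bound m m m m m m
  obtain ⟨h1, h2⟩ := Hq_n2 hD hf
  simp only [Fin.prod_univ_six]
  refine b.trans_lt ?_
  have h1 := h1.ne
  have h2 := h2.ne
  finiteness

lemma Wk0_fin_le (D : E2 → ℝ≥0∞) (ζ : Fin 6 → E2) : Wk 2 (ζ 0) * ∏ i, hh D (ζ i) ≤ ∏ i, Hq D (ζ i) := by
  simp only [Fin.prod_univ_six]
  have := hh_le_Hq D
  calc _ = Hq D (ζ 0) * hh D (ζ 1) * hh D (ζ 2) * hh D (ζ 3) * hh D (ζ 4) * hh D (ζ 5) := by unfold Hq; ring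
    _ ≤ _ := by
      gcongr <;> exact this _


lemma bdW {D : E2 → ℝ≥0∞} {f g : E2 → ℂ} (hf : ∀ z, ‖f z‖ₑ ≤ hh D z) (hg : ∀ z, ‖g z‖ₑ ≤ hh D z) (k : Fin 6) {c : ℂ} (ζ : Fin 6 → E2)
    (hc : ‖c‖ ≤ pj (ζ 0) ^ 2) : ‖c * PK k f g ζ‖ₑ ≤ ∏ i, Hq D (ζ i) := by
  rw [enorm_mul]
  refine (mul_le_mul' ?_ (PK_le hf hg (hh_neg D) k ζ)).trans (Wk0_fin_le D ζ)
  unfold Wk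
  rw [← ofReal_norm]
  exact ENNReal.ofReal_le_ofReal hc

lemma four_le_pj (z : E2) : ‖z‖ ^ 4 ≤ pj z ^ 2 := by
  have : ‖z‖ ^ 4 = (‖z‖ ^ 2) ^ 2 := by ring
  rw [this]; unfold pj; gcongr; linarith

lemma one_le_pj2 (z : E2) : 1 ≤ pj z ^ 2 := one_le_pow₀ (one_le_pj z)

lemma integ_W {D : E2 → ℝ≥0∞} (hD : Measurable D) (fin : nw (Wk (kn + 3)) D < ⊤) {f g : E2 → ℂ} (mf : Measurable f) (mg : Measurable g)
    (hf : ∀ z, ‖f z‖ₑ ≤ hh D z) (hg : ∀ z, ‖g z‖ₑ ≤ hh D z) (k : Fin 6) {c : (Fin 6 → E2) → ℂ} (mc : Measurable c)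
    (hc : ∀ ζ, ‖c ζ‖ ≤ pj (ζ 0) ^ 2) : Integrable fun p => c (zeta p) * PK k f g (zeta p) :=
  integ_T (F := fun ζ => c ζ * PK k f g ζ) (mc.mul (measurable_PK mf mg k)) (fun ζ => bdW hf hg k ζ (hc ζ)) (Hq_fin hD fin)

lemma fubK {f g : E2 → ℂ} (b : E2 → ℂ) (hi : Integrable fun p : X6 => b p.1 * PK 0 f g (zeta p)) :
    ∫ p : X6, b p.1 * PK 0 f g (zeta p) = ∫ ξ, b ξ * conj (g ξ) * N5 f ξ := by
  rw [Measure.volume_eq_prod] at hi ⊢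
  rw [integral_prod _ hi]
  refine integral_congr_ae (Filter.Eventually.of_forall fun ξ => ?_)
  dsimp only
  unfold N5
  rw [← integral_const_mul]
  refine integral_congr_ae (Filter.Eventually.of_forall fun z => ?_)
  dsimp only
  rw [PK_zeta]; ring

lemma PR_mul {m : E2 → ℝ} (hme : ∀ z, m (-z) = m z) (f : E2 → ℂ) (ζ : Fin 6 → E2) :
    PR (fun z => (m z : ℂ) * f z) ζ = (Mm m ζ : ℂ) * PR f ζ := by
  unfold PR Mm
  push_cast
  rw [← Finset.prod_mul_distrib]
  refine Finset.prod_congr rfl fun i _ => ?_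
  unfold cj
  split_ifs
  · rfl
  · dsimp only; rw [hme, map_mul, Complex.conj_ofReal]

lemma PK0_add (f g : E2 → ℂ) (ζ : Fin 6 → E2) (r : ℝ) (hr : r = ‖ζ 0‖ ^ 4) :
    PK 0 f (fun z => -(Complex.I * (‖z‖ ^ 4 : ℝ) * f z) + g z) ζ = Complex.I * (r : ℂ) * PR f ζ + PK 0 f g ζ := by
  unfold PK PR
  simp only [Fin.prod_univ_six]
  subst hr
  simp [cj]
  ring

/-- derivative of the solution transform -/
def du (D : E2 → ℝ≥0∞) (v : ℝ → E2 → ℂ) (t : ℝ) (z : E2) : ℂ :=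
  -(Complex.I * (‖z‖ ^ 4 : ℝ) * uh v t z) + eph t z * wd D v t z

lemma eph_enorm (t : ℝ) (z : E2) : ‖eph t z‖ₑ = 1 := by rw [← ofReal_norm, norm_eph]; simp

lemma eph_deriv (t : ℝ) (z : E2) : HasDerivAt (fun τ => eph τ z) (-(Complex.I * (‖z‖ ^ 4 : ℝ) * eph t z)) t := by
  unfold eph
  have h0 : HasDerivAt (fun τ : ℝ => ((τ : ℝ) : ℂ)) 1 t := Complex.ofRealCLM.hasDerivAt
  have h1 := ((h0.const_mul (-Complex.I)).mul_const ((‖z‖ : ℂ) ^ 4)).cexp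
  have e : (fun τ : ℝ => Complex.exp (-Complex.I * (τ : ℂ) * (‖z‖ : ℂ) ^ 4)) = fun τ : ℝ => Complex.exp (-Complex.I * (τ : ℂ) * ((‖z‖ ^ 4 : ℝ) : ℂ)) := by
    push_cast; rfl
  push_cast
  convert h1 using 1
  ring

namespace Sol
variable {g : E2 → ℂ} {δ : ℝ} {D : E2 → ℝ≥0∞} {v : ℝ → E2 → ℂ}

lemma uh_deriv (h : Sol g δ D v) (z : E2) {t : ℝ} (ht : t ∈ Ioo (-δ) δ) : HasDerivAt (fun τ => uh v τ z) (du D v t z) t := by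
  have := (eph_deriv t z).fun_mul (h.hasDeriv z ht)
  refine HasDerivAt.congr_deriv (f := fun τ => uh v τ z) this ?_
  unfold du uh; ring

lemma m_eph (t : ℝ) : Measurable (eph t) := (continuous_eph.comp (Continuous.prodMk_right t)).measurable

lemma m_uh (h : Sol g δ D v) (t : ℝ) : Measurable (uh v t) := (m_eph t).mul (h.mvt t)

lemma m_wd (h : Sol g δ D v) (t : ℝ) : Measurable (wd D v t) := h.measurable_wd.comp measurable_prodMk_left

lemma m_w (h : Sol g δ D v) (t : ℝ) : Measurable (fun z => eph t z * wd D v t z) := (m_eph t).mul (h.m_wd t)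

lemma m_du (h : Sol g δ D v) (t : ℝ) : Measurable (du D v t) := by
  have h1 := h.m_uh t
  have h2 := h.m_w t
  unfold du
  fun_prop

lemma v_hh (h : Sol g δ D v) {t : ℝ} (ht : t ∈ Icc (-δ) δ) (z : E2) : ‖v t z‖ₑ ≤ hh D z := (h.le t ht z).trans (D_le_hh D z)
lemma wd_hh (h : Sol g δ D v) {t : ℝ} (ht : t ∈ Icc (-δ) δ) (z : E2) : ‖wd D v t z‖ₑ ≤ hh D z := (h.wd_le ht z).trans (D2_le_hh D z)
lemma uh_hh (h : Sol g δ D v) {t : ℝ} (ht : t ∈ Icc (-δ) δ) (z : E2) : ‖uh v t z‖ₑ ≤ hh D z := by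
  unfold uh; rw [enorm_mul, eph_enorm, one_mul]; exact h.v_hh ht z
lemma w_hh (h : Sol g δ D v) {t : ℝ} (ht : t ∈ Icc (-δ) δ) (z : E2) : ‖eph t z * wd D v t z‖ₑ ≤ hh D z := by
  rw [enorm_mul, eph_enorm, one_mul]; exact h.wd_hh ht z

lemma du_Hq (h : Sol g δ D v) {t : ℝ} (ht : t ∈ Icc (-δ) δ) (z : E2) : ‖du D v t z‖ₑ ≤ Hq D z := by
  unfold du
  refine (enorm_add_le _ _).trans ?_
  have a : ‖-(Complex.I * ((‖z‖ ^ 4 : ℝ) : ℂ) * uh v t z)‖ₑ ≤ Wk 2 z * D z := by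
    rw [enorm_neg, enorm_mul]
    refine mul_le_mul' ?_ ?_
    · unfold Wk
      rw [← ofReal_norm]
      refine ENNReal.ofReal_le_ofReal ?_
      rw [norm_mul, Complex.norm_I, one_mul, Complex.norm_real, Real.norm_of_nonneg (by positivity)]
      exact four_le_pj z
    · unfold uh; rw [enorm_mul, eph_enorm, one_mul]; exact h.le t ht z
  have b : ‖eph t z * wd D v t z‖ₑ ≤ Wk 2 z * D2 D z := by
    rw [enorm_mul, eph_enorm, one_mul]
    exact (h.wd_le ht z).trans (le_mul_of_one_le_left' (one_le_Wk 2 z))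
  calc _ ≤ Wk 2 z * D z + Wk 2 z * D2 D z := add_le_add a b
    _ = Wk 2 z * (D z + D2 D z) := by ring
    _ ≤ _ := by unfold Hq; gcongr; exact DD2_le_hh D z

lemma w_ae (h : Sol g δ D v) (hf : nw (Wk (kn + 3)) D < ⊤) (t : ℝ) :
    ∀ᵐ z, eph t z * wd D v t z = -(Complex.I * (k0 : ℂ) * N5 (uh v t) z) := by
  filter_upwards [(h.rgg hf).aeD] with z hz
  unfold wd Nt
  rw [if_neg hz.ne]
  have := eph_mul_conj t z
  calc _ = -(Complex.I * (k0 : ℂ) * N5 (uh v t) z) * (eph t z * conj (eph t z)) := by unfold uh; ring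
    _ = _ := by rw [this, mul_one]

/-- derivative of the kinetic part -/
lemma K_deriv (h : Sol g δ D v) (hf : nw (Wk (kn + 3)) D < ⊤) {m : E2 → ℝ} (hm : Measurable m) (hm1 : ∀ ξ, |m ξ| ≤ 1)
    {t : ℝ} (ht : t ∈ Ioo (-δ) δ) :
    HasDerivAt (fun τ => ∫ ξ, ‖ξ‖ ^ 4 * ‖(m ξ : ℂ) * uh v τ ξ‖ ^ 2)
      (∫ ξ, ‖ξ‖ ^ 4 * (m ξ ^ 2 * (2 * inner ℝ (v t ξ) (wd D v t ξ)))) t := by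
  have nrm : ∀ τ ξ, ‖(m ξ : ℂ) * uh v τ ξ‖ ^ 2 = m ξ ^ 2 * ‖v τ ξ‖ ^ 2 := by
    intro τ ξ
    unfold uh
    rw [norm_mul, norm_mul, norm_eph, one_mul, mul_pow, Complex.norm_real, Real.norm_eq_abs, sq_abs]
  simp only [nrm]
  have hI : Ioo (-δ) δ ⊆ Icc (-δ) δ := Ioo_subset_Icc_self
  have mH := measurable_Hq h.mD
  have fb : ∫⁻ ξ, 2 * (Hq D ξ * Hq D ξ) ≠ ⊤ := by
    have mHH : Measurable fun ξ => Hq D ξ * Hq D ξ := mH.mul mH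
    rw [lintegral_const_mul _ mHH]
    exact ENNReal.mul_ne_top (by norm_num) ((lint_mul_le mH mH).trans_lt (ENNReal.mul_lt_top (Hq_n2 h.mD hf).1 (Hq_n2 h.mD hf).1)).ne
  have mb : Measurable fun ξ => 2 * (Hq D ξ * Hq D ξ) := by fun_prop
  have mv := fun τ => h.mvt τ
  have mw := fun τ => h.m_wd τ
  refine (hasDerivAt_integral_of_dominated_loc_of_deriv_le (s := Ioo (-δ) δ)
    (F := fun τ ξ => ‖ξ‖ ^ 4 * (m ξ ^ 2 * ‖v τ ξ‖ ^ 2))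
    (F' := fun τ ξ => ‖ξ‖ ^ 4 * (m ξ ^ 2 * (2 * inner ℝ (v τ ξ) (wd D v τ ξ))))
    (bound := fun ξ => (2 * (Hq D ξ * Hq D ξ)).toReal) (Ioo_mem_nhds ht.1 ht.2) ?_ ?_ ?_ ?_ ?_ ?_).2
  · refine Filter.Eventually.of_forall fun τ => Measurable.aestronglyMeasurable ?_
    have := mv τ
    fun_prop
  · have := ((h.rg hf (hI ht)).mulr hm hm1).int4
    simp only [nrm] at this
    exact this
  · refine Measurable.aestronglyMeasurable ?_
    have := mv t
    have := mw t
    fun_prop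
  · filter_upwards [ae_lt_top mb fb] with ξ hξ τ hτ
    rw [← ENNReal.ofReal_le_iff_le_toReal hξ.ne, ofReal_norm]
    have e1 : ‖‖ξ‖ ^ 4 * (m ξ ^ 2 * (2 * inner ℝ (v τ ξ) (wd D v τ ξ)))‖ ≤ 2 * (pj ξ ^ 2 * ‖v τ ξ‖ * ‖wd D v τ ξ‖) := by
      rw [norm_mul, norm_mul, norm_mul, Real.norm_of_nonneg (by positivity : 0 ≤ ‖ξ‖ ^ 4), Real.norm_of_nonneg (by positivity : 0 ≤ m ξ ^ 2),
        Real.norm_of_nonneg (by positivity : (0:ℝ) ≤ 2)]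
      have a1 := four_le_pj ξ
      have a2 : m ξ ^ 2 ≤ 1 := by rw [← sq_abs]; exact pow_le_one₀ (abs_nonneg _) (hm1 ξ)
      have a3 : ‖inner ℝ (v τ ξ) (wd D v τ ξ)‖ ≤ ‖v τ ξ‖ * ‖wd D v τ ξ‖ := norm_inner_le_norm _ _
      calc _ ≤ pj ξ ^ 2 * (1 * (2 * (‖v τ ξ‖ * ‖wd D v τ ξ‖))) := by gcongr
        _ = _ := by ring
    calc _ = ENNReal.ofReal ‖‖ξ‖ ^ 4 * (m ξ ^ 2 * (2 * inner ℝ (v τ ξ) (wd D v τ ξ)))‖ := (ofReal_norm _).symm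
      _ ≤ ENNReal.ofReal (2 * (pj ξ ^ 2 * ‖v τ ξ‖ * ‖wd D v τ ξ‖)) := ENNReal.ofReal_le_ofReal e1
      _ = 2 * (Wk 2 ξ * ‖v τ ξ‖ₑ * ‖wd D v τ ξ‖ₑ) := by
        rw [ENNReal.ofReal_mul (by norm_num), ENNReal.ofReal_mul (by positivity), ENNReal.ofReal_mul (by positivity), ofReal_norm, ofReal_norm]
        norm_num [Wk]
      _ ≤ 2 * (Hq D ξ * Hq D ξ) := by
        gcongr
        · unfold Hq; gcongr; exact h.v_hh (hI hτ) ξ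
        · exact (h.wd_hh (hI hτ) ξ).trans (hh_le_Hq D ξ)
  · exact integrable_toReal_of_lintegral_ne_top mb.aemeasurable fb
  · refine Filter.Eventually.of_forall fun ξ τ hτ => ?_
    exact ((h.hasDeriv ξ hτ).norm_sq.const_mul _).const_mul _

end Sol


lemma measurable_Mm {m : E2 → ℝ} (hm : Measurable m) : Measurable (Mm m) := by
  unfold Mm
  exact Finset.measurable_fun_prod _ fun i _ => hm.comp (measurable_pi_apply i)

/-- bookkeeping: mild properties of the multiplier -/
structure Ml (m : E2 → ℝ) : Prop where
  mm : Measurable m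
  ev : ∀ z, m (-z) = m z
  nn : ∀ z, 0 ≤ m z
  le : ∀ z, m z ≤ 1

lemma IsIMult.ml {s N : ℝ} {Cd : ℕ → ℝ} {m : E2 → ℝ} (h : IsIMult s N Cd m) : Ml m where
  mm := h.smooth.continuous.measurable
  ev z := le_antisymm (h.mono _ _ (by simp)) (h.mono _ _ (by simp))
  nn z := (h.pos z).le
  le := h.le_one

namespace Ml
variable {m : E2 → ℝ}
lemma ab (h : Ml m) (z : E2) : |m z| ≤ 1 := by rw [abs_of_nonneg (h.nn z)]; exact h.le z
lemma Mm0 (h : Ml m) (ζ : Fin 6 → E2) : 0 ≤ Mm m ζ := Finset.prod_nonneg fun _ _ => h.nn _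
lemma Mm1 (h : Ml m) (ζ : Fin 6 → E2) : Mm m ζ ≤ 1 := Finset.prod_le_one (fun _ _ => h.nn _) fun _ _ => h.le _
lemma sq1 (h : Ml m) (z : E2) : m z ^ 2 ≤ 1 := pow_le_one₀ (h.nn z) (h.le z)
lemma df (h : Ml m) (ζ : Fin 6 → E2) : |(m (ζ 0)) ^ 2 - Mm m ζ| ≤ 1 := by
  have h1 := h.Mm0 ζ
  have h2 := h.Mm1 ζ
  have h3 := h.sq1 (ζ 0)
  have h4 := sq_nonneg (m (ζ 0))
  rw [abs_le]; constructor <;> linarith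
lemma sg_le (h : Ml m) (ζ : Fin 6 → E2) : |sg m ζ| ≤ pj (ζ 0) ^ 2 := by
  unfold sg
  rw [abs_mul, abs_of_nonneg (by positivity)]
  calc _ ≤ ‖ζ 0‖ ^ 4 * 1 := by gcongr; exact h.df ζ
    _ ≤ _ := by rw [mul_one]; exact four_le_pj _
lemma msg (h : Ml m) : Measurable (sg m) := by
  have h1 := measurable_Mm h.mm
  have h2 : Measurable fun ζ : Fin 6 → E2 => m (ζ 0) := h.mm.comp (measurable_pi_apply 0)
  have h3 : Measurable fun ζ : Fin 6 → E2 => ‖ζ 0‖ ^ 4 := by fun_prop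
  unfold sg
  exact h3.mul ((h2.pow_const 2).sub h1)
lemma mdf (h : Ml m) : Measurable fun ζ => (m (ζ 0)) ^ 2 - Mm m ζ := by
  have h1 := measurable_Mm h.mm
  have h2 : Measurable fun ζ : Fin 6 → E2 => m (ζ 0) := h.mm.comp (measurable_pi_apply 0)
  exact (h2.pow_const 2).sub h1
end Ml

lemma zeta_zero (p : X6) : zeta p 0 = -p.1 := rfl

namespace Sol
variable {g : E2 → ℂ} {δ : ℝ} {D : E2 → ℝ≥0∞} {v : ℝ → E2 → ℂ}

/-- derivative of the energy, raw -/
lemma E_deriv (h : Sol g δ D v) (hf : nw (Wk (kn + 3)) D < ⊤) {m : E2 → ℝ} (hm : Ml m)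
    {t : ℝ} (ht : t ∈ Ioo (-δ) δ) :
    HasDerivAt (fun τ => energy (invFt fun ξ => (m ξ : ℂ) * uh v τ ξ))
      (c2 / 2 * (∫ ξ, ‖ξ‖ ^ 4 * (m ξ ^ 2 * (2 * inner ℝ (v t ξ) (wd D v t ξ)))) +
        c2 * k0 / 6 * (∫ p, (Mm m (zeta p) : ℂ) * ∑ k, PK k (uh v t) (du D v t) (zeta p)).re) t := by
  have hI : Ioo (-δ) δ ⊆ Icc (-δ) δ := Ioo_subset_Icc_self
  have mM := measurable_Mm hm.mm
  have mMc : Measurable fun ζ => (Mm m ζ : ℂ) := Complex.measurable_ofReal.comp mM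
  have nM : ∀ ζ, ‖(Mm m ζ : ℂ)‖ ≤ 1 := fun ζ => by
    rw [Complex.norm_real, Real.norm_of_nonneg (hm.Mm0 ζ)]; exact hm.Mm1 ζ
  have eP : ∀ τ ∈ Icc (-δ) δ, (∫ ξ, conj ((m ξ : ℂ) * uh v τ ξ) * N5 (fun ξ => (m ξ : ℂ) * uh v τ ξ) ξ) =
      ∫ p, (Mm m (zeta p) : ℂ) * PR (uh v τ) (zeta p) := by
    intro τ hτ
    have r := (h.rg hf hτ).mulr hm.mm hm.ab
    have bd : ∀ z, ‖(m z : ℂ) * uh v τ z‖ₑ ≤ hh D z := fun z => (r.le z).trans (D_le_hh D z)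
    have i1 := integ_W h.mD hf r.mf r.mf bd bd 0 (c := fun _ => 1) measurable_const (fun ζ => by simpa using one_le_pj2 (ζ 0))
    have e := fubK (fun _ => 1) i1
    simp only [one_mul, PK_self, PR_mul hm.ev] at e
    exact e.symm
  have dP := deriv_T (V := uh v) (dV := du D v) (H := Hq D) (a := fun _ ζ => (Mm m ζ : ℂ)) (a' := fun _ _ => 0) (A := fun _ => 1) (δ := δ)
    h.m_uh h.m_du (fun t ht z => h.uh_deriv z ht) (fun t ht z => (h.uh_hh (hI ht) z).trans (hh_le_Hq D z))
    (fun t ht z => h.du_Hq (hI ht) z) (Hq_neg D) (fun _ => mMc) (fun _ => measurable_const) (fun t ζ => hasDerivAt_const _ _)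
    (fun t _ ζ => by rw [← ofReal_norm, ← ENNReal.ofReal_one]; exact ENNReal.ofReal_le_ofReal (nM ζ))
    (fun t _ ζ => by simp) (by simpa using Hq_meas h.mD) (by simpa using Hq_fin h.mD hf) ht
  have dPr := Complex.reCLM.hasFDerivAt.comp_hasDerivAt t dP
  have dK := h.K_deriv hf hm.mm hm.ab ht
  have := (dK.const_mul (c2 / 2)).add (dPr.const_mul (c2 * k0 / 6))
  simp only [zero_mul, zero_add, Complex.reCLM_apply] at this
  refine this.congr_of_eventuallyEq ?_
  filter_upwards [Ioo_mem_nhds ht.1 ht.2] with τ hτ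
  rw [((h.rg hf (hI hτ)).mulr hm.mm hm.ab).energy_eq, eP τ (hI hτ)]
  rfl

/-- derivative of the energy, final form -/
lemma E_deriv2 (h : Sol g δ D v) (hf : nw (Wk (kn + 3)) D < ⊤) {m : E2 → ℝ} (hm : Ml m)
    {t : ℝ} (ht : t ∈ Ioo (-δ) δ) :
    HasDerivAt (fun τ => energy (invFt fun ξ => (m ξ : ℂ) * uh v τ ξ))
      (c2 * k0 * ((∫ p, (sg m (zeta p) : ℂ) * PR (uh v t) (zeta p)).im -
        (∫ p, (((m (zeta p 0)) ^ 2 - Mm m (zeta p) : ℝ) : ℂ) * PK 0 (uh v t) (fun z => eph t z * wd D v t z) (zeta p)).re)) t := by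
  refine (h.E_deriv hf hm ht).congr_deriv ?_
  have hT : t ∈ Icc (-δ) δ := Ioo_subset_Icc_self ht
  set w : E2 → ℂ := fun z => eph t z * wd D v t z with hw
  set u : E2 → ℂ := uh v t with hu
  have mM := measurable_Mm hm.mm
  have mMc : Measurable fun ζ => (Mm m ζ : ℂ) := Complex.measurable_ofReal.comp mM
  have m0 : Measurable fun ζ : Fin 6 → E2 => m (ζ 0) := hm.mm.comp (measurable_pi_apply 0)
  have n4 : Measurable fun ζ : Fin 6 → E2 => ‖ζ 0‖ ^ 4 := by fun_prop
  have mu := h.m_uh t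
  have mw := h.m_w t
  have mdu := h.m_du t
  have bu := h.uh_hh hT
  have bw := h.w_hh hT
  have nM : ∀ ζ, ‖(Mm m ζ : ℂ)‖ ≤ 1 := fun ζ => by
    rw [Complex.norm_real, Real.norm_of_nonneg (hm.Mm0 ζ)]; exact hm.Mm1 ζ
  -- integrability facts
  have iA : Integrable fun p => (((‖zeta p 0‖ ^ 4 * m (zeta p 0) ^ 2 : ℝ)) : ℂ) * PK 0 u u (zeta p) := by
    refine integ_W h.mD hf mu mu bu bu 0 (c := fun ζ => ((‖ζ 0‖ ^ 4 * m (ζ 0) ^ 2 : ℝ) : ℂ)) (Complex.measurable_ofReal.comp (n4.mul (m0.pow_const 2))) (fun ζ => ?_)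
    rw [Complex.norm_real, Real.norm_of_nonneg (by positivity)]
    exact (mul_le_of_le_one_right (by positivity) (hm.sq1 _)).trans (four_le_pj _)
  have iB : Integrable fun p => (((‖zeta p 0‖ ^ 4 * Mm m (zeta p) : ℝ)) : ℂ) * PK 0 u u (zeta p) := by
    refine integ_W h.mD hf mu mu bu bu 0 (c := fun ζ => ((‖ζ 0‖ ^ 4 * Mm m ζ : ℝ) : ℂ)) (by fun_prop) (fun ζ => ?_)
    rw [Complex.norm_real, Real.norm_of_nonneg (mul_nonneg (by positivity) (hm.Mm0 ζ))]
    exact (mul_le_of_le_one_right (by positivity) (hm.Mm1 _)).trans (four_le_pj _)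
  have iC : Integrable fun p => (Mm m (zeta p) : ℂ) * PK 0 u w (zeta p) :=
    integ_W h.mD hf mu mw bu bw 0 (c := fun ζ => (Mm m ζ : ℂ)) mMc (fun ζ => (nM ζ).trans (one_le_pj2 _))
  have iD : Integrable fun p => (((m (zeta p 0)) ^ 2 : ℝ) : ℂ) * PK 0 u w (zeta p) := by
    refine integ_W h.mD hf mu mw bu bw 0 (c := fun ζ => ((m (ζ 0) ^ 2 : ℝ) : ℂ)) (Complex.measurable_ofReal.comp (m0.pow_const 2)) (fun ζ => ?_)
    rw [Complex.norm_real, Real.norm_of_nonneg (by positivity)]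
    exact (hm.sq1 _).trans (one_le_pj2 _)
  have iK : ∀ k, Integrable fun p => (Mm m (zeta p) : ℂ) * PK k u (du D v t) (zeta p) := fun k => by
    refine integ_T (F := fun ζ => (Mm m ζ : ℂ) * PK k u (du D v t) ζ) (B := fun ζ => ∏ i, Hq D (ζ i)) (mMc.mul (measurable_PK mu mdu k)) (fun ζ => ?_) (Hq_fin h.mD hf)
    rw [enorm_mul]
    calc _ ≤ 1 * ∏ i, Hq D (ζ i) := by
          refine mul_le_mul' ?_ (PK_le (fun z => (bu z).trans (hh_le_Hq D z)) (h.du_Hq hT) (Hq_neg D) k ζ)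
          rw [← ofReal_norm, ← ENNReal.ofReal_one]; exact ENNReal.ofReal_le_ofReal (nM ζ)
      _ = _ := one_mul _
  -- the potential part
  have eP : (∫ p, (Mm m (zeta p) : ℂ) * ∑ k, PK k u (du D v t) (zeta p)).re =
      6 * (∫ p, (Mm m (zeta p) : ℂ) * PK 0 u (du D v t) (zeta p)).re := by
    simp only [Finset.mul_sum]
    rw [integral_finsetSum _ fun k _ => iK k, Complex.re_sum]
    rw [Finset.sum_congr rfl fun k _ => PK_sym mu mdu hm.mm hm.ev k]
    simp [hu]
  have eQ : ∫ p, (Mm m (zeta p) : ℂ) * PK 0 u (du D v t) (zeta p) =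
      Complex.I * (∫ p, (((‖zeta p 0‖ ^ 4 * Mm m (zeta p) : ℝ)) : ℂ) * PK 0 u u (zeta p)) + ∫ p, (Mm m (zeta p) : ℂ) * PK 0 u w (zeta p) := by
    rw [← integral_const_mul, ← integral_add (iB.const_mul _) iC]
    refine integral_congr_ae (Filter.Eventually.of_forall fun p => ?_)
    dsimp only
    have := PK0_add u w (zeta p) _ rfl
    rw [show du D v t = fun z => -(Complex.I * (‖z‖ ^ 4 : ℝ) * u z) + w z from rfl, this, PK_self]
    push_cast; ring
  -- Fubini
  have eA : ∫ p, (((‖zeta p 0‖ ^ 4 * m (zeta p 0) ^ 2 : ℝ)) : ℂ) * PK 0 u u (zeta p) =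
      ∫ ξ, ((‖ξ‖ ^ 4 * m ξ ^ 2 : ℝ) : ℂ) * conj (u ξ) * N5 u ξ := by
    simp only [zeta_zero, norm_neg, hm.ev] at iA ⊢
    exact fubK (fun ξ => ((‖ξ‖ ^ 4 * m ξ ^ 2 : ℝ) : ℂ)) iA
  have eD : (∫ p, (((m (zeta p 0)) ^ 2 : ℝ) : ℂ) * PK 0 u w (zeta p)).re = 0 := by
    simp only [zeta_zero, hm.ev] at iD ⊢
    rw [fubK (fun ξ => ((m ξ ^ 2 : ℝ) : ℂ)) iD]
    have : ∫ ξ, ((m ξ ^ 2 : ℝ) : ℂ) * conj (w ξ) * N5 u ξ = ∫ ξ, Complex.I * ((m ξ ^ 2 * k0 * ‖N5 u ξ‖ ^ 2 : ℝ) : ℂ) := by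
      refine integral_congr_ae ?_
      filter_upwards [h.w_ae hf t] with ξ hξ
      have hξ' : w ξ = -(Complex.I * (k0 : ℂ) * N5 u ξ) := hξ
      have hn : conj (N5 u ξ) * N5 u ξ = ((‖N5 u ξ‖ ^ 2 : ℝ) : ℂ) := by rw [Complex.conj_mul']; push_cast; rfl
      rw [hξ', map_neg, map_mul, map_mul, Complex.conj_I, Complex.conj_ofReal]
      calc _ = Complex.I * ((m ξ ^ 2 : ℝ) : ℂ) * (k0 : ℂ) * (conj (N5 u ξ) * N5 u ξ) := by ring
        _ = _ := by rw [hn]; push_cast; ring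
    rw [this, integral_const_mul, integral_complex_ofReal]
    simp
  have eK : ∫ ξ, ‖ξ‖ ^ 4 * (m ξ ^ 2 * (2 * inner ℝ (v t ξ) (wd D v t ξ))) =
      2 * k0 * (∫ p, (((‖zeta p 0‖ ^ 4 * m (zeta p 0) ^ 2 : ℝ)) : ℂ) * PK 0 u u (zeta p)).im := by
    rw [eA]
    have iX : Integrable fun ξ => ((‖ξ‖ ^ 4 * m ξ ^ 2 : ℝ) : ℂ) * conj (u ξ) * N5 u ξ := by
      have h1 : Integrable fun p : X6 => ((‖p.1‖ ^ 4 * m p.1 ^ 2 : ℝ) : ℂ) * PK 0 u u (zeta p) := by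
        simpa only [zeta_zero, norm_neg, hm.ev] using iA
      rw [Measure.volume_eq_prod] at h1
      refine h1.integral_prod_left.congr (Filter.Eventually.of_forall fun ξ => ?_)
      dsimp only
      unfold N5
      rw [← integral_const_mul]
      refine integral_congr_ae (Filter.Eventually.of_forall fun z => ?_)
      dsimp only
      rw [PK_zeta]; ring
    have : (∫ ξ, ((‖ξ‖ ^ 4 * m ξ ^ 2 : ℝ) : ℂ) * conj (u ξ) * N5 u ξ).im = ∫ ξ, (((‖ξ‖ ^ 4 * m ξ ^ 2 : ℝ) : ℂ) * conj (u ξ) * N5 u ξ).im :=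
      (Complex.imCLM.integral_comp_comm iX).symm
    rw [this, ← integral_const_mul]
    refine integral_congr_ae ?_
    filter_upwards [h.w_ae hf t] with ξ hξ
    have e1 : inner ℝ (v t ξ) (wd D v t ξ) = (conj (u ξ) * (eph t ξ * wd D v t ξ)).re := by
      rw [Complex.inner]
      have := eph_mul_conj t ξ
      rw [hu, uh, map_mul, show conj (eph t ξ) * conj (v t ξ) * (eph t ξ * wd D v t ξ) = (eph t ξ * conj (eph t ξ)) * (wd D v t ξ * conj (v t ξ)) by ring,
        this, one_mul]
    rw [e1, hξ, show conj (u ξ) * -(Complex.I * (k0 : ℂ) * N5 (uh v t) ξ) = -(Complex.I * ((k0 : ℂ) * (conj (u ξ) * N5 u ξ))) by rw [hu]; ring,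
      mul_assoc ((‖ξ‖ ^ 4 * m ξ ^ 2 : ℝ) : ℂ), Complex.im_ofReal_mul, Complex.neg_re, Complex.I_mul_re, Complex.im_ofReal_mul]
    ring
  have eS : (∫ p, (sg m (zeta p) : ℂ) * PR u (zeta p)) = (∫ p, (((‖zeta p 0‖ ^ 4 * m (zeta p 0) ^ 2 : ℝ)) : ℂ) * PK 0 u u (zeta p)) -
      ∫ p, (((‖zeta p 0‖ ^ 4 * Mm m (zeta p) : ℝ)) : ℂ) * PK 0 u u (zeta p) := by
    rw [← integral_sub iA iB]
    refine integral_congr_ae (Filter.Eventually.of_forall fun p => ?_)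
    dsimp only
    rw [PK_self]; unfold sg; push_cast; ring
  have eR : (∫ p, (((m (zeta p 0)) ^ 2 - Mm m (zeta p) : ℝ) : ℂ) * PK 0 u w (zeta p)) =
      (∫ p, (((m (zeta p 0)) ^ 2 : ℝ) : ℂ) * PK 0 u w (zeta p)) - ∫ p, (Mm m (zeta p) : ℂ) * PK 0 u w (zeta p) := by
    rw [← integral_sub iD iC]
    refine integral_congr_ae (Filter.Eventually.of_forall fun p => ?_)
    dsimp only
    push_cast; ring
  rw [eK, eP, eQ, eS, eR, Complex.sub_re, Complex.sub_im, eD, Complex.add_re, Complex.I_mul_re]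
  ring

end Sol


lemma norm_le_of_enorm {x : ℂ} {y : ℝ} (hy : 0 ≤ y) (h : ‖x‖ₑ ≤ ENNReal.ofReal y) : ‖x‖ ≤ y := by
  rw [← ofReal_norm] at h
  exact (ENNReal.ofReal_le_ofReal_iff hy).1 h

lemma continuous_qt (t : ℝ) : Continuous fun x => qt t x := by
  unfold qt
  refine intervalIntegral.continuous_parametric_intervalIntegral_of_continuous' (f := fun (x : ℝ) (τ : ℝ) => Complex.exp (-(Complex.I * τ * x))) ?_ 0 t
  unfold Function.uncurry
  fun_prop

section bounds
variable {s N η b : ℝ} {Cd : ℕ → ℝ} {m : E2 → ℝ} {D : E2 → ℝ≥0∞}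

lemma G_bound (hs : 1 < s) (hs2 : s < 2) (hN : 1 ≤ N) (hη : 0 < η) (hη1 : η < 1) (hm : IsIMult s N Cd m) (hD : Measurable D)
    (hb : 0 ≤ b) (hJ : nw (eo s N) (hh D) ≤ ENNReal.ofReal b) {t c : ℝ} (ht : 0 ≤ t) (ht1 : t ≤ 1) (hc : 0 ≤ c)
    {F : (Fin 6 → E2) → ℂ} (hF : ∀ ζ, ‖F ζ‖ₑ ≤ ENNReal.ofReal c * ∏ i, hh D (ζ i)) :
    ‖∫ p, ((sg m (zeta p) : ℂ) * qt t (Om (zeta p))) * F (zeta p)‖ ≤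
      625 * c * (2 * t ^ η * ((CM s η).toReal * N ^ (3 * (η - 1)) * b ^ 6)) := by
  have hNr : 0 ≤ N ^ (3 * (η - 1)) := Real.rpow_nonneg (by linarith) _
  have htr : 0 ≤ t ^ η := Real.rpow_nonneg ht _
  refine norm_le_of_enorm (by positivity) ?_
  have key := multi (S := fun ζ => ENNReal.ofReal (|sg m ζ| / 625)) (q := fun ζ => ‖qt t (Om ζ)‖ₑ) (κ := ENNReal.ofReal (2 * t ^ η))
    hs hs2 hN hη hη1 es_abs (measurable_hh hD) (fun ζ h0 σ ha => ⟨?_, fun hlow => ?_⟩) (fun ζ => qt_crude ht ht1 hη hη1)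
    (fun ζ => qt_interp ht hη hη1)
  · calc _ ≤ ∫⁻ p, ENNReal.ofReal (625 * c) * (ENNReal.ofReal (|sg m (zeta p)| / 625) * ‖qt t (Om (zeta p))‖ₑ * ∏ i, hh D (zeta p i)) := by
          refine enorm_T (F := fun ζ => ((sg m ζ : ℂ) * qt t (Om ζ)) * F ζ)
            (B := fun ζ => ENNReal.ofReal (625 * c) * (ENNReal.ofReal (|sg m ζ| / 625) * ‖qt t (Om ζ)‖ₑ * ∏ i, hh D (ζ i))) (fun ζ => ?_)
          rw [enorm_mul, enorm_mul]
          have e1 : ‖(sg m ζ : ℂ)‖ₑ = ENNReal.ofReal 625 * ENNReal.ofReal (|sg m ζ| / 625) := by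
            rw [← ENNReal.ofReal_mul (by norm_num), ← ofReal_norm, Complex.norm_real, Real.norm_eq_abs]
            congr 1; ring
          rw [e1, ENNReal.ofReal_mul (by norm_num)]
          calc _ ≤ ENNReal.ofReal 625 * ENNReal.ofReal (|sg m ζ| / 625) * ‖qt t (Om ζ)‖ₑ * (ENNReal.ofReal c * ∏ i, hh D (ζ i)) := by
                gcongr; exact hF ζ
            _ = _ := by ring
      _ = ENNReal.ofReal (625 * c) * ∫⁻ p, (ENNReal.ofReal (|sg m (zeta p)| / 625) * ‖qt t (Om (zeta p))‖ₑ * ∏ i, hh D (zeta p i)) :=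
          lintegral_const_mul' _ _ ENNReal.ofReal_ne_top
      _ ≤ ENNReal.ofReal (625 * c) * (ENNReal.ofReal (2 * t ^ η) * (CM s η * ENNReal.ofReal (N ^ (3 * (η - 1))) * ENNReal.ofReal b ^ 6)) := by
          gcongr
          refine key.trans ?_
          gcongr
      _ = _ := by
          rw [ENNReal.ofReal_mul (q := 2 * t ^ η * ((CM s η).toReal * N ^ (3 * (η - 1)) * b ^ 6)) (by positivity),
            ENNReal.ofReal_mul (q := (CM s η).toReal * N ^ (3 * (η - 1)) * b ^ 6) (by positivity),
            ENNReal.ofReal_mul (q := b ^ 6) (by positivity), ENNReal.ofReal_mul (q := N ^ (3 * (η - 1))) (by positivity),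
            ENNReal.ofReal_toReal (CM_lt_top hs hη).ne, ENNReal.ofReal_pow hb]
  · unfold eo
    rw [← ENNReal.ofReal_mul (om_nonneg (by linarith) _)]
    refine ENNReal.ofReal_le_ofReal ?_
    have := sg_bound hs hs2 hN hm h0 ha
    rw [div_le_iff₀ (by norm_num)]
    linarith
  · have : sg m ζ = 0 := by unfold sg; rw [m_low hm ha hlow, mul_zero]
    simp [this]

lemma R_bound (hs : 1 < s) (hs2 : s < 2) (hN : 1 ≤ N) (hm : IsIMult s N Cd m) (hD : Measurable D)
    (hb : 0 ≤ b) (hJ : nw (eo s N) (hh D) ≤ ENNReal.ofReal b)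
    {F : (Fin 6 → E2) → ℂ} (hF : ∀ ζ, ‖F ζ‖ₑ ≤ ∏ i, hh D (ζ i)) :
    ‖∫ p, (((m (zeta p 0)) ^ 2 - Mm m (zeta p) : ℝ) : ℂ) * F (zeta p)‖ ≤
      25 * N ^ (-4:ℝ) * (720 * (Cw s).toReal ^ 4 * b ^ 6) := by
  have hNr : 0 ≤ N ^ (-4:ℝ) := Real.rpow_nonneg (by linarith) _
  refine norm_le_of_enorm (by positivity) ?_
  have key := multi0 (S := fun ζ => ENNReal.ofReal |(m (ζ 0)) ^ 2 - Mm m ζ|) (κ := ENNReal.ofReal (25 * N ^ (-4:ℝ)))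
    hs hs2 hN (measurable_hh hD) (fun ζ h0 σ ha => ?_)
  · calc _ ≤ ∫⁻ p, ENNReal.ofReal |(m (zeta p 0)) ^ 2 - Mm m (zeta p)| * ∏ i, hh D (zeta p i) := by
          refine enorm_T (F := fun ζ => (((m (ζ 0)) ^ 2 - Mm m ζ : ℝ) : ℂ) * F ζ)
            (B := fun ζ => ENNReal.ofReal |(m (ζ 0)) ^ 2 - Mm m ζ| * ∏ i, hh D (ζ i)) (fun ζ => ?_)
          rw [enorm_mul]
          refine mul_le_mul' (le_of_eq ?_) (hF ζ)
          rw [← ofReal_norm, Complex.norm_real, Real.norm_eq_abs]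
      _ ≤ ENNReal.ofReal (25 * N ^ (-4:ℝ)) * (720 * Cw s ^ 4 * ENNReal.ofReal b ^ 6) := by
          refine key.trans ?_
          gcongr
      _ = _ := by
          rw [ENNReal.ofReal_mul (q := 720 * (Cw s).toReal ^ 4 * b ^ 6) (by positivity),
            ENNReal.ofReal_mul (q := b ^ 6) (by positivity), ENNReal.ofReal_mul (q := (Cw s).toReal ^ 4) (by norm_num),
            ENNReal.ofReal_pow ENNReal.toReal_nonneg,
            ENNReal.ofReal_toReal (Cw_lt_top hs).ne, ENNReal.ofReal_pow hb]
          norm_num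
  · unfold eo
    rw [← ENNReal.ofReal_mul (om_nonneg (by linarith) _), ← ENNReal.ofReal_mul (by positivity)]
    exact ENNReal.ofReal_le_ofReal (sd_bound hs hs2 hN hm h0 ha)
end bounds

/-- correction term -/
def Gc (m : E2 → ℝ) (v : ℝ → E2 → ℂ) (t : ℝ) : ℂ := ∫ p, ((sg m (zeta p) : ℂ) * qt t (Om (zeta p))) * PR (v t) (zeta p)

namespace Sol
variable {g : E2 → ℂ} {δ : ℝ} {D : E2 → ℝ≥0∞} {v : ℝ → E2 → ℂ}

lemma G_deriv (h : Sol g δ D v) (hf : nw (Wk (kn + 3)) D < ⊤) (hδ : δ ≤ 1) {m : E2 → ℝ} (hm : Ml m)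
    {t : ℝ} (ht : t ∈ Ioo (-δ) δ) :
    HasDerivAt (Gc m v) ((∫ p, (sg m (zeta p) : ℂ) * PR (uh v t) (zeta p)) +
      ∫ p, ((sg m (zeta p) : ℂ) * qt t (Om (zeta p))) * ∑ k, PK k (v t) (wd D v t) (zeta p)) t := by
  have hI : Ioo (-δ) δ ⊆ Icc (-δ) δ := Ioo_subset_Icc_self
  have msg : Measurable fun ζ => (sg m ζ : ℂ) := Complex.measurable_ofReal.comp hm.msg
  have mq : ∀ t, Measurable fun ζ => qt t (Om ζ) := fun t => ((continuous_qt t).comp continuous_Om).measurable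
  have me : ∀ t : ℝ, Measurable fun ζ => Complex.exp (-(Complex.I * t * Om ζ)) := fun t => by
    have := continuous_Om
    exact Continuous.measurable (by fun_prop)
  have mhh := measurable_hh h.mD
  have mB : Measurable fun p => Wk 2 (zeta p 0) * ∏ i, hh D (zeta p i) :=
    ((measurable_Wk 2).comp ((measurable_pi_apply 0).comp measurable_zeta)).mul
      (Finset.measurable_fun_prod _ fun i _ => mhh.comp ((measurable_pi_apply i).comp measurable_zeta))
  have fin : ∫⁻ p, Wk 2 (zeta p 0) * ∏ i, hh D (zeta p i) < ⊤ := (lintegral_mono fun p => Wk0_fin_le D (zeta p)).trans_lt (Hq_fin h.mD hf)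
  have nsg : ∀ ζ, ‖(sg m ζ : ℂ)‖ₑ ≤ Wk 2 (ζ 0) := fun ζ => by
    rw [← ofReal_norm, Complex.norm_real]; exact ENNReal.ofReal_le_ofReal (hm.sg_le ζ)
  have nq : ∀ t ∈ Ioo (-δ) δ, ∀ x, ‖qt t x‖ₑ ≤ 1 := fun t ht x => by
    rw [← ofReal_norm, ← ENNReal.ofReal_one]
    refine ENNReal.ofReal_le_ofReal ((qt_le t x).trans ?_)
    rw [abs_le]; constructor <;> linarith [ht.1, ht.2]
  have ba : ∀ t ∈ Ioo (-δ) δ, ∀ ζ, ‖(sg m ζ : ℂ) * qt t (Om ζ)‖ₑ ≤ Wk 2 (ζ 0) := fun t ht ζ => by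
    rw [enorm_mul]; exact (mul_le_mul' (nsg ζ) (nq t ht _)).trans (mul_one _).le
  have ba' : ∀ t ∈ Ioo (-δ) δ, ∀ ζ, ‖(sg m ζ : ℂ) * Complex.exp (-(Complex.I * t * Om ζ))‖ₑ ≤ Wk 2 (ζ 0) := fun t ht ζ => by
    rw [enorm_mul, ← ofReal_norm (Complex.exp _), norm_expi, ENNReal.ofReal_one, mul_one]; exact nsg ζ
  have key := deriv_T (V := v) (dV := wd D v) (H := hh D) (a := fun t ζ => (sg m ζ : ℂ) * qt t (Om ζ))
    (a' := fun t ζ => (sg m ζ : ℂ) * Complex.exp (-(Complex.I * t * Om ζ))) (A := fun ζ => Wk 2 (ζ 0)) (δ := δ)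
    h.mvt h.m_wd (fun t ht z => h.hasDeriv z ht) (fun t ht z => h.v_hh (hI ht) z) (fun t ht z => h.wd_hh (hI ht) z) (hh_neg D)
    (fun t => msg.mul (mq t)) (fun t => msg.mul (me t)) (fun t ζ => (qt_deriv t (Om ζ)).const_mul _) ba ba' mB fin ht
  refine HasDerivAt.congr_deriv (f := Gc m v) key ?_
  have i1 : Integrable fun p => (sg m (zeta p) : ℂ) * Complex.exp (-(Complex.I * t * Om (zeta p))) * PR (v t) (zeta p) := by
    refine integ_T (F := fun ζ => (sg m ζ : ℂ) * Complex.exp (-(Complex.I * t * Om ζ)) * PR (v t) ζ)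
      (B := fun ζ => Wk 2 (ζ 0) * ∏ i, hh D (ζ i)) ((msg.mul (me t)).mul (measurable_PR (h.mvt t))) (fun ζ => ?_) fin
    rw [enorm_mul]; exact mul_le_mul' (ba' t ht ζ) (PR_le (h.v_hh (hI ht)) (hh_neg D) ζ)
  have i2 : Integrable fun p => (sg m (zeta p) : ℂ) * qt t (Om (zeta p)) * ∑ k, PK k (v t) (wd D v t) (zeta p) := by
    simp only [Finset.mul_sum]
    refine integrable_finsetSum _ fun k _ => ?_
    refine integ_T (F := fun ζ => (sg m ζ : ℂ) * qt t (Om ζ) * PK k (v t) (wd D v t) ζ)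
      (B := fun ζ => Wk 2 (ζ 0) * ∏ i, hh D (ζ i)) ((msg.mul (mq t)).mul (measurable_PK (h.mvt t) (h.m_wd t) k)) (fun ζ => ?_) fin
    rw [enorm_mul]; exact mul_le_mul' (ba t ht ζ) (PK_le (h.v_hh (hI ht)) (h.wd_hh (hI ht)) (hh_neg D) k ζ)
  rw [integral_add i1 i2]
  congr 1
  refine integral_congr_ae (Filter.Eventually.of_forall fun p => ?_)
  have := PR_phase t (v t) (zeta p)
  have e : uh v t = fun z => eph t z * v t z := rfl
  dsimp only
  rw [e, this, mul_assoc]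

lemma G_zero (m : E2 → ℝ) : Gc m v 0 = 0 := by unfold Gc; simp [qt_zero]

/-- the constant -/
def KK (s η : ℝ) : ℝ := c2 * k0 * (8750 * (CM s η).toReal + 18000 * (Cw s).toReal ^ 4)

/-- main energy increment bound -/
lemma E_incr (h : Sol g δ D v) (hf : nw (Wk (kn + 3)) D < ⊤) (hδ : δ ≤ 1) {s N η b : ℝ} {Cd : ℕ → ℝ} {m : E2 → ℝ}
    (hs : 1 < s) (hs2 : s < 2) (hN : 1 ≤ N) (hη : 0 < η) (hη1 : η < 1) (hm : IsIMult s N Cd m)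
    (hb : 0 ≤ b) (hJ : nw (eo s N) (hh D) ≤ ENNReal.ofReal b) {t : ℝ} (ht0 : 0 ≤ t) (ht : t < δ) :
    |energy (invFt fun ξ => (m ξ : ℂ) * uh v t ξ) - energy (invFt fun ξ => (m ξ : ℂ) * uh v 0 ξ)| ≤
      KK s η * (t ^ η * b ^ 6) * N ^ (3 * (η - 1)) := by
  set E : ℝ → ℝ := fun τ => energy (invFt fun ξ => (m ξ : ℂ) * uh v τ ξ) with hE
  have hml := hm.ml
  have hcp : 0 < c2 * k0 := mul_pos c2_pos k0_pos
  have h4 : N ^ (-4:ℝ) ≤ N ^ (3 * (η - 1)) := Real.rpow_le_rpow_of_exponent_le hN (by linarith)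
  have hNr : 0 ≤ N ^ (3 * (η - 1)) := Real.rpow_nonneg (by linarith) _
  have htr : 0 ≤ t ^ η := Real.rpow_nonneg ht0 _
  have ht1 : t ≤ 1 := by linarith
  have htη : t ≤ t ^ η := by
    have := Real.rpow_le_rpow_of_exponent_ge' ht0 ht1 hη.le hη1.le
    rwa [Real.rpow_one] at this
  have htη1 : t ^ η ≤ 1 := Real.rpow_le_one ht0 ht1 hη.le
  set P := (CM s η).toReal with hP
  set Q := (Cw s).toReal with hQ
  have hP0 : 0 ≤ P := ENNReal.toReal_nonneg
  have hQ0 : 0 ≤ Q := ENNReal.toReal_nonneg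
  set X := N ^ (3 * (η - 1)) with hX
  set B := c2 * k0 * ((18000 * Q ^ 4 + 7500 * P) * (b ^ 6 * X)) with hB
  have mem : ∀ τ ∈ Icc 0 t, τ ∈ Ioo (-δ) δ := fun τ hτ => ⟨by linarith [hτ.1, h.pos], by linarith [hτ.2]⟩
  have deriv : ∀ τ ∈ Icc 0 t, ∃ d, HasDerivAt (fun τ => E τ - c2 * k0 * (Gc m v τ).im) d τ ∧ ‖d‖ ≤ B := by
    intro τ hτ
    have hτI := mem τ hτ
    have hτ' := Ioo_subset_Icc_self hτI
    have d1 := h.E_deriv2 hf hml hτI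
    have d2 := Complex.imCLM.hasFDerivAt.comp_hasDerivAt τ (h.G_deriv hf hδ hml hτI)
    have d3 := d1.sub (d2.const_mul (c2 * k0))
    refine ⟨_, d3, ?_⟩
    have hR := R_bound hs hs2 hN hm h.mD hb hJ (F := PK 0 (uh v τ) (fun z => eph τ z * wd D v τ z))
      (PK_le (h.uh_hh hτ') (h.w_hh hτ') (hh_neg D) 0)
    have hG := G_bound hs hs2 hN hη hη1 hm h.mD hb hJ hτ.1 (hτ.2.trans ht1) (c := 6) (by norm_num)
      (F := fun ζ => ∑ k, PK k (v τ) (wd D v τ) ζ) (fun ζ => by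
        have := sum_PK_le (h.v_hh hτ') (h.wd_hh hτ') (hh_neg D) ζ
        simpa using this)
    set R := ∫ p, (((m (zeta p 0)) ^ 2 - Mm m (zeta p) : ℝ) : ℂ) * PK 0 (uh v τ) (fun z => eph τ z * wd D v τ z) (zeta p) with hRdef
    set G' := ∫ p, ((sg m (zeta p) : ℂ) * qt τ (Om (zeta p))) * ∑ k, PK k (v τ) (wd D v τ) (zeta p) with hG'def
    have r1 : |R.re| ≤ 18000 * Q ^ 4 * (b ^ 6 * X) := by
      refine (Complex.abs_re_le_norm R).trans (hR.trans ?_)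
      calc _ ≤ 25 * X * (720 * Q ^ 4 * b ^ 6) := by gcongr
        _ = _ := by ring
    have r2 : |G'.im| ≤ 7500 * P * (b ^ 6 * X) := by
      refine (Complex.abs_im_le_norm G').trans (hG.trans ?_)
      have : τ ^ η ≤ 1 := Real.rpow_le_one hτ.1 (hτ.2.trans ht1) hη.le
      calc _ ≤ 625 * 6 * (2 * 1 * (P * X * b ^ 6)) := by gcongr
        _ = _ := by ring
    have e : ∀ S : ℂ, c2 * k0 * (S.im - R.re) - c2 * k0 * Complex.imCLM (S + G') = c2 * k0 * (-(R.re) - G'.im) := by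
      intro S
      simp only [Complex.imCLM_apply, Complex.add_im]; ring
    rw [e, norm_mul, Real.norm_of_nonneg hcp.le, Real.norm_eq_abs, hB]
    refine mul_le_mul_of_nonneg_left ?_ hcp.le
    calc _ ≤ |R.re| + |G'.im| := by
          rw [← abs_neg (R.re)]; exact abs_sub _ _
      _ ≤ _ := by linarith
  choose! d hd hdB using deriv
  have mv := norm_image_sub_le_of_norm_deriv_le_segment' (f := fun τ => E τ - c2 * k0 * (Gc m v τ).im) (f' := d) (C := B) (a := 0) (b := t)
    (fun τ hτ => (hd τ hτ).hasDerivWithinAt) (fun τ hτ => hdB τ ⟨hτ.1, hτ.2.le⟩) t ⟨ht0, le_rfl⟩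
  rw [G_zero, Complex.zero_im, mul_zero, sub_zero, sub_zero, Real.norm_eq_abs] at mv
  have hGt := G_bound hs hs2 hN hη hη1 hm h.mD hb hJ ht0 ht1 (c := 1) (by norm_num) (F := PR (v t)) (fun ζ => by
    have := PR_le (h.v_hh (Ioo_subset_Icc_self (mem t ⟨ht0, le_rfl⟩))) (hh_neg D) ζ
    simpa using this)
  have hGt' : |c2 * k0 * (Gc m v t).im| ≤ c2 * k0 * (1250 * P * (t ^ η * (b ^ 6 * X))) := by
    rw [abs_mul, abs_of_pos hcp]
    refine mul_le_mul_of_nonneg_left ((Complex.abs_im_le_norm _).trans (le_trans hGt (le_of_eq ?_))) hcp.le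
    ring
  have hB0 : 0 ≤ B := by rw [hB]; positivity
  have hBt : B * t ≤ B * t ^ η := mul_le_mul_of_nonneg_left htη hB0
  have tri : |E t - E 0| ≤ |E t - c2 * k0 * (Gc m v t).im - E 0| + |c2 * k0 * (Gc m v t).im| := by
    have := abs_add_le (E t - c2 * k0 * (Gc m v t).im - E 0) (c2 * k0 * (Gc m v t).im)
    rwa [show E t - c2 * k0 * (Gc m v t).im - E 0 + c2 * k0 * (Gc m v t).im = E t - E 0 by ring] at this
  calc _ ≤ B * t ^ η + c2 * k0 * (1250 * P * (t ^ η * (b ^ 6 * X))) := by linarith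
    _ = _ := by rw [hB]; unfold KK; ring

end Sol


/-- size of the contraction ball -/
def RE (r : ℝ) : ℝ≥0∞ := ENNReal.ofReal (Rr r + 1)

/-- constant in the contraction estimate -/
def ME (s r : ℝ) : ℝ≥0∞ := (2 * (ENNReal.ofReal (4 ^ (kn + 3)) + Cs s) ^ 2) ^ 4 * (2 * RE r) ^ 5

/-- bound for the majorant -/
def bE (s r : ℝ) : ℝ≥0∞ :=
  2 * (2 * RE r) + 2 * (ENNReal.ofReal k0 * ((2 * Cw s ^ 2) ^ 4 * (2 * RE r) ^ 5))

/-- existence time -/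
def d1 (s η r : ℝ) : ℝ :=
  min 1 (min ((Rr r + 1) / (k0 * (ME s r).toReal + 1)) ((1 / ((bE s r).toReal ^ 6 + 1)) ^ (1 / η)))

lemma ME_lt_top {s : ℝ} (hs : 1 < s) (r : ℝ) : ME s r < ⊤ := by
  have h1 : ENNReal.ofReal (4 ^ (kn + 3)) + Cs s < ⊤ := ENNReal.add_lt_top.2 ⟨by simp, Cs_lt_top hs⟩
  have h2 : RE r < ⊤ := ENNReal.ofReal_lt_top
  unfold ME
  exact ENNReal.mul_lt_top (ENNReal.pow_lt_top (ENNReal.mul_lt_top (by simp) (ENNReal.pow_lt_top h1)))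
    (ENNReal.pow_lt_top (ENNReal.mul_lt_top (by simp) h2))

lemma bE_lt_top {s : ℝ} (hs : 1 < s) (r : ℝ) : bE s r < ⊤ := by
  have h1 := Cw_lt_top hs
  have h2 : RE r < ⊤ := ENNReal.ofReal_lt_top
  have h3 : 2 * RE r < ⊤ := ENNReal.mul_lt_top (by simp) h2
  unfold bE
  refine ENNReal.add_lt_top.2 ⟨ENNReal.mul_lt_top (by simp) h3, ENNReal.mul_lt_top (by simp) (ENNReal.mul_lt_top (by simp) ?_)⟩
  exact ENNReal.mul_lt_top (ENNReal.pow_lt_top (ENNReal.mul_lt_top (by simp) (ENNReal.pow_lt_top h1)))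
    (ENNReal.pow_lt_top h3)

lemma Rr_nonneg (r : ℝ) : 0 ≤ Rr r := Real.sqrt_nonneg _

lemma d1_pos (s η r : ℝ) : 0 < d1 s η r := by
  have h0 := Rr_nonneg r
  have h1 := k0_pos
  have h2 : 0 ≤ (ME s r).toReal := ENNReal.toReal_nonneg
  have h3 : 0 ≤ (bE s r).toReal := ENNReal.toReal_nonneg
  unfold d1
  refine lt_min one_pos (lt_min (by positivity) (by positivity))

lemma d1_le (s η r : ℝ) : d1 s η r ≤ 1 := min_le_left _ _

lemma d1_contr {s : ℝ} (hs : 1 < s) (η r : ℝ) :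
    ENNReal.ofReal k0 * (ENNReal.ofReal (d1 s η r) * ME s r) ≤ RE r := by
  have h0 := Rr_nonneg r
  have h1 := k0_pos
  have h2 : 0 ≤ (ME s r).toReal := ENNReal.toReal_nonneg
  have hd := d1_pos s η r
  have h4 : d1 s η r ≤ (Rr r + 1) / (k0 * (ME s r).toReal + 1) := (min_le_right _ _).trans (min_le_left _ _)
  rw [← ENNReal.ofReal_toReal (ME_lt_top hs r).ne, ← ENNReal.ofReal_mul hd.le, ← ENNReal.ofReal_mul h1.le]
  refine ENNReal.ofReal_le_ofReal ?_
  rw [le_div_iff₀ (by positivity)] at h4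
  nlinarith

lemma d1_b (s r : ℝ) {η : ℝ} (hη : 0 < η) : d1 s η r ^ η * (bE s r).toReal ^ 6 ≤ 1 := by
  have h3 : 0 ≤ (bE s r).toReal := ENNReal.toReal_nonneg
  have hd := d1_pos s η r
  have h4 : d1 s η r ≤ (1 / ((bE s r).toReal ^ 6 + 1)) ^ (1 / η) := (min_le_right _ _).trans (min_le_right _ _)
  have h5 := Real.rpow_le_rpow hd.le h4 hη.le
  rw [← Real.rpow_mul (by positivity), one_div_mul_cancel hη.ne', Real.rpow_one] at h5
  have h6 : 0 ≤ (bE s r).toReal ^ 6 := by positivity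
  calc _ ≤ 1 / ((bE s r).toReal ^ 6 + 1) * (bE s r).toReal ^ 6 := by gcongr
    _ ≤ 1 := by
      rw [one_div_mul_eq_div, div_le_one (by positivity)]; linarith

/-- weight choice -/
lemma exists_lam {s N : ℝ} (hs : 1 < s) (hs2 : s < 2) {f : E2 → ℝ≥0∞} (mf : Measurable f)
    (hf : nw (Wk (kn + 3)) f < ⊤) {ρ : ℝ} (hρ : 0 ≤ ρ) (h : nw (fun ξ => ENNReal.ofReal (om s N ξ)) f ≤ ENNReal.ofReal ρ) (hN : 1 ≤ N) :
    ∃ lam : ℝ, 0 < lam ∧ nw (fun ξ => ENNReal.ofReal (wt s N lam (kn + 3) ξ)) f ≤ ENNReal.ofReal (ρ + 1) := by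
  have hq : 0 ≤ (nw (Wk (kn + 3)) f).toReal := ENNReal.toReal_nonneg
  have hl : 0 < 1 / ((nw (Wk (kn + 3)) f).toReal + 1) := by positivity
  refine ⟨1 / ((nw (Wk (kn + 3)) f).toReal + 1), hl, ?_⟩
  generalize hlam : 1 / ((nw (Wk (kn + 3)) f).toReal + 1) = lam at *
  have m1 : Measurable (fun ξ => ENNReal.ofReal (om s N ξ)) := (continuous_om s N (by linarith)).measurable.ennreal_ofReal
  have m2 : Measurable (Wk (kn + 3)) := measurable_Wk _
  have e : ∀ ξ, ENNReal.ofReal (wt s N lam (kn + 3) ξ) * f ξ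
      = ENNReal.ofReal (om s N ξ) * f ξ + ENNReal.ofReal lam * (Wk (kn + 3) ξ * f ξ) := by
    intro ξ
    have := pj_pos ξ
    unfold wt Wk
    rw [ENNReal.ofReal_add (om_nonneg (by linarith) ξ) (by positivity), ENNReal.ofReal_mul hl.le]
    ring
  calc nw (fun ξ => ENNReal.ofReal (wt s N lam (kn + 3) ξ)) f
      = n2 (fun ξ => ENNReal.ofReal (om s N ξ) * f ξ + ENNReal.ofReal lam * (Wk (kn + 3) ξ * f ξ)) := by
        unfold nw; simp_rw [e]
    _ ≤ nw (fun ξ => ENNReal.ofReal (om s N ξ)) f + ENNReal.ofReal lam * nw (Wk (kn + 3)) f := by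
        refine (n2_add_le (by fun_prop) (by fun_prop)).trans ?_
        rw [n2_const_mul _ (by fun_prop)]
        rfl
    _ ≤ ENNReal.ofReal ρ + ENNReal.ofReal 1 := by
        gcongr
        rw [← ENNReal.ofReal_toReal hf.ne, ← ENNReal.ofReal_mul hl.le]
        refine ENNReal.ofReal_le_ofReal ?_
        rw [← hlam, one_div_mul_eq_div, div_le_one (by positivity)]; linarith
    _ = _ := by rw [← ENNReal.ofReal_add hρ zero_le_one]

theorem acl_main {s ε : ℝ} (hs : 1 < s) (hs2 : s < 2) (hε : 0 < ε) (Cd : ℕ → ℝ) {η : ℝ} (hη : 0 < η) (hη1 : η < 1) (hηε : 3 * η ≤ ε)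
    {N : ℝ} (hN : 1 ≤ N) {m : E2 → ℝ} (hm : IsIMult s N Cd m) {u₀ : E2 → ℂ} (h1 : ContDiff ℝ (⊤ : ℕ∞) u₀) (h2 : HasCompactSupport u₀)
    (hE : energy (mulOp m u₀) ≤ 1) {δ : ℝ} (hδ : δ = d1 s η ((eLpNorm u₀ 2 volume).toReal) / 2) :
    ∃ u : ℝ → E2 → ℂ,
      (∀ x, u 0 x = u₀ x) ∧ ContHs s (Icc 0 δ) u ∧ DuhamelOn (Icc 0 δ) u u₀ ∧
      ∀ t ∈ Icc (0:ℝ) δ, |energy (mulOp m (u t)) - energy (mulOp m u₀)| ≤ (Sol.KK s η + 1) * N ^ (-3 + ε) := by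
  obtain ⟨φ, hφ⟩ := ft_schwartz h1 h2
  have hφ' : ft u₀ = fun ξ => φ ξ := funext fun ξ => (hφ ξ).symm
  generalize hr : (eLpNorm u₀ 2 volume).toReal = r at hδ
  have mg : Measurable (ft u₀) := by rw [hφ']; exact φ.continuous.measurable
  have hgi : ∀ t, Integrable (invFt (fun ξ => eph t ξ * ft u₀ ξ)) := by
    intro t; rw [hφ']; exact dispersed_schwartz t φ
  have hfin0 : nw (Wk (kn + 3)) (fun ξ => ‖ft u₀ ξ‖ₑ) < ⊤ := by rw [hφ']; exact nw_schwartz _ φ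
  have hib := init_bound hs hs2 hN hm h1 h2 hE
  rw [hr] at hib
  obtain ⟨lam, hlam, hR⟩ := exists_lam hs hs2 mg.enorm hfin0 (Rr_nonneg r) hib hN
  have hW := isWt_wt hs hs2.le hN hlam.le (k := kn + 3) (by omega)
  obtain ⟨D, v, mD, nD, mv, p1, p2, p3, p4⟩ := exists_v mg (d1_pos s η r) hW hR (d1_contr hs η r)
  have h : Sol (ft u₀) (d1 s η r) D v := ⟨d1_pos s η r, mg, mD, mv, p1, p2, p3, p4⟩
  change _ ≤ 2 * RE r at nD
  have hRE : 2 * RE r < ⊤ := ENNReal.mul_lt_top (by simp) ENNReal.ofReal_lt_top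
  have hf : nw (Wk (kn + 3)) D < ⊤ := by
    have a : ENNReal.ofReal lam * nw (Wk (kn + 3)) D ≤ 2 * RE r := by
      have mp : Measurable fun ξ => Wk (kn + 3) ξ * D ξ := (measurable_Wk _).mul mD
      rw [nw, ← n2_const_mul _ mp]
      refine le_trans (n2_mono fun ξ => ?_) nD
      rw [← mul_assoc]
      gcongr
      unfold Wk wt
      rw [← ENNReal.ofReal_mul hlam.le]
      refine ENNReal.ofReal_le_ofReal ?_
      have := om_nonneg (s := s) (N := N) (by linarith) ξ
      linarith
    by_contra hc
    rw [not_lt, top_le_iff] at hc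
    rw [hc, ENNReal.mul_top (by simpa using hlam)] at a
    exact absurd hRE (not_lt.2 a)
  have nE : nw (eo s N) D ≤ 2 * RE r := by
    refine le_trans (nw_mono_wt fun ξ => ?_) nD
    unfold eo wt
    refine ENNReal.ofReal_le_ofReal ?_
    have := pj_pos ξ
    have : 0 ≤ lam * pj ξ ^ (kn + 3) := by positivity
    linarith
  have hJ : nw (eo s N) (hh D) ≤ ENNReal.ofReal (bE s r).toReal := by
    rw [ENNReal.ofReal_toReal (bE_lt_top hs r).ne]
    refine (nw_hh (isWt_eo hs hs2 hN) mD).trans ?_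
    unfold bE Cw
    gcongr
  have hd := d1_pos s η r
  have hsub : Icc (0:ℝ) δ ⊆ Icc 0 (d1 s η r) := Icc_subset_Icc_right (by linarith)
  have hz : us v 0 = u₀ := funext fun x => h.us_zero hf (fun _ => rfl) h1 h2 x
  have hc := h.contHs hf hs2.le hgi
  have hKK : 0 ≤ Sol.KK s η := by
    have := c2_pos; have := k0_pos
    unfold Sol.KK
    have : 0 ≤ (CM s η).toReal := ENNReal.toReal_nonneg
    have : 0 ≤ (Cw s).toReal := ENNReal.toReal_nonneg
    positivity
  refine ⟨us v, fun x => congrFun hz x, ⟨fun t ht => hc.1 t (hsub ht), fun t₀ ht₀ κ hκ => ?_⟩,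
    fun t ht => h.duhamel hf (fun _ => rfl) t (hsub ht), fun t ht => ?_⟩
  · obtain ⟨τ, hτ, hh⟩ := hc.2 t₀ (hsub ht₀) κ hκ
    exact ⟨τ, hτ, fun t ht => hh t (hsub ht)⟩
  · have e0 : mulOp m u₀ = invFt (fun ξ => (m ξ : ℂ) * uh v 0 ξ) := by
      rw [← h.mulOp_us hf (t := 0) ⟨le_rfl, hd.le⟩ (hgi 0) m, hz]
    rw [e0, h.mulOp_us hf (hsub ht) (hgi t) m]
    have hb : 0 ≤ (bE s r).toReal := ENNReal.toReal_nonneg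
    refine (h.E_incr hf (d1_le _ _ _) hs hs2 hN hη hη1 hm hb hJ ht.1 (by linarith [ht.2])).trans ?_
    have a1 : t ^ η * (bE s r).toReal ^ 6 ≤ 1 := by
      refine le_trans ?_ (d1_b s r hη)
      gcongr
      · exact ht.1
      · exact (hsub ht).2
    have a2 : N ^ (3 * (η - 1)) ≤ N ^ (-3 + ε) := Real.rpow_le_rpow_of_exponent_le hN (by linarith)
    have a3 : 0 ≤ t ^ η * (bE s r).toReal ^ 6 := mul_nonneg (Real.rpow_nonneg ht.1 _) (by positivity)
    refine mul_le_mul ?_ a2 (by positivity) (by positivity)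
    nlinarith

/-- almost conservation law for the modified energy `E(I_N u)`. -/
theorem almost_conservation_law (s ε : ℝ) (hs₁ : 8/7 < s) (hs₂ : s < 2) (hε : 0 < ε)
    (Cd : ℕ → ℝ) :
    ∃ C > (0:ℝ), ∃ N₀ : ℝ, 1 ≤ N₀ ∧ ∃ dfun : ℝ → ℝ, (∀ r, 0 < dfun r) ∧
      ∀ N : ℝ, N₀ ≤ N → ∀ m : E2 → ℝ, IsIMult s N Cd m →
        ∀ u₀ : E2 → ℂ, ContDiff ℝ (⊤ : ℕ∞) u₀ → HasCompactSupport u₀ →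
          energy (mulOp m u₀) ≤ 1 →
          ∃ δ : ℝ, δ = dfun ((eLpNorm u₀ 2 volume).toReal) ∧ 0 < δ ∧
            ∃ u : ℝ → E2 → ℂ,
              (∀ x, u 0 x = u₀ x) ∧
              ContHs s (Icc 0 δ) u ∧
              DuhamelOn (Icc 0 δ) u u₀ ∧
              ∀ t ∈ Icc (0:ℝ) δ,
                |energy (mulOp m (u t)) - energy (mulOp m u₀)| ≤ C * N ^ (-3 + ε) := by
  have hs : 1 < s := by linarith
  have hm0 : 0 < min ε 1 := lt_min hε one_pos
  have hm1 : min ε 1 ≤ ε := min_le_left _ _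
  have hm2 : min ε 1 ≤ 1 := min_le_right _ _
  have hKK : 0 ≤ Sol.KK s (min ε 1 / 4) := by
    have := c2_pos
    have := k0_pos
    unfold Sol.KK
    have : 0 ≤ (CM s (min ε 1 / 4)).toReal := ENNReal.toReal_nonneg
    have : 0 ≤ (Cw s).toReal := ENNReal.toReal_nonneg
    positivity
  refine ⟨Sol.KK s (min ε 1 / 4) + 1, by positivity, 1, le_rfl, fun r => d1 s (min ε 1 / 4) r / 2,
    fun r => half_pos (d1_pos _ _ _), fun N hN m hm u₀ h1 h2 hE => ⟨_, rfl, half_pos (d1_pos _ _ _), ?_⟩⟩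
  exact acl_main hs hs₂ hε Cd (by linarith) (by linarith) (by linarith) hN hm h1 h2 hE rfl
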